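/- Let G = (I, J, {A_i}, {B_j}, μ, V) be a non-degenerate projection game, and let c(a,b|i,j) = ⟨ψ, P^i_a Q^j_b ψ⟩ be a commuting operator correlation for G with w_G(c) ≥ 1 − ε, where ε ≥ 0. Let L = max_{(i,j) : μ(i,j) > 0} μ(i)/μ(i,j), where μ(i) = Σ_{j∈J} μ(i,j). Then there exists a tracial correlation c′ for G — i.e. a complex Hilbert space K, a unit vector ξ ∈ K, and PVMs {r^i_a}_{a∈A_i}, {r^j_b}_{b∈B_j} of orthogonal projections on K with ⟨ξ, x y ξ⟩ = ⟨ξ, y x ξ⟩ for all x, y in the unital *-subalgebra generated by all these projections, and c′(a,b|i,j) = ⟨ξ, r^i_a r^j_b ξ⟩ — such that w_G(c′) ≥ 1 − 148(Lε)^{1/4}. -/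

import Mathlib

set_option linter.unusedSectionVars false

namespace TracialRounding

open scoped InnerProductSpace ComplexConjugate ENNReal ComplexOrder
open Filter Topology

section Ultralimit

variable {α : Type*} {H K : Type*} [NormedAddCommGroup H] [InnerProductSpace ℂ H]
  [NormedAddCommGroup K] [InnerProductSpace ℂ K] [CompleteSpace K]

/-- A bounded family of complex numbers converges along any ultrafilter. -/
lemma exists_tendsto_of_bounded (F : Ultrafilter α) (f : α → ℂ) (C : ℝ) (hf : ∀ n, ‖f n‖ ≤ C) :
    ∃ z, ‖z‖ ≤ C ∧ Tendsto f F (𝓝 z) := by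
  have hc : IsCompact (Metric.closedBall (0 : ℂ) C) := isCompact_closedBall _ _
  have h := hc.ultrafilter_le_nhds (F.map f) (by
    rw [Ultrafilter.coe_map, le_principal_iff]
    exact mem_map.2 (Filter.univ_mem' fun n => by simpa using hf n))
  obtain ⟨z, hz, hle⟩ := h
  exact ⟨z, by simpa using hz, hle⟩

/-- Bounded families of operators have weak-operator limits along ultrafilters. -/
lemma exists_weak_limit (F : Ultrafilter α) (T : α → H →L[ℂ] K) (C : ℝ) (hT : ∀ n, ‖T n‖ ≤ C) :
    ∃ T' : H →L[ℂ] K, ‖T'‖ ≤ C ∧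
      ∀ v w, Tendsto (fun n => ⟪v, T n w⟫_ℂ) F (𝓝 ⟪v, T' w⟫_ℂ) := by
  have hC : 0 ≤ C := by
    obtain ⟨n, -⟩ := F.nonempty_of_mem Filter.univ_mem
    exact (norm_nonneg _).trans (hT n)
  have hb : ∀ w v n, ‖⟪T n w, v⟫_ℂ‖ ≤ C * ‖w‖ * ‖v‖ := fun w v n =>
    (norm_inner_le_norm _ _).trans (by
      gcongr; exact ((T n).le_opNorm w).trans (by gcongr; exact hT n))
  choose B hB1 hB2 using fun w v => exists_tendsto_of_bounded F (fun n => ⟪T n w, v⟫_ℂ) _ (hb w v)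
  let ℓ : H → K →L[ℂ] ℂ := fun w => LinearMap.mkContinuous
    { toFun := B w
      map_add' := fun x y => tendsto_nhds_unique (hB2 w (x + y)) (by
        simpa [inner_add_right] using (hB2 w x).add (hB2 w y))
      map_smul' := fun c x => tendsto_nhds_unique (hB2 w (c • x)) (by
        simpa [inner_smul_right] using (hB2 w x).const_mul c) } (C * ‖w‖) (fun v => hB1 w v)
  have hℓ : ∀ w v, ℓ w v = B w v := fun _ _ => rfl
  have hin : ∀ w v, ⟪(InnerProductSpace.toDual ℂ K).symm (ℓ w), v⟫_ℂ = B w v := fun w v => by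
    rw [InnerProductSpace.toDual_symm_apply]; rfl
  let T' : H →L[ℂ] K := LinearMap.mkContinuous
    { toFun := fun w => (InnerProductSpace.toDual ℂ K).symm (ℓ w)
      map_add' := fun x y => ext_inner_right ℂ fun v => by
        rw [hin, inner_add_left, hin, hin]
        exact tendsto_nhds_unique (hB2 (x + y) v) (by
          simpa [inner_add_left] using (hB2 x v).add (hB2 y v))
      map_smul' := fun c x => ext_inner_right ℂ fun v => by
        rw [hin, RingHom.id_apply, inner_smul_left, hin]
        exact tendsto_nhds_unique (hB2 (c • x) v) (by
          simpa [inner_smul_left, mul_comm] using (hB2 x v).const_mul (conj c)) } C (fun w => by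
      change ‖(InnerProductSpace.toDual ℂ K).symm (ℓ w)‖ ≤ _
      rw [LinearIsometryEquiv.norm_map]
      exact LinearMap.mkContinuous_norm_le _ (by positivity) _)
  refine ⟨T', LinearMap.mkContinuous_norm_le _ hC _, fun v w => ?_⟩
  have h1 := (Complex.continuous_conj.tendsto _).comp (hB2 w v)
  have h2 : conj (B w v) = ⟪v, T' w⟫_ℂ := by
    rw [← inner_conj_symm, ← hin]; rfl
  rw [h2] at h1
  refine h1.congr fun n => ?_
  simp [inner_conj_symm]

end Ultralimit

section RealProjection

variable {H : Type*} [NormedAddCommGroup H] [InnerProductSpace ℂ H] [CompleteSpace H]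

/-- Existence of the orthogonal projection onto a closed real subspace of a complex Hilbert
space. -/
lemma exists_realProj (V : Submodule ℝ H) (v : H) :
    ∃ w ∈ V.topologicalClosure, ∀ u ∈ V, (⟪u, v - w⟫_ℂ).re = 0 := by
  let _ : InnerProductSpace ℝ H := InnerProductSpace.complexToReal
  have : CompleteSpace V.topologicalClosure := V.isClosed_topologicalClosure.completeSpace_coe
  refine ⟨V.topologicalClosure.starProjection v,
    V.topologicalClosure.starProjection_apply_mem v, fun u hu => ?_⟩
  have h := V.topologicalClosure.starProjection_inner_eq_zero v u (V.le_topologicalClosure hu)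
  rw [real_inner_comm] at h
  exact h

/-- The orthogonal projection onto the closure of a real subspace. -/
noncomputable def realProj (V : Submodule ℝ H) (v : H) : H := (exists_realProj V v).choose

lemma realProj_mem (V : Submodule ℝ H) (v : H) : realProj V v ∈ V.topologicalClosure :=
  (exists_realProj V v).choose_spec.1

lemma re_inner_sub_realProj (V : Submodule ℝ H) (v : H) {u : H} (hu : u ∈ V.topologicalClosure) :
    (⟪u, v - realProj V v⟫_ℂ).re = 0 := by
  have hcl : IsClosed {u : H | (⟪u, v - realProj V v⟫_ℂ).re = 0} :=
    isClosed_eq (by fun_prop) continuous_const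
  have hsub : (V : Set H) ⊆ {u : H | (⟪u, v - realProj V v⟫_ℂ).re = 0} :=
    fun u hu => (exists_realProj V v).choose_spec.2 u hu
  exact hcl.closure_subset_iff.2 hsub hu

lemma re_inner_self_eq (x : H) : (⟪x, x⟫_ℂ).re = ‖x‖ ^ 2 := by
  rw [inner_self_eq_norm_sq_to_K]; norm_cast

lemma re_inner_comm (x y : H) : (⟪x, y⟫_ℂ).re = (⟪y, x⟫_ℂ).re := inner_re_symm (𝕜 := ℂ) x y

lemma norm_sub_sq_re (x y : H) : ‖x - y‖ ^ 2 = ‖x‖ ^ 2 - 2 * (⟪x, y⟫_ℂ).re + ‖y‖ ^ 2 :=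
  norm_sub_sq (𝕜 := ℂ) x y

lemma norm_add_sq_re (x y : H) : ‖x + y‖ ^ 2 = ‖x‖ ^ 2 + 2 * (⟪x, y⟫_ℂ).re + ‖y‖ ^ 2 :=
  norm_add_sq (𝕜 := ℂ) x y

lemma realProj_unique {V : Submodule ℝ H} {v w : H} (hw : w ∈ V.topologicalClosure)
    (h : ∀ u ∈ V, (⟪u, v - w⟫_ℂ).re = 0) : w = realProj V v := by
  have hcl : IsClosed {u : H | (⟪u, v - w⟫_ℂ).re = 0} :=
    isClosed_eq (by fun_prop) continuous_const
  have h2 : ∀ u ∈ V.topologicalClosure, (⟪u, v - w⟫_ℂ).re = 0 :=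
    fun u hu => hcl.closure_subset_iff.2 (fun u hu => h u hu) hu
  have hd : w - realProj V v ∈ V.topologicalClosure := sub_mem hw (realProj_mem V v)
  have h3 := re_inner_sub_realProj V v hd
  have h4 := h2 _ hd
  have h5 : (⟪w - realProj V v, w - realProj V v⟫_ℂ).re = 0 := by
    have : w - realProj V v = (v - realProj V v) - (v - w) := by abel
    conv_lhs => rw [this, inner_sub_right, Complex.sub_re, ← this, h3, h4]
    simp
  rw [re_inner_self_eq] at h5
  exact sub_eq_zero.1 (by simpa using h5)

lemma realProj_add (V : Submodule ℝ H) (v w : H) :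
    realProj V (v + w) = realProj V v + realProj V w := by
  refine (realProj_unique (add_mem (realProj_mem V v) (realProj_mem V w)) fun u hu => ?_).symm
  have : v + w - (realProj V v + realProj V w) = (v - realProj V v) + (w - realProj V w) := by abel
  rw [this, inner_add_right, Complex.add_re,
    re_inner_sub_realProj V v (V.le_topologicalClosure hu),
    re_inner_sub_realProj V w (V.le_topologicalClosure hu), add_zero]

lemma realProj_smul (V : Submodule ℝ H) (c : ℝ) (v : H) :
    realProj V (c • v) = c • realProj V v := by
  refine (realProj_unique (V.topologicalClosure.smul_mem c (realProj_mem V v))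
    fun u hu => ?_).symm
  rw [← smul_sub, inner_smul_right_eq_smul, Complex.smul_re,
    re_inner_sub_realProj V v (V.le_topologicalClosure hu), smul_zero]

lemma realProj_neg (V : Submodule ℝ H) (v : H) : realProj V (-v) = -realProj V v := by
  simpa using realProj_smul V (-1) v

lemma realProj_of_mem {V : Submodule ℝ H} {v : H} (hv : v ∈ V.topologicalClosure) :
    realProj V v = v :=
  (realProj_unique hv (by simp)).symm

lemma re_inner_realProj_comm (V : Submodule ℝ H) (v w : H) :
    (⟪v, realProj V w⟫_ℂ).re = (⟪realProj V v, realProj V w⟫_ℂ).re := by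
  have h := re_inner_sub_realProj V v (realProj_mem V w)
  rw [inner_sub_right, Complex.sub_re, re_inner_comm, re_inner_comm (realProj V w)] at h
  linarith

lemma norm_sq_sub_realProj (V : Submodule ℝ H) (v : H) {u : H} (hu : u ∈ V.topologicalClosure) :
    ‖u - v‖ ^ 2 = ‖u - realProj V v‖ ^ 2 + ‖v - realProj V v‖ ^ 2 := by
  have : u - v = (u - realProj V v) - (v - realProj V v) := by abel
  rw [this, norm_sub_sq_re, re_inner_sub_realProj V v (sub_mem hu (realProj_mem V v))]
  ring

lemma norm_realProj_le (V : Submodule ℝ H) (v : H) : ‖realProj V v‖ ≤ ‖v‖ := by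
  have h := norm_sq_sub_realProj V v (Submodule.zero_mem _)
  simp only [zero_sub, norm_neg] at h
  refine le_of_sq_le_sq ?_ (norm_nonneg _) |>.trans le_rfl
  nlinarith [sq_nonneg ‖v - realProj V v‖]

end RealProjection

section Orbit

variable {H : Type*} [NormedAddCommGroup H] [InnerProductSpace ℂ H] [CompleteSpace H]

lemma VonNeumannAlgebra.smul_mem' (M : VonNeumannAlgebra H) (c : ℂ) {x : H →L[ℂ] H} (hx : x ∈ M) :
    c • x ∈ M := M.toStarSubalgebra.smul_mem hx c

lemma real_smul_mem (M : VonNeumannAlgebra H) (c : ℝ) {x : H →L[ℂ] H} (hx : x ∈ M) :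
    c • x ∈ M := by
  have : c • x = (c : ℂ) • x := by ext v; simp
  rw [this]; exact M.toStarSubalgebra.smul_mem hx _

lemma mem_of_commute (M : VonNeumannAlgebra H) {x : H →L[ℂ] H}
    (h : ∀ y ∈ M.commutant, Commute x y) : x ∈ M := by
  rw [← M.commutant_commutant, VonNeumannAlgebra.mem_commutant_iff]
  exact fun g hg => (h g hg).symm

lemma commute_of_mem {M : VonNeumannAlgebra H} {x y : H →L[ℂ] H} (hx : x ∈ M)
    (hy : y ∈ M.commutant) : Commute x y :=
  VonNeumannAlgebra.mem_commutant_iff.1 hy x hx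

lemma cfc_mem (M : VonNeumannAlgebra H) {x : H →L[ℂ] H} (hx : x ∈ M)
    (f : ℝ → ℝ) : cfc f x ∈ M :=
  mem_of_commute M fun _ hy => (commute_of_mem hx hy).cfc_real f

/-- The von Neumann algebra of operators commuting with a star-closed set. -/
noncomputable def vnCentralizer (S : Set (H →L[ℂ] H)) : VonNeumannAlgebra H where
  toStarSubalgebra := StarSubalgebra.centralizer ℂ S
  centralizer_centralizer' := by
    change Set.centralizer (Set.centralizer (StarSubalgebra.centralizer ℂ S : Set (H →L[ℂ] H))) = 
      (StarSubalgebra.centralizer ℂ S : Set (H →L[ℂ] H))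
    rw [StarSubalgebra.coe_centralizer, Set.centralizer_centralizer_centralizer]

lemma mem_vnCentralizer {S : Set (H →L[ℂ] H)} (hS : ∀ x ∈ S, star x ∈ S) {x : H →L[ℂ] H} :
    x ∈ vnCentralizer S ↔ ∀ g ∈ S, g * x = x * g := by
  have h : x ∈ vnCentralizer S ↔ x ∈ StarSubalgebra.centralizer ℂ S := Iff.rfl
  rw [h, StarSubalgebra.mem_centralizer_iff]
  exact ⟨fun h g hg => (h g hg).1, fun h g hg => ⟨h g hg, h _ (hS g hg)⟩⟩

lemma subset_commutant_vnCentralizer {S : Set (H →L[ℂ] H)} {x : H →L[ℂ] H} (hx : x ∈ S) :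
    x ∈ (vnCentralizer S).commutant := by
  rw [VonNeumannAlgebra.mem_commutant_iff]
  intro g hg
  have h : g ∈ StarSubalgebra.centralizer ℂ S := hg
  rw [StarSubalgebra.mem_centralizer_iff] at h
  exact ((h x hx).1).symm

/-- The real subspace `M_sa ψ`. -/
def saOrbit (M : VonNeumannAlgebra H) (ψ : H) : Submodule ℝ H where
  carrier := {v | ∃ g ∈ M, IsSelfAdjoint g ∧ v = g ψ}
  add_mem' := by
    rintro _ _ ⟨g, hg, hgs, rfl⟩ ⟨h, hh, hhs, rfl⟩
    exact ⟨g + h, add_mem hg hh, hgs.add hhs, rfl⟩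
  zero_mem' := ⟨0, zero_mem M, .zero _, rfl⟩
  smul_mem' := by
    rintro c _ ⟨g, hg, hgs, rfl⟩
    refine ⟨(c : ℂ) • g, M.toStarSubalgebra.smul_mem hg _, ?_, by simp⟩
    rw [isSelfAdjoint_iff, star_smul, hgs.star_eq]; simp

lemma mem_saOrbit {M : VonNeumannAlgebra H} {ψ : H} {g : H →L[ℂ] H} (hg : g ∈ M)
    (hs : IsSelfAdjoint g) : g ψ ∈ saOrbit M ψ := ⟨g, hg, hs, rfl⟩

lemma re_inner_nonneg {x : H →L[ℂ] H} (hx : 0 ≤ x) (ψ : H) : 0 ≤ (⟪ψ, x ψ⟫_ℂ).re :=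
  ((ContinuousLinearMap.nonneg_iff_isPositive x).1 hx).re_inner_nonneg_right ψ

lemma IsSelfAdjoint.inner_right {x : H →L[ℂ] H} (hx : IsSelfAdjoint x) (v w : H) :
    ⟪x v, w⟫_ℂ = ⟪v, x w⟫_ℂ := hx.isSymmetric v w

lemma inner_star_left (x : H →L[ℂ] H) (v w : H) : ⟪(star x) v, w⟫_ℂ = ⟪v, x w⟫_ℂ :=
  ContinuousLinearMap.adjoint_inner_left x w v

lemma inner_star_right (x : H →L[ℂ] H) (v w : H) : ⟪v, (star x) w⟫_ℂ = ⟪x v, w⟫_ℂ :=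
  ContinuousLinearMap.adjoint_inner_right x v w

lemma nonneg_of_inner {z : H →L[ℂ] H} (hz : ∀ v, 0 ≤ (⟪v, z v⟫_ℂ).re)
    (hz' : ∀ v, (⟪v, z v⟫_ℂ).im = 0) : 0 ≤ z := by
  rw [ContinuousLinearMap.nonneg_iff_isPositive, ContinuousLinearMap.isPositive_iff_complex]
  intro v
  have h : ⟪z v, v⟫_ℂ = ((⟪v, z v⟫_ℂ).re : ℂ) := by
    have h1 : (⟪z v, v⟫_ℂ).im = -(⟪v, z v⟫_ℂ).im := inner_im_symm (𝕜 := ℂ) _ _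
    exact Complex.ext (re_inner_comm _ _) (by rw [h1, hz' v]; simp)
  rw [h]
  exact ⟨by simp, by simpa using hz v⟩

lemma im_inner_eq_zero {x : H →L[ℂ] H} (hx : IsSelfAdjoint x) (v : H) : (⟪v, x v⟫_ℂ).im = 0 := by
  have h4 := inner_conj_symm (𝕜 := ℂ) v (x v)
  rw [IsSelfAdjoint.inner_right hx] at h4
  exact Complex.conj_eq_iff_im.1 h4

/-- Truncating a self-adjoint element to `[0, 1]` brings it closer to any commuting
contraction `0 ≤ x ≤ 1`. -/
lemma exists_truncation (M : VonNeumannAlgebra H) {x g : H →L[ℂ] H} (hx : x ∈ M.commutant)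
    (hx0 : 0 ≤ x) (hx1 : x ≤ 1) (hg : g ∈ M) (hgs : IsSelfAdjoint g) (ψ : H) :
    ∃ c ∈ M, 0 ≤ c ∧ c ≤ 1 ∧ ‖c ψ - x ψ‖ ≤ ‖g ψ - x ψ‖ := by
  set c := cfc (fun t : ℝ => max 0 (min t 1)) g
  set p := cfc (fun t : ℝ => max (t - 1) 0) g with hp
  set n := cfc (fun t : ℝ => max (-t) 0) g with hn
  have hcM : c ∈ M := cfc_mem M hg _
  have hpM : p ∈ M := cfc_mem M hg _
  have hnM : n ∈ M := cfc_mem M hg _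
  have hp0 : 0 ≤ p := cfc_nonneg fun t _ => le_max_right _ _
  have hn0 : 0 ≤ n := cfc_nonneg fun t _ => le_max_right _ _
  have hpc : p * c = p := by
    rw [← cfc_mul (fun t : ℝ => max (t - 1) 0) _ g (by fun_prop) (by fun_prop)]
    refine cfc_congr fun t _ => ?_
    rcases le_total t 1 with h | h
    · simp [h]
    · simp [h]
  have hnc : n * c = 0 := by
    rw [← cfc_mul (fun t : ℝ => max (-t) 0) _ g (by fun_prop) (by fun_prop),
      ← cfc_const_zero ℝ g]
    refine cfc_congr fun t _ => ?_
    rcases le_total t 0 with h | h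
    · simp [h, h.trans zero_le_one]
    · simp [h]
  have hsum : g = c + p - n := by
    have h1 : c + p - n = cfc (fun t : ℝ => max 0 (min t 1) + max (t - 1) 0 - max (-t) 0) g := by
      rw [cfc_sub _ _ g (by fun_prop) (by fun_prop), cfc_add g _ _ (by fun_prop) (by fun_prop)]
    rw [h1]
    conv_lhs => rw [← cfc_id' ℝ g]
    refine cfc_congr fun t _ => ?_
    rcases le_total t 0 with h | h
    · simp [h, h.trans zero_le_one]
    · rcases le_total t 1 with h' | h'
      · simp [h, h']
      · simp [h, h']
  refine ⟨c, hcM, cfc_nonneg fun t _ => le_max_left _ _,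
    cfc_le_one (R := ℝ) _ _ fun t _ => max_le zero_le_one (min_le_right _ _), ?_⟩
  have hh : IsSelfAdjoint (p - n) := hp0.isSelfAdjoint.sub hn0.isSelfAdjoint
  have hpos : 0 ≤ (p - n) * (c - x) := by
    have : (p - n) * (c - x) = p * (1 - x) + n * x := by
      rw [sub_mul, mul_sub, mul_sub, mul_sub, hpc, hnc, mul_one]; abel
    rw [this]
    refine add_nonneg (Commute.mul_nonneg hp0 (sub_nonneg.2 hx1) ?_)
      (Commute.mul_nonneg hn0 hx0 (commute_of_mem hnM hx))
    exact (Commute.one_right p).sub_right (commute_of_mem hpM hx)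
  have hdec : g ψ - x ψ = (p - n) ψ + (c ψ - x ψ) := by
    rw [hsum]; simp; abel
  have hin : 0 ≤ (⟪(p - n) ψ, c ψ - x ψ⟫_ℂ).re := by
    rw [IsSelfAdjoint.inner_right hh]
    exact re_inner_nonneg hpos ψ
  refine le_of_sq_le_sq ?_ (norm_nonneg _)
  rw [hdec, norm_add_sq_re]
  nlinarith [sq_nonneg ‖(p - n) ψ‖]

/-- A Radon–Nikodym theorem: the real projection of `x ψ` onto `M_sa ψ` is implemented by an
element of `M`. -/
theorem exists_radonNikodym (M : VonNeumannAlgebra H) {x : H →L[ℂ] H} (hx : x ∈ M.commutant)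
    (hx0 : 0 ≤ x) (hx1 : x ≤ 1) (ψ : H) :
    ∃ z ∈ M, 0 ≤ z ∧ z ≤ 1 ∧ z ψ = realProj (saOrbit M ψ) (x ψ) := by
  set V := saOrbit M ψ
  have hmem := realProj_mem V (x ψ)
  obtain ⟨u, hu, hlim⟩ := mem_closure_iff_seq_limit.1 hmem
  choose g hgM hgs hgu using hu
  choose c hcM hc0 hc1 hcn using fun n => exists_truncation M hx hx0 hx1 (hgM n) (hgs n) ψ
  have hcsa : ∀ n, IsSelfAdjoint (c n) := fun n => (hc0 n).isSelfAdjoint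
  have hle : ∀ n, ‖c n ψ - realProj V (x ψ)‖ ≤ ‖u n - realProj V (x ψ)‖ := fun n => by
    refine le_of_sq_le_sq ?_ (norm_nonneg _)
    have h1 := norm_sq_sub_realProj V (x ψ)
      (V.le_topologicalClosure (mem_saOrbit (hcM n) (hcsa n)))
    have h2 := norm_sq_sub_realProj V (x ψ)
      (V.le_topologicalClosure (mem_saOrbit (ψ := ψ) (hgM n) (hgs n)))
    have h3 := pow_le_pow_left₀ (norm_nonneg _) (hcn n) 2
    rw [hgu n]
    linarith
  have hclim : Tendsto (fun n => c n ψ) atTop (𝓝 (realProj V (x ψ))) := by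
    rw [tendsto_iff_norm_sub_tendsto_zero] at hlim ⊢
    exact squeeze_zero (fun _ => norm_nonneg _) hle hlim
  have hnorm : ∀ n, ‖c n‖ ≤ 1 := fun n => by
    rw [CStarAlgebra.norm_le_one_iff_of_nonneg _ (hc0 n)]; exact hc1 n
  obtain ⟨z, -, hz⟩ := exists_weak_limit (hyperfilter ℕ) c 1 hnorm
  have hzin : ∀ v, 0 ≤ (⟪v, z v⟫_ℂ).re ∧ (⟪v, z v⟫_ℂ).re ≤ (⟪v, v⟫_ℂ).re ∧
      (⟪v, z v⟫_ℂ).im = 0 := fun v => by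
    have h1 := (Complex.continuous_re.tendsto _).comp (hz v v)
    have h2 := (Complex.continuous_im.tendsto _).comp (hz v v)
    refine ⟨ge_of_tendsto' h1 fun n => re_inner_nonneg (hc0 n) v, le_of_tendsto' h1 fun n => ?_,
      tendsto_nhds_unique h2 (tendsto_const_nhds.congr fun n => ?_)⟩
    · have := re_inner_nonneg (sub_nonneg.2 (hc1 n)) v
      simpa [inner_sub_right] using this
    · exact (im_inner_eq_zero (hcsa n) v).symm
  have hz0 : 0 ≤ z := nonneg_of_inner (fun v => (hzin v).1) fun v => (hzin v).2.2
  refine ⟨z, mem_of_commute M fun y hy => ?_, hz0, ?_, ?_⟩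
  · refine ContinuousLinearMap.ext fun w => ext_inner_left ℂ fun v => ?_
    have h1 := hz v (y w)
    have h2 := hz ((star y) v) w
    rw [inner_star_left] at h2
    refine tendsto_nhds_unique h1 (h2.congr fun n => ?_)
    rw [inner_star_left]
    exact congrArg (fun T : H →L[ℂ] H => ⟪v, T w⟫_ℂ) (commute_of_mem (hcM n) hy).eq.symm
  · rw [← sub_nonneg]
    refine nonneg_of_inner (fun v => ?_) fun v => ?_
    · simpa [inner_sub_right] using (hzin v).2.1
    · simp [(hzin v).2.2, ← Complex.ofReal_pow]
  · refine ext_inner_left ℂ fun v => ?_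
    refine tendsto_nhds_unique (hz v ψ) ?_
    exact ((innerSL ℂ v).continuous.tendsto _).comp (hclim.mono_left Nat.hyperfilter_le_atTop)

end Orbit

section Matrices

variable {ι κ : Type*} [Fintype ι] [DecidableEq ι] [Fintype κ] [DecidableEq κ]
variable {H : Type*} [NormedAddCommGroup H] [InnerProductSpace ℂ H] [CompleteSpace H]

/-- The Hilbert space direct sum of copies of `H` indexed by `ι`. -/
abbrev Amp (ι : Type*) (H : Type*) := PiLp 2 (fun _ : ι => H)

/-- The isometric inclusion of a coordinate. -/
noncomputable def emb (a : ι) : H →L[ℂ] Amp ι H :=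
  LinearMap.mkContinuous
    { toFun := fun v => PiLp.single 2 a v
      map_add' := fun v w => PiLp.single_add 2 a
      map_smul' := fun c v => by
        ext b; by_cases h : b = a
        · subst h; simp
        · simp [h] } 1 (fun v => by simp)

lemma emb_apply (a b : ι) (v : H) : emb a v b = if b = a then v else 0 := by
  change (PiLp.single 2 a v : Amp ι H) b = _
  split_ifs with h
  · subst h; simp
  · simp [h]

/-- The coordinate projection. -/
noncomputable def prj (a : ι) : Amp ι H →L[ℂ] H := PiLp.proj 2 (fun _ : ι => H) a

@[simp] lemma prj_apply (a : ι) (v : Amp ι H) : prj a v = v a := rfl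

lemma inner_emb_left (a : ι) (v : H) (w : Amp ι H) : ⟪emb a v, w⟫_ℂ = ⟪v, w a⟫_ℂ := by
  rw [PiLp.inner_apply, Finset.sum_eq_single a]
  · simp [emb_apply]
  · intro b _ h; simp [emb_apply, h]
  · simp

lemma sum_emb (v : Amp ι H) : ∑ a, emb a (v a) = v := by
  ext b; simp [emb_apply]

/-- The operator with a given matrix of operator entries. -/
noncomputable def ofMat (x : ι → κ → H →L[ℂ] H) : Amp κ H →L[ℂ] Amp ι H :=
  ∑ a, ∑ b, (emb a).comp ((x a b).comp (prj b))

lemma ofMat_apply (x : ι → κ → H →L[ℂ] H) (v : Amp κ H) (a : ι) :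
    ofMat x v a = ∑ b, x a b (v b) := by
  simp only [ofMat, sum_apply, ContinuousLinearMap.comp_apply, prj_apply,
    WithLp.ofLp_sum, Finset.sum_apply, emb_apply]
  rw [Finset.sum_eq_single a]
  · simp
  · intro b _ h; simp [h.symm]
  · simp

/-- The matrix entries of an operator between direct sums. -/
noncomputable def entry (T : Amp κ H →L[ℂ] Amp ι H) (a : ι) (b : κ) : H →L[ℂ] H :=
  (prj a).comp (T.comp (emb b))

lemma entry_apply (T : Amp κ H →L[ℂ] Amp ι H) (a : ι) (b : κ) (v : H) :
    entry T a b v = T (emb b v) a := rfl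

lemma apply_eq_sum_entry (T : Amp κ H →L[ℂ] Amp ι H) (v : Amp κ H) (a : ι) :
    T v a = ∑ b, entry T a b (v b) := by
  conv_lhs => rw [← sum_emb v, map_sum]
  simp [entry_apply]

lemma ofMat_entry (T : Amp κ H →L[ℂ] Amp ι H) : ofMat (entry T) = T := by
  ext v a; rw [ofMat_apply, apply_eq_sum_entry]

lemma entry_ofMat (x : ι → κ → H →L[ℂ] H) : entry (ofMat x) = x := by
  ext a b v
  rw [entry_apply, ofMat_apply, Finset.sum_eq_single b]
  · simp [emb_apply]
  · intro c _ h; simp [emb_apply, h]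
  · simp

lemma entry_ext {S T : Amp κ H →L[ℂ] Amp ι H} (h : ∀ a b, entry S a b = entry T a b) : S = T := by
  rw [← ofMat_entry S, ← ofMat_entry T]; congr 1; ext a b : 2; exact h a b

lemma entry_mul (S T : Amp ι H →L[ℂ] Amp ι H) (a c : ι) :
    entry (S * T) a c = ∑ b, entry S a b * entry T b c := by
  ext v
  simp only [entry_apply, mul_apply_eq_comp, sum_apply]
  rw [apply_eq_sum_entry]
  rfl

lemma entry_star (T : Amp ι H →L[ℂ] Amp ι H) (a b : ι) :
    entry (star T) a b = star (entry T b a) := by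
  ext v
  refine ext_inner_left ℂ fun w => ?_
  rw [inner_star_right, entry_apply, entry_apply, ← inner_emb_left, inner_star_right,
    ← inner_conj_symm, inner_emb_left, inner_conj_symm]

lemma entry_sub (S T : Amp κ H →L[ℂ] Amp ι H) (a : ι) (b : κ) :
    entry (S - T) a b = entry S a b - entry T a b := by
  ext v; simp [entry_apply]

lemma entry_one (a b : ι) : entry (1 : Amp ι H →L[ℂ] Amp ι H) a b = if a = b then 1 else 0 := by
  ext v; simp only [entry_apply, one_apply_eq_self, emb_apply]; split_ifs <;> simp

/-- The diagonal operator with equal diagonal entries. -/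
noncomputable def diag (ι : Type*) [Fintype ι] [DecidableEq ι] (x : H →L[ℂ] H) :
    Amp ι H →L[ℂ] Amp ι H :=
  ofMat fun a b => if a = b then x else 0

lemma diag_apply (x : H →L[ℂ] H) (v : Amp ι H) (a : ι) : diag ι x v a = x (v a) := by
  rw [diag, ofMat_apply, Finset.sum_eq_single a]
  · simp
  · intro b _ h; simp [h.symm]
  · simp

lemma entry_diag (x : H →L[ℂ] H) (a b : ι) : entry (diag ι x) a b = if a = b then x else 0 := by
  rw [diag, entry_ofMat]

lemma entry_diag_mul (x : H →L[ℂ] H) (T : Amp ι H →L[ℂ] Amp ι H) (a b : ι) :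
    entry (diag ι x * T) a b = x * entry T a b := by
  ext v; simp [entry_apply, diag_apply]

lemma entry_mul_diag (x : H →L[ℂ] H) (T : Amp ι H →L[ℂ] Amp ι H) (a b : ι) :
    entry (T * diag ι x) a b = entry T a b * x := by
  rw [entry_mul, Finset.sum_eq_single b]
  · simp [entry_diag]
  · intro c _ h; simp [entry_diag, h]
  · simp

/-- The diagonal embedding as a star homomorphism. -/
noncomputable def diagHom (ι : Type*) [Fintype ι] [DecidableEq ι] :
    (H →L[ℂ] H) →⋆ₐ[ℂ] (Amp ι H →L[ℂ] Amp ι H) where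
  toFun := diag ι
  map_one' := by ext v a; simp [diag_apply]
  map_mul' x y := by ext v a; simp [diag_apply]
  map_zero' := by ext v a; simp [diag_apply]
  map_add' x y := by ext v a; simp [diag_apply]
  commutes' c := by ext v a; simp [diag_apply, Algebra.algebraMap_eq_smul_one]
  map_star' x := entry_ext fun a b => by
    rw [entry_star, entry_diag, entry_diag]
    by_cases h : a = b
    · simp [h]
    · simp [h, Ne.symm h]

lemma diagHom_apply (x : H →L[ℂ] H) : (diagHom ι : (H →L[ℂ] H) →⋆ₐ[ℂ] _) x = diag ι x := rfl

lemma diag_commute_iff (x : H →L[ℂ] H) (T : Amp ι H →L[ℂ] Amp ι H) :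
    Commute (diag ι x) T ↔ ∀ a b, Commute x (entry T a b) := by
  refine ⟨fun h a b => ?_, fun h => entry_ext fun a b => ?_⟩
  · have := congrArg (fun S => entry S a b) h.eq
    simp only [entry_diag_mul, entry_mul_diag] at this
    exact this
  · rw [entry_diag_mul, entry_mul_diag]; exact (h a b).eq

/-- The operator with a single nonzero entry. -/
noncomputable def unit (a b : ι) (x : H →L[ℂ] H) : Amp ι H →L[ℂ] Amp ι H :=
  ofMat fun c d => if c = a ∧ d = b then x else 0

lemma entry_unit (a b : ι) (x : H →L[ℂ] H) (c d : ι) :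
    entry (unit a b x) c d = if c = a ∧ d = b then x else 0 := by
  rw [unit, entry_ofMat]

/-- An operator commuting with all matrix units is diagonal with equal entries. -/
lemma eq_diag_of_commute_unit [Nonempty ι] {T : Amp ι H →L[ℂ] Amp ι H}
    (h : ∀ a b, Commute (unit a b 1) T) (i : ι) : T = diag ι (entry T i i) := by
  have key : ∀ a b c d, (if c = a then entry T b d else 0) = if d = b then entry T c a else 0 := by
    intro a b c d
    have := congrArg (fun S => entry S c d) (h a b).eq
    simp only [entry_mul, entry_unit] at this
    rw [Finset.sum_eq_single b (fun e _ he => by simp [he]) (by simp),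
      Finset.sum_eq_single a (fun e _ he => by simp [he]) (by simp)] at this
    simpa using this
  refine entry_ext fun c d => ?_
  rw [entry_diag]
  have h1 := key i i c d
  have h2 := key i c i d
  split_ifs with hcd
  · subst hcd; simpa using h2
  · have := key d d c d
    simpa [hcd] using this.symm

end Matrices

section Modular

variable {H : Type*} [NormedAddCommGroup H] [InnerProductSpace ℂ H] [CompleteSpace H]

/-- The vector `ψ` is cyclic for `M`. -/
def Cyclic (M : VonNeumannAlgebra H) (ψ : H) : Prop :=
  Dense ((fun x : H →L[ℂ] H => x ψ) '' (M : Set (H →L[ℂ] H)))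

lemma Cyclic.ext {M : VonNeumannAlgebra H} {ψ : H} (h : Cyclic M ψ) {y z : H →L[ℂ] H}
    (hy : y ∈ M.commutant) (hz : z ∈ M.commutant) (he : y ψ = z ψ) : y = z := by
  refine DFunLike.coe_injective (Continuous.ext_on h y.continuous z.continuous ?_)
  rintro _ ⟨x, hx, rfl⟩
  have h1 := congrArg (fun T : H →L[ℂ] H => T ψ) (commute_of_mem hx hy).eq
  have h2 := congrArg (fun T : H →L[ℂ] H => T ψ) (commute_of_mem hx hz).eq
  simp only [mul_apply_eq_comp] at h1 h2
  simp only [← h1, ← h2, he]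

/-- The complex-linear operator `v ↦ P v - i P (i v)` attached to a real subspace. -/
noncomputable def modOp (V : Submodule ℝ H) : H →L[ℂ] H :=
  LinearMap.mkContinuous
    { toFun := fun v => realProj V v - Complex.I • realProj V (Complex.I • v)
      map_add' := fun v w => by
        rw [smul_add, realProj_add, realProj_add, smul_add]; abel
      map_smul' := fun c v => by
        have h1 : ∀ (r : ℝ) (w : H), realProj V ((r : ℂ) • w) = (r : ℂ) • realProj V w :=
          fun r w => by
            have := realProj_smul V r w
            rwa [← Complex.coe_smul, ← Complex.coe_smul] at this
        have h2 : c • v = (c.re : ℂ) • v + (c.im : ℂ) • (Complex.I • v) := by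
          conv_lhs => rw [← Complex.re_add_im c]
          rw [add_smul, mul_smul]
        have h3 : Complex.I • c • v =
            (c.re : ℂ) • (Complex.I • v) + (((-c.im : ℝ)) : ℂ) • v := by
          match_scalars
          linear_combination (-Complex.I) * Complex.re_add_im c + (c.im : ℂ) * Complex.I_mul_I
        rw [h3, h2, realProj_add, realProj_add, h1, h1, h1, h1, RingHom.id_apply]
        generalize realProj V v = a
        generalize realProj V (Complex.I • v) = b
        match_scalars
        · linear_combination Complex.re_add_im c
        · linear_combination (-Complex.I) * Complex.re_add_im c + (c.im : ℂ) * Complex.I_mul_I } 2 (fun v => by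
      refine (norm_sub_le _ _).trans ?_
      rw [norm_smul, Complex.norm_I, one_mul]
      have h1 := norm_realProj_le V v
      have h2 := norm_realProj_le V (Complex.I • v)
      rw [norm_smul, Complex.norm_I, one_mul] at h2
      linarith)

lemma modOp_apply (V : Submodule ℝ H) (v : H) :
    modOp V v = realProj V v - Complex.I • realProj V (Complex.I • v) := rfl

lemma re_inner_neg_I_smul (u w : H) : (⟪u, -(Complex.I • w)⟫_ℂ).re = (⟪Complex.I • u, w⟫_ℂ).re := by
  rw [inner_neg_right, inner_smul_right, inner_smul_left]; simp

lemma re_inner_modOp (V : Submodule ℝ H) (u v : H) : (⟪u, modOp V v⟫_ℂ).re =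
    (⟪realProj V u, realProj V v⟫_ℂ).re +
      (⟪realProj V (Complex.I • u), realProj V (Complex.I • v)⟫_ℂ).re := by
  rw [modOp_apply, sub_eq_add_neg, inner_add_right, Complex.add_re, re_inner_neg_I_smul,
    re_inner_realProj_comm, re_inner_realProj_comm V (Complex.I • u)]

lemma re_inner_left_im (x y : H) : (⟪x, y⟫_ℂ).im = (⟪Complex.I • x, y⟫_ℂ).re := by
  rw [inner_smul_left]; simp

lemma modOp_isSelfAdjoint (V : Submodule ℝ H) : IsSelfAdjoint (modOp V) := by
  have hre : ∀ u v, (⟪modOp V u, v⟫_ℂ).re = (⟪u, modOp V v⟫_ℂ).re := fun u v => by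
    rw [re_inner_comm, re_inner_modOp, re_inner_modOp, re_inner_comm (realProj V v),
      re_inner_comm (realProj V (Complex.I • v))]
  rw [isSelfAdjoint_iff]
  refine ContinuousLinearMap.ext fun v => ext_inner_left ℂ fun u => ?_
  rw [inner_star_right]
  refine Complex.ext (hre u v) ?_
  rw [re_inner_left_im, re_inner_left_im, ← hre, map_smul]

lemma modOp_nonneg (V : Submodule ℝ H) : 0 ≤ modOp V := by
  refine nonneg_of_inner (fun v => ?_) fun v => im_inner_eq_zero (modOp_isSelfAdjoint V) v
  rw [re_inner_modOp, re_inner_self_eq, re_inner_self_eq]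
  positivity

lemma two_sub_modOp_nonneg (V : Submodule ℝ H) : 0 ≤ 2 - modOp V := by
  have hs : IsSelfAdjoint (2 - modOp V) := by
    have : IsSelfAdjoint (2 : H →L[ℂ] H) := by
      rw [← one_add_one_eq_two]; exact (IsSelfAdjoint.one _).add (.one _)
    exact this.sub (modOp_isSelfAdjoint V)
  refine nonneg_of_inner (fun v => ?_) fun v => im_inner_eq_zero hs v
  have h2 : (2 - modOp V) v = v + v - modOp V v := by
    rw [← one_add_one_eq_two]; simp
  rw [h2, inner_sub_right, inner_add_right, Complex.sub_re, Complex.add_re, re_inner_modOp,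
    re_inner_self_eq, re_inner_self_eq, re_inner_self_eq]
  have h1 := norm_realProj_le V v
  have h3 := norm_realProj_le V (Complex.I • v)
  rw [norm_smul, Complex.norm_I, one_mul] at h3
  nlinarith [norm_nonneg (realProj V v), norm_nonneg (realProj V (Complex.I • v)), norm_nonneg v]

/-- A nondegeneracy statement equivalent to the duality between `M_sa ψ` and `M'_sa ψ`. -/
lemma eq_zero_of_inner_real_imag {M : VonNeumannAlgebra H} {ψ : H} (hcyc : Cyclic M ψ) {ζ : H}
    (h1 : ∀ x ∈ M, ⟪x ψ, ζ⟫_ℂ = ⟪ζ, (star x) ψ⟫_ℂ)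
    (h2 : ∀ y ∈ M.commutant, ⟪y ψ, ζ⟫_ℂ = -⟪ζ, (star y) ψ⟫_ℂ) : ζ = 0 := by
  let vec : H → H → Amp (Fin 2) H := fun v w => emb 0 v + emb 1 w
  have hv0 : ∀ v w, vec v w 0 = v := fun v w => by simp [vec, emb_apply]
  have hv1 : ∀ v w, vec v w 1 = w := fun v w => by simp [vec, emb_apply]
  let W : Submodule ℂ (Amp (Fin 2) H) :=
    { carrier := {u | ∃ x ∈ M, u = vec (x ψ) (x ζ)}
      add_mem' := by
        rintro _ _ ⟨x, hx, rfl⟩ ⟨y, hy, rfl⟩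
        exact ⟨x + y, add_mem hx hy, by simp [vec]; abel⟩
      zero_mem' := ⟨0, zero_mem M, by simp [vec]⟩
      smul_mem' := by
        rintro c _ ⟨x, hx, rfl⟩
        exact ⟨c • x, VonNeumannAlgebra.smul_mem' M c hx, by simp [vec]⟩ }
  let p := W.topologicalClosure.starProjection
  have hpsa : IsSelfAdjoint p := isSelfAdjoint_starProjection _
  have hpmem : ∀ a b, entry p a b ∈ M.commutant := by
    intro a b
    rw [VonNeumannAlgebra.mem_commutant_iff]
    intro x hx
    have hstab : ∀ x ∈ M, ∀ u ∈ W.topologicalClosure, diag (Fin 2) x u ∈ W.topologicalClosure := by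
      intro x hx u hu
      refine map_mem_closure (diag (Fin 2) x).continuous hu ?_
      rintro _ ⟨y, hy, rfl⟩
      refine ⟨x * y, mul_mem hx hy, ?_⟩
      ext i; fin_cases i <;> simp [diag_apply, hv0, hv1]
    refine (((diag_commute_iff x p).1 ?_) a b).eq
    refine ContinuousLinearMap.ext fun u => ?_
    rw [mul_apply_eq_comp, mul_apply_eq_comp]
    refine (Submodule.eq_starProjection_of_mem_of_inner_eq_zero
      (hstab x hx _ (Submodule.starProjection_apply_mem _ _)) fun w hw => ?_).symm
    rw [← map_sub, ← inner_star_right, ← diagHom_apply, ← map_star, diagHom_apply]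
    exact Submodule.starProjection_inner_eq_zero _ _ (hstab _ (star_mem hx) _ hw)
  have hfix : p (vec ψ ζ) = vec ψ ζ :=
    Submodule.starProjection_eq_self_iff.2
      (W.le_topologicalClosure ⟨1, one_mem M, by simp⟩)
  have hker : p (vec ζ (-ψ)) = 0 := by
    refine (Submodule.starProjection_apply_eq_zero_iff _).2 ?_
    rw [Submodule.orthogonal_closure, Submodule.mem_orthogonal]
    rintro _ ⟨x, hx, rfl⟩
    rw [PiLp.inner_apply, Fin.sum_univ_two, hv0, hv1, hv0, hv1, inner_neg_right, h1 x hx,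
      inner_star_right, add_neg_cancel]
  have hp : ∀ v w a, p (vec v w) a = entry p a 0 v + entry p a 1 w := fun v w a => by
    rw [apply_eq_sum_entry, Fin.sum_univ_two, hv0, hv1]
  have e1 : entry p 0 0 ψ + entry p 0 1 ζ = ψ := by rw [← hp, hfix, hv0]
  have e2 : entry p 0 0 ζ = entry p 0 1 ψ := by
    have := hp ζ (-ψ) 0
    rw [hker, map_neg] at this
    exact eq_of_sub_eq_zero (by rw [sub_eq_add_neg, ← this]; rfl)
  have hstar : star (entry p 1 0) = entry p 0 1 := by rw [← entry_star, hpsa.star_eq]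
  have hp0 : 0 ≤ p := by
    rw [ContinuousLinearMap.nonneg_iff_isPositive]
    exact ContinuousLinearMap.IsPositive.of_isStarProjection isStarProjection_starProjection
  have hp1 : 0 ≤ 1 - p := by
    rw [ContinuousLinearMap.nonneg_iff_isPositive]
    exact ContinuousLinearMap.IsPositive.of_isStarProjection
      isStarProjection_starProjection.one_sub
  have hpos : ∀ v, 0 ≤ (⟪v, entry p 0 0 v⟫_ℂ).re := fun v => by
    rw [entry_apply, ← inner_emb_left]; exact re_inner_nonneg hp0 _
  have hpos' : ∀ v, 0 ≤ (⟪v, entry (1 - p) 0 0 v⟫_ℂ).re := fun v => by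
    rw [entry_apply, ← inner_emb_left]; exact re_inner_nonneg hp1 _
  have h1p : entry (1 - p) 0 0 = 1 - entry p 0 0 := by rw [entry_sub, entry_one]; simp
  have hA : ⟪ψ, (1 - entry p 0 0) ψ⟫_ℂ = -⟪ζ, entry p 0 0 ζ⟫_ℂ := by
    have : (1 - entry p 0 0) ψ = entry p 0 1 ζ := by
      rw [sub_apply, one_apply_eq_self, sub_eq_iff_eq_add', e1]
    rw [this, ← hstar, inner_star_right, h2 _ (hpmem 1 0), hstar, e2]
  have hz1 : (⟪ψ, (1 - entry p 0 0) ψ⟫_ℂ).re = 0 := by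
    refine le_antisymm ?_ (h1p ▸ hpos' ψ)
    rw [hA, Complex.neg_re]; linarith [hpos ζ]
  have hz2 : (⟪ζ, entry p 0 0 ζ⟫_ℂ).re = 0 := by
    have := congrArg Complex.re hA
    rw [hz1, Complex.neg_re] at this; linarith
  have hq : entry p 0 0 = 1 := by
    refine (Cyclic.ext hcyc (hpmem 0 0) (one_mem _) ?_)
    have h00 : 0 ≤ 1 - entry p 0 0 := by
      rw [← h1p]
      refine nonneg_of_inner hpos' fun v => im_inner_eq_zero ?_ v
      rw [isSelfAdjoint_iff, ← entry_star, ((IsSelfAdjoint.one _).sub hpsa).star_eq]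
    have := ((ContinuousLinearMap.nonneg_iff_isPositive _).1 h00)
    have hk : (1 - entry p 0 0) ψ = 0 := by
      obtain ⟨s, hs⟩ := CStarAlgebra.nonneg_iff_eq_star_mul_self.1 h00
      rw [hs, mul_apply_eq_comp, inner_star_right, re_inner_self_eq] at hz1
      have : s ψ = 0 := by simpa using hz1
      rw [hs, mul_apply_eq_comp, this, map_zero]
    rw [sub_apply, one_apply_eq_self, sub_eq_zero] at hk
    rw [← hk, one_apply_eq_self]
  rw [hq, one_apply_eq_self, re_inner_self_eq] at hz2
  simpa using hz2

lemma exists_re_im (M : VonNeumannAlgebra H) {x : H →L[ℂ] H} (hx : x ∈ M) :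
    ∃ a ∈ M, ∃ b ∈ M, IsSelfAdjoint a ∧ IsSelfAdjoint b ∧
      x = a + Complex.I • b ∧ star x = a - Complex.I • b := by
  refine ⟨(2⁻¹ : ℂ) • (x + star x), VonNeumannAlgebra.smul_mem' M _ (add_mem hx (star_mem hx)),
    (-Complex.I * 2⁻¹ : ℂ) • (x - star x), VonNeumannAlgebra.smul_mem' M _ (sub_mem hx (star_mem hx)), ?_, ?_, ?_, ?_⟩
  · rw [isSelfAdjoint_iff, star_smul, star_add, star_star, add_comm]; simp
  · rw [isSelfAdjoint_iff, star_smul, star_sub, star_star]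
    simp only [star_mul', star_neg, Complex.star_def, Complex.conj_I, map_inv₀, Complex.conj_ofNat]
    module
  · rw [smul_smul]
    match_scalars
    · linear_combination (1/2 : ℂ) * Complex.I_mul_I
    · linear_combination (-1/2 : ℂ) * Complex.I_mul_I
  · rw [smul_smul]
    match_scalars
    · linear_combination (1/2 : ℂ) * Complex.I_mul_I
    · linear_combination (-1/2 : ℂ) * Complex.I_mul_I

lemma im_inner_commuting {x y : H →L[ℂ] H} (hx : IsSelfAdjoint x) (hy : IsSelfAdjoint y)
    (h : Commute x y) (ψ : H) : (⟪x ψ, y ψ⟫_ℂ).im = 0 := by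
  rw [← inner_star_right, hx.star_eq]
  exact im_inner_eq_zero (x := x * y) (by
    rw [isSelfAdjoint_iff, star_mul, hx.star_eq, hy.star_eq, h.eq]) ψ

lemma im_inner_saOrbit {M : VonNeumannAlgebra H} {ψ u v : H} (hu : u ∈ (saOrbit M ψ).topologicalClosure)
    (hv : v ∈ (saOrbit M.commutant ψ).topologicalClosure) : (⟪u, v⟫_ℂ).im = 0 := by
  have h1 : ∀ u ∈ saOrbit M ψ, (⟪u, v⟫_ℂ).im = 0 := by
    rintro _ ⟨x, hx, hxs, rfl⟩
    have : IsClosed {v : H | (⟪x ψ, v⟫_ℂ).im = 0} := isClosed_eq (by fun_prop) (by fun_prop)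
    refine this.closure_subset_iff.2 ?_ hv
    rintro _ ⟨y, hy, hys, rfl⟩
    exact im_inner_commuting hxs hys (commute_of_mem hx hy) ψ
  have : IsClosed {u : H | (⟪u, v⟫_ℂ).im = 0} := isClosed_eq (by fun_prop) (by fun_prop)
  exact this.closure_subset_iff.2 h1 hu

lemma realProj_commutant {M : VonNeumannAlgebra H} {ψ : H} (hcyc : Cyclic M ψ) (v : H) :
    realProj (saOrbit M.commutant ψ) v =
      v + Complex.I • realProj (saOrbit M ψ) (Complex.I • v) := by
  symm
  rw [← sub_eq_zero]
  set V := saOrbit M ψ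
  set V' := saOrbit M.commutant ψ
  have him : ∀ u w : H, (⟪u, Complex.I • w⟫_ℂ).im = (⟪u, w⟫_ℂ).re := fun u w => by
    rw [inner_smul_right]; simp
  have hre : ∀ u w : H, (⟪u, Complex.I • w⟫_ℂ).re = -(⟪u, w⟫_ℂ).im := fun u w => by
    rw [inner_smul_right]; simp
  have key1 : ∀ x ∈ M, IsSelfAdjoint x → (⟪x ψ, v + Complex.I • realProj V (Complex.I • v)
      - realProj V' v⟫_ℂ).im = 0 := by
    intro x hx hxs
    have hmem : x ψ ∈ V.topologicalClosure := V.le_topologicalClosure (mem_saOrbit hx hxs)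
    have h1 := re_inner_sub_realProj V (Complex.I • v) hmem
    have h2 := im_inner_saOrbit hmem (realProj_mem V' v)
    rw [inner_sub_right, Complex.sub_re, hre] at h1
    rw [inner_sub_right, inner_add_right, Complex.sub_im, Complex.add_im, him, h2]
    linarith
  have key2 : ∀ y ∈ M.commutant, IsSelfAdjoint y → (⟪y ψ, v + Complex.I • realProj V (Complex.I • v)
      - realProj V' v⟫_ℂ).re = 0 := by
    intro y hy hys
    have hmem : y ψ ∈ V'.topologicalClosure := V'.le_topologicalClosure (mem_saOrbit hy hys)
    have h1 := re_inner_sub_realProj V' v hmem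
    have h2 := im_inner_saOrbit (realProj_mem V (Complex.I • v)) hmem
    rw [← inner_conj_symm, Complex.conj_im, neg_eq_zero] at h2
    rw [inner_sub_right, Complex.sub_re] at h1
    rw [inner_sub_right, inner_add_right, Complex.sub_re, Complex.add_re, hre, h2]
    linarith
  generalize v + Complex.I • realProj V (Complex.I • v) - realProj V' v = ζ at key1 key2
  refine eq_zero_of_inner_real_imag hcyc (fun x hx => ?_) fun y hy => ?_
  · obtain ⟨a, ha, b, hb, has, hbs, h1, h2⟩ := exists_re_im M hx
    have ea : ⟪ζ, a ψ⟫_ℂ = ⟪a ψ, ζ⟫_ℂ := by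
      rw [← inner_conj_symm, Complex.conj_eq_iff_im.2 (key1 a ha has)]
    have eb : ⟪ζ, b ψ⟫_ℂ = ⟪b ψ, ζ⟫_ℂ := by
      rw [← inner_conj_symm, Complex.conj_eq_iff_im.2 (key1 b hb hbs)]
    rw [h2, h1, add_apply, sub_apply, smul_apply, inner_add_left, inner_sub_right, inner_smul_left,
      inner_smul_right, ea, eb, Complex.conj_I]
    ring
  · obtain ⟨a, ha, b, hb, has, hbs, h1, h2⟩ := exists_re_im _ hy
    have ea : ⟪ζ, a ψ⟫_ℂ = -⟪a ψ, ζ⟫_ℂ := by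
      rw [← inner_conj_symm]
      apply Complex.ext <;> simp only [Complex.conj_re, Complex.conj_im, Complex.neg_re, Complex.neg_im, key2 a ha has, neg_zero]
    have eb : ⟪ζ, b ψ⟫_ℂ = -⟪b ψ, ζ⟫_ℂ := by
      rw [← inner_conj_symm]
      apply Complex.ext <;> simp only [Complex.conj_re, Complex.conj_im, Complex.neg_re, Complex.neg_im, key2 b hb hbs, neg_zero]
    rw [h2, h1, add_apply, sub_apply, smul_apply, inner_add_left, inner_sub_right, inner_smul_left,
      inner_smul_right, ea, eb, Complex.conj_I]
    ring

/-- Duality between the real subspaces `M_sa ψ` and `M'_sa ψ`, in terms of their operators. -/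
theorem modOp_commutant {M : VonNeumannAlgebra H} {ψ : H} (hcyc : Cyclic M ψ) :
    modOp (saOrbit M.commutant ψ) = 2 - modOp (saOrbit M ψ) := by
  ext v
  have h2 : (2 - modOp (saOrbit M ψ)) v = v + v - modOp (saOrbit M ψ) v := by
    rw [← one_add_one_eq_two]; simp
  rw [h2, modOp_apply, modOp_apply, realProj_commutant hcyc, realProj_commutant hcyc, smul_smul,
    Complex.I_mul_I, neg_one_smul, realProj_neg]
  match_scalars
  · linear_combination -Complex.I_mul_I
  · ring
  · linear_combination Complex.I_mul_I

lemma eq_modOp_of_inner {N : VonNeumannAlgebra H} {ψ v : H} {ζ : H →L[ℂ] H} (hζ : ζ ∈ N)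
    (h : ∀ w ∈ N, ⟪w ψ, ζ ψ⟫_ℂ + ⟪(star ζ) ψ, (star w) ψ⟫_ℂ = 2 * ⟪w ψ, v⟫_ℂ) :
    ζ ψ = modOp (saOrbit N ψ) v := by
  obtain ⟨a, ha, b, hb, has, hbs, h1, h2⟩ := exists_re_im N hζ
  have key : ∀ w ∈ N, IsSelfAdjoint w → (⟪w ψ, v - a ψ⟫_ℂ).re = 0 ∧
      (⟪w ψ, -(Complex.I • v) - b ψ⟫_ℂ).re = 0 := by
    intro w hw hws
    have := h w hw
    rw [hws.star_eq, h2, h1, add_apply, sub_apply, smul_apply, inner_add_right, inner_sub_left,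
      inner_smul_left, inner_smul_right, ← inner_conj_symm (a ψ), ← inner_conj_symm (b ψ)] at this
    have hr := congrArg Complex.re this
    have hi := congrArg Complex.im this
    simp only [Complex.add_re, Complex.sub_re, Complex.mul_re, Complex.conj_re, Complex.conj_im,
      Complex.add_im, Complex.sub_im, Complex.mul_im, Complex.I_re, Complex.I_im, Complex.re_ofNat,
      Complex.im_ofNat] at hr hi
    rw [inner_sub_right, inner_sub_right, inner_neg_right, inner_smul_right]
    simp
    constructor <;> linarith
  have hcl : ∀ u : H, (∀ w ∈ N, IsSelfAdjoint w → (⟪w ψ, u⟫_ℂ).re = 0) →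
      ∀ w ∈ saOrbit N ψ, (⟪w, u⟫_ℂ).re = 0 := by
    rintro u hu _ ⟨w, hw, hws, rfl⟩
    exact hu w hw hws
  have e1 := realProj_unique ((saOrbit N ψ).le_topologicalClosure (mem_saOrbit ha has))
    (hcl _ fun w hw hws => (key w hw hws).1)
  have e2 := realProj_unique ((saOrbit N ψ).le_topologicalClosure (mem_saOrbit hb hbs))
    (hcl _ fun w hw hws => (key w hw hws).2)
  rw [realProj_neg] at e2
  rw [modOp_apply, h1, add_apply, smul_apply, e1, e2, smul_neg, sub_eq_add_neg]

lemma weighted_eq_modOp {N : VonNeumannAlgebra H} {ψ v : H} {ζ : H →L[ℂ] H} (hζ : ζ ∈ N) {α β : ℂ}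
    (hβ : β ≠ 0)
    (h : ∀ w ∈ N, α * ⟪w ψ, ζ ψ⟫_ℂ + β * ⟪(star ζ) ψ, (star w) ψ⟫_ℂ = 2 * ⟪w ψ, v⟫_ℂ) :
    (2 * β) • ζ ψ = modOp (saOrbit N ψ) ((β - α) • ζ ψ + (2 : ℂ) • v) := by
  have := eq_modOp_of_inner (v := (2 * β)⁻¹ • ((β - α) • ζ ψ + (2 : ℂ) • v)) hζ fun w hw => by
    rw [inner_smul_right, inner_add_right, inner_smul_right, inner_smul_right, ← h w hw]
    field_simp
    ring
  rw [map_smul, eq_inv_smul_iff₀ (by simpa using hβ)] at this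
  exact this

lemma inner_of_realProj {N : VonNeumannAlgebra H} {ψ : H} {x z : H →L[ℂ] H}
    (hx : x ∈ N.commutant) (hxs : IsSelfAdjoint x)
    (h : z ψ = realProj (saOrbit N ψ) (x ψ)) {w : H →L[ℂ] H} (hw : w ∈ N) :
    ⟪w ψ, z ψ⟫_ℂ + ⟪z ψ, (star w) ψ⟫_ℂ = 2 * ⟪w ψ, x ψ⟫_ℂ := by
  have key : ∀ a ∈ N, IsSelfAdjoint a → ⟪a ψ, z ψ⟫_ℂ + ⟪z ψ, a ψ⟫_ℂ = 2 * ⟪a ψ, x ψ⟫_ℂ := by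
    intro a ha has
    have h1 := re_inner_sub_realProj (saOrbit N ψ) (x ψ)
      ((saOrbit N ψ).le_topologicalClosure (mem_saOrbit ha has))
    have h2 := im_inner_commuting has hxs (commute_of_mem ha hx) ψ
    rw [← h, inner_sub_right, Complex.sub_re] at h1
    rw [← inner_conj_symm (z ψ), Complex.add_conj]
    apply Complex.ext
    · simp; linarith
    · simp [h2]
  obtain ⟨a, ha, b, hb, has, hbs, h1, h2⟩ := exists_re_im N hw
  have ea := key a ha has
  have eb := key b hb hbs
  rw [h2, h1, add_apply, sub_apply, smul_apply, inner_add_left, inner_add_left, inner_sub_right,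
    inner_smul_left, inner_smul_left, inner_smul_right, Complex.conj_I]
  linear_combination ea - Complex.I * eb

end Modular

section Amplification

variable {H : Type*} [NormedAddCommGroup H] [InnerProductSpace ℂ H] [CompleteSpace H]
variable {ι : Type*} [Fintype ι] [DecidableEq ι]

/-- Left action of a matrix of operators on `Amp ι (Amp ι H)`. -/
noncomputable def lop (x : ι → ι → H →L[ℂ] H) : Amp ι (Amp ι H) →L[ℂ] Amp ι (Amp ι H) :=
  diag ι (ofMat x)

/-- Right action of a matrix of operators on `Amp ι (Amp ι H)`. -/
noncomputable def rop (z : ι → ι → H →L[ℂ] H) : Amp ι (Amp ι H) →L[ℂ] Amp ι (Amp ι H) :=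
  ofMat fun l j => diag ι (z l j)

lemma lop_apply (x : ι → ι → H →L[ℂ] H) (v : Amp ι (Amp ι H)) (l m : ι) :
    lop x v l m = ∑ j, x m j (v l j) := by
  rw [lop, diag_apply, ofMat_apply]

lemma rop_apply (z : ι → ι → H →L[ℂ] H) (v : Amp ι (Amp ι H)) (l m : ι) :
    rop z v l m = ∑ j, z l j (v j m) := by
  rw [rop, ofMat_apply]
  simp [diag_apply]

lemma commute_lop_rop_iff (x z : ι → ι → H →L[ℂ] H) :
    Commute (lop x) (rop z) ↔ ∀ a b c d, Commute (x a b) (z c d) := by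
  rw [lop, diag_commute_iff]
  simp only [rop, entry_ofMat]
  constructor
  · intro h a b c d
    have := (diag_commute_iff _ _).1 (h c d).symm a b
    rw [entry_ofMat] at this
    exact this.symm
  · intro h a b
    refine ((diag_commute_iff _ _).2 fun c d => ?_).symm
    rw [entry_ofMat]
    exact (h c d a b).symm

lemma star_ofMat (x : ι → ι → H →L[ℂ] H) : star (ofMat x) = ofMat fun a b => star (x b a) :=
  entry_ext fun a b => by rw [entry_star, entry_ofMat, entry_ofMat]

lemma diag_one : diag ι (1 : H →L[ℂ] H) = 1 := by
  ext v a; simp [diag_apply]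

lemma diag_zero : diag ι (0 : H →L[ℂ] H) = 0 := by
  ext v a; simp [diag_apply]

lemma star_diag (x : H →L[ℂ] H) : star (diag ι x) = diag ι (star x) :=
  entry_ext fun a b => by
    rw [entry_star, entry_diag, entry_diag]
    by_cases h : a = b
    · simp [h]
    · simp [h, Ne.symm h]

lemma star_lop (x : ι → ι → H →L[ℂ] H) : star (lop x) = lop fun a b => star (x b a) := by
  rw [lop, star_diag, star_ofMat, lop]

lemma star_rop (z : ι → ι → H →L[ℂ] H) : star (rop z) = rop fun a b => star (z b a) := by
  rw [rop, star_ofMat, rop]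
  simp only [star_diag]

lemma lop_injective : Function.Injective (lop : (ι → ι → H →L[ℂ] H) → _) := by
  intro x y h
  funext a b
  have := congrArg (fun T => entry (entry T a a) a b) h
  simpa [lop, entry_diag, entry_ofMat] using this

lemma rop_injective : Function.Injective (rop : (ι → ι → H →L[ℂ] H) → _) := by
  intro x y h
  funext a b
  have := congrArg (fun T => entry (entry T a b) a a) h
  simpa [rop, entry_diag, entry_ofMat] using this

/-- The right matrix algebra over the commutant of `M`. -/
noncomputable def ampRight (ι : Type*) [Fintype ι] [DecidableEq ι] (M : VonNeumannAlgebra H) :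
    VonNeumannAlgebra (Amp ι (Amp ι H)) :=
  vnCentralizer {T | ∃ x : ι → ι → H →L[ℂ] H, (∀ a b, x a b ∈ M) ∧ T = lop x}

lemma rop_mem {M : VonNeumannAlgebra H} {z : ι → ι → H →L[ℂ] H}
    (hz : ∀ a b, z a b ∈ M.commutant) : rop z ∈ ampRight ι M := by
  refine (mem_vnCentralizer ?_).2 ?_
  · rintro _ ⟨x, hx, rfl⟩
    exact ⟨_, fun a b => star_mem (hx b a), star_lop x⟩
  · rintro _ ⟨x, hx, rfl⟩
    exact ((commute_lop_rop_iff x z).2 fun a b c d => commute_of_mem (hx a b) (hz c d)).eq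

lemma lop_mem {M : VonNeumannAlgebra H} {x : ι → ι → H →L[ℂ] H}
    (hx : ∀ a b, x a b ∈ M) : lop x ∈ (ampRight ι M).commutant :=
  subset_commutant_vnCentralizer ⟨x, hx, rfl⟩

lemma exists_eq_rop [Nonempty ι] {M : VonNeumannAlgebra H} {T : Amp ι (Amp ι H) →L[ℂ] Amp ι (Amp ι H)}
    (hT : T ∈ ampRight ι M) : ∃ z : ι → ι → H →L[ℂ] H, (∀ a b, z a b ∈ M.commutant) ∧ T = rop z := by
  have h : ∀ x : ι → ι → H →L[ℂ] H, (∀ a b, x a b ∈ M) → ∀ c d, Commute (ofMat x) (entry T c d) :=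
    fun x hx => (diag_commute_iff _ _).1 (commute_of_mem hT (lop_mem hx)).symm
  let i : ι := Classical.arbitrary ι
  have h1 : ∀ c d, entry T c d = diag ι (entry (entry T c d) i i) := fun c d =>
    eq_diag_of_commute_unit (fun a b => h _ (fun a' b' => by
      split_ifs
      · exact one_mem M
      · exact zero_mem M) c d) i
  refine ⟨fun c d => entry (entry T c d) i i, fun c d => ?_, entry_ext fun c d => ?_⟩
  · rw [VonNeumannAlgebra.mem_commutant_iff]
    intro x hx
    exact ((diag_commute_iff x _).1 (h (fun a b => if a = b then x else 0) (fun a b => by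
      split_ifs
      · exact hx
      · exact zero_mem M) c d) i i).eq
  · rw [rop, entry_ofMat]; exact h1 c d

lemma exists_eq_lop [Nonempty ι] {M : VonNeumannAlgebra H} {T : Amp ι (Amp ι H) →L[ℂ] Amp ι (Amp ι H)}
    (hT : T ∈ (ampRight ι M).commutant) :
    ∃ x : ι → ι → H →L[ℂ] H, (∀ a b, x a b ∈ M) ∧ T = lop x := by
  have h : ∀ z : ι → ι → H →L[ℂ] H, (∀ a b, z a b ∈ M.commutant) → Commute (rop z) T :=
    fun z hz => commute_of_mem (rop_mem hz) hT
  let i : ι := Classical.arbitrary ι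
  have h1 : T = diag ι (entry T i i) := by
    refine eq_diag_of_commute_unit (fun a b => ?_) i
    convert h (fun c d => if c = a ∧ d = b then 1 else 0) (fun c d => by
      split_ifs
      · exact one_mem _
      · exact zero_mem _) using 1
    refine entry_ext fun c d => ?_
    rw [entry_unit, rop, entry_ofMat]
    split_ifs
    · exact diag_one.symm
    · exact diag_zero.symm
  refine ⟨entry (entry T i i), fun a b => mem_of_commute M fun y hy => ?_, ?_⟩
  · have h2 := h (fun c d => if c = d then y else 0) (fun c d => by
      split_ifs
      · exact hy
      · exact zero_mem _)
    have h3 : rop (fun c d : ι => if c = d then y else 0) = diag ι (diag ι y) := by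
      refine entry_ext fun c d => ?_
      rw [entry_diag, rop, entry_ofMat]
      split_ifs
      · rfl
      · exact diag_zero
    rw [h3] at h2
    exact ((diag_commute_iff y _).1 ((diag_commute_iff _ _).1 h2 i i) a b).symm
  · rw [lop, ofMat_entry]; exact h1

/-- The vector `∑ l, √(k l) e_l ⊗ e_l ⊗ ψ`. -/
noncomputable def diagVec (k : ι → ℝ) (ψ : H) : Amp ι (Amp ι H) :=
  ∑ l, emb l (emb l ((√(k l) : ℂ) • ψ))

lemma diagVec_apply (k : ι → ℝ) (ψ : H) (l m : ι) :
    diagVec k ψ l m = if m = l then (√(k l) : ℂ) • ψ else 0 := by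
  rw [diagVec, WithLp.ofLp_sum, Finset.sum_apply, WithLp.ofLp_sum, Finset.sum_apply,
    Finset.sum_eq_single l]
  · simp [emb_apply]
  · intro b _ hb; simp [emb_apply, Ne.symm hb]
  · simp

lemma lop_diagVec (x : ι → ι → H →L[ℂ] H) (k : ι → ℝ) (ψ : H) (l m : ι) :
    lop x (diagVec k ψ) l m = (√(k l) : ℂ) • x m l ψ := by
  rw [lop_apply, Finset.sum_eq_single l]
  · simp [diagVec_apply]
  · intro b _ hb; simp [diagVec_apply, hb]
  · simp

lemma rop_diagVec (z : ι → ι → H →L[ℂ] H) (k : ι → ℝ) (ψ : H) (l m : ι) :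
    rop z (diagVec k ψ) l m = (√(k m) : ℂ) • z l m ψ := by
  rw [rop_apply, Finset.sum_eq_single m]
  · simp [diagVec_apply]
  · intro b _ hb; simp [diagVec_apply, Ne.symm hb]
  · simp

lemma inner_amp (v w : Amp ι (Amp ι H)) : ⟪v, w⟫_ℂ = ∑ l, ∑ m, ⟪v l m, w l m⟫_ℂ := by
  simp only [PiLp.inner_apply]

lemma sum_sum_eq_single {f : ι → ι → ℂ} (a b : ι) (h : ∀ c d, ¬(c = a ∧ d = b) → f c d = 0) :
    ∑ c, ∑ d, f c d = f a b := by
  rw [Finset.sum_eq_single a, Finset.sum_eq_single b]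
  · intro d _ hd; exact h _ _ (by simp [hd])
  · simp
  · intro c _ hc; exact Finset.sum_eq_zero fun d _ => h _ _ (by simp [hc])
  · simp

lemma sqrt_mul_self_ofReal {r : ℝ} (hr : 0 ≤ r) : ((√r : ℝ) : ℂ) * ((√r : ℝ) : ℂ) = (r : ℂ) := by
  rw [← Complex.ofReal_mul, Real.mul_self_sqrt hr]

theorem exists_rop_step [Nonempty ι] (M : VonNeumannAlgebra H) (ψ : H) {k : ι → ℝ} (hk : ∀ l, 0 < k l)
    {x : ι → ι → H →L[ℂ] H} (hx : ∀ a b, x a b ∈ M) (hx0 : 0 ≤ lop x) (hx1 : lop x ≤ 1) :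
    ∃ z : ι → ι → H →L[ℂ] H, (∀ a b, z a b ∈ M.commutant) ∧ 0 ≤ rop z ∧ rop z ≤ 1 ∧
      ∀ l m, (2 * k l : ℂ) • z l m ψ = modOp (saOrbit M.commutant ψ)
        ((k l - k m : ℂ) • z l m ψ + (2 : ℂ) • (√(k m) * √(k l) : ℂ) • x m l ψ) := by
  obtain ⟨Z, hZ, hZ0, hZ1, hZψ⟩ :=
    exists_radonNikodym (ampRight ι M) (lop_mem hx) hx0 hx1 (diagVec k ψ)
  obtain ⟨z, hz, rfl⟩ := exists_eq_rop hZ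
  refine ⟨z, hz, hZ0, hZ1, fun l m => ?_⟩
  have hzs : ∀ a b, star (z a b) = z b a := fun a b => by
    have := hZ0.isSelfAdjoint.star_eq
    rw [star_rop] at this
    exact congrFun (congrFun (rop_injective this) b) a
  refine weighted_eq_modOp (hz l m) (by exact_mod_cast (hk l).ne') fun w hw => ?_
  let W : ι → ι → H →L[ℂ] H := fun a b => if a = l ∧ b = m then w else 0
  have hW : rop W ∈ ampRight ι M := rop_mem fun a b => by
    simp only [W]; split_ifs
    · exact hw
    · exact zero_mem _
  have key := inner_of_realProj (lop_mem hx) hx0.isSelfAdjoint hZψ hW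
  have hsW : star (rop W) = rop fun a b => if b = l ∧ a = m then star w else 0 := by
    rw [star_rop]
    congr 1; funext a b
    simp only [W]; split_ifs <;> simp
  rw [hsW, inner_amp, inner_amp, inner_amp, sum_sum_eq_single l m, sum_sum_eq_single m l,
    sum_sum_eq_single l m] at key
  · simp only [rop_diagVec, lop_diagVec, W, inner_smul_left, inner_smul_right, Complex.conj_ofReal]
      at key
    simp only [and_self, if_true] at key
    rw [hzs, inner_smul_right]
    linear_combination key - ⟪w ψ, z l m ψ⟫_ℂ * sqrt_mul_self_ofReal (hk m).le
      - ⟪z m l ψ, (star w) ψ⟫_ℂ * sqrt_mul_self_ofReal (hk l).le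
  all_goals
    intro c d hcd
    simp only [rop_diagVec, W]
    rw [if_neg (by tauto)]
    simp

theorem exists_lop_step [Nonempty ι] (M : VonNeumannAlgebra H) (ψ : H) {k : ι → ℝ} (hk : ∀ l, 0 < k l)
    {z : ι → ι → H →L[ℂ] H} (hz : ∀ a b, z a b ∈ M.commutant) (hz0 : 0 ≤ rop z) (hz1 : rop z ≤ 1) :
    ∃ x : ι → ι → H →L[ℂ] H, (∀ a b, x a b ∈ M) ∧ 0 ≤ lop x ∧ lop x ≤ 1 ∧
      ∀ l m, (2 * k m : ℂ) • x m l ψ = modOp (saOrbit M ψ)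
        ((k m - k l : ℂ) • x m l ψ + (2 : ℂ) • (√(k m) * √(k l) : ℂ) • z l m ψ) := by
  have hzc : rop z ∈ (ampRight ι M).commutant.commutant := by
    rw [VonNeumannAlgebra.commutant_commutant]; exact rop_mem hz
  obtain ⟨X, hX, hX0, hX1, hXψ⟩ :=
    exists_radonNikodym (ampRight ι M).commutant hzc hz0 hz1 (diagVec k ψ)
  obtain ⟨x, hx, rfl⟩ := exists_eq_lop hX
  refine ⟨x, hx, hX0, hX1, fun l m => ?_⟩
  have hxs : ∀ a b, star (x a b) = x b a := fun a b => by
    have := hX0.isSelfAdjoint.star_eq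
    rw [star_lop] at this
    exact congrFun (congrFun (lop_injective this) b) a
  refine weighted_eq_modOp (hx m l) (by exact_mod_cast (hk m).ne') fun w hw => ?_
  let W : ι → ι → H →L[ℂ] H := fun a b => if a = m ∧ b = l then w else 0
  have hW : lop W ∈ (ampRight ι M).commutant := lop_mem fun a b => by
    simp only [W]; split_ifs
    · exact hw
    · exact zero_mem _
  have key := inner_of_realProj hzc hz0.isSelfAdjoint hXψ hW
  have hsW : star (lop W) = lop fun a b => if b = m ∧ a = l then star w else 0 := by
    rw [star_lop]
    congr 1; funext a b
    simp only [W]; split_ifs <;> simp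
  rw [hsW, inner_amp, inner_amp, inner_amp, sum_sum_eq_single l m, sum_sum_eq_single m l,
    sum_sum_eq_single l m] at key
  · simp only [rop_diagVec, lop_diagVec, W, inner_smul_left, inner_smul_right, Complex.conj_ofReal]
      at key
    simp only [and_self, if_true] at key
    rw [hxs, inner_smul_right]
    linear_combination key - ⟪w ψ, x m l ψ⟫_ℂ * sqrt_mul_self_ofReal (hk l).le
      - ⟪x l m ψ, (star w) ψ⟫_ℂ * sqrt_mul_self_ofReal (hk m).le
  all_goals
    intro c d hcd
    simp only [lop_diagVec, W]
    rw [if_neg (by tauto)]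
    simp

end Amplification

section Chain

variable {H : Type*} [NormedAddCommGroup H] [InnerProductSpace ℂ H] [CompleteSpace H]
variable {ι : Type*} [Fintype ι] [DecidableEq ι]

lemma spectrum_modOp_subset (V : Submodule ℝ H) : spectrum ℝ (modOp V) ⊆ Set.Icc 0 2 := by
  intro r hr
  refine ⟨spectrum_nonneg_of_nonneg (modOp_nonneg V) hr, ?_⟩
  have h : (2 : ℝ) - r ∈ spectrum ℝ (2 - modOp V) := by
    rw [← map_ofNat (algebraMap ℝ (H →L[ℂ] H)) 2, ← spectrum.singleton_sub_eq]
    exact Set.sub_mem_sub rfl hr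
  have := spectrum_nonneg_of_nonneg (two_sub_modOp_nonneg V) h
  linarith

lemma cfc_solve {S : H →L[ℂ] H} (hS : IsSelfAdjoint S) {t : ℝ → ℝ}
    (ht : ContinuousOn t (spectrum ℝ S)) {α β c : ℝ}
    (hD : ∀ σ ∈ spectrum ℝ S, 2 * β - (β - α) * t σ ≠ 0) {u w : H}
    (h : (2 * β : ℂ) • u = cfc t S ((β - α : ℂ) • u + (2 : ℂ) • (c : ℂ) • w)) :
    u = cfc (fun σ => 2 * c * t σ / (2 * β - (β - α) * t σ)) S w := by
  have hDc : ContinuousOn (fun σ => 2 * β - (β - α) * t σ) (spectrum ℝ S) := by fun_prop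
  have hD' : ContinuousOn (fun σ => (2 * β - (β - α) * t σ)⁻¹) (spectrum ℝ S) := hDc.inv₀ hD
  have h1 : cfc (fun σ => (2 * β - (β - α) * t σ)⁻¹) S *
      cfc (fun σ => 2 * β - (β - α) * t σ) S = 1 := by
    rw [← cfc_mul _ _ S hD' hDc, ← cfc_one ℝ S]
    exact cfc_congr fun σ hσ => inv_mul_cancel₀ (hD σ hσ)
  have h2 : cfc (fun σ => 2 * β - (β - α) * t σ) S u = cfc (fun σ => 2 * c * t σ) S w := by
    rw [cfc_sub (fun _ => 2 * β) (fun σ => (β - α) * t σ) S, cfc_const _ S, cfc_const_mul _ t S,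
      cfc_const_mul _ t S, sub_apply, Algebra.algebraMap_eq_smul_one, smul_apply, smul_apply,
      smul_apply, one_apply_eq_self]
    rw [map_add, map_smul, map_smul, map_smul] at h
    rw [← Complex.coe_smul, ← Complex.coe_smul, ← Complex.coe_smul]
    push_cast
    rw [h]
    module
  have h3 : cfc (fun σ => 2 * c * t σ / (2 * β - (β - α) * t σ)) S =
      cfc (fun σ => (2 * β - (β - α) * t σ)⁻¹) S * cfc (fun σ => 2 * c * t σ) S := by
    rw [← cfc_mul _ _ S hD' (by fun_prop)]
    exact cfc_congr fun σ _ => by rw [div_eq_inv_mul]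
  rw [h3, mul_apply_eq_comp, ← h2, ← mul_apply_eq_comp, h1, one_apply_eq_self]

/-- The denominator common to the transfer functions. -/
def den (a b σ : ℝ) : ℝ := a * σ + b * (2 - σ)

/-- The transfer function of half a step. -/
noncomputable def half (a b σ : ℝ) : ℝ := 2 * (√a * √b) * σ / den a b σ

/-- The transfer function of a full step. -/
noncomputable def full (a b σ : ℝ) : ℝ := 4 * (a * b) * (σ * (2 - σ)) / den a b σ ^ 2

lemma den_pos {a b σ : ℝ} (ha : 0 < a) (hb : 0 < b) (hσ : σ ∈ Set.Icc (0 : ℝ) 2) :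
    0 < den a b σ := by
  obtain ⟨h0, h2⟩ := hσ
  unfold den
  rcases h0.eq_or_lt with rfl | h0
  · nlinarith
  · nlinarith [mul_pos ha h0, mul_nonneg hb.le (sub_nonneg.2 h2)]

lemma continuousOn_half {a b : ℝ} (ha : 0 < a) (hb : 0 < b) :
    ContinuousOn (half a b) (Set.Icc 0 2) := by
  unfold half
  refine ContinuousOn.div (by fun_prop) (by unfold den; fun_prop) fun σ hσ => (den_pos ha hb hσ).ne'

lemma continuousOn_full {a b : ℝ} (ha : 0 < a) (hb : 0 < b) :
    ContinuousOn (full a b) (Set.Icc 0 2) := by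
  unfold full
  refine ContinuousOn.div (by fun_prop) (by unfold den; fun_prop)
    fun σ hσ => pow_ne_zero _ (den_pos ha hb hσ).ne'

lemma modOp_eq_cfc (V : Submodule ℝ H) : modOp V = cfc (fun σ : ℝ => σ) (modOp V) :=
  (cfc_id' ℝ (modOp V) (modOp_isSelfAdjoint V)).symm

lemma two_sub_modOp_eq_cfc (V : Submodule ℝ H) :
    2 - modOp V = cfc (fun σ : ℝ => 2 - σ) (modOp V) := by
  have := modOp_isSelfAdjoint V
  rw [cfc_sub (fun _ : ℝ => (2 : ℝ)) (fun σ => σ) (modOp V), cfc_const _ (modOp V),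
    cfc_id' ℝ (modOp V), map_ofNat]

theorem half_step [Nonempty ι] {M : VonNeumannAlgebra H} {ψ : H}
    {k : ι → ℝ} (hk : ∀ l, 0 < k l) {x : ι → ι → H →L[ℂ] H} (hx : ∀ a b, x a b ∈ M)
    (hx0 : 0 ≤ lop x) (hx1 : lop x ≤ 1) :
    ∃ z : ι → ι → H →L[ℂ] H, (∀ a b, z a b ∈ M.commutant) ∧ 0 ≤ rop z ∧ rop z ≤ 1 ∧
      ∀ l m, z l m ψ = cfc (half (k m) (k l)) (modOp (saOrbit M.commutant ψ)) (x m l ψ) := by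
  obtain ⟨z, hzM, hz0, hz1, hz⟩ := exists_rop_step M ψ hk hx hx0 hx1
  refine ⟨z, hzM, hz0, hz1, fun l m => ?_⟩
  have h := hz l m
  rw [← Complex.ofReal_mul] at h
  nth_rewrite 1 [modOp_eq_cfc] at h
  have hden : ∀ σ, 2 * k l - (k l - k m) * σ = den (k m) (k l) σ := fun σ => by unfold den; ring
  rw [cfc_solve (modOp_isSelfAdjoint _) (by fun_prop) (fun σ hσ => by
    rw [hden]; exact (den_pos (hk m) (hk l) (spectrum_modOp_subset _ hσ)).ne') h]
  simp only [hden]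
  rfl

theorem half_step' [Nonempty ι] {M : VonNeumannAlgebra H} {ψ : H} (hcyc : Cyclic M ψ)
    {k : ι → ℝ} (hk : ∀ l, 0 < k l) {z : ι → ι → H →L[ℂ] H} (hz : ∀ a b, z a b ∈ M.commutant)
    (hz0 : 0 ≤ rop z) (hz1 : rop z ≤ 1) :
    ∃ x : ι → ι → H →L[ℂ] H, (∀ a b, x a b ∈ M) ∧ 0 ≤ lop x ∧ lop x ≤ 1 ∧
      ∀ m l, x m l ψ = cfc (fun σ => 2 * (√(k m) * √(k l)) * (2 - σ) / den (k m) (k l) σ)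
        (modOp (saOrbit M.commutant ψ)) (z l m ψ) := by
  obtain ⟨x, hxM, hx0, hx1, hx⟩ := exists_lop_step M ψ hk hz hz0 hz1
  refine ⟨x, hxM, hx0, hx1, fun m l => ?_⟩
  have h := hx l m
  have hR : modOp (saOrbit M ψ) = 2 - modOp (saOrbit M.commutant ψ) := by
    rw [modOp_commutant hcyc]; abel
  rw [← Complex.ofReal_mul, hR, two_sub_modOp_eq_cfc] at h
  have hden : ∀ σ, 2 * k m - (k m - k l) * (2 - σ) = den (k m) (k l) σ :=
    fun σ => by unfold den; ring
  rw [cfc_solve (modOp_isSelfAdjoint _) (by fun_prop) (fun σ hσ => by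
    rw [hden]; exact (den_pos (hk m) (hk l) (spectrum_modOp_subset _ hσ)).ne') h]
  simp only [hden]

theorem exists_chain [Nonempty ι] {M : VonNeumannAlgebra H} {ψ : H} (hcyc : Cyclic M ψ)
    {k : ι → ℝ} (hk : ∀ l, 0 < k l) {x₀ : ι → ι → H →L[ℂ] H} (hx : ∀ a b, x₀ a b ∈ M)
    (hx0 : 0 ≤ lop x₀) (hx1 : lop x₀ ≤ 1) (n : ℕ) :
    ∃ x : ι → ι → H →L[ℂ] H, (∀ a b, x a b ∈ M) ∧ 0 ≤ lop x ∧ lop x ≤ 1 ∧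
      ∀ m l, x m l ψ = cfc (fun σ => full (k m) (k l) σ ^ n) (modOp (saOrbit M.commutant ψ))
        (x₀ m l ψ) := by
  set S := modOp (saOrbit M.commutant ψ) with hSdef
  have hS : IsSelfAdjoint S := modOp_isSelfAdjoint _
  have hspec : spectrum ℝ S ⊆ Set.Icc 0 2 := spectrum_modOp_subset _
  induction n with
  | zero => exact ⟨x₀, hx, hx0, hx1, fun m l => by simp [cfc_const_one ℝ S]⟩
  | succ n ih =>
    obtain ⟨x, hxM, hx0, hx1, hxe⟩ := ih
    obtain ⟨z, hzM, hz0, hz1, hz⟩ := half_step hk hxM hx0 hx1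
    obtain ⟨y, hyM, hy0, hy1, hy⟩ := half_step' hcyc hk hzM hz0 hz1
    refine ⟨y, hyM, hy0, hy1, fun m l => ?_⟩
    have c1 := (continuousOn_half (hk m) (hk l)).mono hspec
    have c2 : ContinuousOn (fun σ => full (k m) (k l) σ ^ n) (spectrum ℝ S) :=
      ((continuousOn_full (hk m) (hk l)).pow n).mono hspec
    have c3 : ContinuousOn (fun σ => 2 * (√(k m) * √(k l)) * (2 - σ) / den (k m) (k l) σ)
        (spectrum ℝ S) :=
      ContinuousOn.div (by fun_prop) (by unfold den; fun_prop)
        fun σ hσ => (den_pos (hk m) (hk l) (hspec hσ)).ne'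
    have c4 : ContinuousOn (fun σ => 2 * (√(k m) * √(k l)) * (2 - σ) / den (k m) (k l) σ *
        half (k m) (k l) σ) (spectrum ℝ S) := c3.mul c1
    rw [hy, hz, hxe, ← mul_apply_eq_comp, ← mul_apply_eq_comp, ← cfc_mul _ _ S c3 c1,
      ← cfc_mul _ _ S c4 c2]
    congr 1
    refine cfc_congr fun σ hσ => ?_
    have hd := (den_pos (hk m) (hk l) (hspec hσ)).ne'
    simp only [pow_succ', half, full]
    congr 1
    field_simp
    rw [Real.sq_sqrt (hk m).le, Real.sq_sqrt (hk l).le]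
    ring

end Chain

section Convolution

/-- The indicator of the window `[-J, J]`. -/
def window (J r : ℤ) : ℝ := if |r| ≤ J then 1 else 0

lemma window_nonneg (J r : ℤ) : 0 ≤ window J r := by unfold window; split_ifs <;> norm_num

lemma window_sq (J r : ℤ) : window J r ^ 2 = window J r := by unfold window; split_ifs <;> norm_num

lemma window_neg (J r : ℤ) : window J (-r) = window J r := by simp [window]

lemma window_sub_comm (J a b : ℤ) : window J (a - b) = window J (b - a) := by
  rw [← window_neg, neg_sub]

lemma sum_window_le {J : ℤ} (hJ : 0 ≤ J) (s : Finset ℤ) (a : ℤ) :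
    ∑ j ∈ s, window J (j - a) ≤ 2 * J + 1 := by
  have h : s.filter (fun j => |j - a| ≤ J) ⊆ Finset.Icc (a - J) (a + J) := by
    intro j hj
    rw [Finset.mem_filter, abs_le] at hj
    rw [Finset.mem_Icc]; omega
  have h2 := Finset.card_le_card h
  rw [Int.card_Icc] at h2
  have h3 : ((s.filter (fun j => |j - a| ≤ J)).card : ℤ) ≤ 2 * J + 1 := by omega
  unfold window
  rw [Finset.sum_boole]
  exact_mod_cast h3

lemma sum_window_le' {J : ℤ} (hJ : 0 ≤ J) (s : Finset ℤ) (a : ℤ) :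
    ∑ j ∈ s, window J (a - j) ≤ 2 * J + 1 := by
  simp_rw [window_sub_comm J a]
  exact sum_window_le hJ s a

variable {N J : ℤ} {k γ : ℤ → ℝ} {κ : ℝ}

lemma conv_sq_le (hγ : ∀ r, 0 ≤ γ r) (s : Finset ℤ) (f : ℤ → ℤ) (g : ℤ → ℤ) :
    (∑ j ∈ s, γ (f j) * window J (g j)) ^ 2 ≤
      (∑ j ∈ s, γ (f j)) * ∑ j ∈ s, γ (f j) * window J (g j) :=
  Finset.sum_sq_le_sum_mul_sum_of_sq_le_mul s (fun _ _ => hγ _)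
    (fun _ _ => mul_nonneg (hγ _) (window_nonneg _ _)) fun j _ => by
      rw [mul_pow, window_sq]; exact (by ring : _ = _).le

lemma sum_conv_sq_le_left (hγ : ∀ r, 0 ≤ γ r) {s t : Finset ℤ} {f : ℤ → ℤ → ℤ}
    {g : ℤ → ℤ} (hκ : 0 ≤ κ) (h1 : ∀ m ∈ t, ∑ j ∈ s, γ (f m j) ≤ κ)
    (h2 : ∀ j ∈ s, ∑ m ∈ t, γ (f m j) ≤ κ) :
    ∑ m ∈ t, (∑ j ∈ s, γ (f m j) * window J (g j)) ^ 2 ≤ κ ^ 2 * ∑ j ∈ s, window J (g j) := by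
  calc _ ≤ ∑ m ∈ t, κ * ∑ j ∈ s, γ (f m j) * window J (g j) := by
        refine Finset.sum_le_sum fun m hm => (conv_sq_le hγ s _ _).trans ?_
        exact mul_le_mul_of_nonneg_right (h1 m hm)
          (Finset.sum_nonneg fun j _ => mul_nonneg (hγ _) (window_nonneg _ _))
    _ = κ * ∑ j ∈ s, (∑ m ∈ t, γ (f m j)) * window J (g j) := by
        rw [← Finset.mul_sum, Finset.sum_comm]; simp_rw [Finset.sum_mul]
    _ ≤ κ * ∑ j ∈ s, κ * window J (g j) := by
        refine mul_le_mul_of_nonneg_left (Finset.sum_le_sum fun j hj => ?_) hκ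
        exact mul_le_mul_of_nonneg_right (h2 j hj) (window_nonneg _ _)
    _ = _ := by rw [← Finset.mul_sum]; ring

lemma sum_conv_sq_le_right (hγ : ∀ r, 0 ≤ γ r) {s t : Finset ℤ} {f : ℤ → ℤ}
    {g : ℤ → ℤ → ℤ} (hκ : 0 ≤ κ) (h1 : ∑ j ∈ s, γ (f j) ≤ κ) {C : ℝ}
    (h2 : ∀ j ∈ s, ∑ l ∈ t, window J (g l j) ≤ C) (hC : 0 ≤ C) :
    ∑ l ∈ t, (∑ j ∈ s, γ (f j) * window J (g l j)) ^ 2 ≤ κ ^ 2 * C := by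
  calc _ ≤ ∑ l ∈ t, κ * ∑ j ∈ s, γ (f j) * window J (g l j) := by
        refine Finset.sum_le_sum fun m hm => (conv_sq_le hγ s _ _).trans ?_
        exact mul_le_mul_of_nonneg_right h1
          (Finset.sum_nonneg fun j _ => mul_nonneg (hγ _) (window_nonneg _ _))
    _ = κ * ∑ j ∈ s, γ (f j) * ∑ l ∈ t, window J (g l j) := by
        rw [← Finset.mul_sum, Finset.sum_comm]; simp_rw [Finset.mul_sum]
    _ ≤ κ * ∑ j ∈ s, γ (f j) * C := by
        refine mul_le_mul_of_nonneg_left (Finset.sum_le_sum fun j hj => ?_) hκ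
        exact mul_le_mul_of_nonneg_left (h2 j hj) (hγ _)
    _ ≤ κ * (κ * C) := by
        rw [← Finset.sum_mul]
        exact mul_le_mul_of_nonneg_left (mul_le_mul_of_nonneg_right h1 hC) hκ
    _ = _ := by ring

/-- The squared norm of the windowed vector. -/
noncomputable def windowMass (N J : ℤ) (k : ℤ → ℝ) : ℝ :=
  ∑ l ∈ Finset.Ico 0 N, k l * ∑ m ∈ Finset.Ico 0 N, window J (m - l)

theorem sum_conv_upper (hk : ∀ l, 0 ≤ k l) (hγ : ∀ r, 0 ≤ γ r) (hκ : 0 ≤ κ)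
    (h1 : ∀ l ∈ Finset.Ico 0 N, ∑ j ∈ Finset.Ico 0 N, γ (j - l) ≤ κ)
    (h2 : ∀ l ∈ Finset.Ico 0 N, ∑ j ∈ Finset.Ico 0 N, γ (l - j) ≤ κ) :
    ∑ l ∈ Finset.Ico 0 N, k l * ∑ m ∈ Finset.Ico 0 N,
      (∑ j ∈ Finset.Ico 0 N, γ (m - j) * window J (j - l)) ^ 2 ≤ κ ^ 2 * windowMass N J k := by
  rw [windowMass, Finset.mul_sum]
  refine Finset.sum_le_sum fun l hl => ?_
  rw [mul_left_comm]
  exact mul_le_mul_of_nonneg_left (sum_conv_sq_le_left hγ hκ h2 h1) (hk l)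

lemma sum_interior_ge (hk1 : ∀ l, 0 ≤ l → k l ≤ 1) (hk : ∀ l, 0 ≤ k l) {B : ℤ} (hB : 0 ≤ B) :
    ∑ l ∈ Finset.Ico 0 N, k l - 2 * B ≤ ∑ l ∈ Finset.Ico B (N - B), k l := by
  have hsub : Finset.Ico 0 N ⊆ Finset.Ico 0 B ∪ Finset.Ico B (N - B) ∪ (Finset.Ico 0 N ∩ Finset.Ico (N - B) N) := by
    intro l hl
    simp only [Finset.mem_union, Finset.mem_inter, Finset.mem_Ico] at hl ⊢
    omega
  have hcard : ∀ s : Finset ℤ, (∀ l ∈ s, 0 ≤ l) → ∑ l ∈ s, k l ≤ s.card := fun s hs => by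
    calc _ ≤ ∑ l ∈ s, (1 : ℝ) := Finset.sum_le_sum fun l hl => hk1 l (hs l hl)
      _ = _ := by simp
  have e1 := hcard (Finset.Ico 0 B) fun l hl => (Finset.mem_Ico.1 hl).1
  have e2 := hcard (Finset.Ico 0 N ∩ Finset.Ico (N - B) N) fun l hl =>
    (Finset.mem_Ico.1 (Finset.mem_inter.1 hl).1).1
  have c1 : ((Finset.Ico 0 B).card : ℤ) ≤ B := by rw [Int.card_Ico]; omega
  have c2 : ((Finset.Ico 0 N ∩ Finset.Ico (N - B) N).card : ℤ) ≤ B := by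
    have := Finset.card_le_card (Finset.inter_subset_right (s₁ := Finset.Ico 0 N)
      (s₂ := Finset.Ico (N - B) N))
    rw [Int.card_Ico] at this
    omega
  have c1' : ((Finset.Ico 0 B).card : ℝ) ≤ B := by exact_mod_cast c1
  have c2' : ((Finset.Ico 0 N ∩ Finset.Ico (N - B) N).card : ℝ) ≤ B := by exact_mod_cast c2
  have := Finset.sum_le_sum_of_subset_of_nonneg hsub fun l _ _ => hk l
  have h3 := Finset.sum_union_inter (s₁ := Finset.Ico 0 B ∪ Finset.Ico B (N - B))
    (s₂ := Finset.Ico 0 N ∩ Finset.Ico (N - B) N) (f := k)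
  have h4 := Finset.sum_union_inter (s₁ := Finset.Ico 0 B) (s₂ := Finset.Ico B (N - B)) (f := k)
  have p1 : 0 ≤ ∑ l ∈ (Finset.Ico 0 B ∪ Finset.Ico B (N - B)) ∩ (Finset.Ico 0 N ∩ Finset.Ico (N - B) N), k l :=
    Finset.sum_nonneg fun l _ => hk l
  have p2 : 0 ≤ ∑ l ∈ Finset.Ico 0 B ∩ Finset.Ico B (N - B), k l := Finset.sum_nonneg fun l _ => hk l
  linarith

lemma windowMass_le (hk : ∀ l, 0 ≤ k l) (hJ : 0 ≤ J) :
    windowMass N J k ≤ (2 * J + 1) * ∑ l ∈ Finset.Ico 0 N, k l := by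
  rw [windowMass, Finset.mul_sum]
  refine Finset.sum_le_sum fun l _ => ?_
  rw [mul_comm]
  exact mul_le_mul_of_nonneg_right (sum_window_le hJ _ _) (hk l)

lemma sum_window_eq {s : Finset ℤ} {a : ℤ} (h : Finset.Icc (a - J) (a + J) ⊆ s) (f : ℤ → ℝ) :
    ∑ j ∈ s, f j * window J (j - a) = ∑ j ∈ Finset.Icc (a - J) (a + J), f j := by
  rw [← Finset.sum_subset h]
  · refine Finset.sum_congr rfl fun j hj => ?_
    rw [Finset.mem_Icc] at hj
    rw [window, if_pos (abs_le.2 (by omega)), mul_one]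
  · intro j _ hj
    rw [Finset.mem_Icc] at hj
    rw [window, if_neg (by rw [abs_le]; omega), mul_zero]

/-- Lower bound for convolution sums by concentration of the kernel near `k₀`. -/
theorem sum_conv_lower (hk1 : ∀ l, 0 ≤ l → k l ≤ 1) (hk : ∀ l, 0 ≤ k l) (hγ : ∀ r, 0 ≤ γ r)
    {a k₀ : ℤ} (ha : 0 ≤ a) (haJ : a ≤ J) {V : ℝ} (hV0 : 0 ≤ V)
    (hV : V ≤ ∑ r ∈ Finset.Icc (k₀ - a) (k₀ + a), γ r) :
    (∑ l ∈ Finset.Ico 0 N, k l - 2 * ((J + |k₀| : ℤ) : ℝ)) * ((2 * (J - a) + 1) * V ^ 2) ≤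
    ∑ l ∈ Finset.Ico 0 N, k l * ∑ m ∈ Finset.Ico 0 N,
      (∑ j ∈ Finset.Ico 0 N, γ (m - j) * window J (j - l)) ^ 2 := by
  set B : ℤ := J + |k₀| with hBdef
  have hB : 0 ≤ B := by have := abs_nonneg k₀; omega
  have hk₀ := abs_le.1 (le_refl |k₀|)
  have hJa : (0 : ℝ) ≤ 2 * (J - a) + 1 := by
    have : (a : ℝ) ≤ J := by exact_mod_cast haJ
    linarith
  calc _ ≤ (∑ l ∈ Finset.Ico B (N - B), k l) * ((2 * (J - a) + 1) * V ^ 2) :=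
        mul_le_mul_of_nonneg_right (sum_interior_ge hk1 hk hB) (by positivity)
    _ = ∑ l ∈ Finset.Ico B (N - B), k l * ((2 * (J - a) + 1) * V ^ 2) := Finset.sum_mul _ _ _
    _ ≤ ∑ l ∈ Finset.Ico B (N - B), k l * ∑ m ∈ Finset.Ico 0 N,
      (∑ j ∈ Finset.Ico 0 N, γ (m - j) * window J (j - l)) ^ 2 := by
        refine Finset.sum_le_sum fun l hl => mul_le_mul_of_nonneg_left ?_ (hk l)
        rw [Finset.mem_Ico] at hl
        calc _ = ∑ m ∈ Finset.Icc (l + k₀ - (J - a)) (l + k₀ + (J - a)), V ^ 2 := by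
              rw [Finset.sum_const, Int.card_Icc, nsmul_eq_mul]
              congr 1
              have : ((l + k₀ + (J - a) + 1 - (l + k₀ - (J - a))).toNat : ℤ) =
                2 * (J - a) + 1 := by omega
              exact_mod_cast this.symm
          _ ≤ ∑ m ∈ Finset.Icc (l + k₀ - (J - a)) (l + k₀ + (J - a)),
              (∑ j ∈ Finset.Ico 0 N, γ (m - j) * window J (j - l)) ^ 2 := by
              refine Finset.sum_le_sum fun m hm => pow_le_pow_left₀ hV0 (hV.trans ?_) 2
              rw [Finset.mem_Icc] at hm
              rw [sum_window_eq (fun j hj => by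
                rw [Finset.mem_Icc] at hj; rw [Finset.mem_Ico]; omega)]
              calc _ = ∑ j ∈ Finset.Icc (m - k₀ - a) (m - k₀ + a), γ (m - j) := by
                    refine Finset.sum_nbij' (fun r => m - r) (fun j => m - j) ?_ ?_ ?_ ?_ ?_ <;>
                      intro r hr <;> simp only [Finset.mem_Icc, sub_sub_cancel] at hr ⊢
                    all_goals omega
                _ ≤ _ := Finset.sum_le_sum_of_subset_of_nonneg (fun j hj => by
                    rw [Finset.mem_Icc] at hj ⊢; omega) fun _ _ _ => hγ _
          _ ≤ _ := Finset.sum_le_sum_of_subset_of_nonneg (fun m hm => by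
              rw [Finset.mem_Icc] at hm; rw [Finset.mem_Ico]; omega) fun _ _ _ => sq_nonneg _
    _ ≤ _ := Finset.sum_le_sum_of_subset_of_nonneg (fun m hm => by
              rw [Finset.mem_Ico] at hm ⊢; omega) fun l _ _ => mul_nonneg (hk l)
                (Finset.sum_nonneg fun _ _ => sq_nonneg _)

lemma le_windowMass (hk1 : ∀ l, 0 ≤ l → k l ≤ 1) (hk : ∀ l, 0 ≤ k l) (hJ : 0 ≤ J) :
    (∑ l ∈ Finset.Ico 0 N, k l - 2 * J) * (2 * J + 1) ≤ windowMass N J k := by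
  calc _ ≤ (∑ l ∈ Finset.Ico J (N - J), k l) * (2 * J + 1) :=
        mul_le_mul_of_nonneg_right (sum_interior_ge hk1 hk hJ) (by positivity)
    _ = ∑ l ∈ Finset.Ico J (N - J), k l * (2 * J + 1) := Finset.sum_mul _ _ _
    _ ≤ ∑ l ∈ Finset.Ico J (N - J), k l * ∑ m ∈ Finset.Ico 0 N, window J (m - l) := by
        refine Finset.sum_le_sum fun l hl => mul_le_mul_of_nonneg_left ?_ (hk l)
        rw [Finset.mem_Ico] at hl
        have := sum_window_eq (s := Finset.Ico 0 N) (a := l) (J := J) (fun j hj => by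
                rw [Finset.mem_Icc] at hj; rw [Finset.mem_Ico]; omega) (fun _ => 1)
        simp only [one_mul] at this
        rw [this, Finset.sum_const, Int.card_Icc, nsmul_eq_mul, mul_one]
        have : ((l + J + 1 - (l - J)).toNat : ℤ) = 2 * J + 1 := by omega
        exact_mod_cast this.symm.le
    _ ≤ _ := Finset.sum_le_sum_of_subset_of_nonneg (fun m hm => by
              rw [Finset.mem_Ico] at hm ⊢; omega) fun l _ _ => mul_nonneg (hk l)
                (Finset.sum_nonneg fun _ _ => window_nonneg _ _)

/-- Away from the boundary, the difference of the two convolutions is governed by `1 - w`. -/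
lemma conv_diff_sq_le (hJ : 0 ≤ J) {w : ℤ → ℝ} {η : ℝ}
    (hw : ∀ r, (1 - w r) ^ 2 * γ r ^ 2 ≤ η * γ r) {l m : ℤ} (hl : l ∈ Finset.Ico J (N - J))
    (hm : m ∈ Finset.Ico J (N - J)) :
    (∑ j ∈ Finset.Ico 0 N, γ (m - j) * window J (j - l) -
      ∑ j ∈ Finset.Ico 0 N, w (j - l) * γ (j - l) * window J (j - m)) ^ 2 ≤
    (2 * J + 1) * ∑ j ∈ Finset.Ico 0 N, η * γ (j - l) * window J (j - m) := by
  rw [Finset.mem_Ico] at hl hm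
  have hsub : ∀ a, J ≤ a ∧ a < N - J → Finset.Icc (a - J) (a + J) ⊆ Finset.Ico 0 N :=
    fun a ha j hj => by rw [Finset.mem_Icc] at hj; rw [Finset.mem_Ico]; omega
  rw [sum_window_eq (hsub l hl), sum_window_eq (hsub m hm), sum_window_eq (hsub m hm)]
  have e : ∑ j ∈ Finset.Icc (l - J) (l + J), γ (m - j) =
      ∑ j ∈ Finset.Icc (m - J) (m + J), γ (j - l) := by
    refine Finset.sum_nbij' (fun j => m + l - j) (fun j => m + l - j) ?_ ?_ ?_ ?_ ?_ <;>
      intro r hr <;> simp only [Finset.mem_Icc, sub_sub_cancel] at hr ⊢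
    · omega
    · omega
    · congr 1; ring
  rw [e, ← Finset.sum_sub_distrib]
  refine (sq_sum_le_card_mul_sum_sq).trans ?_
  have hc : ((Finset.Icc (m - J) (m + J)).card : ℝ) = 2 * J + 1 := by
    rw [Int.card_Icc]
    have : ((m + J + 1 - (m - J)).toNat : ℤ) = 2 * J + 1 := by omega
    exact_mod_cast this
  rw [hc]
  refine mul_le_mul_of_nonneg_left (Finset.sum_le_sum fun j _ => ?_) (by positivity)
  calc _ = (1 - w (j - l)) ^ 2 * γ (j - l) ^ 2 := by ring
    _ ≤ _ := hw _

theorem sum_conv_diff (hk1 : ∀ l, 0 ≤ l → k l ≤ 1) (hk : ∀ l, 0 ≤ k l) (hγ : ∀ r, 0 ≤ γ r)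
    (hJ : 0 ≤ J) (hκ : 0 ≤ κ)
    (h1 : ∀ l ∈ Finset.Ico 0 N, ∑ j ∈ Finset.Ico 0 N, γ (j - l) ≤ κ)
    (h2 : ∀ l ∈ Finset.Ico 0 N, ∑ j ∈ Finset.Ico 0 N, γ (l - j) ≤ κ)
    {w : ℤ → ℝ} (hw0 : ∀ r, 0 ≤ w r) (hw2 : ∀ r, w r ≤ 2) {η : ℝ} (hη : 0 ≤ η)
    (hw : ∀ r, (1 - w r) ^ 2 * γ r ^ 2 ≤ η * γ r) :
    ∑ l ∈ Finset.Ico 0 N, k l * ∑ m ∈ Finset.Ico 0 N,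
      (∑ j ∈ Finset.Ico 0 N, γ (m - j) * window J (j - l) -
        ∑ j ∈ Finset.Ico 0 N, w (j - l) * γ (j - l) * window J (j - m)) ^ 2 ≤
    40 * J * (2 * J + 1) * κ ^ 2 + (2 * J + 1) ^ 2 * η * κ * ∑ l ∈ Finset.Ico 0 N, k l := by
  set I := Finset.Ico (0 : ℤ) N with hI
  have hJ' : (0 : ℝ) ≤ J := by exact_mod_cast hJ
  set bad : Finset ℤ := I.filter (fun l => l ∉ Finset.Ico J (N - J)) with hbad
  have hbc : (bad.card : ℝ) ≤ 2 * J := by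
    have : bad ⊆ Finset.Ico 0 J ∪ Finset.Ico (N - J) N := by
      intro l hl
      simp only [hbad, hI, Finset.mem_filter, Finset.mem_Ico, Finset.mem_union] at hl ⊢
      omega
    have h := (Finset.card_le_card this).trans (Finset.card_union_le _ _)
    rw [Int.card_Ico, Int.card_Ico] at h
    have h' : (bad.card : ℤ) ≤ 2 * J := by omega
    exact_mod_cast h'
  set f : ℤ → ℤ → ℝ := fun l m => ∑ j ∈ I, γ (m - j) * window J (j - l) with hf
  set h : ℤ → ℤ → ℝ := fun l m => ∑ j ∈ I, w (j - l) * γ (j - l) * window J (j - m) with hh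
  set h0 : ℤ → ℤ → ℝ := fun l m => ∑ j ∈ I, γ (j - l) * window J (j - m) with hh0
  set e : ℤ → ℤ → ℝ := fun l m => 2 * f l m ^ 2 + 8 * h0 l m ^ 2 with he
  have he0 : ∀ l m, 0 ≤ e l m := fun l m => by positivity
  set g : ℤ → ℤ → ℝ := fun l m => (2 * J + 1) * ∑ j ∈ I, η * γ (j - l) * window J (j - m) with hg
  have hg0 : ∀ l m, 0 ≤ g l m := fun l m => mul_nonneg (by positivity)
    (Finset.sum_nonneg fun j _ => mul_nonneg (mul_nonneg hη (hγ _)) (window_nonneg _ _))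
  have hde : ∀ l m, (f l m - h l m) ^ 2 ≤ e l m := fun l m => by
    have i1 : 0 ≤ h l m := Finset.sum_nonneg fun j _ =>
      mul_nonneg (mul_nonneg (hw0 _) (hγ _)) (window_nonneg _ _)
    have i2 : h l m ≤ 2 * h0 l m := by
      simp only [hh, hh0, Finset.mul_sum]
      refine Finset.sum_le_sum fun j _ => ?_
      have := mul_nonneg (hγ (j - l)) (window_nonneg J (j - m))
      nlinarith [hw2 (j - l)]
    have i3 : h l m ^ 2 ≤ (2 * h0 l m) ^ 2 := pow_le_pow_left₀ i1 i2 2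
    simp only [he]
    nlinarith [sq_nonneg (f l m + h l m)]
  have hel : ∀ l ∈ I, ∑ m ∈ I, e l m ≤ 10 * (κ ^ 2 * (2 * J + 1)) := fun l hl => by
    have a1 : ∑ m ∈ I, f l m ^ 2 ≤ κ ^ 2 * (2 * J + 1) :=
      (sum_conv_sq_le_left hγ hκ h2 h1).trans
        (mul_le_mul_of_nonneg_left (sum_window_le hJ _ _) (by positivity))
    have a2 : ∑ m ∈ I, h0 l m ^ 2 ≤ κ ^ 2 * (2 * J + 1) :=
      sum_conv_sq_le_right hγ hκ (h1 l hl) (fun j _ => sum_window_le' hJ _ _) (by positivity)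
    simp only [he, Finset.sum_add_distrib, ← Finset.mul_sum]
    linarith
  have hem : ∀ m ∈ I, ∑ l ∈ I, e l m ≤ 10 * (κ ^ 2 * (2 * J + 1)) := fun m hm => by
    have a1 : ∑ l ∈ I, f l m ^ 2 ≤ κ ^ 2 * (2 * J + 1) :=
      sum_conv_sq_le_right hγ hκ (h2 m hm) (fun j _ => sum_window_le' hJ _ _) (by positivity)
    have a2 : ∑ l ∈ I, h0 l m ^ 2 ≤ κ ^ 2 * (2 * J + 1) :=
      (sum_conv_sq_le_left (f := fun m j => j - m) hγ hκ h1 h2).trans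
        (mul_le_mul_of_nonneg_left (sum_window_le hJ _ _) (by positivity))
    simp only [he, Finset.sum_add_distrib, ← Finset.mul_sum]
    linarith
  have hgl : ∀ l ∈ I, ∑ m ∈ I, g l m ≤ (2 * J + 1) ^ 2 * η * κ := fun l hl => by
    simp only [hg, ← Finset.mul_sum]
    rw [Finset.sum_comm]
    simp only [← Finset.mul_sum]
    calc _ ≤ (2 * (J : ℝ) + 1) * ∑ j ∈ I, η * γ (j - l) * (2 * J + 1) := by
          refine mul_le_mul_of_nonneg_left (Finset.sum_le_sum fun j _ => ?_) (by positivity)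
          exact mul_le_mul_of_nonneg_left (sum_window_le' hJ _ _) (mul_nonneg hη (hγ _))
      _ = (2 * (J : ℝ) + 1) ^ 2 * η * ∑ j ∈ I, γ (j - l) := by
          rw [← Finset.sum_mul, ← Finset.mul_sum]; ring
      _ ≤ _ := mul_le_mul_of_nonneg_left (h1 l hl) (by positivity)
  have hpt : ∀ l ∈ I, ∀ m ∈ I, k l * (f l m - h l m) ^ 2 ≤
      k l * g l m + ((if l ∈ bad then e l m else 0) + if m ∈ bad then e l m else 0) := by
    intro l hl m hm
    have hkl := hk1 l (Finset.mem_Ico.1 hl).1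
    have a1 : k l * (f l m - h l m) ^ 2 ≤ e l m :=
      (mul_le_of_le_one_left (sq_nonneg _) hkl).trans (hde l m)
    have a2 := mul_nonneg (hk l) (hg0 l m)
    have a3 := he0 l m
    by_cases hb : l ∈ bad
    · rw [if_pos hb]; split_ifs <;> linarith
    by_cases hb' : m ∈ bad
    · rw [if_pos hb']; split_ifs; linarith
    rw [if_neg hb, if_neg hb', add_zero, add_zero]
    refine mul_le_mul_of_nonneg_left (conv_diff_sq_le hJ hw ?_ ?_) (hk l)
    · by_contra hc; exact hb (Finset.mem_filter.2 ⟨hl, hc⟩)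
    · by_contra hc; exact hb' (Finset.mem_filter.2 ⟨hm, hc⟩)
  have hbI : I ∩ bad = bad := Finset.inter_eq_right.2 (Finset.filter_subset _ _)
  have hcd : ∀ F : ℤ → ℝ, (∀ l ∈ I, F l ≤ 10 * (κ ^ 2 * (2 * J + 1))) →
      ∑ l ∈ bad, F l ≤ 2 * J * (10 * (κ ^ 2 * (2 * J + 1))) := fun F hF => by
    calc _ ≤ bad.card • (10 * (κ ^ 2 * (2 * (J : ℝ) + 1))) :=
          Finset.sum_le_card_nsmul _ _ _ fun l hl => hF l (Finset.mem_filter.1 hl).1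
      _ ≤ _ := by rw [nsmul_eq_mul]; exact mul_le_mul_of_nonneg_right hbc (by positivity)
  calc _ = ∑ l ∈ I, ∑ m ∈ I, k l * (f l m - h l m) ^ 2 := by simp_rw [Finset.mul_sum]; rfl
    _ ≤ ∑ l ∈ I, ∑ m ∈ I, (k l * g l m +
        ((if l ∈ bad then e l m else 0) + if m ∈ bad then e l m else 0)) :=
        Finset.sum_le_sum fun l hl => Finset.sum_le_sum fun m hm => hpt l hl m hm
    _ = ∑ l ∈ I, k l * ∑ m ∈ I, g l m + (∑ l ∈ bad, ∑ m ∈ I, e l m +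
        ∑ m ∈ bad, ∑ l ∈ I, e l m) := by
        simp only [Finset.sum_add_distrib, ← Finset.mul_sum]
        congr 2
        · rw [← hbI, ← Finset.sum_ite_mem]
          refine Finset.sum_congr rfl fun l _ => ?_
          rw [hbI]; split_ifs <;> simp
        · rw [Finset.sum_comm, ← hbI, ← Finset.sum_ite_mem]
          refine Finset.sum_congr rfl fun l _ => ?_
          rw [hbI]; split_ifs <;> simp
    _ ≤ ∑ l ∈ I, k l * ((2 * J + 1) ^ 2 * η * κ) + (2 * J * (10 * (κ ^ 2 * (2 * J + 1))) +
        2 * J * (10 * (κ ^ 2 * (2 * J + 1)))) :=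
        add_le_add (Finset.sum_le_sum fun l hl => mul_le_mul_of_nonneg_left (hgl l hl) (hk l))
          (add_le_add (hcd _ hel) (hcd _ hem))
    _ = _ := by rw [← Finset.sum_mul]; ring

end Convolution

section Kernel

/-- The squared hyperbolic secant of half the argument. -/
noncomputable def bump (t : ℝ) : ℝ := (Real.cosh (t / 2) ^ 2)⁻¹

lemma bump_nonneg (t : ℝ) : 0 ≤ bump t := by unfold bump; positivity

lemma bump_anti {s t : ℝ} (h : |s| ≤ |t|) : bump t ≤ bump s := by
  unfold bump
  have h1 := Real.cosh_pos (s / 2)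
  have : Real.cosh (s / 2) ≤ Real.cosh (t / 2) := by
    rw [Real.cosh_le_cosh, abs_div, abs_div]
    gcongr
  gcongr

lemma bump_zero : bump 0 = 1 := by simp [bump]

lemma bump_le_one (t : ℝ) : bump t ≤ 1 := by
  rw [← bump_zero]; exact bump_anti (by simp)

lemma bump_pow_ge (t : ℝ) (n : ℕ) : 1 - n * t ^ 2 / 4 ≤ bump t ^ n := by
  have h : Real.exp (-(t ^ 2 / 4)) ≤ bump t := by
    unfold bump
    rw [Real.exp_neg]
    have h0 := Real.cosh_pos (t / 2)
    refine inv_anti₀ (by positivity) ?_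
    calc Real.cosh (t / 2) ^ 2 ≤ Real.exp ((t / 2) ^ 2 / 2) ^ 2 :=
          pow_le_pow_left₀ h0.le (Real.cosh_le_exp_half_sq _) 2
      _ = _ := by rw [← Real.exp_nat_mul]; congr 1; push_cast; ring
  calc _ ≤ Real.exp (n * -(t ^ 2 / 4)) := by
        have := Real.add_one_le_exp (n * -(t ^ 2 / 4)); linarith
    _ = Real.exp (-(t ^ 2 / 4)) ^ n := Real.exp_nat_mul _ _
    _ ≤ _ := pow_le_pow_left₀ (Real.exp_pos _).le h n

lemma bump_pow_le (t : ℝ) (n : ℕ) : bump t ^ n ≤ (1 + n * (t ^ 2 / 4))⁻¹ := by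
  have h : 1 + t ^ 2 / 4 ≤ Real.cosh (t / 2) ^ 2 := by
    rw [Real.cosh_sq]
    have h1 : |t / 2| ≤ Real.sinh |t / 2| := Real.self_le_sinh_iff.2 (abs_nonneg _)
    have h2 := pow_le_pow_left₀ (abs_nonneg _) h1 2
    rw [sq_abs, ← Real.abs_sinh, sq_abs] at h2
    nlinarith
  unfold bump
  rw [inv_pow]
  refine inv_anti₀ (by positivity) ?_
  calc _ ≤ (1 + t ^ 2 / 4) ^ n := one_add_mul_le_pow (by nlinarith [sq_nonneg t]) n
    _ ≤ _ := pow_le_pow_left₀ (by positivity) h n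

lemma bump_eq_exp (t : ℝ) : bump t = 4 * Real.exp t / (Real.exp t + 1) ^ 2 := by
  have h1 : Real.exp t = Real.exp (t / 2) ^ 2 := by
    rw [← Real.exp_nat_mul]; congr 1; push_cast; ring
  have h2 := Real.exp_pos (t / 2)
  rw [bump, Real.cosh_eq, Real.exp_neg, h1]
  field_simp
  norm_num

lemma full_eq_bump {a b σ t : ℝ} (hb : 0 < b) (hσ : σ < 2)
    (h : a * σ = Real.exp t * (b * (2 - σ))) : full a b σ = bump t := by
  have hd : 0 < b * (2 - σ) := mul_pos hb (by linarith)
  have ht := Real.exp_pos t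
  generalize hD : b * (2 - σ) = d at hd h
  rw [full, den, show 4 * (a * b) * (σ * (2 - σ)) = 4 * (a * σ) * (b * (2 - σ)) by ring, h, hD,
    bump_eq_exp]
  field_simp

/-- The transfer function of half a step after absorbing the weights. -/
noncomputable def ratio (a b σ : ℝ) : ℝ := 2 * (a * σ) / den a b σ

lemma one_sub_ratio_sq {a b σ t : ℝ} (hb : 0 < b) (hσ : σ < 2)
    (h : a * σ = Real.exp t * (b * (2 - σ))) : (1 - ratio a b σ) ^ 2 = 1 - bump t := by
  have hd : 0 < b * (2 - σ) := mul_pos hb (by linarith)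
  have ht := Real.exp_pos t
  generalize hD : b * (2 - σ) = d at hd h
  rw [ratio, den, h, hD, bump_eq_exp]
  field_simp
  ring

lemma one_sub_mul_pow_le {τ : ℝ} (h0 : 0 ≤ τ) (h1 : τ ≤ 1) (n : ℕ) :
    (1 - τ) * τ ^ n ≤ (n + 1 : ℝ)⁻¹ := by
  have h : (n + 1 : ℝ) * τ ^ n ≤ ∑ i ∈ Finset.range (n + 1), τ ^ i := by
    calc _ = ∑ i ∈ Finset.range (n + 1), τ ^ n := by simp
      _ ≤ _ := Finset.sum_le_sum fun i hi =>
        pow_le_pow_of_le_one h0 h1 (Nat.lt_succ_iff.1 (Finset.mem_range.1 hi))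
  have h2 := mul_neg_geom_sum τ (n + 1)
  have h3 : 0 ≤ τ ^ (n + 1) := by positivity
  rw [← one_div, le_div_iff₀ (by positivity)]
  nlinarith [mul_le_mul_of_nonneg_left h (sub_nonneg.2 h1)]

lemma exists_center (x : ℝ) (N : ℕ) : ∃ k : ℤ, |k| ≤ N ∧ ∀ r : ℤ, |r| ≤ N →
    (r ≤ k → ((k - r : ℤ) : ℝ) ≤ |x - r|) ∧ (k < r → ((r - k - 1 : ℤ) : ℝ) ≤ |x - r|) := by
  have h1 := Int.floor_le x
  have h2 := Int.lt_floor_add_one x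
  refine ⟨max (-N) (min ⌊x⌋ N), abs_le.2 (by omega), fun r hr => ?_⟩
  rw [abs_le] at hr
  constructor
  · intro h
    rcases le_or_gt (max (-(N : ℤ)) (min ⌊x⌋ N)) ⌊x⌋ with hk | hk
    · have : ((max (-(N : ℤ)) (min ⌊x⌋ N) : ℤ) : ℝ) ≤ ⌊x⌋ := by exact_mod_cast hk
      refine le_trans ?_ (le_abs_self _)
      push_cast at this ⊢; linarith
    · have : max (-(N : ℤ)) (min ⌊x⌋ N) - r ≤ 0 := by omega
      exact le_trans (by exact_mod_cast this) (abs_nonneg _)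
  · intro h
    rcases le_or_gt ⌊x⌋ (max (-(N : ℤ)) (min ⌊x⌋ N)) with hk | hk
    · have : ((⌊x⌋ : ℤ) : ℝ) ≤ (max (-(N : ℤ)) (min ⌊x⌋ N) : ℤ) := by exact_mod_cast hk
      refine le_trans ?_ (neg_le_abs _)
      push_cast at this ⊢; linarith
    · have : r - max (-(N : ℤ)) (min ⌊x⌋ N) - 1 ≤ 0 := by omega
      exact le_trans (by exact_mod_cast this) (abs_nonneg _)

lemma sum_toNat_le {W : Finset ℤ} {f : ℤ → ℤ} (hf : Set.InjOn f W) {M : ℕ}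
    (h0 : ∀ r ∈ W, 0 ≤ f r ∧ f r < M) {F : ℕ → ℝ} (hF : ∀ i, 0 ≤ F i) :
    ∑ r ∈ W, F (f r).toNat ≤ ∑ i ∈ Finset.range M, F i := by
  rw [← Finset.sum_image (f := F) (g := fun r => (f r).toNat) (s := W)]
  · refine Finset.sum_le_sum_of_subset_of_nonneg ?_ fun i _ _ => hF i
    intro i hi
    obtain ⟨r, hr, rfl⟩ := Finset.mem_image.1 hi
    have := h0 r hr
    rw [Finset.mem_range]; omega
  · intro r hr s hs hrs
    have h1 := h0 r hr
    have h2 := h0 s hs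
    exact hf hr hs (by simp only at hrs; omega)

/-- Half the normalizing constant of the kernel. -/
noncomputable def kernelMass (δ : ℝ) (n N : ℕ) : ℝ :=
  ∑ i ∈ Finset.range (2 * N + 1), bump (δ * i) ^ n

theorem sum_bump_le (δ x : ℝ) (n N : ℕ) {W : Finset ℤ}
    (hW : ∀ r ∈ W, |r| ≤ N) :
    ∑ r ∈ W, bump (δ * (x - r)) ^ n ≤ 2 * kernelMass δ n N := by
  obtain ⟨k, hk, h⟩ := exists_center x N
  rw [abs_le] at hk
  have key : ∀ (i : ℤ) (y : ℝ), 0 ≤ i → (i : ℝ) ≤ |y| →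
      bump (δ * y) ^ n ≤ bump (δ * (i.toNat : ℝ)) ^ n := by
    intro i y hi hy
    refine pow_le_pow_left₀ (bump_nonneg _) (bump_anti ?_) n
    have e : ((i.toNat : ℕ) : ℝ) = i := by exact_mod_cast Int.toNat_of_nonneg hi
    rw [abs_mul, abs_mul, e]
    have : |(i : ℝ)| = i := abs_of_nonneg (by exact_mod_cast hi)
    rw [this]
    gcongr
  rw [← Finset.sum_filter_add_sum_filter_not W (fun r => r ≤ k), two_mul]
  refine add_le_add ?_ ?_
  · refine le_trans (Finset.sum_le_sum fun r hr => ?_) (sum_toNat_le (W := W.filter (fun r => r ≤ k))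
      (f := fun r => k - r) (M := 2 * N + 1) (F := fun i => bump (δ * i) ^ n) ?_ ?_ ?_)
    · rw [Finset.mem_filter] at hr
      exact key _ _ (by omega) ((h r (hW r hr.1)).1 hr.2)
    · intro a _ b _ hab; simp only at hab; omega
    · intro r hr
      rw [Finset.mem_filter] at hr
      have := abs_le.1 (hW r hr.1)
      push_cast; omega
    · intro i; exact pow_nonneg (bump_nonneg _) n
  · refine le_trans (Finset.sum_le_sum fun r hr => ?_) (sum_toNat_le (W := W.filter (fun r => ¬ r ≤ k))
      (f := fun r => r - k - 1) (M := 2 * N + 1) (F := fun i => bump (δ * i) ^ n) ?_ ?_ ?_)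
    · rw [Finset.mem_filter] at hr
      exact key _ _ (by omega) ((h r (hW r hr.1)).2 (by omega))
    · intro a _ b _ hab; simp only at hab; omega
    · intro r hr
      rw [Finset.mem_filter] at hr
      have := abs_le.1 (hW r hr.1)
      push_cast; omega
    · intro i; exact pow_nonneg (bump_nonneg _) n

/-- Concentration of the kernel near its centre. -/
theorem le_sum_bump {δ : ℝ} (hδ : 0 ≤ δ) (x : ℝ) (n N a : ℕ) (haN : a ≤ 2 * N) :
    2 * kernelMass δ n N - 2 - 4 * N * bump (δ * a) ^ n ≤
      ∑ r ∈ Finset.Icc (⌊x⌋ - a) (⌊x⌋ + a), bump (δ * (x - r)) ^ n := by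
  have h1 := Int.floor_le x
  have h2 := Int.lt_floor_add_one x
  set k := ⌊x⌋
  set F : ℕ → ℝ := fun i => bump (δ * i) ^ n with hF
  have hF0 : ∀ i, 0 ≤ F i := fun i => pow_nonneg (bump_nonneg _) n
  have hsum : kernelMass δ n N - 1 - 2 * N * bump (δ * a) ^ n ≤ ∑ i ∈ Finset.range a, F (i + 1) := by
    have e1 : kernelMass δ n N = ∑ i ∈ Finset.range (2 * N), F (i + 1) + 1 := by
      rw [kernelMass, Finset.sum_range_succ']
      simp [hF, bump_zero]
    have e2 : ∑ i ∈ Finset.range (2 * N), F (i + 1) = ∑ i ∈ Finset.range a, F (i + 1) +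
        ∑ i ∈ Finset.Ico a (2 * N), F (i + 1) := (Finset.sum_range_add_sum_Ico _ haN).symm
    have e3 : ∑ i ∈ Finset.Ico a (2 * N), F (i + 1) ≤ 2 * N * bump (δ * a) ^ n := by
      calc _ ≤ (Finset.Ico a (2 * N)).card • (bump (δ * a) ^ n) := by
            refine Finset.sum_le_card_nsmul _ _ _ fun i hi => ?_
            rw [Finset.mem_Ico] at hi
            refine pow_le_pow_left₀ (bump_nonneg _) (bump_anti ?_) n
            have : (a : ℝ) ≤ ((i + 1 : ℕ) : ℝ) := by exact_mod_cast (by omega)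
            rw [abs_of_nonneg (by positivity), abs_of_nonneg (by positivity)]
            gcongr
        _ ≤ _ := by
            rw [nsmul_eq_mul, Nat.card_Ico]
            refine mul_le_mul_of_nonneg_right ?_ (pow_nonneg (bump_nonneg _) n)
            exact_mod_cast Nat.sub_le _ _
    linarith
  have hub : ∀ (i : ℕ) (r : ℤ), |x - r| ≤ ((i + 1 : ℕ) : ℝ) → F (i + 1) ≤ bump (δ * (x - r)) ^ n := by
    intro i r h
    refine pow_le_pow_left₀ (bump_nonneg _) (bump_anti ?_) n
    rw [abs_mul, abs_mul, abs_of_nonneg (by positivity : (0:ℝ) ≤ ((i + 1 : ℕ) : ℝ))]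
    gcongr
  have hL : ∑ i ∈ Finset.range a, F (i + 1) ≤ ∑ r ∈ Finset.Ioc (k - a) k, bump (δ * (x - r)) ^ n := by
    calc _ ≤ ∑ i ∈ Finset.range a, bump (δ * (x - ((k - i : ℤ) : ℝ))) ^ n := by
          refine Finset.sum_le_sum fun i _ => hub i _ ?_
          push_cast
          rw [abs_le]; constructor <;> linarith
      _ = _ := by
          refine Finset.sum_nbij' (fun i => k - i) (fun r => (k - r).toNat) ?_ ?_ ?_ ?_ ?_ <;>
            intro i hi <;> simp only [Finset.mem_range, Finset.mem_Ioc] at hi ⊢ <;> omega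
  have hR : ∑ i ∈ Finset.range a, F (i + 1) ≤ ∑ r ∈ Finset.Ioc k (k + a), bump (δ * (x - r)) ^ n := by
    calc _ ≤ ∑ i ∈ Finset.range a, bump (δ * (x - ((k + 1 + i : ℤ) : ℝ))) ^ n := by
          refine Finset.sum_le_sum fun i _ => hub i _ ?_
          push_cast
          rw [abs_le]; constructor <;> linarith
      _ = _ := by
          refine Finset.sum_nbij' (fun i => k + 1 + i) (fun r => (r - k - 1).toNat) ?_ ?_ ?_ ?_ ?_ <;>
            intro i hi <;> simp only [Finset.mem_range, Finset.mem_Ioc] at hi ⊢ <;> omega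
  have hLR : ∑ r ∈ Finset.Ioc (k - a) k, bump (δ * (x - r)) ^ n +
      ∑ r ∈ Finset.Ioc k (k + a), bump (δ * (x - r)) ^ n ≤
      ∑ r ∈ Finset.Icc (k - a) (k + a), bump (δ * (x - r)) ^ n := by
    rw [← Finset.sum_union (Finset.disjoint_left.2 fun r hr hr' => by
      rw [Finset.mem_Ioc] at hr hr'; omega)]
    refine Finset.sum_le_sum_of_subset_of_nonneg (fun r hr => ?_) fun _ _ _ =>
      pow_nonneg (bump_nonneg _) n
    rw [Finset.mem_union, Finset.mem_Ioc, Finset.mem_Ioc] at hr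
    rw [Finset.mem_Icc]; omega
  linarith

end Kernel

section Parameters

/-- The number of weights at scale `K`. -/
def sz (K : ℕ) : ℕ := K ^ 8

/-- The number of full steps at scale `K`. -/
def stp (K : ℕ) : ℕ := K ^ 12

/-- The window width at scale `K`. -/
def win (K : ℕ) : ℤ := K ^ 6

/-- The logarithmic spacing of the weights at scale `K`. -/
noncomputable def gap (K : ℕ) : ℝ := ((K : ℝ) ^ 7)⁻¹

/-- The weights at scale `K`. -/
noncomputable def wt (K : ℕ) (l : ℤ) : ℝ := Real.exp (-(gap K * l))

/-- The normalizing constant at scale `K`. -/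
noncomputable def nrm (K : ℕ) : ℝ := (2 * kernelMass (gap K) (stp K) (sz K))⁻¹

/-- The kernel of transfer functions at scale `K`. -/
noncomputable def ker (K : ℕ) (m j : ℤ) (σ : ℝ) : ℝ := nrm K * full (wt K m) (wt K j) σ ^ stp K

/-- The total weight at scale `K`. -/
noncomputable def totalWt (K : ℕ) : ℝ := ∑ l ∈ Finset.Ico (0 : ℤ) (sz K), wt K l

/-- The mass of the windowed vector at scale `K`. -/
noncomputable def mass (K : ℕ) : ℝ := windowMass (sz K) (win K) (wt K)

variable {K : ℕ}

lemma wt_pos (K : ℕ) (l : ℤ) : 0 < wt K l := Real.exp_pos _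

lemma gap_pos (hK : 10 ≤ K) : 0 < gap K := by
  have : (10 : ℝ) ≤ K := by exact_mod_cast hK
  unfold gap; positivity

lemma wt_le_one (l : ℤ) (hl : 0 ≤ l) : wt K l ≤ 1 := by
  unfold wt gap
  rw [Real.exp_le_one_iff, neg_nonpos]
  have : (0 : ℝ) ≤ l := by exact_mod_cast hl
  positivity

lemma kernelMass_ge (hK : 10 ≤ K) : (K : ℝ) / 2 ≤ kernelMass (gap K) (stp K) (sz K) := by
  have hK' : (10 : ℝ) ≤ K := by exact_mod_cast hK
  have h1 : K + 1 ≤ 2 * sz K + 1 := by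
    unfold sz
    have := Nat.le_self_pow (n := 8) (by norm_num) K
    omega
  unfold kernelMass
  calc (K : ℝ) / 2 ≤ ∑ i ∈ Finset.range (K + 1), (3 / 4 : ℝ) := by
        rw [Finset.sum_const, Finset.card_range, nsmul_eq_mul]; push_cast; linarith
    _ ≤ ∑ i ∈ Finset.range (K + 1), bump (gap K * i) ^ stp K := by
        refine Finset.sum_le_sum fun i hi => le_trans ?_ (bump_pow_ge _ _)
        have hi' : (i : ℝ) ≤ K := by
          exact_mod_cast Nat.lt_succ_iff.1 (Finset.mem_range.1 hi)
        have : (stp K : ℝ) * (gap K * i) ^ 2 ≤ 1 := by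
          unfold stp gap
          push_cast
          rw [mul_pow, inv_pow, ← pow_mul, ← mul_assoc, mul_comm ((K : ℝ) ^ 12), mul_assoc,
            inv_mul_le_iff₀ (by positivity), mul_one]
          calc _ ≤ (K : ℝ) ^ 12 * K ^ 2 := by gcongr
            _ = _ := by ring
        linarith
    _ ≤ _ := by
        refine Finset.sum_le_sum_of_subset_of_nonneg ?_ fun i _ _ => pow_nonneg (bump_nonneg _) _
        intro i hi
        rw [Finset.mem_range] at hi ⊢; omega

lemma nrm_pos (hK : 10 ≤ K) : 0 < nrm K := by
  have hK' : (10 : ℝ) ≤ K := by exact_mod_cast hK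
  have := kernelMass_ge hK
  unfold nrm
  have : 0 < kernelMass (gap K) (stp K) (sz K) := by linarith
  positivity

lemma nrm_le (hK : 10 ≤ K) : nrm K ≤ (K : ℝ)⁻¹ := by
  have hK' : (10 : ℝ) ≤ K := by exact_mod_cast hK
  have := kernelMass_ge hK
  exact inv_anti₀ (by positivity) (by linarith)

lemma nrm_mul (hK : 10 ≤ K) : nrm K * (2 * kernelMass (gap K) (stp K) (sz K)) = 1 := by
  have hK' : (10 : ℝ) ≤ K := by exact_mod_cast hK
  have := kernelMass_ge hK
  exact inv_mul_cancel₀ (by linarith)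

lemma totalWt_ge (hK : 10 ≤ K) : (K : ℝ) / (K + 1) ≤ totalWt K * gap K := by
  have hK' : (10 : ℝ) ≤ K := by exact_mod_cast hK
  have hg := gap_pos hK
  have e : totalWt K = ∑ i ∈ Finset.range (sz K), Real.exp (-gap K) ^ i := by
    unfold totalWt
    refine Finset.sum_nbij' (fun l => l.toNat) (fun i => (i : ℤ)) ?_ ?_ ?_ ?_ ?_ <;>
      intro l hl <;> simp only [Finset.mem_range, Finset.mem_Ico] at hl ⊢
    · omega
    · omega
    · omega
    · omega
    · rw [← Real.exp_nat_mul, wt]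
      have : ((l.toNat : ℕ) : ℝ) = l := by exact_mod_cast Int.toNat_of_nonneg hl.1
      rw [this]; congr 1; ring
  have h1 := mul_neg_geom_sum (Real.exp (-gap K)) (sz K)
  rw [← e] at h1
  have h2 : 1 - Real.exp (-gap K) ≤ gap K := by
    have := Real.add_one_le_exp (-gap K); linarith
  have h3 : Real.exp (-gap K) ^ sz K ≤ (K + 1 : ℝ)⁻¹ := by
    rw [← Real.exp_nat_mul]
    have : (sz K : ℝ) * -gap K = -K := by
      unfold sz gap; push_cast; field_simp
    rw [this, Real.exp_neg]
    exact inv_anti₀ (by positivity) (Real.add_one_le_exp _)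
  have h4 : 0 ≤ totalWt K := Finset.sum_nonneg fun l _ => (wt_pos K l).le
  calc (K : ℝ) / (K + 1) = 1 - (K + 1 : ℝ)⁻¹ := by field_simp; ring
    _ ≤ (1 - Real.exp (-gap K)) * totalWt K := by linarith
    _ ≤ gap K * totalWt K := mul_le_mul_of_nonneg_right h2 h4
    _ = _ := mul_comm _ _

lemma totalWt_ge' (hK : 10 ≤ K) : (K : ℝ) ^ 7 / 2 ≤ totalWt K := by
  have hK' : (10 : ℝ) ≤ K := by exact_mod_cast hK
  have h := totalWt_ge hK
  have h2 : (1 : ℝ) / 2 ≤ (K : ℝ) / (K + 1) := by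
    rw [div_le_div_iff₀ (by norm_num) (by positivity)]; linarith
  unfold gap at h
  rw [← div_eq_mul_inv, le_div_iff₀ (by positivity)] at h
  nlinarith [pow_pos (by linarith : (0:ℝ) < K) 7]

lemma mass_ge (hK : 10 ≤ K) : totalWt K / 2 * (2 * win K + 1) ≤ mass K := by
  have hK' : (10 : ℝ) ≤ K := by exact_mod_cast hK
  refine le_trans ?_ (le_windowMass wt_le_one (fun l => (wt_pos K l).le) (by unfold win; positivity))
  refine mul_le_mul_of_nonneg_right ?_ (by unfold win; positivity)
  have hZ := totalWt_ge' hK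
  have h7 : (K : ℝ) ^ 7 = K * K ^ 6 := by ring
  have h10 : (10 : ℝ) * K ^ 6 ≤ K ^ 7 := by rw [h7]; gcongr
  have hw : ((win K : ℤ) : ℝ) = (K : ℝ) ^ 6 := by unfold win; push_cast; rfl
  rw [hw]
  change _ ≤ totalWt K - _
  have h6 : (0 : ℝ) ≤ (K : ℝ) ^ 6 := by positivity
  linarith

lemma mass_pos (hK : 10 ≤ K) : 0 < mass K := by
  have hK' : (10 : ℝ) ≤ K := by exact_mod_cast hK
  have h1 := totalWt_ge' hK
  have h2 : 0 < totalWt K := lt_of_lt_of_le (by positivity) h1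
  refine lt_of_lt_of_le ?_ (mass_ge hK)
  have : (0 : ℝ) ≤ (win K : ℤ) := by unfold win; positivity
  positivity

/-- The logarithm of the modular ratio. -/
noncomputable def logRatio (σ : ℝ) : ℝ := Real.log (σ / (2 - σ))

lemma wt_mul_eq {σ : ℝ} (h0 : 0 < σ) (h2 : σ < 2) (hK : 10 ≤ K) (m j : ℤ) :
    wt K m * σ = Real.exp (gap K * (logRatio σ / gap K - ((m - j : ℤ) : ℝ))) * (wt K j * (2 - σ)) := by
  have hg := gap_pos hK
  have h3 : 0 < 2 - σ := by linarith
  rw [mul_sub, mul_div_cancel₀ _ hg.ne', sub_eq_add_neg, Real.exp_add, logRatio,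
    Real.exp_log (by positivity)]
  have : wt K m = Real.exp (-(gap K * ((m - j : ℤ) : ℝ))) * wt K j := by
    unfold wt
    rw [← Real.exp_add]; congr 1; push_cast; ring
  rw [this]
  field_simp

/-- The kernel as a function of the difference of the indices. -/
noncomputable def conv (K : ℕ) (σ : ℝ) (r : ℤ) : ℝ :=
  nrm K * bump (gap K * (logRatio σ / gap K - r)) ^ stp K

lemma ker_eq {σ : ℝ} (h0 : 0 < σ) (h2 : σ < 2) (hK : 10 ≤ K) (m j : ℤ) :
    ker K m j σ = conv K σ (m - j) := by
  rw [ker, conv, full_eq_bump (wt_pos K j) h2 (wt_mul_eq h0 h2 hK m j)]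

lemma ker_eq_zero {σ : ℝ} (h : ¬ (0 < σ ∧ σ < 2)) (hσ : σ ∈ Set.Icc (0 : ℝ) 2) (hK : 10 ≤ K)
    (m j : ℤ) : ker K m j σ = 0 := by
  have : σ = 0 ∨ σ = 2 := by
    obtain ⟨h0, h2⟩ := hσ
    rcases h0.eq_or_lt with h0 | h0
    · exact Or.inl h0.symm
    · exact Or.inr (le_antisymm h2 (not_lt.1 fun h' => h ⟨h0, h'⟩))
  have hs : stp K ≠ 0 := by unfold stp; positivity
  rw [ker]
  rcases this with rfl | rfl <;> simp [full, hs]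

lemma conv_nonneg (hK : 10 ≤ K) (σ : ℝ) (r : ℤ) : 0 ≤ conv K σ r :=
  mul_nonneg (nrm_pos hK).le (pow_nonneg (bump_nonneg _) _)

lemma sum_conv_le_one (hK : 10 ≤ K) (σ : ℝ) {W : Finset ℤ} (hW : ∀ r ∈ W, |r| ≤ sz K) :
    ∑ r ∈ W, conv K σ r ≤ 1 := by
  simp only [conv]
  rw [← Finset.mul_sum, ← nrm_mul hK]
  exact mul_le_mul_of_nonneg_left (sum_bump_le _ _ _ _ hW) (nrm_pos hK).le

lemma sum_conv_right (hK : 10 ≤ K) (σ : ℝ) (l : ℤ) (hl : l ∈ Finset.Ico (0 : ℤ) (sz K)) :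
    ∑ j ∈ Finset.Ico (0 : ℤ) (sz K), conv K σ (j - l) ≤ 1 := by
  rw [← Finset.sum_image (f := conv K σ) (g := fun j => j - l) fun a _ b _ h => by
    simp only at h; omega]
  refine sum_conv_le_one hK σ fun r hr => ?_
  obtain ⟨j, hj, rfl⟩ := Finset.mem_image.1 hr
  rw [Finset.mem_Ico] at hl hj
  rw [abs_le]; omega

lemma sum_conv_left (hK : 10 ≤ K) (σ : ℝ) (l : ℤ) (hl : l ∈ Finset.Ico (0 : ℤ) (sz K)) :
    ∑ j ∈ Finset.Ico (0 : ℤ) (sz K), conv K σ (l - j) ≤ 1 := by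
  rw [← Finset.sum_image (f := conv K σ) (g := fun j => l - j) fun a _ b _ h => by
    simp only at h; omega]
  refine sum_conv_le_one hK σ fun r hr => ?_
  obtain ⟨j, hj, rfl⟩ := Finset.mem_image.1 hr
  rw [Finset.mem_Ico] at hl hj
  rw [abs_le]; omega

theorem sum_ker_row (hK : 10 ≤ K) {m : ℤ} (hm : m ∈ Finset.Ico (0 : ℤ) (sz K)) :
    ∑ j ∈ Finset.Ico (0 : ℤ) (sz K), ker K m j 1 ≤ 1 := by
  simp_rw [ker_eq one_pos one_lt_two hK]; exact sum_conv_left hK 1 m hm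

theorem ker_nonneg (hK : 10 ≤ K) (m j : ℤ) : 0 ≤ ker K m j 1 := by
  rw [ker_eq one_pos one_lt_two hK]; exact conv_nonneg hK _ _

/-- The transfer function of the left action on the windowed vector. -/
noncomputable def leftTf (K : ℕ) (l m : ℤ) (σ : ℝ) : ℝ :=
  ∑ j ∈ Finset.Ico (0 : ℤ) (sz K), ker K m j σ * window (win K) (j - l)

/-- The transfer function of the right action on the windowed vector. -/
noncomputable def rightTf (K : ℕ) (l m : ℤ) (σ : ℝ) : ℝ :=
  ∑ j ∈ Finset.Ico (0 : ℤ) (sz K), ratio (wt K j) (wt K l) σ * ker K j l σ * window (win K) (j - m)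

theorem sum_leftTf_le (hK : 10 ≤ K) {σ : ℝ} (hσ : σ ∈ Set.Icc (0 : ℝ) 2) :
    ∑ l ∈ Finset.Ico (0 : ℤ) (sz K), wt K l * ∑ m ∈ Finset.Ico (0 : ℤ) (sz K),
      leftTf K l m σ ^ 2 ≤ mass K := by
  by_cases h : 0 < σ ∧ σ < 2
  · simp_rw [leftTf, ker_eq h.1 h.2 hK]
    have := sum_conv_upper (N := sz K) (J := win K) (k := wt K) (γ := conv K σ) (κ := 1)
      (fun l => (wt_pos K l).le) (conv_nonneg hK σ) zero_le_one (sum_conv_right hK σ)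
      (sum_conv_left hK σ)
    rwa [one_pow, one_mul] at this
  · simp only [leftTf, ker_eq_zero h hσ hK, zero_mul, Finset.sum_const_zero, ne_eq,
      OfNat.ofNat_ne_zero, not_false_eq_true, zero_pow, mul_zero]
    exact (mass_pos hK).le

theorem sum_leftTf_sub_rightTf_le (hK : 10 ≤ K) {σ : ℝ} (hσ : σ ∈ Set.Icc (0 : ℝ) 2) :
    ∑ l ∈ Finset.Ico (0 : ℤ) (sz K), wt K l * ∑ m ∈ Finset.Ico (0 : ℤ) (sz K),
      (leftTf K l m σ - rightTf K l m σ) ^ 2 ≤ 1000 / K * mass K := by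
  have hK' : (10 : ℝ) ≤ K := by exact_mod_cast hK
  by_cases h : 0 < σ ∧ σ < 2
  · simp_rw [leftTf, rightTf, ker_eq h.1 h.2 hK]
    set w : ℤ → ℝ := fun r => ratio (wt K r) (wt K 0) σ with hw
    have hwe : ∀ j l, ratio (wt K j) (wt K l) σ = w (j - l) := fun j l => by
      have e : wt K j = wt K (j - l) * wt K l := by
        unfold wt; rw [← Real.exp_add]; congr 1; push_cast; ring
      have e0 : wt K 0 = 1 := by simp [wt]
      have := wt_pos K l
      simp only [hw, ratio, den]
      rw [e, e0]
      field_simp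
    have hw0 : ∀ r, 0 ≤ w r := fun r => by
      have := den_pos (wt_pos K r) (wt_pos K 0) hσ
      have := wt_pos K r
      have := h.1
      simp only [hw, ratio]; positivity
    have hw2 : ∀ r, w r ≤ 2 := fun r => by
      have h1 := den_pos (wt_pos K r) (wt_pos K 0) hσ
      simp only [hw, ratio]
      rw [div_le_iff₀ h1]
      have := mul_nonneg (wt_pos K 0).le (by linarith [h.2] : 0 ≤ 2 - σ)
      unfold den
      linarith
    have hws : ∀ r, (1 - w r) ^ 2 * conv K σ r ^ 2 ≤ (K ^ 12 : ℝ)⁻¹ * conv K σ r := fun r => by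
      have e := one_sub_ratio_sq (wt_pos K 0) h.2 (wt_mul_eq h.1 h.2 hK r 0)
      rw [sub_zero] at e
      simp only [hw]
      rw [e, sq (conv K σ r), ← mul_assoc]
      refine mul_le_mul_of_nonneg_right ?_ (conv_nonneg hK σ r)
      have b0 := bump_nonneg (gap K * (logRatio σ / gap K - r))
      have b1 := bump_le_one (gap K * (logRatio σ / gap K - r))
      have h1 := one_sub_mul_pow_le b0 b1 (stp K)
      have h2 : nrm K ≤ 1 := (nrm_le hK).trans (inv_le_one_of_one_le₀ (by linarith))
      calc _ = nrm K * ((1 - bump (gap K * (logRatio σ / gap K - r))) *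
            bump (gap K * (logRatio σ / gap K - r)) ^ stp K) := by rw [conv]; ring
        _ ≤ 1 * ((1 - bump (gap K * (logRatio σ / gap K - r))) *
            bump (gap K * (logRatio σ / gap K - r)) ^ stp K) :=
            mul_le_mul_of_nonneg_right h2 (mul_nonneg (by linarith) (pow_nonneg b0 _))
        _ ≤ _ := by
            rw [one_mul]
            refine h1.trans (inv_anti₀ (by positivity) ?_)
            unfold stp; push_cast; linarith
    have := sum_conv_diff (N := sz K) (J := win K) (k := wt K) (γ := conv K σ) (κ := 1) (w := w)
      wt_le_one (fun l => (wt_pos K l).le) (conv_nonneg hK σ) (by unfold win; positivity)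
      zero_le_one (sum_conv_right hK σ) (sum_conv_left hK σ) hw0 hw2
      (η := (K ^ 12 : ℝ)⁻¹) (by positivity) hws
    simp_rw [hwe]
    refine this.trans ?_
    change _ + _ * totalWt K ≤ _
    have hZ := totalWt_ge' hK
    have hJ : ((win K : ℤ) : ℝ) = (K : ℝ) ^ 6 := by unfold win; push_cast; rfl
    have hm := mass_ge hK
    rw [hJ] at hm ⊢
    have hJ1 : (2 * (K : ℝ) ^ 6 + 1) ≤ 3 * K ^ 6 := by
      have : (1 : ℝ) ≤ (K : ℝ) ^ 6 := one_le_pow₀ (by linarith)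
      linarith
    have p6 : 0 < (K : ℝ) ^ 6 := by positivity
    have k12 : (K : ℝ) ^ 6 * (K ^ 12 : ℝ)⁻¹ ≤ (K : ℝ)⁻¹ := by
      rw [← div_eq_mul_inv, div_le_iff₀ (by positivity), inv_mul_eq_div, le_div_iff₀ (by positivity)]
      calc (K : ℝ) ^ 6 * (K : ℝ) = (K : ℝ) ^ 7 := by ring
        _ ≤ (K : ℝ) ^ 12 := pow_le_pow_right₀ (by linarith) (by norm_num)
    have hZ0 : 0 < totalWt K := lt_of_lt_of_le (by positivity) hZ
    have t1 : 40 * (K : ℝ) ^ 6 ≤ 80 * (K : ℝ)⁻¹ * totalWt K := by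
      calc 40 * (K : ℝ) ^ 6 = 80 * (K : ℝ)⁻¹ * (K ^ 7 / 2) := by field_simp; norm_num
        _ ≤ _ := by gcongr
    have t2 : (2 * (K : ℝ) ^ 6 + 1) * (K ^ 12 : ℝ)⁻¹ ≤ 3 * (K : ℝ)⁻¹ := by
      calc _ ≤ 3 * (K : ℝ) ^ 6 * (K ^ 12 : ℝ)⁻¹ := by gcongr
        _ = 3 * ((K : ℝ) ^ 6 * (K ^ 12 : ℝ)⁻¹) := by ring
        _ ≤ _ := by gcongr
    calc _ = (40 * (K : ℝ) ^ 6 + (2 * (K : ℝ) ^ 6 + 1) * (K ^ 12 : ℝ)⁻¹ * totalWt K) *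
          (2 * (K : ℝ) ^ 6 + 1) := by ring
      _ ≤ (80 * (K : ℝ)⁻¹ * totalWt K + 3 * (K : ℝ)⁻¹ * totalWt K) * (2 * (K : ℝ) ^ 6 + 1) := by
          gcongr
      _ = 166 * (K : ℝ)⁻¹ * (totalWt K / 2 * (2 * (K : ℝ) ^ 6 + 1)) := by ring
      _ ≤ 166 * (K : ℝ)⁻¹ * mass K := by gcongr
      _ ≤ _ := by
          rw [div_eq_mul_inv]
          have := mass_pos hK
          gcongr; norm_num
  · simp only [leftTf, rightTf, ker_eq_zero h hσ hK, zero_mul, mul_zero, Finset.sum_const_zero, ne_eq,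
      OfNat.ofNat_ne_zero, not_false_eq_true, zero_pow, sub_zero]
    have := mass_pos hK
    positivity

lemma abs_logRatio_le {σ : ℝ} (h : |σ - 1| ≤ 1 / 12) : |logRatio σ| ≤ 3 * |σ - 1| := by
  have h' := abs_le.1 h
  have h0 : 0 < σ := by linarith
  have h2 : 0 < 2 - σ := by linarith
  have hy : 0 < σ / (2 - σ) := by positivity
  have h1 := Real.log_le_sub_one_of_pos hy
  have h3 := Real.one_sub_inv_le_log_of_pos hy
  have e1 : σ / (2 - σ) - 1 = 2 * (σ - 1) / (2 - σ) := by field_simp; ring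
  have e3 : 1 - (σ / (2 - σ))⁻¹ = 2 * (σ - 1) / σ := by field_simp; ring
  rw [e1] at h1
  rw [e3] at h3
  have n0 := abs_nonneg (σ - 1)
  have a1 := le_abs_self (σ - 1)
  have a2 := neg_abs_le (σ - 1)
  rw [abs_le]
  constructor
  · refine le_trans ?_ h3
    rw [le_div_iff₀ h0]
    nlinarith
  · refine h1.trans ?_
    rw [div_le_iff₀ h2]
    nlinarith

lemma sum_conv_ge (hK : 10 ≤ K) (σ : ℝ) :
    1 - 18 / K ≤ ∑ r ∈ Finset.Icc (⌊logRatio σ / gap K⌋ - (K ^ 5 : ℕ))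
      (⌊logRatio σ / gap K⌋ + (K ^ 5 : ℕ)), conv K σ r := by
  have hK' : (10 : ℝ) ≤ K := by exact_mod_cast hK
  have h := le_sum_bump (gap_pos hK).le (logRatio σ / gap K) (stp K) (sz K) (K ^ 5) (by
    unfold sz
    have := Nat.pow_le_pow_right (n := K) (by omega) (show 5 ≤ 8 by norm_num)
    omega)
  simp only [conv]
  rw [← Finset.mul_sum]
  refine le_trans ?_ (mul_le_mul_of_nonneg_left h (nrm_pos hK).le)
  have hb : (sz K : ℝ) * bump (gap K * (K ^ 5 : ℕ)) ^ stp K ≤ 4 := by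
    have h1 := bump_pow_le (gap K * (K ^ 5 : ℕ)) (stp K)
    have e : (stp K : ℝ) * ((gap K * (K ^ 5 : ℕ)) ^ 2 / 4) = (K : ℝ) ^ 8 / 4 := by
      unfold stp gap; push_cast; field_simp
    rw [e] at h1
    have h2 : (1 + (K : ℝ) ^ 8 / 4)⁻¹ ≤ ((K : ℝ) ^ 8 / 4)⁻¹ :=
      inv_anti₀ (by positivity) (by linarith)
    calc _ ≤ (sz K : ℝ) * ((K : ℝ) ^ 8 / 4)⁻¹ :=
          mul_le_mul_of_nonneg_left (h1.trans h2) (by positivity)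
      _ = 4 := by unfold sz; push_cast; field_simp
  have hn := nrm_le hK
  have hn0 := nrm_pos hK
  have hm := nrm_mul hK
  calc 1 - 18 / (K : ℝ) = 1 - 18 * (K : ℝ)⁻¹ := by rw [div_eq_mul_inv]
    _ ≤ 1 - 18 * nrm K := by linarith
    _ = nrm K * (2 * kernelMass (gap K) (stp K) (sz K)) - nrm K * (2 + 4 * 4) := by rw [hm]; ring
    _ ≤ nrm K * (2 * kernelMass (gap K) (stp K) (sz K)) -
        nrm K * (2 + 4 * ((sz K : ℝ) * bump (gap K * (K ^ 5 : ℕ)) ^ stp K)) := by gcongr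
    _ = _ := by ring

set_option maxHeartbeats 800000 in
theorem le_sum_leftTf (hK : 10 ≤ K) (σ : ℝ) :
    (1 - 100 / K - 12 * |σ - 1|) * mass K ≤
      ∑ l ∈ Finset.Ico (0 : ℤ) (sz K), wt K l * ∑ m ∈ Finset.Ico (0 : ℤ) (sz K),
        leftTf K l m σ ^ 2 := by
  have hK' : (10 : ℝ) ≤ K := by exact_mod_cast hK
  have hm0 := mass_pos hK
  by_cases hc : 1 - 100 / K - 12 * |σ - 1| ≤ 0
  · refine (mul_nonpos_of_nonpos_of_nonneg hc hm0.le).trans ?_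
    exact Finset.sum_nonneg fun l _ => mul_nonneg (wt_pos K l).le
      (Finset.sum_nonneg fun m _ => sq_nonneg _)
  rw [not_le] at hc
  set u := |σ - 1| with hu
  have hu0 : 0 ≤ u := abs_nonneg _
  have hk0 : 0 ≤ 100 / (K : ℝ) := by positivity
  have hu1 : |σ - 1| ≤ 1 / 12 := by rw [← hu]; linarith
  have hK1 : (100 : ℝ) ≤ K := by
    have : 100 / (K : ℝ) ≤ 1 := by linarith
    rwa [div_le_one (by linarith)] at this
  have hu2 := abs_le.1 hu1
  have h0 : 0 < σ := by linarith
  have h2 : σ < 2 := by linarith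
  simp_rw [leftTf, ker_eq h0 h2 hK]
  have hJ : ((win K : ℤ) : ℝ) = (K : ℝ) ^ 6 := by unfold win; push_cast; rfl
  have hi : (0 : ℝ) < (K : ℝ)⁻¹ := by positivity
  have hi1 : (K : ℝ)⁻¹ ≤ 1 / 100 := by
    rw [one_div]; exact inv_anti₀ (by norm_num) hK1
  have hd : ∀ c : ℝ, c / K = c * (K : ℝ)⁻¹ := fun c => div_eq_mul_inv _ _
  have hlow := sum_conv_lower (N := sz K) (J := win K) (k := wt K) (γ := conv K σ)
    (k₀ := ⌊logRatio σ / gap K⌋) (a := (K ^ 5 : ℕ)) (V := 1 - 18 / K)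
    wt_le_one (fun l => (wt_pos K l).le) (conv_nonneg hK σ) (by positivity)
    (by unfold win; exact_mod_cast Nat.pow_le_pow_right (by omega) (by norm_num))
    (by rw [hd]; linarith) (sum_conv_ge hK σ)
  refine le_trans ?_ hlow
  have hup := windowMass_le (N := sz K) (J := win K) (k := wt K) (fun l => (wt_pos K l).le)
    (by unfold win; positivity)
  change mass K ≤ _ * totalWt K at hup
  change _ ≤ (totalWt K - _) * _
  have hfl : (|⌊logRatio σ / gap K⌋| : ℝ) ≤ 3 * u * K ^ 7 + 1 := by
    have hx : |logRatio σ / gap K| ≤ 3 * u * K ^ 7 := by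
      rw [abs_div, abs_of_pos (gap_pos hK), gap, div_inv_eq_mul]
      exact mul_le_mul_of_nonneg_right (abs_logRatio_le hu1) (by positivity)
    have f1 := Int.floor_le (logRatio σ / gap K)
    have f2 := Int.lt_floor_add_one (logRatio σ / gap K)
    have hx' := abs_le.1 hx
    rw [abs_le]; constructor <;> linarith
  have hZ := totalWt_ge hK
  unfold gap at hZ
  have hZ2 : (K : ℝ) ^ 7 * (10 / 11) ≤ totalWt K := by
    have : (10 : ℝ) / 11 ≤ (K : ℝ) / (K + 1) := by
      rw [div_le_div_iff₀ (by norm_num) (by positivity)]; linarith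
    rw [← div_eq_mul_inv, le_div_iff₀ (by positivity)] at hZ
    nlinarith [pow_pos (by linarith : (0:ℝ) < K) 7]
  have hZ0 : 0 < totalWt K := lt_of_lt_of_le (by positivity) hZ2
  have p6 : (1 : ℝ) ≤ (K : ℝ) ^ 6 := one_le_pow₀ (by linarith)
  have e6 : (K : ℝ) ^ 6 = (K : ℝ) ^ 7 * (K : ℝ)⁻¹ := by field_simp
  have e5 : (K : ℝ) ^ 5 = (K : ℝ) ^ 6 * (K : ℝ)⁻¹ := by field_simp
  have hB : 2 * (((win K + |⌊logRatio σ / gap K⌋| : ℤ)) : ℝ) ≤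
      (8 * (K : ℝ)⁻¹ + 12 * u) * totalWt K := by
    push_cast
    rw [hJ]
    have : 2 * ((K : ℝ) ^ 6 + (3 * u * K ^ 7 + 1)) ≤
        (8 * (K : ℝ)⁻¹ + 12 * u) * ((K : ℝ) ^ 7 * (10 / 11)) := by
      have h4 : 0 ≤ u * (K : ℝ) ^ 7 := by positivity
      have h5 : (8 * (K : ℝ)⁻¹ + 12 * u) * ((K : ℝ) ^ 7 * (10 / 11)) =
          80 / 11 * (K : ℝ) ^ 6 + 120 / 11 * (u * (K : ℝ) ^ 7) := by rw [e6]; ring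
      rw [h5]
      linarith
    have h3 : (8 * (K : ℝ)⁻¹ + 12 * u) * ((K : ℝ) ^ 7 * (10 / 11)) ≤
      (8 * (K : ℝ)⁻¹ + 12 * u) * totalWt K := by gcongr
    linarith
  have hC : (2 * (K : ℝ) ^ 6 + 1) * (1 - (K : ℝ)⁻¹) ≤
      2 * (((win K : ℤ) : ℝ) - (((K ^ 5 : ℕ) : ℤ) : ℝ)) + 1 := by
    rw [hJ]; push_cast; rw [e5]; linarith
  have hcp : 0 < 1 - 100 * (K : ℝ)⁻¹ - 12 * u := by rw [← hd]; exact hc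
  have hV : 1 - 36 * (K : ℝ)⁻¹ ≤ (1 - 18 / (K : ℝ)) ^ 2 := by
    rw [hd]; nlinarith [sq_nonneg (18 * (K : ℝ)⁻¹)]
  have hA : totalWt K * (1 - 8 * (K : ℝ)⁻¹ - 12 * u) ≤
      totalWt K - 2 * (((win K + |⌊logRatio σ / gap K⌋| : ℤ)) : ℝ) := by linarith
  have hprod : 1 - 100 * (K : ℝ)⁻¹ - 12 * u ≤
      (1 - 8 * (K : ℝ)⁻¹ - 12 * u) * ((1 - (K : ℝ)⁻¹) * (1 - 36 * (K : ℝ)⁻¹)) := by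
    have q1 : 1 - 37 * (K : ℝ)⁻¹ ≤ (1 - (K : ℝ)⁻¹) * (1 - 36 * (K : ℝ)⁻¹) := by
      nlinarith [sq_nonneg (K : ℝ)⁻¹]
    have q2 : 0 ≤ 8 * (K : ℝ)⁻¹ + 12 * u := by positivity
    nlinarith [mul_le_mul_of_nonneg_left q1 (by linarith : 0 ≤ 1 - 8 * (K : ℝ)⁻¹ - 12 * u)]
  rw [hJ] at hup
  rw [hd]
  have hCp : 0 < 2 * (K : ℝ) ^ 6 + 1 := by positivity
  have hA0 : 0 ≤ totalWt K * (1 - 8 * (K : ℝ)⁻¹ - 12 * u) := mul_nonneg hZ0.le (by linarith)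
  have hV0 : 0 ≤ 1 - 36 * (K : ℝ)⁻¹ := by linarith
  have hC0 : 0 ≤ (2 * (K : ℝ) ^ 6 + 1) * (1 - (K : ℝ)⁻¹) := mul_nonneg hCp.le (by linarith)
  calc (1 - 100 * (K : ℝ)⁻¹ - 12 * u) * mass K
      ≤ (1 - 100 * (K : ℝ)⁻¹ - 12 * u) * ((2 * (K : ℝ) ^ 6 + 1) * totalWt K) := by gcongr
    _ ≤ ((1 - 8 * (K : ℝ)⁻¹ - 12 * u) * ((1 - (K : ℝ)⁻¹) * (1 - 36 * (K : ℝ)⁻¹))) *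
        ((2 * (K : ℝ) ^ 6 + 1) * totalWt K) :=
        mul_le_mul_of_nonneg_right hprod (by positivity)
    _ = (totalWt K * (1 - 8 * (K : ℝ)⁻¹ - 12 * u)) * (((2 * (K : ℝ) ^ 6 + 1) * (1 - (K : ℝ)⁻¹)) *
        (1 - 36 * (K : ℝ)⁻¹)) := by ring
    _ ≤ _ := by
        refine mul_le_mul hA ?_ (mul_nonneg hC0 hV0) (hA0.trans hA)
        exact mul_le_mul hC hV hV0 (hC0.trans hC)

end Parameters

section Functional

variable {H : Type*} [NormedAddCommGroup H] [InnerProductSpace ℂ H] [CompleteSpace H]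
variable {ι : Type*} [Fintype ι] [DecidableEq ι]

theorem cfc_apply_of_fixed {S : H →L[ℂ] H} (hS : IsSelfAdjoint S) {v : H} (hv : v ≠ 0)
    (h : S v = v) {f : ℝ → ℝ} (hf : ContinuousOn f (spectrum ℝ S)) :
    cfc f S v = f 1 • v := by
  have h1 : (1 : ℝ) ∈ spectrum ℝ S := by
    rw [spectrum.mem_iff, map_one]
    rintro ⟨u, hu⟩
    have h2 : (u : H →L[ℂ] H) v = 0 := by rw [hu]; simp [h]
    have h3 : ((u⁻¹ : (H →L[ℂ] H)ˣ) * u : H →L[ℂ] H) v = 0 := by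
      rw [mul_apply_eq_comp, h2, map_zero]
    rw [Units.inv_mul] at h3
    exact hv h3
  rw [cfc_apply f S hS hf]
  have key : ∀ g : C(spectrum ℝ S, ℝ), cfcHom hS g v = g ⟨1, h1⟩ • v := by
    intro g
    have hid : cfcHom hS (.restrict (spectrum ℝ S) (.id ℝ)) v =
        (ContinuousMap.restrict (spectrum ℝ S) (.id ℝ)) ⟨1, h1⟩ • v := by
      rw [cfcHom_id hS]; simp [h]
    refine ContinuousMap.induction_on_of_compact (p := fun g => cfcHom hS g v = g ⟨1, h1⟩ • v)
      ?_ hid ?_ ?_ ?_ ?_ g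
    · intro r
      have : ContinuousMap.const (spectrum ℝ S) r = algebraMap ℝ C(spectrum ℝ S, ℝ) r := rfl
      rw [this, AlgHomClass.commutes, Algebra.algebraMap_eq_smul_one]
      rfl
    · have : star (ContinuousMap.restrict (spectrum ℝ S) (.id ℝ)) = .restrict (spectrum ℝ S) (.id ℝ) := by
        ext; simp
      rw [this]; exact hid
    · intro f g hf hg
      rw [map_add, add_apply, hf, hg, ContinuousMap.add_apply, add_smul]
    · intro f g hf hg
      rw [map_mul, mul_apply_eq_comp, hg, ContinuousMap.mul_apply, mul_smul,
        smul_comm, ← hf, ← Complex.coe_smul, ← Complex.coe_smul, map_smul]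
    · intro f hf
      have hc : IsClosed {g : C(spectrum ℝ S, ℝ) | cfcHom hS g v = g ⟨1, h1⟩ • v} := by
        have c1 : Continuous (cfcHom hS : C(spectrum ℝ S, ℝ) → H →L[ℂ] H) := cfcHom_continuous hS
        have c2 : Continuous fun g : C(spectrum ℝ S, ℝ) => cfcHom hS g v :=
          (ContinuousLinearMap.apply ℂ H v).continuous.comp c1
        exact isClosed_eq c2 (by fun_prop)
      exact hc.mem_of_frequently_of_tendsto hf tendsto_id
  exact key _

lemma norm_sq_cfc_apply {S : H →L[ℂ] H} {f : ℝ → ℝ}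
    (hf : ContinuousOn f (spectrum ℝ S)) (v : H) :
    ‖cfc f S v‖ ^ 2 = (⟪v, cfc (fun σ => f σ ^ 2) S v⟫_ℂ).re := by
  have hs : IsSelfAdjoint (cfc f S) := cfc_predicate f S
  simp_rw [sq (f _)]
  rw [cfc_mul f f S hf hf, mul_apply_eq_comp, ← IsSelfAdjoint.inner_right hs, re_inner_self_eq]

lemma re_inner_mono {x y : H →L[ℂ] H} (h : x ≤ y) (v : H) :
    (⟪v, x v⟫_ℂ).re ≤ (⟪v, y v⟫_ℂ).re := by
  have := re_inner_nonneg (sub_nonneg.2 h) v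
  rwa [sub_apply, inner_sub_right, Complex.sub_re, sub_nonneg] at this

lemma sum_norm_sq_cfc_apply {α : Type*} (s : Finset α) {S : H →L[ℂ] H} {w : α → ℝ}
    {f : α → ℝ → ℝ} (hf : ∀ i ∈ s, ContinuousOn (f i) (spectrum ℝ S)) (v : H) :
    ∑ i ∈ s, w i * ‖cfc (f i) S v‖ ^ 2 =
      (⟪v, cfc (fun σ => ∑ i ∈ s, w i * f i σ ^ 2) S v⟫_ℂ).re := by
  have e : cfc (fun σ => ∑ i ∈ s, w i * f i σ ^ 2) S =
      ∑ i ∈ s, w i • cfc (fun σ => f i σ ^ 2) S := by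
    have := cfc_sum (fun i σ => w i * f i σ ^ 2) S s fun i hi =>
      (continuousOn_const.mul ((hf i hi).pow 2))
    have e2 : (∑ i ∈ s, fun σ => w i * f i σ ^ 2) = fun σ => ∑ i ∈ s, w i * f i σ ^ 2 := by
      ext; simp
    rw [← e2, this]
    exact Finset.sum_congr rfl fun i hi => cfc_const_mul (w i) (fun σ => f i σ ^ 2) S ((hf i hi).pow 2)
  rw [e, sum_apply, inner_sum, Complex.re_sum]
  refine Finset.sum_congr rfl fun i hi => ?_
  rw [norm_sq_cfc_apply (hf i hi), smul_apply, ← Complex.coe_smul, inner_smul_right,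
    Complex.re_ofReal_mul]

theorem sum_norm_sq_cfc_le {α : Type*} {s : Finset α} {S : H →L[ℂ] H} (hS : IsSelfAdjoint S)
    {w : α → ℝ} {f : α → ℝ → ℝ} (hf : ∀ i ∈ s, ContinuousOn (f i) (spectrum ℝ S)) {C : ℝ}
    (h : ∀ σ ∈ spectrum ℝ S, ∑ i ∈ s, w i * f i σ ^ 2 ≤ C) (v : H) :
    ∑ i ∈ s, w i * ‖cfc (f i) S v‖ ^ 2 ≤ C * ‖v‖ ^ 2 := by
  have hc : ContinuousOn (fun σ => ∑ i ∈ s, w i * f i σ ^ 2) (spectrum ℝ S) :=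
    continuousOn_finsetSum _ fun i hi => continuousOn_const.mul ((hf i hi).pow 2)
  rw [sum_norm_sq_cfc_apply s hf]
  refine (re_inner_mono ((cfc_mono h hc).trans_eq (cfc_const C S)) v).trans_eq ?_
  rw [Algebra.algebraMap_eq_smul_one, smul_apply, one_apply_eq_self, ← Complex.coe_smul,
    inner_smul_right, Complex.re_ofReal_mul, re_inner_self_eq]

theorem le_sum_norm_sq_cfc {α : Type*} {s : Finset α} {S : H →L[ℂ] H} (hS : IsSelfAdjoint S)
    {w : α → ℝ} {f : α → ℝ → ℝ} (hf : ∀ i ∈ s, ContinuousOn (f i) (spectrum ℝ S)) {A B : ℝ}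
    (h : ∀ σ ∈ spectrum ℝ S, A - B * (σ - 1) ^ 2 ≤ ∑ i ∈ s, w i * f i σ ^ 2) (v : H) :
    A * ‖v‖ ^ 2 - B * ‖(S - 1) v‖ ^ 2 ≤ ∑ i ∈ s, w i * ‖cfc (f i) S v‖ ^ 2 := by
  have hc : ContinuousOn (fun σ => ∑ i ∈ s, w i * f i σ ^ 2) (spectrum ℝ S) :=
    continuousOn_finsetSum _ fun i hi => continuousOn_const.mul ((hf i hi).pow 2)
  rw [sum_norm_sq_cfc_apply s hf]
  refine le_trans (le_of_eq ?_) (re_inner_mono (cfc_mono h (by fun_prop) hc) v)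
  have e1 : S - 1 = cfc (fun σ : ℝ => σ - 1) S := by
    rw [cfc_sub (fun σ : ℝ => σ) (fun _ => 1) S, cfc_id' ℝ S, cfc_const_one ℝ S]
  rw [cfc_sub (fun _ : ℝ => A) (fun σ => B * (σ - 1) ^ 2) S, cfc_const A S,
    cfc_const_mul B (fun σ : ℝ => (σ - 1) ^ 2) S, e1, norm_sq_cfc_apply (by fun_prop), sub_apply,
    inner_sub_right, Complex.sub_re, smul_apply, ← Complex.coe_smul, inner_smul_right,
    Complex.re_ofReal_mul, Algebra.algebraMap_eq_smul_one, smul_apply, one_apply_eq_self,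
    ← Complex.coe_smul, inner_smul_right, Complex.re_ofReal_mul, re_inner_self_eq]

lemma re_inner_smul_one (c : ℝ) (v w : H) : (⟪v, (c • (1 : H →L[ℂ] H)) w⟫_ℂ).re = c * (⟪v, w⟫_ℂ).re := by
  rw [smul_apply, one_apply_eq_self, ← Complex.coe_smul, inner_smul_right, Complex.re_ofReal_mul]

lemma two_re_inner_le (v w : H) : 2 * (⟪v, w⟫_ℂ).re ≤ ‖v‖ ^ 2 + ‖w‖ ^ 2 := by
  have := re_inner_le_norm (𝕜 := ℂ) v w
  have h2 : (⟪v, w⟫_ℂ).re ≤ ‖v‖ * ‖w‖ := this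
  nlinarith [sq_nonneg (‖v‖ - ‖w‖)]

lemma norm_sq_amp (v : Amp ι (Amp ι H)) : ‖v‖ ^ 2 = ∑ l, ∑ m, ‖v l m‖ ^ 2 := by
  simp only [PiLp.norm_sq_eq_of_L2]

lemma le_of_re_inner {x y : H →L[ℂ] H} (hx : IsSelfAdjoint x) (hy : IsSelfAdjoint y)
    (h : ∀ v, (⟪v, x v⟫_ℂ).re ≤ (⟪v, y v⟫_ℂ).re) : x ≤ y := by
  rw [← sub_nonneg]
  refine nonneg_of_inner (fun v => ?_) (im_inner_eq_zero (hy.sub hx))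
  rw [sub_apply, inner_sub_right, Complex.sub_re, sub_nonneg]
  exact h v

/-- The Schur test for a symmetric nonnegative kernel. -/
lemma sum_schur {c : ι → ι → ℝ} (hc : ∀ a b, 0 ≤ c a b) (hs : ∀ a b, c a b = c b a)
    (hr : ∀ a, ∑ b, c a b ≤ 1) (u : ι → H) :
    ∑ a, ∑ b, c a b * (⟪u a, u b⟫_ℂ).re ≤ ∑ a, ‖u a‖ ^ 2 := by
  have h1 : ∑ a, ∑ b, c a b * (⟪u a, u b⟫_ℂ).re ≤
      ∑ a, ∑ b, (c a b * ‖u a‖ ^ 2 + c a b * ‖u b‖ ^ 2) / 2 := by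
    refine Finset.sum_le_sum fun a _ => Finset.sum_le_sum fun b _ => ?_
    nlinarith [mul_le_mul_of_nonneg_left (two_re_inner_le (u a) (u b)) (hc a b)]
  have h2 : ∑ a, ∑ b, c a b * ‖u a‖ ^ 2 ≤ ∑ a, ‖u a‖ ^ 2 := by
    refine Finset.sum_le_sum fun a _ => ?_
    rw [← Finset.sum_mul]
    nlinarith [hr a, sq_nonneg ‖u a‖]
  have h3 : ∑ a, ∑ b, c a b * ‖u b‖ ^ 2 = ∑ a, ∑ b, c a b * ‖u a‖ ^ 2 := by
    rw [Finset.sum_comm]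
    simp_rw [fun a b => hs a b]
  simp_rw [← Finset.sum_div, Finset.sum_add_distrib] at h1
  rw [h3] at h1
  linarith

lemma isSelfAdjoint_real_smul {x : H →L[ℂ] H} (hx : IsSelfAdjoint x) (c : ℝ) :
    IsSelfAdjoint (c • x) := by
  rw [isSelfAdjoint_iff, star_smul, hx.star_eq, star_trivial]

lemma isSelfAdjoint_scalar (c : ℝ) : IsSelfAdjoint (c • (1 : H →L[ℂ] H)) :=
  isSelfAdjoint_real_smul (IsSelfAdjoint.one _) c

theorem lop_scalar_le_one {c : ι → ι → ℝ} (hc : ∀ a b, 0 ≤ c a b) (hs : ∀ a b, c a b = c b a)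
    (hr : ∀ a, ∑ b, c a b ≤ 1) : lop (fun a b => c a b • (1 : H →L[ℂ] H)) ≤ 1 := by
  refine le_of_re_inner ?_ (IsSelfAdjoint.one _) fun v => ?_
  · rw [isSelfAdjoint_iff, star_lop]
    simp_rw [(isSelfAdjoint_scalar _).star_eq, fun a b => hs a b]
  · rw [one_apply_eq_self, re_inner_self_eq, norm_sq_amp, inner_amp, Complex.re_sum]
    refine Finset.sum_le_sum fun l _ => ?_
    simp_rw [Complex.re_sum, lop_apply, inner_sum, Complex.re_sum, re_inner_smul_one]
    exact sum_schur hc hs hr _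

theorem rop_scalar_le_one {c : ι → ι → ℝ} (hc : ∀ a b, 0 ≤ c a b) (hs : ∀ a b, c a b = c b a)
    (hr : ∀ a, ∑ b, c a b ≤ 1) : rop (fun a b => c a b • (1 : H →L[ℂ] H)) ≤ 1 := by
  refine le_of_re_inner ?_ (IsSelfAdjoint.one _) fun v => ?_
  · rw [isSelfAdjoint_iff, star_rop]
    simp_rw [(isSelfAdjoint_scalar _).star_eq, fun a b => hs a b]
  · rw [one_apply_eq_self, re_inner_self_eq, norm_sq_amp, inner_amp, Finset.sum_comm,
      Finset.sum_comm (f := fun l m => ‖v l m‖ ^ 2), Complex.re_sum]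
    refine Finset.sum_le_sum fun m _ => ?_
    simp_rw [Complex.re_sum, rop_apply, inner_sum, Complex.re_sum, re_inner_smul_one]
    exact sum_schur hc hs hr fun l => v l m

lemma lop_sum_smul {α : Type*} (s : Finset α) (t : α → ℝ) (x : α → ι → ι → H →L[ℂ] H) :
    lop (fun a b => ∑ i ∈ s, t i • x i a b) = ∑ i ∈ s, t i • lop (x i) := by
  ext v l m
  rw [lop_apply]
  simp only [sum_apply, smul_apply, WithLp.ofLp_sum, Finset.sum_apply, WithLp.ofLp_smul,
    Pi.smul_apply, lop_apply, Finset.smul_sum]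
  exact Finset.sum_comm

lemma lop_add (x y : ι → ι → H →L[ℂ] H) : lop (fun a b => x a b + y a b) = lop x + lop y := by
  ext v l m
  simp only [lop_apply, add_apply, WithLp.ofLp_add, Pi.add_apply, Finset.sum_add_distrib]

lemma rop_add (x y : ι → ι → H →L[ℂ] H) : rop (fun a b => x a b + y a b) = rop x + rop y := by
  ext v l m
  simp only [rop_apply, add_apply, WithLp.ofLp_add, Pi.add_apply, Finset.sum_add_distrib]

lemma lop_smul (t : ℝ) (x : ι → ι → H →L[ℂ] H) : lop (fun a b => t • x a b) = t • lop x := by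
  have := lop_sum_smul (Finset.univ : Finset Unit) (fun _ => t) (fun _ => x)
  simpa using this

lemma rop_smul (t : ℝ) (x : ι → ι → H →L[ℂ] H) : rop (fun a b => t • x a b) = t • rop x := by
  ext v l m
  rw [rop_apply]
  simp only [smul_apply, WithLp.ofLp_smul, Pi.smul_apply, rop_apply, Finset.smul_sum]

lemma inner_lop_const (x : H →L[ℂ] H) (v : Amp ι (Amp ι H)) :
    ⟪v, lop (fun _ _ => x) v⟫_ℂ = ∑ l, ⟪∑ m, v l m, x (∑ m, v l m)⟫_ℂ := by
  rw [inner_amp]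
  refine Finset.sum_congr rfl fun l _ => ?_
  simp_rw [lop_apply, map_sum, sum_inner]

lemma lop_const_nonneg {x : H →L[ℂ] H} (hx : 0 ≤ x) :
    0 ≤ lop (ι := ι) (fun _ _ => x) := by
  refine nonneg_of_inner (fun v => ?_) (im_inner_eq_zero ?_)
  · rw [inner_lop_const, Complex.re_sum]
    exact Finset.sum_nonneg fun l _ => re_inner_nonneg hx _
  · rw [isSelfAdjoint_iff, star_lop]
    simp_rw [(IsSelfAdjoint.of_nonneg hx).star_eq]

lemma lop_const_le_one [Nonempty ι] {x : H →L[ℂ] H} (hx : 0 ≤ x) (hx1 : x ≤ 1) :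
    lop (ι := ι) (fun _ _ => (Fintype.card ι : ℝ)⁻¹ • x) ≤ 1 := by
  have hN : (0 : ℝ) < Fintype.card ι := by exact_mod_cast Fintype.card_pos
  rw [lop_smul]
  have h0 := lop_const_nonneg (ι := ι) hx
  refine le_of_re_inner (isSelfAdjoint_real_smul (IsSelfAdjoint.of_nonneg h0) _)
    (IsSelfAdjoint.one _) fun v => ?_
  rw [smul_apply, ← Complex.coe_smul, inner_smul_right, Complex.re_ofReal_mul, inner_lop_const,
    Complex.re_sum, one_apply_eq_self, re_inner_self_eq, norm_sq_amp, inv_mul_le_iff₀ hN,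
    Finset.mul_sum]
  refine Finset.sum_le_sum fun l _ => ?_
  refine (re_inner_mono hx1 _).trans ?_
  rw [one_apply_eq_self, re_inner_self_eq]
  have h1 : ‖∑ m, v l m‖ ^ 2 ≤ (∑ m, ‖v l m‖) ^ 2 := by gcongr; exact norm_sum_le _ _
  exact h1.trans (by simpa using sq_sum_le_card_mul_sum_sq (s := (Finset.univ : Finset ι)) (f := fun m => ‖v l m‖))

end Functional

section Model

variable {H : Type*} [NormedAddCommGroup H] [InnerProductSpace ℂ H] [CompleteSpace H]

/-- The index set of the amplification used at scale `K`. -/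
abbrev Grid (K : ℕ) := {x : ℤ // x ∈ Finset.Ico (0 : ℤ) (sz K)}

instance (K : ℕ) [NeZero K] : Nonempty (Grid K) :=
  ⟨⟨0, by simp [sz, Nat.pos_iff_ne_zero, NeZero.ne K]⟩⟩

/-- The amplified space at scale `K`. -/
abbrev Scale (K : ℕ) (H : Type*) [NormedAddCommGroup H] [InnerProductSpace ℂ H] := Amp (Grid K) (Amp (Grid K) H)

lemma continuousOn_ker (K : ℕ) (m l : ℤ) : ContinuousOn (ker K m l) (Set.Icc 0 2) :=
  continuousOn_const.mul ((continuousOn_full (wt_pos K m) (wt_pos K l)).pow _)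

lemma real_smul_nonneg {x : H →L[ℂ] H} (hx : 0 ≤ x) {c : ℝ} (hc : 0 ≤ c) : 0 ≤ c • x := by
  refine nonneg_of_inner (fun v => ?_)
    (im_inner_eq_zero (isSelfAdjoint_real_smul (IsSelfAdjoint.of_nonneg hx) c))
  rw [smul_apply, ← Complex.coe_smul, inner_smul_right, Complex.re_ofReal_mul]
  exact mul_nonneg hc (re_inner_nonneg hx v)

lemma modOp_fixed (M : VonNeumannAlgebra H) (ψ : H) : modOp (saOrbit M ψ) ψ = ψ := by
  have := eq_modOp_of_inner (N := M) (ψ := ψ) (ζ := 1) (v := ψ) (one_mem M) fun w hw => by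
    rw [one_apply_eq_self, star_one, one_apply_eq_self, inner_star_right]
    ring
  simpa using this.symm

variable {M : VonNeumannAlgebra H} {ψ : H} {K : ℕ}

theorem exists_model (hcyc : Cyclic M ψ) [NeZero K] (hK : 10 ≤ K) {p : H →L[ℂ] H} (hp : p ∈ M)
    (hp0 : 0 ≤ p) (hp1 : p ≤ 1) :
    ∃ x z : Grid K → Grid K → H →L[ℂ] H, (∀ a b, x a b ∈ M) ∧ (∀ a b, z a b ∈ M.commutant) ∧
      0 ≤ lop x ∧ 0 ≤ rop z ∧
      (∀ m l, x m l ψ = cfc (ker K m l) (modOp (saOrbit M.commutant ψ)) (p ψ)) ∧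
      ∀ l m, z l m ψ = cfc (fun σ => half (wt K m) (wt K l) σ * ker K m l σ)
        (modOp (saOrbit M.commutant ψ)) (p ψ) := by
  set S := modOp (saOrbit M.commutant ψ) with hSdef
  have hspec : spectrum ℝ S ⊆ Set.Icc 0 2 := spectrum_modOp_subset _
  obtain ⟨N, hN⟩ : ∃ N : ℝ, N = (Fintype.card (Grid K) : ℝ) := ⟨_, rfl⟩
  have hNpos : 0 < N := by rw [hN]; exact_mod_cast Fintype.card_pos
  obtain ⟨x, hxM, hx0, hx1, hx⟩ := exists_chain hcyc (k := fun l : Grid K => wt K l)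
    (fun l => wt_pos K l) (x₀ := fun _ _ => N⁻¹ • p) (fun _ _ => real_smul_mem M _ hp)
    (by rw [lop_smul]; exact real_smul_nonneg (lop_const_nonneg hp0) (by positivity))
    (by rw [hN]; exact lop_const_le_one hp0 hp1) (stp K)
  obtain ⟨z, hzM, hz0, hz1, hz⟩ := half_step (ψ := ψ) (k := fun l : Grid K => wt K l)
    (fun l => wt_pos K l) hxM hx0 hx1
  have hc : 0 ≤ N * nrm K := mul_nonneg hNpos.le (nrm_pos hK).le
  have hX : ∀ m l, (N * nrm K) • x m l ψ = cfc (ker K m l) S (p ψ) := fun m l => by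
    have e : cfc (ker K m l) S = nrm K • cfc (fun σ => full (wt K m) (wt K l) σ ^ stp K) S :=
      cfc_const_mul (nrm K) (fun σ => full (wt K m) (wt K l) σ ^ stp K) S
        (((continuousOn_full (wt_pos K m) (wt_pos K l)).pow _).mono hspec)
    rw [hx, e, smul_apply, smul_apply, ← Complex.coe_smul N⁻¹, map_smul, Complex.coe_smul,
      smul_smul, mul_comm N, mul_assoc, mul_inv_cancel₀ hNpos.ne', mul_one]
  refine ⟨fun a b => (N * nrm K) • x a b, fun a b => (N * nrm K) • z a b,
    fun a b => real_smul_mem M _ (hxM a b), fun a b => real_smul_mem _ _ (hzM a b), ?_, ?_, hX, ?_⟩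
  · rw [lop_smul]; exact real_smul_nonneg hx0 hc
  · rw [rop_smul]; exact real_smul_nonneg hz0 hc
  · intro l m
    rw [smul_apply, hz, cfc_mul _ _ S ((continuousOn_half (wt_pos K m) (wt_pos K l)).mono hspec)
      ((continuousOn_ker K m l).mono hspec), mul_apply_eq_comp, ← hX, ← Complex.coe_smul,
      ← Complex.coe_smul, map_smul]

/-- The (unnormalized) state vector at scale `K`. -/
noncomputable def scaleVec (K : ℕ) (ψ : H) : Scale K H :=
  WithLp.toLp 2 fun l => WithLp.toLp 2 fun m => (√(wt K l) * window (win K) (m - l)) • ψ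

lemma scaleVec_apply (l m : Grid K) :
    scaleVec K ψ l m = (√(wt K l) * window (win K) (m - l)) • ψ := rfl

lemma sum_grid (f : ℤ → ℤ → ℝ) : ∑ l : Grid K, ∑ m : Grid K, f l m =
    ∑ l ∈ Finset.Ico (0 : ℤ) (sz K), ∑ m ∈ Finset.Ico (0 : ℤ) (sz K), f l m := by
  rw [← Finset.sum_coe_sort (Finset.Ico (0 : ℤ) (sz K))]
  exact Finset.sum_congr rfl fun l _ =>
    Finset.sum_coe_sort (Finset.Ico (0 : ℤ) (sz K)) (fun m => f l m)

lemma norm_sq_scaleVec (hψ : ‖ψ‖ = 1) : ‖scaleVec K ψ‖ ^ 2 = mass K := by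
  rw [norm_sq_amp]
  simp_rw [scaleVec_apply, norm_smul, hψ, mul_one, Real.norm_eq_abs, sq_abs, mul_pow, window_sq,
    Real.sq_sqrt (wt_pos K _).le]
  rw [sum_grid fun l m => wt K l * window (win K) (m - l), mass, windowMass]
  simp_rw [Finset.mul_sum]

lemma continuousOn_leftTf (K : ℕ) (l m : ℤ) : ContinuousOn (leftTf K l m) (Set.Icc 0 2) :=
  continuousOn_finsetSum _ fun j _ => (continuousOn_ker K m j).mul continuousOn_const

lemma sqrt_mul_half {a b : ℝ} (ha : 0 < a) (σ : ℝ) : √a * half a b σ = √b * ratio a b σ := by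
  unfold half ratio
  have : √a * √a = a := Real.mul_self_sqrt ha.le
  rw [← mul_div_assoc, ← mul_div_assoc]
  congr 1
  linear_combination (2 * √b * σ) * this

lemma continuousOn_ratio {a b : ℝ} (ha : 0 < a) (hb : 0 < b) :
    ContinuousOn (ratio a b) (Set.Icc 0 2) := by
  unfold ratio
  refine ContinuousOn.div (by fun_prop) (by unfold den; fun_prop) fun σ hσ => (den_pos ha hb hσ).ne'

lemma continuousOn_rightTf (K : ℕ) (l m : ℤ) : ContinuousOn (rightTf K l m) (Set.Icc 0 2) :=
  continuousOn_finsetSum _ fun j _ => ((continuousOn_ratio (wt_pos K j) (wt_pos K l)).mul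
    (continuousOn_ker K j l)).mul continuousOn_const

lemma sum_smul_cfc {α : Type*} (s : Finset α) {S : H →L[ℂ] H} (c : α → ℝ) (f : α → ℝ → ℝ)
    (hf : ∀ i ∈ s, ContinuousOn (f i) (spectrum ℝ S)) (v : H) :
    ∑ i ∈ s, c i • cfc (f i) S v = cfc (fun σ => ∑ i ∈ s, c i * f i σ) S v := by
  have := cfc_sum (fun i σ => c i * f i σ) S s fun i hi => continuousOn_const.mul (hf i hi)
  have e2 : (∑ i ∈ s, fun σ => c i * f i σ) = fun σ => ∑ i ∈ s, c i * f i σ := by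
    ext; simp
  rw [← e2, this, sum_apply]
  refine Finset.sum_congr rfl fun i hi => ?_
  rw [cfc_const_mul (c i) (f i) S (hf i hi), smul_apply]

lemma clm_real_smul (T : H →L[ℂ] H) (c : ℝ) (v : H) : T (c • v) = c • T v := by
  rw [← Complex.coe_smul, map_smul, Complex.coe_smul]

lemma lop_scaleVec {x : Grid K → Grid K → H →L[ℂ] H} {S : H →L[ℂ] H} {v : H}
    (hspec : spectrum ℝ S ⊆ Set.Icc 0 2) (hx : ∀ m l, x m l ψ = cfc (ker K m l) S v) (l m : Grid K) :
    lop x (scaleVec K ψ) l m = √(wt K l) • cfc (leftTf K l m) S v := by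
  rw [lop_apply]
  simp_rw [scaleVec_apply, clm_real_smul, hx, mul_smul, ← Finset.smul_sum]
  congr 1
  rw [sum_smul_cfc _ (fun j : Grid K => window (win K) (j - l)) (fun j => ker K m j) fun j _ =>
    (continuousOn_ker K m j).mono hspec]
  refine congrArg (fun f => cfc f S v) (funext fun σ => ?_)
  rw [leftTf, ← Finset.sum_coe_sort (Finset.Ico (0 : ℤ) (sz K))]
  exact Finset.sum_congr rfl fun j _ => mul_comm (window (win K) (j - l)) (ker K m j σ)

lemma rop_scaleVec {z : Grid K → Grid K → H →L[ℂ] H} {S : H →L[ℂ] H} {v : H}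
    (hspec : spectrum ℝ S ⊆ Set.Icc 0 2)
    (hz : ∀ l m, z l m ψ = cfc (fun σ => half (wt K m) (wt K l) σ * ker K m l σ) S v)
    (l m : Grid K) :
    rop z (scaleVec K ψ) l m = √(wt K l) • cfc (rightTf K l m) S v := by
  rw [rop_apply]
  simp_rw [scaleVec_apply, clm_real_smul, hz]
  have hc : ContinuousOn (rightTf K l m) (spectrum ℝ S) := (continuousOn_rightTf K l m).mono hspec
  rw [sum_smul_cfc _ (fun j : Grid K => √(wt K j) * window (win K) (m - j))
    (fun j σ => half (wt K j) (wt K l) σ * ker K j l σ) fun j _ => ((continuousOn_half (wt_pos K j) (wt_pos K l)).mul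
    (continuousOn_ker K j l)).mono hspec, ← smul_apply, ← cfc_const_mul _ _ S hc]
  refine congrArg (fun f => cfc f S v) (funext fun σ => ?_)
  rw [rightTf, ← Finset.sum_coe_sort (Finset.Ico (0 : ℤ) (sz K)), Finset.mul_sum]
  refine Finset.sum_congr rfl fun j _ => ?_
  have e : window (win K) ((m : ℤ) - j) = window (win K) (j - m) := by
    unfold window; rw [abs_sub_comm]
  rw [e]
  linear_combination (window (win K) (j - m) * ker K j l σ) * sqrt_mul_half (b := wt K l) (wt_pos K j) σ

lemma half_one_nonneg {a b : ℝ} (ha : 0 < a) (hb : 0 < b) : 0 ≤ half a b 1 := by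
  unfold half den; positivity

lemma half_one_le {a b : ℝ} (ha : 0 < a) (hb : 0 < b) : half a b 1 ≤ 1 := by
  unfold half den
  rw [div_le_one (by linarith)]
  nlinarith [sq_nonneg (√a - √b), Real.sq_sqrt ha.le, Real.sq_sqrt hb.le]

lemma half_one_symm (a b : ℝ) : half a b 1 = half b a 1 := by
  unfold half den; rw [mul_comm √a]; congr 1; ring

lemma full_one_symm (a b : ℝ) : full a b 1 = full b a 1 := by
  unfold full den; rw [mul_comm a b]; congr 1; ring

lemma ker_one_symm (K : ℕ) (m l : ℤ) : ker K m l 1 = ker K l m 1 := by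
  unfold ker; rw [full_one_symm]

lemma sum_ker_grid (hK : 10 ≤ K) (m : Grid K) : ∑ j : Grid K, ker K m j 1 ≤ 1 := by
  rw [Finset.sum_coe_sort (Finset.Ico (0 : ℤ) (sz K)) (fun j => ker K m j 1)]
  exact sum_ker_row hK m.2

lemma sum_sum_grid_product (f : Grid K → Grid K → ℝ) (w : ℤ → ℝ) (g : ℤ → ℤ → ℝ)
    (h : ∀ l m, f l m = w l * g l m) : ∑ l, ∑ m, f l m =
      ∑ q ∈ Finset.Ico (0 : ℤ) (sz K) ×ˢ Finset.Ico (0 : ℤ) (sz K), w q.1 * g q.1 q.2 := by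
  simp_rw [h]
  rw [sum_grid fun l m => w l * g l m, Finset.sum_product]

lemma sum_product_wt (g : ℤ → ℤ → ℝ) :
    ∑ q ∈ Finset.Ico (0 : ℤ) (sz K) ×ˢ Finset.Ico (0 : ℤ) (sz K), wt K q.1 * g q.1 q.2 =
      ∑ l ∈ Finset.Ico (0 : ℤ) (sz K), wt K l * ∑ m ∈ Finset.Ico (0 : ℤ) (sz K), g l m := by
  rw [Finset.sum_product]
  simp_rw [Finset.mul_sum]

/-- The quantities produced at one scale. -/
structure ScaleModel (E : Type*) [NormedAddCommGroup E] [InnerProductSpace ℂ E] [CompleteSpace E]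
    (S : H →L[ℂ] H) (ψ : H) (K : ℕ) {γ : Type*} (p : γ → H →L[ℂ] H) where
  vec : E
  left : γ → E →L[ℂ] E
  right : γ → E →L[ℂ] E
  norm_vec : ‖vec‖ = 1
  left_nonneg : ∀ g, 0 ≤ left g
  left_le : ∀ g, left g ≤ 1
  right_nonneg : ∀ g, 0 ≤ right g
  right_le : ∀ g, right g ≤ 1
  comm : ∀ g h, Commute (left g) (right h)
  norm_sub : ∀ g, ‖p g ψ‖ ≤ 1 → ‖left g vec - right g vec‖ ^ 2 ≤ 1000 / K
  sum_le : ∀ (s : Finset γ) (t : γ → ℝ), ∑ g ∈ s, t g • p g = 1 → ∑ g ∈ s, t g • left g ≤ 1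
  norm_le : ∀ (s : Finset γ) (t : γ → ℝ),
    ‖(∑ g ∈ s, t g • left g) vec‖ ^ 2 ≤ ‖(∑ g ∈ s, t g • p g) ψ‖ ^ 2
  le_norm : ∀ (s : Finset γ) (t : γ → ℝ) (α : ℝ), 0 < α →
    (1 - 100 / K - 6 * α) * ‖(∑ g ∈ s, t g • p g) ψ‖ ^ 2
      - 6 / α * ‖(S - 1) ((∑ g ∈ s, t g • p g) ψ)‖ ^ 2 ≤ ‖(∑ g ∈ s, t g • left g) vec‖ ^ 2

theorem exists_scaleModel (hcyc : Cyclic M ψ) (hcyc' : Cyclic M.commutant ψ) (hψ : ‖ψ‖ = 1)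
    (hK : 10 ≤ K) {γ : Type*} {p : γ → H →L[ℂ] H} (hp : ∀ g, p g ∈ M) (hp0 : ∀ g, 0 ≤ p g)
    (hp1 : ∀ g, p g ≤ 1) :
    Nonempty (ScaleModel (Scale K H) (modOp (saOrbit M.commutant ψ)) ψ K p) := by
  have : NeZero K := ⟨by omega⟩
  have hψ0 : ψ ≠ 0 := by rintro rfl; simp at hψ
  set S := modOp (saOrbit M.commutant ψ) with hSdef
  have hS : IsSelfAdjoint S := modOp_isSelfAdjoint _
  have hspec : spectrum ℝ S ⊆ Set.Icc 0 2 := spectrum_modOp_subset _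
  have hfix : S ψ = ψ := modOp_fixed _ _
  have hm := mass_pos hK
  choose x z hxM hzM hx0 hz0 hx hz using
    fun g => exists_model hcyc hK (hp g) (hp0 g) (hp1 g)
  choose x' z' hxM' hzM' hx0' hz0' hx' hz' using
    fun g => exists_model hcyc hK (sub_mem (one_mem M) (hp g)) (sub_nonneg.2 (hp1 g))
      (sub_le_self 1 (hp0 g))
  have hker : ∀ m l : Grid K, cfc (ker K m l) S ψ = (ker K m l 1 • (1 : H →L[ℂ] H)) ψ :=
    fun m l => by
      rw [cfc_apply_of_fixed hS hψ0 hfix ((continuousOn_ker K m l).mono hspec), smul_apply,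
        one_apply_eq_self]
  have hlopone : lop (fun m l : Grid K => ker K m l 1 • (1 : H →L[ℂ] H)) ≤ 1 :=
    lop_scalar_le_one (fun _ _ => ker_nonneg hK _ _) (fun _ _ => ker_one_symm K _ _)
      fun m => sum_ker_grid hK m
  have hropone : rop (fun l m : Grid K =>
      (half (wt K m) (wt K l) 1 * ker K m l 1) • (1 : H →L[ℂ] H)) ≤ 1 := by
    refine rop_scalar_le_one (fun _ _ => mul_nonneg (half_one_nonneg (wt_pos K _) (wt_pos K _))
      (ker_nonneg hK _ _)) (fun _ _ => by rw [ker_one_symm, half_one_symm]) fun l => ?_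
    refine le_trans (Finset.sum_le_sum fun m _ => ?_) (sum_ker_grid hK l)
    rw [ker_one_symm]
    exact mul_le_of_le_one_left (ker_nonneg hK _ _) (half_one_le (wt_pos K _) (wt_pos K _))
  have hsum : ∀ (s : Finset γ) (t : γ → ℝ) (m l : Grid K),
      (∑ g ∈ s, t g • x g m l) ψ = cfc (ker K m l) S ((∑ g ∈ s, t g • p g) ψ) := by
    intro s t m l
    simp_rw [sum_apply, smul_apply, hx, map_sum, clm_real_smul, hSdef]
  have hsumle : ∀ (s : Finset γ) (t : γ → ℝ), ∑ g ∈ s, t g • p g = 1 →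
      ∑ g ∈ s, t g • lop (x g) ≤ 1 := by
    intro s t h
    rw [← lop_sum_smul]
    have : (fun m l => ∑ g ∈ s, t g • x g m l) =
        fun m l : Grid K => ker K m l 1 • (1 : H →L[ℂ] H) := by
      funext m l
      refine Cyclic.ext (M := M.commutant) hcyc' ?_ ?_ ?_
      · rw [VonNeumannAlgebra.commutant_commutant]
        exact sum_mem fun g _ => real_smul_mem M _ (hxM g m l)
      · rw [VonNeumannAlgebra.commutant_commutant]
        exact real_smul_mem M _ (one_mem M)
      · rw [hsum, h, one_apply_eq_self, hker]
    rw [this]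
    exact hlopone
  have hxle : ∀ g, lop (x g) ≤ 1 := by
    intro g
    have e : lop (x g) + lop (x' g) = lop (fun m l : Grid K => ker K m l 1 • (1 : H →L[ℂ] H)) := by
      rw [← lop_add]
      congr 1
      funext m l
      refine Cyclic.ext (M := M.commutant) hcyc' ?_ ?_ ?_
      · rw [VonNeumannAlgebra.commutant_commutant]
        exact add_mem (hxM g m l) (hxM' g m l)
      · rw [VonNeumannAlgebra.commutant_commutant]
        exact real_smul_mem M _ (one_mem M)
      · rw [add_apply, hx, hx', ← map_add, sub_apply, add_sub_cancel, one_apply_eq_self, hker]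
    exact (le_add_of_nonneg_right (hx0' g)).trans (e.trans_le hlopone)
  have hzle : ∀ g, rop (z g) ≤ 1 := by
    intro g
    have e : rop (z g) + rop (z' g) = rop (fun l m : Grid K =>
        (half (wt K m) (wt K l) 1 * ker K m l 1) • (1 : H →L[ℂ] H)) := by
      rw [← rop_add]
      congr 1
      funext l m
      refine Cyclic.ext (M := M) hcyc ?_ ?_ ?_
      · exact add_mem (hzM g l m) (hzM' g l m)
      · exact real_smul_mem _ _ (one_mem _)
      · rw [add_apply, hz, hz', ← map_add, sub_apply, add_sub_cancel, one_apply_eq_self,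
          cfc_apply_of_fixed hS hψ0 hfix, smul_apply, one_apply_eq_self]
        exact ((continuousOn_half (wt_pos K m) (wt_pos K l)).mul
          (continuousOn_ker K m l)).mono hspec
    exact (le_add_of_nonneg_right (hz0' g)).trans (e.trans_le hropone)
  set ξ : Scale K H := (√(mass K))⁻¹ • scaleVec K ψ with hξ
  have hscale : ∀ v : Scale K H, ‖(√(mass K))⁻¹ • v‖ ^ 2 = (mass K)⁻¹ * ‖v‖ ^ 2 := fun v => by
    rw [norm_smul, mul_pow, Real.norm_eq_abs, sq_abs, inv_pow, Real.sq_sqrt hm.le]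
  have hleft : ∀ (s : Finset γ) (t : γ → ℝ), ‖(∑ g ∈ s, t g • lop (x g)) ξ‖ ^ 2 = (mass K)⁻¹ *
      ∑ q ∈ Finset.Ico (0 : ℤ) (sz K) ×ˢ Finset.Ico (0 : ℤ) (sz K),
        wt K q.1 * ‖cfc (leftTf K q.1 q.2) S ((∑ g ∈ s, t g • p g) ψ)‖ ^ 2 := by
    intro s t
    rw [hξ, clm_real_smul, hscale, ← lop_sum_smul, norm_sq_amp]
    congr 1
    refine sum_sum_grid_product _ (wt K)
      (fun l m => ‖cfc (leftTf K l m) S ((∑ g ∈ s, t g • p g) ψ)‖ ^ 2) fun l m => ?_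
    rw [lop_scaleVec hspec (hsum s t), norm_smul, mul_pow, Real.norm_eq_abs, sq_abs,
      Real.sq_sqrt (wt_pos K _).le]
  refine ⟨⟨ξ, fun g => lop (x g), fun g => rop (z g), ?_, hx0, hxle, hz0, hzle, ?_, ?_, hsumle,
    ?_, ?_⟩⟩
  · have h : ‖ξ‖ ^ 2 = 1 := by
      rw [hξ, hscale, norm_sq_scaleVec hψ, inv_mul_cancel₀ hm.ne']
    exact (pow_eq_one_iff_of_nonneg (norm_nonneg _) two_ne_zero).1 h
  · intro g h
    rw [commute_lop_rop_iff]
    intro a b c d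
    exact commute_of_mem (hxM g a b) (hzM h c d)
  · intro g hg
    have e : lop (x g) ξ - rop (z g) ξ =
        (√(mass K))⁻¹ • (lop (x g) (scaleVec K ψ) - rop (z g) (scaleVec K ψ)) := by
      rw [hξ, clm_real_smul, clm_real_smul, smul_sub]
    rw [e, hscale, norm_sq_amp, sum_sum_grid_product _ (wt K)
      (fun l m => ‖cfc (fun σ => leftTf K l m σ - rightTf K l m σ) S (p g ψ)‖ ^ 2)]
    · have := sum_norm_sq_cfc_le (s := Finset.Ico (0 : ℤ) (sz K) ×ˢ Finset.Ico (0 : ℤ) (sz K)) hS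
        (w := fun q => wt K q.1) (f := fun q σ => leftTf K q.1 q.2 σ - rightTf K q.1 q.2 σ)
        (fun q _ => ((continuousOn_leftTf K _ _).sub (continuousOn_rightTf K _ _)).mono hspec)
        (C := 1000 / K * mass K) (fun σ hσ => by
          rw [sum_product_wt fun l m => (leftTf K l m σ - rightTf K l m σ) ^ 2]
          exact sum_leftTf_sub_rightTf_le hK (hspec hσ)) (p g ψ)
      rw [inv_mul_le_iff₀ hm]
      refine this.trans ?_
      have h1 : ‖p g ψ‖ ^ 2 ≤ 1 := pow_le_one₀ (norm_nonneg _) hg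
      have h2 : 0 ≤ 1000 / (K : ℝ) * mass K := by positivity
      nlinarith
    · intro l m
      have h1 : (lop (x g) (scaleVec K ψ) - rop (z g) (scaleVec K ψ)) l m =
        lop (x g) (scaleVec K ψ) l m - rop (z g) (scaleVec K ψ) l m := rfl
      rw [h1, lop_scaleVec hspec (hx g), rop_scaleVec hspec (hz g), ← smul_sub, norm_smul, mul_pow,
        Real.norm_eq_abs, sq_abs, Real.sq_sqrt (wt_pos K _).le,
        cfc_sub _ _ S ((continuousOn_leftTf K l m).mono hspec)
          ((continuousOn_rightTf K l m).mono hspec), sub_apply]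
  · intro s t
    rw [hleft, inv_mul_le_iff₀ hm]
    exact sum_norm_sq_cfc_le hS (fun q _ => (continuousOn_leftTf K _ _).mono hspec)
      (fun σ hσ => by
        rw [sum_product_wt fun l m => leftTf K l m σ ^ 2]
        exact sum_leftTf_le hK (hspec hσ)) _
  · intro s t α hα
    rw [hleft, le_inv_mul_iff₀ hm]
    have := le_sum_norm_sq_cfc (s := Finset.Ico (0 : ℤ) (sz K) ×ˢ Finset.Ico (0 : ℤ) (sz K)) hS
      (w := fun q => wt K q.1) (f := fun q σ => leftTf K q.1 q.2 σ)
      (fun q _ => (continuousOn_leftTf K _ _).mono hspec)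
      (A := (1 - 100 / K - 6 * α) * mass K) (B := 6 / α * mass K) (fun σ hσ => by
          rw [sum_product_wt fun l m => leftTf K l m σ ^ 2]
          refine le_trans (le_of_eq_of_le ?_ (mul_le_mul_of_nonneg_right
            (?_ : 1 - 100 / (K : ℝ) - (6 * α + 6 / α * (σ - 1) ^ 2) ≤
              1 - 100 / (K : ℝ) - 12 * |σ - 1|) hm.le)) (le_sum_leftTf hK σ)
          · ring
          · have h1 : 12 * |σ - 1| ≤ 6 * α + 6 / α * (σ - 1) ^ 2 := by
              have h2 : 6 * α + 6 / α * (σ - 1) ^ 2 - 12 * |σ - 1| = 6 / α * (α - |σ - 1|) ^ 2 := by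
                rw [← sq_abs (σ - 1)]; field_simp; ring
              have h3 : 0 ≤ 6 / α * (α - |σ - 1|) ^ 2 := by positivity
              linarith
            linarith) ((∑ g ∈ s, t g • p g) ψ)
    refine le_of_eq_of_le ?_ this
    ring

end Model

theorem exists_gns {A : Type} [CStarAlgebra A] (ω : A →ₗ[ℂ] ℂ) (hω : ∀ b, 0 ≤ ω (star b * b)) :
    ∃ (K : Type) (_ : NormedAddCommGroup K) (_ : InnerProductSpace ℂ K) (_ : CompleteSpace K)
      (ζ : K) (π : A →⋆ₐ[ℂ] (K →L[ℂ] K)), ∀ x, ω x = ⟪ζ, π x ζ⟫_ℂ := by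
  let _ := CStarAlgebra.spectralOrder A
  let _ := CStarAlgebra.spectralOrderedRing A
  have hpos : ∀ x : A, 0 ≤ x → 0 ≤ ω x := by
    intro x hx
    obtain ⟨b, rfl⟩ := CStarAlgebra.nonneg_iff_eq_star_mul_self.1 hx
    exact hω b
  let f : A →ₚ[ℂ] ℂ := PositiveLinearMap.mk₀ ω hpos
  refine ⟨f.GNS, inferInstance, inferInstance, inferInstance,
    ((f.toPreGNS 1 : f.PreGNS) : f.GNS), f.gnsStarAlgHom, fun x => ?_⟩
  have : f.gnsStarAlgHom x ((f.toPreGNS 1 : f.PreGNS) : f.GNS) = (f.toPreGNS x : f.PreGNS) := by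
    change f.gnsNonUnitalStarAlgHom x ((f.toPreGNS 1 : f.PreGNS) : f.GNS) = _
    rw [PositiveLinearMap.gnsNonUnitalStarAlgHom_apply_coe,
      PositiveLinearMap.leftMulMapPreGNS_apply]
    simp
  rw [this, UniformSpace.Completion.inner_coe, PositiveLinearMap.preGNS_inner_def]
  simp only [PositiveLinearMap.ofPreGNS_toPreGNS, star_one, one_mul]
  rfl

section Limit

variable {E : ℕ → Type} [∀ n, NormedAddCommGroup (E n)] [∀ n, InnerProductSpace ℂ (E n)]
  [∀ n, CompleteSpace (E n)] [∀ n, Nontrivial (E n)]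

/-- The C⋆-algebra of bounded sequences of operators. -/
noncomputable abbrev BddSeq (E : ℕ → Type) [∀ n, NormedAddCommGroup (E n)] [∀ n, InnerProductSpace ℂ (E n)] :=
  lp (fun n => E n →L[ℂ] E n) ∞

noncomputable instance : CStarAlgebra (BddSeq E) where


lemma exists_limit_inner (ξ : ∀ n, E n) (hξ : ∀ n, ‖ξ n‖ = 1) (x : BddSeq E) :
    ∃ c : ℂ, Tendsto (fun n => ⟪ξ n, x n (ξ n)⟫_ℂ) (hyperfilter ℕ : Filter ℕ) (𝓝 c) := by
  suffices h : ∀ n, ‖⟪ξ n, x n (ξ n)⟫_ℂ‖ ≤ ‖x‖ by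
    obtain ⟨c, -, hc⟩ := exists_tendsto_of_bounded (hyperfilter ℕ) _ ‖x‖ h
    exact ⟨c, hc⟩
  intro n
  refine (norm_inner_le_norm _ _).trans ?_
  rw [hξ, one_mul]
  refine ((x n).le_opNorm _).trans ?_
  rw [hξ, mul_one]
  exact lp.norm_apply_le_norm ENNReal.top_ne_zero x n

theorem exists_gns_limit (ξ : ∀ n, E n) (hξ : ∀ n, ‖ξ n‖ = 1) :
    ∃ (K : Type) (_ : NormedAddCommGroup K) (_ : InnerProductSpace ℂ K) (_ : CompleteSpace K)
      (ζ : K) (π : BddSeq E →⋆ₐ[ℂ] (K →L[ℂ] K)),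
      ∀ x : BddSeq E, Tendsto (fun n => ⟪ξ n, x n (ξ n)⟫_ℂ) (hyperfilter ℕ : Filter ℕ)
        (𝓝 ⟪ζ, π x ζ⟫_ℂ) := by
  choose ω hω using exists_limit_inner ξ hξ
  let ωl : BddSeq E →ₗ[ℂ] ℂ :=
    { toFun := ω
      map_add' := fun x y => tendsto_nhds_unique (hω _) <| by
        refine ((hω x).add (hω y)).congr fun n => ?_
        rw [lp.coeFn_add, Pi.add_apply, add_apply, inner_add_right]
      map_smul' := fun c x => tendsto_nhds_unique (hω _) <| by
        refine ((hω x).const_mul c).congr fun n => ?_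
        rw [lp.coeFn_smul, Pi.smul_apply, smul_apply, inner_smul_right] }
  obtain ⟨K, i1, i2, i3, ζ, π, h⟩ := exists_gns ωl fun b => by
    refine ge_of_tendsto' (hω (star b * b)) fun n => ?_
    rw [lp.infty_coeFn_mul, Pi.mul_apply, mul_apply_eq_comp, lp.coeFn_star, Pi.star_apply,
      inner_star_right, inner_self_eq_norm_sq_to_K]
    change (0 : ℂ) ≤ ((‖b n (ξ n)‖ : ℝ) : ℂ) ^ 2
    rw [← Complex.ofReal_pow]
    exact Complex.zero_le_real.2 (sq_nonneg _)
  exact ⟨K, i1, i2, i3, ζ, π, fun x => h x ▸ hω x⟩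

variable {K : Type} [NormedAddCommGroup K] [InnerProductSpace ℂ K] [CompleteSpace K]

/-- Bounded families of operators as elements of the C⋆-algebra of bounded sequences. -/
noncomputable def bddSeq (x : ∀ n, E n →L[ℂ] E n) (h : ∃ C, ∀ n, ‖x n‖ ≤ C) : BddSeq E :=
  ⟨x, memℓp_infty (by obtain ⟨C, hC⟩ := h; exact ⟨C, by rintro _ ⟨n, rfl⟩; exact hC n⟩)⟩

lemma bddSeq_apply (x : ∀ n, E n →L[ℂ] E n) (h : ∃ C, ∀ n, ‖x n‖ ≤ C) (n : ℕ) :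
    bddSeq x h n = x n := rfl

lemma map_bddSeq_nonneg (π : BddSeq E →⋆ₐ[ℂ] (K →L[ℂ] K)) {x : BddSeq E} (hx : ∀ n, 0 ≤ x n) :
    0 ≤ π x := by
  choose b hb using fun n => CStarAlgebra.nonneg_iff_eq_star_mul_self.1 (hx n)
  have hbd : ∃ C, ∀ n, ‖b n‖ ≤ C := ⟨√‖x‖, fun n => by
    refine Real.le_sqrt_of_sq_le ?_
    rw [sq, ← CStarRing.norm_star_mul_self, ← hb n]
    exact lp.norm_apply_le_norm ENNReal.top_ne_zero x n⟩
  have e : x = star (bddSeq b hbd) * bddSeq b hbd := by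
    refine lp.ext (funext fun n => ?_)
    rw [lp.infty_coeFn_mul, Pi.mul_apply, lp.coeFn_star, Pi.star_apply, bddSeq_apply, hb n]
  rw [e, map_mul, map_star]
  exact star_mul_self_nonneg _

lemma tendsto_norm_sq {ξ : ∀ n, E n} {ζ : K} {π : BddSeq E →⋆ₐ[ℂ] (K →L[ℂ] K)}
    (h : ∀ x : BddSeq E, Tendsto (fun n => ⟪ξ n, x n (ξ n)⟫_ℂ) (hyperfilter ℕ : Filter ℕ)
      (𝓝 ⟪ζ, π x ζ⟫_ℂ)) (x : BddSeq E) :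
    Tendsto (fun n => ‖x n (ξ n)‖ ^ 2) (hyperfilter ℕ : Filter ℕ) (𝓝 (‖π x ζ‖ ^ 2)) := by
  have h1 := (Complex.continuous_re.tendsto _).comp (h (star x * x))
  rw [map_mul, map_star, mul_apply_eq_comp, inner_star_right, re_inner_self_eq] at h1
  refine h1.congr fun n => ?_
  rw [Function.comp_apply, lp.infty_coeFn_mul, Pi.mul_apply, lp.coeFn_star, Pi.star_apply,
    mul_apply_eq_comp, inner_star_right, re_inner_self_eq]

end Limit

lemma norm_le_one_of_nonneg {H : Type*} [NormedAddCommGroup H] [InnerProductSpace ℂ H]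
    [CompleteSpace H] {x : H →L[ℂ] H} (h0 : 0 ≤ x) (h1 : x ≤ 1) : ‖x‖ ≤ 1 :=
  (CStarAlgebra.norm_le_one_iff_of_nonneg x h0).2 h1

/-- The limit of the finite-scale models. -/
theorem exists_limit_pair {H : Type} [NormedAddCommGroup H] [InnerProductSpace ℂ H]
    [CompleteSpace H] {M : VonNeumannAlgebra H} {ψ : H} (hcyc : Cyclic M ψ)
    (hcyc' : Cyclic M.commutant ψ) (hψ : ‖ψ‖ = 1) {γ : Type} {p : γ → H →L[ℂ] H}
    (hp : ∀ g, p g ∈ M) (hp0 : ∀ g, 0 ≤ p g) (hp1 : ∀ g, p g ≤ 1) :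
    ∃ (K : Type) (_ : NormedAddCommGroup K) (_ : InnerProductSpace ℂ K) (_ : CompleteSpace K)
      (ξ : K) (x z : γ → K →L[ℂ] K), ‖ξ‖ = 1 ∧ (∀ g, 0 ≤ x g) ∧ (∀ g, x g ≤ 1) ∧ (∀ g, 0 ≤ z g) ∧
      (∀ g h, Commute (x g) (z h)) ∧ (∀ g, x g ξ = z g ξ) ∧
      (∀ s : Finset γ, ∑ g ∈ s, p g = 1 → ∑ g ∈ s, x g ≤ 1) ∧
      (∀ (s : Finset γ) (t : γ → ℝ), ‖(∑ g ∈ s, t g • x g) ξ‖ ≤ ‖(∑ g ∈ s, t g • p g) ψ‖) ∧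
      ∀ (s : Finset γ) (t : γ → ℝ) (α : ℝ), 0 < α →
        (1 - 6 * α) * ‖(∑ g ∈ s, t g • p g) ψ‖ ^ 2 - 6 / α *
          ‖(modOp (saOrbit M.commutant ψ) - 1) ((∑ g ∈ s, t g • p g) ψ)‖ ^ 2 ≤
          ‖(∑ g ∈ s, t g • x g) ξ‖ ^ 2 := by
  have hmod : ∃ (E : ℕ → Type) (_ : ∀ n, NormedAddCommGroup (E n))
      (_ : ∀ n, InnerProductSpace ℂ (E n)) (_ : ∀ n, CompleteSpace (E n)),
      ∀ n, Nonempty (ScaleModel (E n) (modOp (saOrbit M.commutant ψ)) ψ (n + 10) p) :=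
    ⟨fun n => Scale (n + 10) H, fun n => inferInstance, fun n => inferInstance,
      fun n => inferInstance, fun n => exists_scaleModel hcyc hcyc' hψ (by omega) hp hp0 hp1⟩
  obtain ⟨E, j1, j2, j3, hmod⟩ := hmod
  have m := fun n => (hmod n).some
  have : ∀ n : ℕ, Nontrivial (E n) := fun n => ⟨(m n).vec, 0, fun h => by
    have := (m n).norm_vec
    rw [h, norm_zero] at this
    exact zero_ne_one this⟩
  obtain ⟨K, i1, i2, i3, ξ, π, hπ⟩ := exists_gns_limit (E := E)
    (fun n => (m n).vec) fun n => (m n).norm_vec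
  let X : γ → BddSeq E := fun g => bddSeq (fun n => (m n).left g)
    ⟨1, fun n => norm_le_one_of_nonneg ((m n).left_nonneg g) ((m n).left_le g)⟩
  let Z : γ → BddSeq E := fun g => bddSeq (fun n => (m n).right g)
    ⟨1, fun n => norm_le_one_of_nonneg ((m n).right_nonneg g) ((m n).right_le g)⟩
  have hF : (hyperfilter ℕ : Filter ℕ) ≤ atTop := Nat.hyperfilter_le_atTop
  have hcast : Tendsto (fun n : ℕ => ((n + 10 : ℕ) : ℝ)) (hyperfilter ℕ : Filter ℕ) atTop :=
    (tendsto_natCast_atTop_atTop.comp (tendsto_add_atTop_nat 10)).mono_left hF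
  have hnorm := fun x => tendsto_norm_sq hπ x
  have hsum : ∀ (s : Finset γ) (t : γ → ℝ), ∑ g ∈ s, t g • π (X g) = π (∑ g ∈ s, (t g : ℂ) • X g) := by
    intro s t
    rw [map_sum]
    exact Finset.sum_congr rfl fun g _ => by rw [map_smul, Complex.coe_smul]
  have hsumn : ∀ (s : Finset γ) (t : γ → ℝ) (n : ℕ),
      (∑ g ∈ s, (t g : ℂ) • X g : BddSeq E) n =
        ∑ g ∈ s, t g • (m n).left g := by
    intro s t n
    rw [lp.coeFn_sum, Finset.sum_apply]
    refine Finset.sum_congr rfl fun g _ => ?_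
    rw [lp.coeFn_smul, Pi.smul_apply, Complex.coe_smul]
    rfl
  have hone : ∀ n : ℕ, (1 : BddSeq E) n = 1 := fun n => by
    rw [lp.infty_coeFn_one, Pi.one_apply]
  refine ⟨K, i1, i2, i3, ξ, fun g => π (X g), fun g => π (Z g), ?_, ?_, ?_, ?_, ?_, ?_, ?_, ?_, ?_⟩
  · have h := hnorm 1
    simp_rw [hone, one_apply_eq_self, map_one, one_apply_eq_self, (m _).norm_vec] at h
    have := tendsto_nhds_unique h tendsto_const_nhds
    exact (pow_eq_one_iff_of_nonneg (norm_nonneg _) two_ne_zero).1 (this.trans (one_pow 2))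
  · exact fun g => map_bddSeq_nonneg π fun n => (m n).left_nonneg g
  · intro g
    rw [← sub_nonneg, ← map_one π, ← map_sub]
    refine map_bddSeq_nonneg π fun n => ?_
    rw [lp.coeFn_sub, Pi.sub_apply, hone]
    exact sub_nonneg.2 ((m n).left_le g)
  · exact fun g => map_bddSeq_nonneg π fun n => (m n).right_nonneg g
  · intro g h
    have : X g * Z h = Z h * X g := by
      refine lp.ext (funext fun n => ?_)
      rw [lp.infty_coeFn_mul, lp.infty_coeFn_mul, Pi.mul_apply, Pi.mul_apply]
      exact (m n).comm g h
    change π (X g) * π (Z h) = π (Z h) * π (X g)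
    rw [← map_mul, this, map_mul]
  · intro g
    have h := hnorm (X g - Z g)
    have hle : ‖p g ψ‖ ≤ 1 := ((p g).le_opNorm ψ).trans (by
      rw [hψ, mul_one]; exact norm_le_one_of_nonneg (hp0 g) (hp1 g))
    have h2 : Tendsto (fun n : ℕ => (1000 : ℝ) / ((n + 10 : ℕ) : ℝ)) (hyperfilter ℕ : Filter ℕ) (𝓝 0) :=
      tendsto_const_nhds.div_atTop hcast
    have h3 := le_of_tendsto_of_tendsto' h h2 fun n => by
      rw [lp.coeFn_sub, Pi.sub_apply, sub_apply]
      exact (m n).norm_sub g hle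
    rw [map_sub, sub_apply] at h3
    have h4 : ‖π (X g) ξ - π (Z g) ξ‖ = 0 := by
      have := norm_nonneg (π (X g) ξ - π (Z g) ξ)
      nlinarith
    exact sub_eq_zero.1 (norm_eq_zero.1 h4)
  · intro s hs
    have h1 := hsum s fun _ => 1
    simp_rw [one_smul] at h1
    rw [h1, ← sub_nonneg, ← map_one π, ← map_sub]
    refine map_bddSeq_nonneg π fun n => ?_
    have h2 := hsumn s (fun _ => 1) n
    rw [lp.coeFn_sub, Pi.sub_apply, hone, h2, sub_nonneg]
    exact (m n).sum_le s _ (by simpa using hs)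
  · intro s t
    have h := hnorm (∑ g ∈ s, (t g : ℂ) • X g)
    rw [hsum]
    refine le_of_sq_le_sq (le_of_tendsto' h fun n => ?_) (norm_nonneg _)
    rw [hsumn]
    exact (m n).norm_le s t
  · intro s t α hα
    have h := hnorm (∑ g ∈ s, (t g : ℂ) • X g)
    rw [hsum]
    have h2 : Tendsto (fun n : ℕ => (100 : ℝ) / ((n + 10 : ℕ) : ℝ)) (hyperfilter ℕ : Filter ℕ) (𝓝 0) :=
      tendsto_const_nhds.div_atTop hcast
    have h3 := (((tendsto_const_nhds (x := (1 : ℝ))).sub h2).sub_const (6 * α)).mul_const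
      (‖(∑ g ∈ s, t g • p g) ψ‖ ^ 2)
    have h4 := h3.sub_const (6 / α *
          ‖(modOp (saOrbit M.commutant ψ) - 1) ((∑ g ∈ s, t g • p g) ψ)‖ ^ 2)
    rw [sub_zero] at h4
    refine le_of_tendsto_of_tendsto' h4 h fun n => ?_
    rw [hsumn]
    exact (m n).le_norm s t α hα

section Standard

variable {H : Type*} [NormedAddCommGroup H] [InnerProductSpace ℂ H] [CompleteSpace H]
  {Γ : Type*} {X Y : Γ → H →L[ℂ] H} {σ : Γ → Γ} {ξ : H}

lemma adjoin_le_vnCentralizer (hXY : ∀ g h, Commute (X g) (Y h))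
    (hY : ∀ g, star (Y g) = Y (σ g)) {a : H →L[ℂ] H}
    (ha : a ∈ StarAlgebra.adjoin ℂ (Set.range X)) : a ∈ vnCentralizer (Set.range Y) := by
  refine StarAlgebra.adjoin_le (S := (vnCentralizer (Set.range Y)).toStarSubalgebra) ?_ ha
  rintro _ ⟨g, rfl⟩
  refine (mem_vnCentralizer ?_).2 ?_
  · rintro _ ⟨h, rfl⟩
    exact ⟨σ h, (hY h).symm⟩
  · rintro _ ⟨h, rfl⟩
    exact (hXY g h).symm

lemma adjoin_le_commutant {a : H →L[ℂ] H}
    (ha : a ∈ StarAlgebra.adjoin ℂ (Set.range Y)) :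
    a ∈ (vnCentralizer (Set.range Y)).commutant := by
  refine StarAlgebra.adjoin_le (S := (vnCentralizer (Set.range Y)).commutant.toStarSubalgebra) ?_ ha
  rintro _ ⟨h, rfl⟩
  exact subset_commutant_vnCentralizer (Set.mem_range_self h)

lemma exists_opposite (hXY : ∀ g h, Commute (X g) (Y h)) (hX : ∀ g, star (X g) = X (σ g))
    (hY : ∀ g, star (Y g) = Y (σ g)) (hξ : ∀ g, X g ξ = Y g ξ) {a : H →L[ℂ] H}
    (ha : a ∈ StarAlgebra.adjoin ℂ (Set.range X)) :
    ∃ b ∈ StarAlgebra.adjoin ℂ (Set.range Y), a ξ = b ξ ∧ (star a) ξ = (star b) ξ := by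
  have hcomm : ∀ {a b : H →L[ℂ] H}, a ∈ StarAlgebra.adjoin ℂ (Set.range X) →
      b ∈ StarAlgebra.adjoin ℂ (Set.range Y) → ∀ v, a (b v) = b (a v) := fun ha hb v => by
    have := commute_of_mem (adjoin_le_vnCentralizer hXY hY ha) (adjoin_le_commutant hb)
    exact congrArg (fun T : H →L[ℂ] H => T v) this.eq
  induction ha using StarAlgebra.adjoin_induction with
  | mem x hx =>
    obtain ⟨g, rfl⟩ := hx
    exact ⟨Y g, StarAlgebra.subset_adjoin _ _ ⟨g, rfl⟩, hξ g, by rw [hX, hY, hξ]⟩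
  | algebraMap r => exact ⟨algebraMap _ _ r, algebraMap_mem _ _, rfl, rfl⟩
  | add x y _ _ h1 h2 =>
    obtain ⟨a, ha, ha1, ha2⟩ := h1
    obtain ⟨b, hb, hb1, hb2⟩ := h2
    exact ⟨a + b, add_mem ha hb, by rw [add_apply, add_apply, ha1, hb1],
      by rw [star_add, star_add, add_apply, add_apply, ha2, hb2]⟩
  | mul x y hx hy h1 h2 =>
    obtain ⟨a, ha, ha1, ha2⟩ := h1
    obtain ⟨b, hb, hb1, hb2⟩ := h2
    refine ⟨b * a, mul_mem hb ha, ?_, ?_⟩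
    · rw [mul_apply_eq_comp, mul_apply_eq_comp, hb1, hcomm hx hb, ha1]
    · rw [star_mul, star_mul, mul_apply_eq_comp, mul_apply_eq_comp, ha2,
        hcomm (star_mem hy) (star_mem ha), hb2]
  | star x _ h =>
    obtain ⟨a, ha, ha1, ha2⟩ := h
    exact ⟨star a, star_mem ha, ha2, by rw [star_star, star_star, ha1]⟩

/-- If a family of operators has a commuting opposite family implementing the same vectors, then
the cyclic vector is a trace vector. -/
theorem trace_of_opposite (hXY : ∀ g h, Commute (X g) (Y h)) (hX : ∀ g, star (X g) = X (σ g))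
    (hY : ∀ g, star (Y g) = Y (σ g)) (hξ : ∀ g, X g ξ = Y g ξ)
    (hd : Dense ((fun a : H →L[ℂ] H => a ξ) '' (StarAlgebra.adjoin ℂ (Set.range X) : Set _))) :
    (∀ g, X g ∈ vnCentralizer (Set.range Y)) ∧ Cyclic (vnCentralizer (Set.range Y)) ξ ∧
      Cyclic (vnCentralizer (Set.range Y)).commutant ξ ∧
      ∀ a ∈ vnCentralizer (Set.range Y), ∀ b ∈ vnCentralizer (Set.range Y),
        ⟪ξ, (a * b) ξ⟫_ℂ = ⟪ξ, (b * a) ξ⟫_ℂ := by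
  set N := vnCentralizer (Set.range Y) with hN
  have key : ∀ x ∈ N, ∀ b ∈ StarAlgebra.adjoin ℂ (Set.range X),
      ⟪(star x) ξ, b ξ⟫_ℂ = ⟪(star b) ξ, x ξ⟫_ℂ := by
    intro x hx b hb
    obtain ⟨c, hc, h1, h2⟩ := exists_opposite hXY hX hY hξ hb
    have := commute_of_mem hx (adjoin_le_commutant hc)
    rw [h1, h2, inner_star_left, inner_star_left, ← mul_apply_eq_comp, this.eq, mul_apply_eq_comp]
  have hmem : ∀ b ∈ StarAlgebra.adjoin ℂ (Set.range X), b ∈ N :=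
    fun b hb => adjoin_le_vnCentralizer hXY hY hb
  have hnorm : ∀ b ∈ StarAlgebra.adjoin ℂ (Set.range X), ‖(star b) ξ‖ = ‖b ξ‖ := by
    intro b hb
    have h := key (star b) (star_mem (hmem b hb)) b hb
    rw [star_star] at h
    have h2 := congrArg Complex.re h
    rw [re_inner_self_eq, re_inner_self_eq] at h2
    exact ((sq_eq_sq₀ (norm_nonneg _) (norm_nonneg _)).1 h2).symm
  have hle : ∀ x ∈ N, ‖(star x) ξ‖ ≤ ‖x ξ‖ := by
    intro x hx
    have h1 : ∀ w, ‖⟪(star x) ξ, w⟫_ℂ‖ ≤ ‖x ξ‖ * ‖w‖ := by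
      intro w
      have hc : IsClosed {w | ‖⟪(star x) ξ, w⟫_ℂ‖ ≤ ‖x ξ‖ * ‖w‖} :=
        isClosed_le (by fun_prop) (by fun_prop)
      refine hc.closure_subset_iff.2 ?_ (hd w)
      rintro _ ⟨b, hb, rfl⟩
      rw [Set.mem_ofPred_eq, key x hx b hb, mul_comm, ← hnorm b hb]
      exact norm_inner_le_norm _ _
    have h2 := h1 ((star x) ξ)
    rw [inner_self_eq_norm_sq_to_K, norm_pow, RCLike.norm_ofReal, abs_norm, sq] at h2
    by_contra! h
    have := norm_nonneg (x ξ)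
    nlinarith
  have hcyc : Cyclic N ξ := hd.mono (Set.image_mono hmem)
  have hopp : ∀ x ∈ N, ∀ y ∈ N, ⟪(star x) ξ, y ξ⟫_ℂ = ⟪(star y) ξ, x ξ⟫_ℂ := by
    intro x hx y hy
    rw [← sub_eq_zero, ← norm_le_zero_iff]
    refine le_of_forall_pos_le_add fun δ hδ => ?_
    have hpos : 0 < ‖x ξ‖ + 1 := by positivity
    obtain ⟨_, ⟨b, hb, rfl⟩, hdist⟩ := hd.exists_dist_lt (y ξ) (ε := δ / 2 / (‖x ξ‖ + 1)) (by positivity)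
    have hyb : y - b ∈ N := sub_mem hy (hmem b hb)
    have e : ⟪(star x) ξ, y ξ⟫_ℂ - ⟪(star y) ξ, x ξ⟫_ℂ =
        ⟪(star x) ξ, (y - b) ξ⟫_ℂ - ⟪(star (y - b)) ξ, x ξ⟫_ℂ := by
      rw [star_sub, sub_apply, sub_apply, inner_sub_right, inner_sub_left, key x hx b hb]
      ring
    rw [dist_eq_norm, ← sub_apply, lt_div_iff₀ hpos] at hdist
    have h1 := norm_inner_le_norm (𝕜 := ℂ) ((star x) ξ) ((y - b) ξ)
    have h2 := norm_inner_le_norm (𝕜 := ℂ) ((star (y - b)) ξ) (x ξ)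
    have h3 := hle x hx
    have h4 := hle _ hyb
    have h5 := norm_nonneg (x ξ)
    have h6 := norm_nonneg ((y - b) ξ)
    rw [e]
    refine (norm_sub_le _ _).trans ?_
    nlinarith
  refine ⟨fun g => hmem _ (StarAlgebra.subset_adjoin _ _ ⟨g, rfl⟩), hcyc, hd.mono ?_, ?_⟩
  · rintro _ ⟨a, ha, rfl⟩
    obtain ⟨b, hb, h, -⟩ := exists_opposite hXY hX hY hξ ha
    exact ⟨b, adjoin_le_commutant hb, h.symm⟩
  · intro a ha b hb
    have := hopp a ha b hb
    rwa [inner_star_left, inner_star_left, ← mul_apply_eq_comp, ← mul_apply_eq_comp] at this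

lemma exists_lift {K : Type*} [NormedAddCommGroup K] [InnerProductSpace ℂ K] [CompleteSpace K]
    (V : H →ₗᵢ[ℂ] K) {L : Γ → K →L[ℂ] K} (hX : ∀ g, star (X g) = X (σ g))
    (hL : ∀ g, star (L g) = L (σ g)) (hXL : ∀ g v, V (X g v) = L g (V v)) {b : K →L[ℂ] K}
    (hb : b ∈ StarAlgebra.adjoin ℂ (Set.range L)) :
    ∃ a ∈ StarAlgebra.adjoin ℂ (Set.range X),
      (∀ v, V (a v) = b (V v)) ∧ ∀ v, V ((star a) v) = (star b) (V v) := by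
  induction hb using StarAlgebra.adjoin_induction with
  | mem x hx =>
    obtain ⟨g, rfl⟩ := hx
    exact ⟨X g, StarAlgebra.subset_adjoin _ _ ⟨g, rfl⟩, hXL g, fun v => by
      rw [hX, hL, hXL]⟩
  | algebraMap r =>
    have h : ∀ (r : ℂ) (v : H), V (algebraMap ℂ (H →L[ℂ] H) r v) =
        algebraMap ℂ (K →L[ℂ] K) r (V v) := fun r v => V.map_smul r v
    exact ⟨algebraMap _ _ r, algebraMap_mem _ _, h r, fun v => by
      rw [← algebraMap_star_comm, ← algebraMap_star_comm, h]⟩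
  | add x y _ _ h1 h2 =>
    obtain ⟨a, ha, ha1, ha2⟩ := h1
    obtain ⟨b, hb, hb1, hb2⟩ := h2
    exact ⟨a + b, add_mem ha hb, fun v => by rw [add_apply, add_apply, map_add, ha1, hb1],
      fun v => by rw [star_add, star_add, add_apply, add_apply, map_add, ha2, hb2]⟩
  | mul x y _ _ h1 h2 =>
    obtain ⟨a, ha, ha1, ha2⟩ := h1
    obtain ⟨b, hb, hb1, hb2⟩ := h2
    exact ⟨a * b, mul_mem ha hb, fun v => by
      rw [mul_apply_eq_comp, mul_apply_eq_comp, ha1, hb1], fun v => by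
      rw [star_mul, star_mul, mul_apply_eq_comp, mul_apply_eq_comp, hb2, ha2]⟩
  | star x _ h =>
    obtain ⟨a, ha, ha1, ha2⟩ := h
    exact ⟨star a, star_mem ha, ha2, fun v => by rw [star_star, star_star, ha1]⟩

/-- Restriction of a commuting pair of families to the cyclic subspace of the first one. -/
theorem exists_standard {K : Type} [NormedAddCommGroup K] [InnerProductSpace ℂ K] [CompleteSpace K]
    {L R : Γ → K →L[ℂ] K} {ξ : K} (hLR : ∀ g h, Commute (L g) (R h))
    (hL : ∀ g, star (L g) = L (σ g)) (hR : ∀ g, star (R g) = R (σ g)) (hξ : ∀ g, L g ξ = R g ξ) :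
    ∃ (K1 : Type) (_ : NormedAddCommGroup K1) (_ : InnerProductSpace ℂ K1) (_ : CompleteSpace K1)
      (V : K1 →ₗᵢ[ℂ] K) (ξ1 : K1) (N : VonNeumannAlgebra K1) (X : Γ → K1 →L[ℂ] K1), V ξ1 = ξ ∧
      (∀ g v, V (X g v) = L g (V v)) ∧ (∀ g, X g ∈ N) ∧ Cyclic N ξ1 ∧ Cyclic N.commutant ξ1 ∧
      ∀ a ∈ N, ∀ b ∈ N, ⟪ξ1, (a * b) ξ1⟫_ℂ = ⟪ξ1, (b * a) ξ1⟫_ℂ := by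
  let 𝒜 := StarAlgebra.adjoin ℂ (Set.range L)
  let ev : (K →L[ℂ] K) →ₗ[ℂ] K :=
    { toFun := fun a => a ξ
      map_add' := fun a b => add_apply a b ξ
      map_smul' := fun c a => rfl }
  let W₀ : Submodule ℂ K := 𝒜.toSubalgebra.toSubmodule.map ev
  let W := W₀.topologicalClosure
  have hW₀ : ∀ {v}, v ∈ W₀ ↔ ∃ a ∈ 𝒜, a ξ = v := Iff.rfl
  have hsub : W₀ ≤ W := W₀.le_topologicalClosure
  have : CompleteSpace W := W₀.isClosed_topologicalClosure.completeSpace_coe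
  have hstab : ∀ T : K →L[ℂ] K, (∀ v ∈ W₀, T v ∈ W₀) → ∀ v : W, T v ∈ W := by
    intro T hT v
    exact map_mem_closure T.continuous v.2 hT
  have hLW : ∀ g, ∀ v ∈ W₀, L g v ∈ W₀ := by
    rintro g _ ⟨a, ha, rfl⟩
    exact ⟨L g * a, (mul_mem (StarAlgebra.subset_adjoin _ _ ⟨g, rfl⟩) ha : _ ∈ 𝒜), rfl⟩
  have hRW : ∀ g, ∀ v ∈ W₀, R g v ∈ W₀ := by
    rintro g _ ⟨a, ha, rfl⟩
    refine ⟨a * L g, (mul_mem ha (StarAlgebra.subset_adjoin _ _ ⟨g, rfl⟩) : _ ∈ 𝒜), ?_⟩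
    have := commute_of_mem (adjoin_le_vnCentralizer hLR hR ha)
      (subset_commutant_vnCentralizer (Set.mem_range_self g))
    change (a * L g) ξ = R g (a ξ)
    rw [mul_apply_eq_comp, hξ, ← mul_apply_eq_comp, this.eq, mul_apply_eq_comp]
  let res : ∀ T : K →L[ℂ] K, (∀ v ∈ W₀, T v ∈ W₀) → (W →L[ℂ] W) := fun T hT =>
    (T ∘L W.subtypeL).codRestrict W (hstab T hT)
  have hres : ∀ T hT v, (res T hT v : K) = T v := fun T hT v => rfl
  let X : Γ → W →L[ℂ] W := fun g => res (L g) (hLW g)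
  let Y : Γ → W →L[ℂ] W := fun g => res (R g) (hRW g)
  let ξ1 : W := ⟨ξ, hsub ⟨1, one_mem 𝒜, rfl⟩⟩
  have hX : ∀ g, star (X g) = X (σ g) := fun g => by
    refine ContinuousLinearMap.ext fun v => ext_inner_right ℂ fun w => ?_
    rw [inner_star_left, Submodule.coe_inner, Submodule.coe_inner, hres _ (hLW g), hres _ (hLW (σ g)), ← hL, inner_star_left]
  have hY : ∀ g, star (Y g) = Y (σ g) := fun g => by
    refine ContinuousLinearMap.ext fun v => ext_inner_right ℂ fun w => ?_
    rw [inner_star_left, Submodule.coe_inner, Submodule.coe_inner, hres _ (hRW g), hres _ (hRW (σ g)), ← hR, inner_star_left]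
  have hXY : ∀ g h, Commute (X g) (Y h) := fun g h => by
    refine ContinuousLinearMap.ext fun v => Subtype.ext ?_
    exact congrArg (fun T : K →L[ℂ] K => T v) (hLR g h).eq
  have hXξ : ∀ g, X g ξ1 = Y g ξ1 := fun g => Subtype.ext (hξ g)
  have hd : Dense ((fun a : W →L[ℂ] W => a ξ1) ''
      (StarAlgebra.adjoin ℂ (Set.range X) : Set _)) := by
    refine Subtype.dense_iff.2 fun v hv => ?_
    refine closure_mono ?_ hv
    rintro _ ⟨b, hb, rfl⟩
    obtain ⟨a, ha, h, -⟩ := exists_lift W.subtypeₗᵢ hX hL (fun g v => rfl) hb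
    exact ⟨a ξ1, ⟨a, ha, rfl⟩, h ξ1⟩
  obtain ⟨h1, h2, h3, h4⟩ := trace_of_opposite hXY hX hY hXξ hd
  exact ⟨W, inferInstance, inferInstance, inferInstance, W.subtypeₗᵢ, ξ1,
    vnCentralizer (Set.range Y), X, rfl, fun g v => rfl, h1, h2, h3, h4⟩

end Standard

/-- A von Neumann algebra in standard form with respect to a trace vector. -/
structure IsTracial {K : Type*} [NormedAddCommGroup K] [InnerProductSpace ℂ K] [CompleteSpace K]
    (N : VonNeumannAlgebra K) (ξ : K) : Prop where
  norm_eq : ‖ξ‖ = 1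
  cyclic : Cyclic N ξ
  cyclic' : Cyclic N.commutant ξ
  trace : ∀ a ∈ N, ∀ b ∈ N, ⟪ξ, (a * b) ξ⟫_ℂ = ⟪ξ, (b * a) ξ⟫_ℂ

/-- A system of matrix units in a von Neumann algebra. -/
structure IsMatrixUnits {K ι : Type*} [NormedAddCommGroup K] [InnerProductSpace ℂ K]
    [CompleteSpace K] [Fintype ι] [DecidableEq ι] (N : VonNeumannAlgebra K)
    (F : ι → ι → K →L[ℂ] K) : Prop where
  mem : ∀ i j, F i j ∈ N
  star_eq : ∀ i j, star (F i j) = F j i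
  mul_eq : ∀ i j k l, F i j * F k l = if j = k then F i l else 0
  sum_eq : ∑ i, F i i = 1

section Units

variable {H : Type*} [NormedAddCommGroup H] [InnerProductSpace ℂ H] [CompleteSpace H]
  {ι : Type*} [Fintype ι] [DecidableEq ι]

lemma norm_sq_le_re_inner {T : H →L[ℂ] H} (h0 : 0 ≤ T) (h1 : T ≤ 1) (v : H) :
    ‖T v‖ ^ 2 ≤ (⟪v, T v⟫_ℂ).re := by
  have hT := norm_le_one_of_nonneg h0 h1
  obtain ⟨b, rfl⟩ := CStarAlgebra.nonneg_iff_eq_star_mul_self.1 h0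
  rw [CStarRing.norm_star_mul_self] at hT
  have hb : ‖star b‖ ≤ 1 := by
    rw [norm_star]
    nlinarith [norm_nonneg b]
  rw [mul_apply_eq_comp, inner_star_right, re_inner_self_eq]
  refine pow_le_pow_left₀ (norm_nonneg _) (((star b).le_opNorm _).trans ?_) 2
  exact mul_le_of_le_one_left (norm_nonneg _) hb

/-- The scalar matrix with a given operator on the diagonal. -/
noncomputable def scalarMat (ι : Type*) [DecidableEq ι] (x : H →L[ℂ] H) : ι → ι → H →L[ℂ] H :=
  fun a b => if a = b then x else 0

/-- The elementary matrices. -/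
noncomputable def unitMat (i j : ι) : ι → ι → H →L[ℂ] H :=
  fun a b => if a = i ∧ b = j then 1 else 0

lemma lop_scalarMat_apply (x : H →L[ℂ] H) (v : Amp ι (Amp ι H)) (l m : ι) :
    lop (scalarMat ι x) v l m = x (v l m) := by
  rw [lop_apply, Finset.sum_eq_single m] <;> simp +contextual [scalarMat, eq_comm]

lemma lop_unitMat_apply (i j : ι) (v : Amp ι (Amp ι H)) (l m : ι) :
    lop (unitMat i j) v l m = if m = i then v l j else 0 := by
  rw [lop_apply, Finset.sum_eq_single j]
  · by_cases h : m = i <;> simp [unitMat, h]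
  · intro b _ hb
    simp [unitMat, hb]
  · simp

lemma lop_unitMat_mul (i j k l : ι) :
    lop (unitMat i j : ι → ι → H →L[ℂ] H) * lop (unitMat k l) =
      if j = k then lop (unitMat i l) else 0 := by
  ext v a b
  rw [mul_apply_eq_comp, lop_unitMat_apply, lop_unitMat_apply]
  by_cases h : j = k <;> by_cases h' : b = i <;> simp [h, h', lop_unitMat_apply]

lemma sum_lop_unitMat : ∑ i, lop (unitMat i i : ι → ι → H →L[ℂ] H) = 1 := by
  ext v a b
  rw [sum_apply, WithLp.ofLp_sum, Finset.sum_apply, WithLp.ofLp_sum, Finset.sum_apply,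
    Finset.sum_eq_single b]
  · simp [lop_unitMat_apply]
  · intro c _ hc
    simp [lop_unitMat_apply, hc.symm]
  · simp

lemma star_scalarMat (x : H →L[ℂ] H) :
    (fun a b => star (scalarMat ι x b a)) = scalarMat ι (star x) := by
  funext a b
  by_cases h : a = b
  · simp [scalarMat, h]
  · simp [scalarMat, h, Ne.symm h]

lemma star_unitMat (i j : ι) :
    (fun a b => star ((unitMat i j : ι → ι → H →L[ℂ] H) b a)) = unitMat j i := by
  funext a b
  by_cases h : a = j <;> by_cases h' : b = i <;> simp [unitMat, h, h']

/-- The vector implementing the normalized trace on matrices. -/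
noncomputable def uniformVec (ι : Type*) [Fintype ι] [DecidableEq ι] (ξ : H) : Amp ι (Amp ι H) :=
  diagVec (fun _ : ι => (Fintype.card ι : ℝ)⁻¹) ξ

lemma norm_lop_scalarMat_uniformVec [Nonempty ι] (T : H →L[ℂ] H) (ξ : H) :
    ‖lop (scalarMat ι T) (uniformVec ι ξ)‖ = ‖T ξ‖ := by
  refine (sq_eq_sq₀ (norm_nonneg _) (norm_nonneg _)).1 ?_
  rw [norm_sq_amp]
  have hcard : (0 : ℝ) < Fintype.card ι := Nat.cast_pos.2 Fintype.card_pos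
  have h : ∀ l m : ι, ‖lop (scalarMat ι T) (uniformVec ι ξ) l m‖ ^ 2 =
      if m = l then (Fintype.card ι : ℝ)⁻¹ * ‖T ξ‖ ^ 2 else 0 := by
    intro l m
    rw [uniformVec, lop_diagVec]
    by_cases h : m = l
    · rw [scalarMat, if_pos h, if_pos h, norm_smul, mul_pow, Complex.norm_real,
        Real.norm_of_nonneg (Real.sqrt_nonneg _), Real.sq_sqrt (by positivity)]
    · simp [scalarMat, h]
  simp_rw [h]
  simp only [Finset.sum_ite_eq', Finset.mem_univ, if_true, Finset.sum_const, Finset.card_univ,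
    nsmul_eq_mul]
  field_simp

lemma scalarMat_one_apply (v : Amp ι (Amp ι H)) : lop (scalarMat ι 1) v = v := by
  ext a b
  rw [lop_scalarMat_apply, one_apply_eq_self]

lemma lop_scalarMat_nonneg {x : H →L[ℂ] H} (hx : 0 ≤ x) (v : Amp ι (Amp ι H)) :
    0 ≤ (⟪v, lop (scalarMat ι x) v⟫_ℂ).re := by
  rw [inner_amp, Complex.re_sum]
  refine Finset.sum_nonneg fun l _ => ?_
  rw [Complex.re_sum]
  refine Finset.sum_nonneg fun m _ => ?_
  rw [lop_scalarMat_apply]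
  exact re_inner_nonneg hx _

end Units

theorem exists_tracial {H : Type} [NormedAddCommGroup H] [InnerProductSpace ℂ H]
    [CompleteSpace H] {M : VonNeumannAlgebra H} {ψ : H} (hcyc : Cyclic M ψ)
    (hcyc' : Cyclic M.commutant ψ) (hψ : ‖ψ‖ = 1) {γ : Type} {p : γ → H →L[ℂ] H}
    (hp : ∀ g, p g ∈ M) (hp0 : ∀ g, 0 ≤ p g) (hp1 : ∀ g, p g ≤ 1)
    (ι : Type) [Fintype ι] [DecidableEq ι] [Nonempty ι] :
    ∃ (K : Type) (_ : NormedAddCommGroup K) (_ : InnerProductSpace ℂ K) (_ : CompleteSpace K)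
      (ξ : K) (N : VonNeumannAlgebra K) (x : γ → K →L[ℂ] K) (F : ι → ι → K →L[ℂ] K),
      IsTracial N ξ ∧ IsMatrixUnits N F ∧ (∀ g, x g ∈ N) ∧ (∀ g, 0 ≤ x g) ∧ (∀ g, x g ≤ 1) ∧
      (∀ g i j, Commute (x g) (F i j)) ∧
      (∀ s : Finset γ, ∑ g ∈ s, p g = 1 → ∑ g ∈ s, x g = 1) ∧
      (∀ (s : Finset γ) (t : γ → ℝ), ‖(∑ g ∈ s, t g • x g) ξ‖ ≤ ‖(∑ g ∈ s, t g • p g) ψ‖) ∧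
      ∀ (s : Finset γ) (t : γ → ℝ) (α : ℝ), 0 < α →
        (1 - 6 * α) * ‖(∑ g ∈ s, t g • p g) ψ‖ ^ 2 - 6 / α *
          ‖(modOp (saOrbit M.commutant ψ) - 1) ((∑ g ∈ s, t g • p g) ψ)‖ ^ 2 ≤
          ‖(∑ g ∈ s, t g • x g) ξ‖ ^ 2 := by
  obtain ⟨K, i1, i2, i3, ξ, x, z, hξ, hx0, hx1, hz0, hxz, hξxz, hsum, hle, hge⟩ :=
    exists_limit_pair hcyc hcyc' hψ hp hp0 hp1
  let L : γ ⊕ (ι × ι) → Amp ι (Amp ι K) →L[ℂ] Amp ι (Amp ι K) :=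
    Sum.elim (fun g => lop (scalarMat ι (x g))) fun e => lop (unitMat e.1 e.2)
  let R : γ ⊕ (ι × ι) → Amp ι (Amp ι K) →L[ℂ] Amp ι (Amp ι K) :=
    Sum.elim (fun g => rop (scalarMat ι (z g))) fun e => rop (unitMat e.2 e.1)
  let σ : γ ⊕ (ι × ι) → γ ⊕ (ι × ι) := Sum.map id Prod.swap
  have hxsa : ∀ g, star (x g) = x g := fun g => (IsSelfAdjoint.of_nonneg (hx0 g)).star_eq
  have hzsa : ∀ g, star (z g) = z g := fun g => (IsSelfAdjoint.of_nonneg (hz0 g)).star_eq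
  have hLR : ∀ g h, Commute (L g) (R h) := by
    rintro (g | ⟨i, j⟩) (h | ⟨k, l⟩) <;> refine (commute_lop_rop_iff _ _).2 fun a b c d => ?_ <;>
    simp only [scalarMat, unitMat] <;> split_ifs <;>
    first | exact Commute.zero_left _ | exact Commute.zero_right _ | exact Commute.one_left _ |
      exact Commute.one_right _ | exact hxz _ _
  have hL : ∀ g, star (L g) = L (σ g) := by
    rintro (g | ⟨i, j⟩)
    · change star (lop _) = lop _
      rw [star_lop, star_scalarMat, hxsa]; rfl
    · change star (lop _) = lop _
      rw [star_lop, star_unitMat]; rfl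
  have hR : ∀ g, star (R g) = R (σ g) := by
    rintro (g | ⟨i, j⟩)
    · change star (rop _) = rop _
      rw [star_rop, star_scalarMat, hzsa]; rfl
    · change star (rop _) = rop _
      rw [star_rop, star_unitMat]; rfl
  have hLRξ : ∀ g, L g (uniformVec ι ξ) = R g (uniformVec ι ξ) := by
    rintro (g | ⟨i, j⟩)
    · change lop _ _ = rop _ _
      ext l m
      rw [uniformVec, lop_diagVec, rop_diagVec]
      by_cases h : m = l
      · simp [scalarMat, h, hξxz]
      · simp [scalarMat, h, Ne.symm h]
    · change lop _ _ = rop _ _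
      ext l m
      rw [uniformVec, lop_diagVec, rop_diagVec]
      by_cases h : m = i <;> by_cases h' : l = j <;> simp [unitMat, h, h']
  obtain ⟨K1, j1, j2, j3, V, ξ1, N, X, hVξ, hVX, hXN, hc1, hc2, htr⟩ :=
    exists_standard hLR hL hR hLRξ
  have hVx : ∀ g v, V (X (Sum.inl g) v) = lop (scalarMat ι (x g)) (V v) := fun g => hVX _
  have hVF : ∀ i j v, V (X (Sum.inr (i, j)) v) = lop (unitMat i j) (V v) := fun i j => hVX _
  have hVsum : ∀ (s : Finset γ) (t : γ → ℝ) v, V ((∑ g ∈ s, t g • X (Sum.inl g)) v) =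
      lop (scalarMat ι (∑ g ∈ s, t g • x g)) (V v) := by
    intro s t v
    ext l m
    rw [sum_apply, map_sum, lop_scalarMat_apply, sum_apply, WithLp.ofLp_sum, Finset.sum_apply,
      WithLp.ofLp_sum, Finset.sum_apply]
    refine Finset.sum_congr rfl fun g _ => ?_
    rw [smul_apply, smul_apply, ← Complex.coe_smul, map_smul, hVx, ← Complex.coe_smul,
      PiLp.smul_apply, PiLp.smul_apply, lop_scalarMat_apply]
  have hnorm : ∀ (s : Finset γ) (t : γ → ℝ), ‖(∑ g ∈ s, t g • X (Sum.inl g)) ξ1‖ =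
      ‖(∑ g ∈ s, t g • x g) ξ‖ := by
    intro s t
    rw [← V.norm_map, hVsum, hVξ, norm_lop_scalarMat_uniformVec]
  have hXsa : ∀ g, IsSelfAdjoint (X (Sum.inl g)) := fun g => by
    refine ContinuousLinearMap.ext fun v => ext_inner_right ℂ fun w => ?_
    rw [inner_star_left, ← V.inner_map_map, ← V.inner_map_map, hVx, hVx, ← inner_star_left,
      star_lop, star_scalarMat, hxsa]
  have h1 : ‖ξ1‖ = 1 := by
    have := norm_lop_scalarMat_uniformVec (ι := ι) 1 ξ
    rwa [scalarMat_one_apply, one_apply_eq_self, hξ, ← hVξ, V.norm_map] at this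
  have hpos : ∀ g v, 0 ≤ (⟪v, X (Sum.inl g) v⟫_ℂ).re ∧
      (⟪v, X (Sum.inl g) v⟫_ℂ).re ≤ (⟪v, v⟫_ℂ).re := by
    intro g v
    rw [← V.inner_map_map, ← V.inner_map_map v v, hVx]
    refine ⟨lop_scalarMat_nonneg (hx0 g) _, ?_⟩
    have h := lop_scalarMat_nonneg (sub_nonneg.2 (hx1 g)) (V v)
    have e : lop (scalarMat ι (1 - x g)) (V v) = V v - lop (scalarMat ι (x g)) (V v) := by
      ext l m
      rw [lop_scalarMat_apply, PiLp.sub_apply, PiLp.sub_apply, lop_scalarMat_apply, sub_apply,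
        one_apply_eq_self]
    rw [e, inner_sub_right, Complex.sub_re] at h
    linarith
  have hcomm : ∀ g i j, Commute (X (Sum.inl g)) (X (Sum.inr (i, j))) := by
    intro g i j
    refine ContinuousLinearMap.ext fun v => V.injective ?_
    rw [mul_apply_eq_comp, mul_apply_eq_comp, hVx, hVF, hVF, hVx]
    ext l m
    rw [lop_scalarMat_apply, lop_unitMat_apply, lop_unitMat_apply, lop_scalarMat_apply]
    split_ifs <;> simp
  have hunits : IsMatrixUnits N fun i j => X (Sum.inr (i, j)) := by
    refine ⟨fun i j => hXN _, fun i j => ?_, fun i j k l => ?_, ?_⟩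
    · refine ContinuousLinearMap.ext fun v => ext_inner_right ℂ fun w => ?_
      rw [inner_star_left, ← V.inner_map_map, ← V.inner_map_map, hVF, hVF, ← inner_star_left,
        star_lop, star_unitMat]
    · refine ContinuousLinearMap.ext fun v => V.injective ?_
      rw [mul_apply_eq_comp, hVF, hVF, ← mul_apply_eq_comp, lop_unitMat_mul]
      by_cases h : j = k
      · rw [if_pos h, if_pos h, hVF]
      · rw [if_neg h, if_neg h, zero_apply, zero_apply, map_zero]
    · refine ContinuousLinearMap.ext fun v => V.injective ?_
      rw [sum_apply, map_sum]
      simp_rw [hVF]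
      rw [← sum_apply, sum_lop_unitMat, one_apply_eq_self, one_apply_eq_self]
  refine ⟨K1, j1, j2, j3, ξ1, N, fun g => X (Sum.inl g), fun i j => X (Sum.inr (i, j)),
    ⟨h1, hc1, hc2, htr⟩, hunits, fun g => hXN _, fun g => ?_, fun g => ?_, hcomm, ?_, ?_, ?_⟩
  · refine le_of_re_inner (.zero _) (hXsa g) fun v => ?_
    rw [zero_apply, inner_zero_right]
    exact (hpos g v).1
  · refine le_of_re_inner (hXsa g) (.one _) fun v => ?_
    rw [one_apply_eq_self]
    exact (hpos g v).2
  · intro s hs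
    have hT0 : 0 ≤ ∑ g ∈ s, x g := Finset.sum_nonneg fun g _ => hx0 g
    have hT1 := hsum s hs
    have hTξ : (1 : ℝ) ≤ ‖(∑ g ∈ s, x g) ξ‖ ^ 2 := by
      refine le_of_forall_pos_le_add fun δ hδ => ?_
      have h := hge s (fun _ => 1) (δ / 6) (by positivity)
      simp_rw [one_smul] at h
      rw [hs, one_apply_eq_self, hψ, sub_apply, modOp_fixed, one_apply_eq_self, sub_self,
        norm_zero] at h
      linarith
    have h0 : (∑ g ∈ s, x g) ξ = ξ := by
      have h2 := norm_sub_sq_re ((∑ g ∈ s, x g) ξ) ξ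
      have h3 := norm_sq_le_re_inner hT0 hT1 ξ
      rw [re_inner_comm, hξ] at h2
      have h4 := sq_nonneg ‖(∑ g ∈ s, x g) ξ - ξ‖
      have h5 : ‖(∑ g ∈ s, x g) ξ - ξ‖ ^ 2 = 0 := by linarith
      exact sub_eq_zero.1 (norm_eq_zero.1 (pow_eq_zero_iff two_ne_zero |>.1 h5))
    refine Cyclic.ext hc2 ?_ (one_mem _) (V.injective ?_)
    · rw [VonNeumannAlgebra.commutant_commutant]
      exact sum_mem fun g _ => hXN _
    · have h := hVsum s (fun _ => 1) ξ1
      simp_rw [one_smul] at h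
      rw [h, one_apply_eq_self, hVξ]
      ext l m
      rw [lop_scalarMat_apply, uniformVec, diagVec_apply]
      split_ifs
      · rw [map_smul, h0]
      · rw [map_zero]
  · intro s t
    rw [hnorm]
    exact hle s t
  · intro s t α hα
    rw [hnorm]
    exact hge s t α hα

section Extreme

variable {H K : Type*} [NormedAddCommGroup H] [InnerProductSpace ℂ H] [CompleteSpace H]
  [NormedAddCommGroup K] [InnerProductSpace ℂ K] [CompleteSpace K]

/-- The matrix coefficients of an operator. -/
noncomputable def coeffs : (H →L[ℂ] K) →ₗ[ℝ] (K × H → ℂ) where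
  toFun T := fun vw => ⟪vw.1, T vw.2⟫_ℂ
  map_add' S T := by
    funext vw
    simp
  map_smul' c T := by
    funext vw
    simp only [smul_apply, RingHom.id_apply, Pi.smul_apply]
    rw [← Complex.coe_smul, inner_smul_right, Complex.real_smul]

lemma coeffs_apply (T : H →L[ℂ] K) (v : K) (w : H) : coeffs T (v, w) = ⟪v, T w⟫_ℂ := rfl

lemma coeffs_injective : Function.Injective (coeffs : (H →L[ℂ] K) →ₗ[ℝ] _) := by
  intro S T h
  refine ContinuousLinearMap.ext fun w => ext_inner_left ℂ fun v => ?_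
  exact congrFun h (v, w)

/-- On a weakly closed bounded convex set of operators a weakly continuous functional attains its
maximum at an extreme point. -/
theorem exists_extreme_maximizer {C : Set (H →L[ℂ] K)} (hbd : ∀ T ∈ C, ‖T‖ ≤ 1) (hne : C.Nonempty)
    (hcl : ∀ (F : Ultrafilter (H →L[ℂ] K)) (T : H →L[ℂ] K), C ∈ F → ‖T‖ ≤ 1 →
      (∀ v w, Tendsto (fun S : H →L[ℂ] K => ⟪v, S w⟫_ℂ) F (𝓝 ⟪v, T w⟫_ℂ)) → T ∈ C) (v₀ : K) (w₀ : H) :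
    ∃ T ∈ C, (∀ S ∈ C, (⟪v₀, S w₀⟫_ℂ).re ≤ (⟪v₀, T w₀⟫_ℂ).re) ∧
      ∀ d, T + d ∈ C → T - d ∈ C → d = 0 := by
  classical
  have hcomp : IsCompact (coeffs '' C) := by
    refine isCompact_iff_ultrafilter_le_nhds.2 fun G hG => ?_
    have hG' : coeffs '' C ∈ G := le_principal_iff.1 hG
    let F := Ultrafilter.ofComapInfPrincipal hG'
    have hF : C ∈ F := Ultrafilter.ofComapInfPrincipal_mem hG'
    have hFG : F.map coeffs = G := Ultrafilter.ofComapInfPrincipal_eq_of_map hG'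
    obtain ⟨T, hT1, hT⟩ := exists_weak_limit F (fun S => if S ∈ C then S else 0) 1 fun S => by
      split_ifs with h
      · exact hbd S h
      · simp
    have hT' : ∀ v w, Tendsto (fun S : H →L[ℂ] K => ⟪v, S w⟫_ℂ) F (𝓝 ⟪v, T w⟫_ℂ) := by
      intro v w
      refine (hT v w).congr' ?_
      filter_upwards [hF] with S hS
      rw [if_pos hS]
    refine ⟨coeffs T, ⟨T, hcl F T hF hT1 hT', rfl⟩, ?_⟩
    rw [← hFG, Ultrafilter.coe_map]
    exact tendsto_pi_nhds.2 fun vw => hT' vw.1 vw.2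
  let φ : (K × H → ℂ) → ℝ := fun g => (g (v₀, w₀)).re
  have hφ : Continuous φ := Complex.continuous_re.comp (continuous_apply _)
  obtain ⟨g₀, hg₀, hmax⟩ := hcomp.exists_isMaxOn (hne.image _) hφ.continuousOn
  have hface : IsCompact (coeffs '' C ∩ {g | φ g = φ g₀}) :=
    hcomp.inter_right (isClosed_eq hφ continuous_const)
  obtain ⟨g, hg⟩ := hface.extremePoints_nonempty ⟨g₀, hg₀, rfl⟩
  obtain ⟨⟨⟨T, hT, rfl⟩, hgφ⟩, hext⟩ := hg
  refine ⟨T, hT, fun S hS => ?_, fun d h1 h2 => ?_⟩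
  · exact (hmax ⟨S, hS, rfl⟩).trans_eq hgφ.symm
  · have e1 : φ (coeffs (T + d)) ≤ φ g₀ := hmax ⟨_, h1, rfl⟩
    have e2 : φ (coeffs (T - d)) ≤ φ g₀ := hmax ⟨_, h2, rfl⟩
    have e3 : φ (coeffs (T + d)) + φ (coeffs (T - d)) = 2 * φ (coeffs T) := by
      simp only [φ, coeffs_apply, add_apply, sub_apply, inner_add_right, inner_sub_right,
        Complex.add_re, Complex.sub_re]
      ring
    have e4 : φ (coeffs T) = φ g₀ := hgφ
    have := hext ⟨⟨_, h1, rfl⟩, by rw [Set.mem_ofPred_eq]; linarith⟩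
      ⟨⟨_, h2, rfl⟩, by rw [Set.mem_ofPred_eq]; linarith⟩ ⟨1 / 2, 1 / 2, by norm_num, by norm_num, by norm_num, by
        rw [← map_smul, ← map_smul, ← map_add, ← smul_add, add_add_sub_cancel, ← two_smul ℝ T,
          smul_smul]
        norm_num⟩
    have := coeffs_injective this
    simpa using this

end Extreme

section Projection

variable {H : Type*} [NormedAddCommGroup H] [InnerProductSpace ℂ H] [CompleteSpace H]

lemma commute_starProjection (W : Submodule ℂ H) [W.HasOrthogonalProjection] {T : H →L[ℂ] H}
    (h : ∀ v ∈ W, T v ∈ W) (h' : ∀ v ∈ W, (star T) v ∈ W) : Commute W.starProjection T := by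
  refine ContinuousLinearMap.ext fun v => ?_
  rw [mul_apply_eq_comp, mul_apply_eq_comp]
  refine Submodule.eq_starProjection_of_mem_orthogonal (h _ (W.starProjection_apply_mem v)) ?_
  intro w hw
  rw [← map_sub, ← inner_star_left]
  exact Submodule.sub_starProjection_mem_orthogonal v _ (h' w hw)

end Projection

section Spectral

variable {H : Type*} [NormedAddCommGroup H] [InnerProductSpace ℂ H] [CompleteSpace H]

lemma spectrum_mem_Icc {x : H →L[ℂ] H} (h0 : 0 ≤ x) (h1 : x ≤ 1) :
    ∀ t ∈ spectrum ℝ x, 0 ≤ t ∧ t ≤ 1 := by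
  have hs : IsSelfAdjoint x := IsSelfAdjoint.of_nonneg h0
  intro t ht
  refine ⟨spectrum_nonneg_of_nonneg h0 ht, ?_⟩
  rw [← cfc_id ℝ x] at h1
  exact (cfc_le_one_iff id x).1 h1 t ht

lemma re_inner_starProjection_split {x : H →L[ℂ] H} (W : Submodule ℂ H)
    [W.HasOrthogonalProjection] (hx : Commute W.starProjection x) (v : H) :
    (⟪v, x v⟫_ℂ).re = (⟪W.starProjection v, x (W.starProjection v)⟫_ℂ).re +
      (⟪v - W.starProjection v, x (v - W.starProjection v)⟫_ℂ).re := by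
  have hq : x (W.starProjection v) = W.starProjection (x v) := congrArg (fun T => T v) hx.eq.symm
  have h1 : ⟪v - W.starProjection v, x (W.starProjection v)⟫_ℂ = 0 := by
    rw [hq]
    exact inner_eq_zero_symm.1
      (Submodule.sub_starProjection_mem_orthogonal v _ (W.starProjection_apply_mem _))
  have h2 : ⟪W.starProjection v, x (v - W.starProjection v)⟫_ℂ = 0 := by
    rw [map_sub, hq]
    exact Submodule.sub_starProjection_mem_orthogonal (x v) _ (W.starProjection_apply_mem _)
  nth_rw 1 2 [← sub_add_cancel v (W.starProjection v)]
  rw [map_add, inner_add_left, inner_add_right, inner_add_right, h1, h2]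
  simp only [Complex.add_re, Complex.zero_re]
  ring

/-- The spectral projection of `0 ≤ x ≤ 1` for the interval `(1 - 1/m, 1]`. -/
theorem exists_spectral_projection {x : H →L[ℂ] H} (h0 : 0 ≤ x) (h1 : x ≤ 1) {m : ℝ}
    (hm : 1 ≤ m) :
    ∃ q : H →L[ℂ] H, IsSelfAdjoint q ∧ q * q = q ∧
      (∀ T, Commute x T → Commute x (star T) → Commute q T) ∧
      (∀ v, (1 - 1 / m) * ‖q v‖ ^ 2 ≤ (⟪v, x v⟫_ℂ).re) ∧
      ∀ v, ‖x (v - q v)‖ ^ 2 ≤ m * (⟪v, (x - x * x) v⟫_ℂ).re := by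
  have hs : IsSelfAdjoint x := IsSelfAdjoint.of_nonneg h0
  have hspec := spectrum_mem_Icc h0 h1
  set s : ℝ := 1 - 1 / m with hs_def
  set g := cfc (fun t : ℝ => max (t - s) 0) x with hg
  have hgs : IsSelfAdjoint g := cfc_predicate _ x
  set W : Submodule ℂ H := (LinearMap.range (g : H →ₗ[ℂ] H)).topologicalClosure with hW
  have : CompleteSpace W := (Submodule.isClosed_topologicalClosure _).completeSpace_coe
  have hgW : ∀ v, g v ∈ W := fun v => Submodule.le_topologicalClosure _ ⟨v, rfl⟩
  have hmap : ∀ T, Commute x T → ∀ v ∈ W, T v ∈ W := by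
    intro T hT v hv
    have hgT : Commute g T := hT.cfc_real _
    refine closure_minimal (s := (LinearMap.range (g : H →ₗ[ℂ] H) : Set H))
      (t := T ⁻¹' (W : Set H)) ?_
      ((Submodule.isClosed_topologicalClosure _).preimage T.continuous) hv
    rintro _ ⟨w, rfl⟩
    have : T (g w) = g (T w) := congrArg (fun S => S w) hgT.eq.symm
    change T (g w) ∈ W
    rw [this]
    exact hgW _
  have hcomm : ∀ T, Commute x T → Commute x (star T) → Commute W.starProjection T :=
    fun T hT hT' => commute_starProjection W (hmap T hT) (hmap _ hT')
  have hqx : Commute W.starProjection x := hcomm x (Commute.refl x) (by rw [hs.star_eq])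
  have hlow : ∀ w ∈ W, s * ‖w‖ ^ 2 ≤ (⟪w, x w⟫_ℂ).re := by
    have hcl : IsClosed {w : H | s * ‖w‖ ^ 2 ≤ (⟪w, x w⟫_ℂ).re} :=
      isClosed_le (by fun_prop)
        (Complex.continuous_re.comp (continuous_id.inner x.continuous))
    refine fun w hw => closure_minimal (s := (LinearMap.range (g : H →ₗ[ℂ] H) : Set H))
      (fun w hw => ?_) hcl hw
    obtain ⟨v, rfl⟩ := hw
    have hpos : 0 ≤ g * (x * g) - s • (g * g) := by
      have e : g * (x * g) - s • (g * g) =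
          cfc (fun t : ℝ => max (t - s) 0 * (t * max (t - s) 0) -
            s * (max (t - s) 0 * max (t - s) 0)) x := by
        rw [cfc_sub _ _ x (by fun_prop) (by fun_prop), cfc_mul _ _ x (by fun_prop) (by fun_prop),
          cfc_mul (fun t : ℝ => t) _ x (by fun_prop) (by fun_prop), cfc_id' ℝ x,
          cfc_const_mul s _ x (by fun_prop), cfc_mul _ _ x (by fun_prop) (by fun_prop)]
      rw [e]
      refine cfc_nonneg fun t _ => ?_
      have : max (t - s) 0 * (t * max (t - s) 0) - s * (max (t - s) 0 * max (t - s) 0) =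
        max (t - s) 0 * max (t - s) 0 * (t - s) := by ring
      rw [this]
      rcases le_total s t with h | h
      · exact mul_nonneg (mul_self_nonneg _) (sub_nonneg.2 h)
      · rw [max_eq_right (sub_nonpos.2 h)]
        simp
    have := re_inner_nonneg hpos v
    rw [sub_apply, mul_apply_eq_comp, mul_apply_eq_comp, smul_apply, mul_apply_eq_comp,
      inner_sub_right, ← Complex.coe_smul, inner_smul_right, ← IsSelfAdjoint.inner_right hgs,
      ← IsSelfAdjoint.inner_right hgs, Complex.sub_re, Complex.re_ofReal_mul,
      re_inner_self_eq] at this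
    change s * ‖g v‖ ^ 2 ≤ (⟪g v, x (g v)⟫_ℂ).re
    linarith
  have hker : ∀ v, (⟪v - W.starProjection v, x (v - W.starProjection v)⟫_ℂ).re ≤
      m * (⟪v - W.starProjection v, (x - x * x) (v - W.starProjection v)⟫_ℂ).re := by
    intro v
    set w := v - W.starProjection v
    have hgw : g w = 0 := by
      refine ext_inner_left ℂ fun u => ?_
      rw [← IsSelfAdjoint.inner_right hgs, inner_zero_right]
      exact Submodule.sub_starProjection_mem_orthogonal v _ (hgW u)
    have hpos : x - m • (x - x * x) ≤ m • g := by
      have e : x - m • (x - x * x) = cfc (fun t : ℝ => t - m * (t - t * t)) x := by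
        rw [cfc_sub _ _ x (by fun_prop) (by fun_prop), cfc_const_mul m _ x (by fun_prop),
          cfc_sub _ _ x (by fun_prop) (by fun_prop), cfc_mul _ _ x (by fun_prop) (by fun_prop),
          cfc_id' ℝ x]
      rw [e, hg, ← cfc_const_mul m _ x (by fun_prop)]
      refine cfc_mono (fun t ht => ?_) (by fun_prop) (by fun_prop)
      obtain ⟨ht0, ht1⟩ := hspec t ht
      have e2 : t - m * (t - t * t) = t * (m * (t - s)) := by
        rw [hs_def]
        field_simp
        ring
      rw [e2]
      rcases le_total s t with h | h
      · rw [max_eq_left (sub_nonneg.2 h)]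
        exact mul_le_of_le_one_left (mul_nonneg (by linarith) (sub_nonneg.2 h)) ht1
      · rw [max_eq_right (sub_nonpos.2 h), mul_zero]
        exact mul_nonpos_of_nonneg_of_nonpos ht0
          (mul_nonpos_of_nonneg_of_nonpos (by linarith) (sub_nonpos.2 h))
    have h3 := re_inner_mono hpos w
    rw [smul_apply, hgw, smul_zero, inner_zero_right, sub_apply, smul_apply, inner_sub_right,
      ← Complex.coe_smul, inner_smul_right, Complex.sub_re, Complex.re_ofReal_mul,
      Complex.zero_re] at h3
    linarith
  have hxx : 0 ≤ x - x * x := by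
    have e : x - x * x = cfc (fun t : ℝ => t - t * t) x := by
      rw [cfc_sub _ _ x (by fun_prop) (by fun_prop), cfc_mul _ _ x (by fun_prop) (by fun_prop),
          cfc_id' ℝ x]
    rw [e]
    refine cfc_nonneg fun t ht => ?_
    obtain ⟨ht0, ht1⟩ := hspec t ht
    nlinarith
  have hqxx : Commute W.starProjection (x - x * x) := hqx.sub_right (hqx.mul_right hqx)
  refine ⟨W.starProjection, isSelfAdjoint_starProjection W,
    W.isIdempotentElem_starProjection, hcomm, fun v => ?_, fun v => ?_⟩
  · rw [re_inner_starProjection_split W hqx v]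
    have := hlow _ (W.starProjection_apply_mem v)
    have := re_inner_nonneg h0 (v - W.starProjection v)
    linarith
  · rw [re_inner_starProjection_split W hqxx v, mul_add]
    have h4 := norm_sq_le_re_inner h0 h1 (v - W.starProjection v)
    have h5 := hker v
    have h6 := mul_nonneg (zero_le_one.trans hm) (re_inner_nonneg hxx (W.starProjection v))
    linarith

end Spectral

section Column

variable {H : Type*} [NormedAddCommGroup H] [InnerProductSpace ℂ H] [CompleteSpace H]
  {ι : Type*} [Fintype ι] [DecidableEq ι]

/-- The column operator with given entries. -/
noncomputable def col (y : ι → H →L[ℂ] H) : H →L[ℂ] Amp ι H := ∑ a, (emb a).comp (y a)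

lemma col_apply (y : ι → H →L[ℂ] H) (v : H) (a : ι) : col y v a = y a v := by
  simp only [col, sum_apply, ContinuousLinearMap.comp_apply, WithLp.ofLp_sum, Finset.sum_apply,
    emb_apply]
  simp

lemma norm_sq_amp_apply (v : Amp ι H) : ‖v‖ ^ 2 = ∑ a, ‖v a‖ ^ 2 :=
  PiLp.norm_sq_eq_of_L2 _ _

lemma norm_col_le {y : ι → H →L[ℂ] H} (hy : ∀ v, ∑ a, ‖y a v‖ ^ 2 ≤ ‖v‖ ^ 2) : ‖col y‖ ≤ 1 := by
  refine ContinuousLinearMap.opNorm_le_bound _ zero_le_one fun v => ?_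
  rw [one_mul]
  refine le_of_sq_le_sq ?_ (norm_nonneg _)
  rw [norm_sq_amp_apply]
  simp_rw [col_apply]
  exact hy v

/-- Among the contractive columns over a von Neumann algebra with prescribed left supports, a
linear functional is maximized at an extreme point. -/
theorem exists_extreme_column (N : VonNeumannAlgebra H) {d : ι → H →L[ℂ] H}
    (hd : ∀ a, IsSelfAdjoint (d a)) (v₀ : ι → H) (w₀ : H) :
    ∃ u : ι → H →L[ℂ] H, (∀ a, u a ∈ N) ∧ (∀ a, d a * u a = u a) ∧
      (∀ v, ∑ a, ‖u a v‖ ^ 2 ≤ ‖v‖ ^ 2) ∧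
      (∀ y : ι → H →L[ℂ] H, (∀ a, y a ∈ N) → (∀ a, d a * y a = y a) →
        (∀ v, ∑ a, ‖y a v‖ ^ 2 ≤ ‖v‖ ^ 2) →
        ∑ a, (⟪v₀ a, y a w₀⟫_ℂ).re ≤ ∑ a, (⟪v₀ a, u a w₀⟫_ℂ).re) ∧
      ∀ w : ι → H →L[ℂ] H, (∀ a, w a ∈ N) → (∀ a, d a * w a = w a) →
        (∀ v, ∑ a, ‖u a v + w a v‖ ^ 2 ≤ ‖v‖ ^ 2) →
        (∀ v, ∑ a, ‖u a v - w a v‖ ^ 2 ≤ ‖v‖ ^ 2) → ∀ a, w a = 0 := by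
  let C : Set (H →L[ℂ] Amp ι H) := {U | ‖U‖ ≤ 1 ∧
    (∀ y ∈ N.commutant, ∀ v a, U (y v) a = y (U v a)) ∧ ∀ v a, d a (U v a) = U v a}
  have hcol : ∀ y : ι → H →L[ℂ] H, (∀ a, y a ∈ N) → (∀ a, d a * y a = y a) →
      (∀ v, ∑ a, ‖y a v‖ ^ 2 ≤ ‖v‖ ^ 2) → col y ∈ C := by
    intro y hy hdy hv
    refine ⟨norm_col_le hv, fun z hz v a => ?_, fun v a => ?_⟩
    · rw [col_apply, col_apply]
      exact congrArg (fun T : H →L[ℂ] H => T v) (commute_of_mem (hy a) hz).eq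
    · rw [col_apply]
      exact congrArg (fun T : H →L[ℂ] H => T v) (hdy a)
  obtain ⟨U, hU, hmax, hext⟩ := exists_extreme_maximizer (C := C) (fun T hT => hT.1)
    ⟨_, hcol 0 (fun a => zero_mem _) (fun a => mul_zero _) fun v => by simp⟩ (fun F T hF hT hlim => by
      refine ⟨hT, fun y hy v a => ?_, fun v a => ?_⟩
      · refine ext_inner_left ℂ fun w => ?_
        rw [← inner_star_left, ← inner_emb_left, ← inner_emb_left]
        refine tendsto_nhds_unique (hlim _ _) ((hlim _ _).congr' ?_)
        filter_upwards [hF] with S hS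
        rw [inner_emb_left, inner_emb_left, hS.2.1 y hy, inner_star_left]
      · refine ext_inner_left ℂ fun w => ?_
        rw [← IsSelfAdjoint.inner_right (hd a), ← inner_emb_left, ← inner_emb_left]
        refine tendsto_nhds_unique (hlim _ _) ((hlim _ _).congr' ?_)
        filter_upwards [hF] with S hS
        rw [inner_emb_left, inner_emb_left, IsSelfAdjoint.inner_right (hd a), hS.2.2])
    (∑ a, emb a (v₀ a)) w₀
  have hval : ∀ S : H →L[ℂ] Amp ι H, (⟪∑ a, emb a (v₀ a), S w₀⟫_ℂ).re =
      ∑ a, (⟪v₀ a, S w₀ a⟫_ℂ).re := by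
    intro S
    rw [sum_inner, Complex.re_sum]
    simp_rw [inner_emb_left]
  have hUa : ∀ v a, ((prj a).comp U) v = U v a := fun v a => rfl
  have hUN : ∀ a, (prj a).comp U ∈ N := fun a => mem_of_commute N fun y hy =>
    ContinuousLinearMap.ext fun v => hU.2.1 y hy v a
  have hUd : ∀ a, d a * (prj a).comp U = (prj a).comp U := fun a =>
    ContinuousLinearMap.ext fun v => hU.2.2 v a
  have hUc : U = col fun a => (prj a).comp U := by
    ext v a
    rw [col_apply, hUa]
  refine ⟨fun a => (prj a).comp U, hUN, hUd, fun v => ?_, fun y hy hdy hyv => ?_,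
    fun w hw hdw h1 h2 a => ?_⟩
  · simp_rw [hUa]
    rw [← norm_sq_amp_apply]
    exact pow_le_pow_left₀ (norm_nonneg _) ((U.le_opNorm v).trans
      (mul_le_of_le_one_left (norm_nonneg _) hU.1)) 2
  · have := hmax _ (hcol y hy hdy hyv)
    rw [hval, hval] at this
    simpa only [col_apply, hUa] using this
  · have hadd : U + col w = col fun a => (prj a).comp U + w a := by
      ext v a
      rw [col_apply, add_apply, add_apply, PiLp.add_apply, col_apply, hUa]
    have hsub : U - col w = col fun a => (prj a).comp U - w a := by
      ext v a
      rw [col_apply, sub_apply, sub_apply, PiLp.sub_apply, col_apply, hUa]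
    have h0 := hext (col w)
      (hadd ▸ hcol _ (fun a => add_mem (hUN a) (hw a)) (fun a => by rw [mul_add, hUd, hdw]) h1)
      (hsub ▸ hcol _ (fun a => sub_mem (hUN a) (hw a)) (fun a => by rw [mul_sub, hUd, hdw]) h2)
    ext v
    rw [← col_apply w, h0]
    rfl

/-- The largest central-type support: the projection onto the closed span of the orbit of a range
under a von Neumann algebra. -/
lemma exists_central_support (N : VonNeumannAlgebra H) {f : H →L[ℂ] H} (hf : f ∈ N)
    {E : Set (H →L[ℂ] H)} (hE : ∀ e ∈ E, ∀ n ∈ N, e * n * f = 0) :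
    ∃ z ∈ N, IsSelfAdjoint z ∧ z * z = z ∧ (∀ n ∈ N, Commute z n) ∧ z * f = f ∧
      ∀ e ∈ E, e * z = 0 := by
  set S : Set H := {w | ∃ n ∈ N, ∃ v, w = n (f v)} with hS
  set W : Submodule ℂ H := (Submodule.span ℂ S).topologicalClosure with hW
  have : CompleteSpace W := (Submodule.isClosed_topologicalClosure _).completeSpace_coe
  have hmin : ∀ (X : Submodule ℂ H), IsClosed (X : Set H) → S ⊆ X → W ≤ X := fun X hX h =>
    Submodule.topologicalClosure_minimal _ (Submodule.span_le.2 h) hX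
  have hSW : ∀ n ∈ N, ∀ v, n (f v) ∈ W := fun n hn v =>
    Submodule.le_topologicalClosure _ (Submodule.subset_span ⟨n, hn, v, rfl⟩)
  have hmap : ∀ T : H →L[ℂ] H, (∀ n ∈ N, ∀ v, T (n (f v)) ∈ W) → ∀ w ∈ W, T w ∈ W := by
    intro T hT w hw
    refine hmin (W.comap (T : H →ₗ[ℂ] H))
      ((Submodule.isClosed_topologicalClosure _).preimage T.continuous) ?_ hw
    rintro _ ⟨n, hn, v, rfl⟩
    exact hT n hn v
  have hN : ∀ T ∈ N, ∀ w ∈ W, T w ∈ W := fun T hT => hmap T fun n hn v =>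
    hSW (T * n) (mul_mem hT hn) v
  have hN' : ∀ T ∈ N.commutant, ∀ w ∈ W, T w ∈ W := fun T hT => hmap T fun n hn v => by
    have h1 : T (n (f v)) = n (f (T v)) :=
      congrArg (fun S : H →L[ℂ] H => S v) (commute_of_mem (mul_mem hn hf) hT).eq.symm
    rw [h1]
    exact hSW n hn _
  refine ⟨W.starProjection, mem_of_commute N fun y hy => commute_starProjection W (hN' y hy)
    (hN' _ (star_mem hy)), isSelfAdjoint_starProjection W, W.isIdempotentElem_starProjection,
    fun n hn => commute_starProjection W (hN n hn) (hN _ (star_mem hn)), ?_, fun e he => ?_⟩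
  · ext v
    exact Submodule.starProjection_eq_self_iff.2 (hSW 1 (one_mem _) v)
  · ext v
    have : W ≤ LinearMap.ker (e : H →ₗ[ℂ] H) := by
      refine hmin _ (ContinuousLinearMap.isClosed_ker e) ?_
      rintro _ ⟨n, hn, v, rfl⟩
      exact congrArg (fun S : H →L[ℂ] H => S v) (hE e he n hn)
    exact this (W.starProjection_apply_mem v)

end Column

section Coisometry

variable {H : Type*} [NormedAddCommGroup H] [InnerProductSpace ℂ H] [CompleteSpace H]
  {ι : Type*} [Fintype ι] [DecidableEq ι]

lemma sum_norm_sq_apply (u : ι → H →L[ℂ] H) (v : H) :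
    ∑ a, ‖u a v‖ ^ 2 = (⟪v, (∑ a, star (u a) * u a) v⟫_ℂ).re := by
  rw [sum_apply, inner_sum, Complex.re_sum]
  refine Finset.sum_congr rfl fun a _ => ?_
  rw [mul_apply_eq_comp, inner_star_right, re_inner_self_eq]

lemma extreme_column_mul_eq_zero {N : VonNeumannAlgebra H} {d u : ι → H →L[ℂ] H}
    (hu : ∀ a, u a ∈ N) (hdu : ∀ a, d a * u a = u a)
    (hu1 : ∀ v, ∑ a, ‖u a v‖ ^ 2 ≤ ‖v‖ ^ 2)
    (hext : ∀ w : ι → H →L[ℂ] H, (∀ a, w a ∈ N) → (∀ a, d a * w a = w a) →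
        (∀ v, ∑ a, ‖u a v + w a v‖ ^ 2 ≤ ‖v‖ ^ 2) →
        (∀ v, ∑ a, ‖u a v - w a v‖ ^ 2 ≤ ‖v‖ ^ 2) → ∀ a, w a = 0) (a : ι) :
    u a * (1 - ∑ b, star (u b) * u b) = 0 := by
  set t := ∑ b, star (u b) * u b with ht
  have htN : t ∈ N := sum_mem fun b _ => mul_mem (star_mem (hu b)) (hu b)
  have ht0 : 0 ≤ t := Finset.sum_nonneg fun b _ => star_mul_self_nonneg _
  have hts : IsSelfAdjoint t := IsSelfAdjoint.of_nonneg ht0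
  have ht1 : t ≤ 1 := by
    rw [← sub_nonneg]
    refine nonneg_of_inner (fun v => ?_)
      (fun v => im_inner_eq_zero ((IsSelfAdjoint.one _).sub hts) v)
    rw [sub_apply, inner_sub_right, Complex.sub_re, one_apply_eq_self, re_inner_self_eq,
      ← sum_norm_sq_apply, sub_nonneg]
    exact hu1 v
  have hspec := spectrum_mem_Icc ht0 ht1
  have key : ∀ c : ℝ, |c| ≤ 1 / 2 → ∀ v,
      ∑ b, ‖u b ((1 + c • (1 - t)) v)‖ ^ 2 ≤ ‖v‖ ^ 2 := by
    intro c hc v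
    set g := 1 + c • (1 - t) with hg
    have hgc : g = cfc (fun s : ℝ => 1 + c * (1 - s)) t := by
      rw [cfc_add t (fun _ => (1 : ℝ)) _ (by fun_prop) (by fun_prop),
        cfc_const_mul c _ t (by fun_prop), cfc_sub _ _ t (by fun_prop) (by fun_prop),
        cfc_const_one ℝ t, cfc_id' ℝ t]
    have hgs : IsSelfAdjoint g := hgc ▸ cfc_predicate _ t
    have hle : g * (t * g) ≤ 1 := by
      have e : g * (t * g) =
          cfc (fun s : ℝ => (1 + c * (1 - s)) * (s * (1 + c * (1 - s)))) t := by
        rw [cfc_mul _ _ t (by fun_prop) (by fun_prop),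
          cfc_mul (fun s : ℝ => s) _ t (by fun_prop) (by fun_prop), cfc_id' ℝ t, ← hgc]
      rw [e, cfc_le_one_iff _ t]
      intro s hs
      obtain ⟨hs0, hs1⟩ := hspec s hs
      obtain ⟨hc1, hc2⟩ := abs_le.1 hc
      have e2 : (1 + c * (1 - s)) * (s * (1 + c * (1 - s))) =
        1 - (1 - s) * (1 - s * (2 * c + c ^ 2 * (1 - s))) := by ring
      rw [e2, sub_le_self_iff]
      refine mul_nonneg (sub_nonneg.2 hs1) ?_
      have h1 : s * (2 * c) ≤ s := by nlinarith
      have h2 : s * (c ^ 2 * (1 - s)) ≤ 1 * (1 - s) := by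
        rw [← mul_assoc]
        refine mul_le_mul_of_nonneg_right ?_ (sub_nonneg.2 hs1)
        nlinarith [sq_nonneg c]
      linarith
    rw [sum_norm_sq_apply, IsSelfAdjoint.inner_right hgs, ← re_inner_self_eq]
    exact re_inner_mono hle v
  have h1t : (1 - t) ∈ N := sub_mem (one_mem _) htN
  have := hext (fun b => (1 / 2 : ℝ) • (u b * (1 - t)))
    (fun b => real_smul_mem N _ (mul_mem (hu b) h1t))
    (fun b => by rw [mul_smul_comm, ← mul_assoc, hdu])
    (fun v => by
      refine (Finset.sum_congr rfl fun b _ => ?_).trans_le (key (1 / 2) (by norm_num) v)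
      rw [add_apply, smul_apply, smul_apply, one_apply_eq_self, map_add, mul_apply_eq_comp,
        ← Complex.coe_smul, ← Complex.coe_smul, map_smul])
    (fun v => by
      refine (Finset.sum_congr rfl fun b _ => ?_).trans_le (key (-(1 / 2)) (by norm_num) v)
      rw [add_apply, smul_apply, smul_apply, one_apply_eq_self, map_add, mul_apply_eq_comp,
        neg_smul, map_neg, ← sub_eq_add_neg, ← Complex.coe_smul, ← Complex.coe_smul, map_smul]) a
  exact (smul_eq_zero.1 this).resolve_left (by norm_num)

lemma extreme_column_corner {N : VonNeumannAlgebra H} {d u : ι → H →L[ℂ] H}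
    (hdN : ∀ a, d a ∈ N) (hd : ∀ a, IsSelfAdjoint (d a)) (hdd : ∀ a, d a * d a = d a)
    (hu : ∀ a, u a ∈ N) (hdu : ∀ a, d a * u a = u a)
    (hut : ∀ a, u a * (1 - ∑ b, star (u b) * u b) = 0)
    (hext : ∀ w : ι → H →L[ℂ] H, (∀ a, w a ∈ N) → (∀ a, d a * w a = w a) →
        (∀ v, ∑ a, ‖u a v + w a v‖ ^ 2 ≤ ‖v‖ ^ 2) →
        (∀ v, ∑ a, ‖u a v - w a v‖ ^ 2 ≤ ‖v‖ ^ 2) → ∀ a, w a = 0) (a b : ι)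
    {n : H →L[ℂ] H} (hn : n ∈ N) :
    ((if a = b then d a else 0) - u a * star (u b)) * n *
      (1 - ∑ b, star (u b) * u b) = 0 := by
  set t := ∑ b, star (u b) * u b with ht
  have htN : t ∈ N := sum_mem fun b _ => mul_mem (star_mem (hu b)) (hu b)
  have hts : IsSelfAdjoint t := IsSelfAdjoint.of_nonneg
    (Finset.sum_nonneg fun b _ => star_mul_self_nonneg _)
  have hut' : ∀ a, u a * t = u a := fun a => by
    have := hut a
    rw [mul_sub, mul_one, sub_eq_zero] at this
    exact this.symm
  have htt : t * t = t := by
    have h : (∑ b, star (u b) * u b) * t = ∑ b, star (u b) * u b := by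
      rw [Finset.sum_mul]
      exact Finset.sum_congr rfl fun b _ => by rw [mul_assoc, hut']
    exact h
  have htu : ∀ a, t * star (u a) = star (u a) := fun a => by
    rw [← hts.star_eq, ← star_mul, hut']
  set f := 1 - t with hf
  have hff : f * f = f := by
    rw [hf, mul_sub, sub_mul, sub_mul, htt]
    simp
  have htf : t * f = 0 := by rw [hf, mul_sub, htt, mul_one, sub_self]
  have hfs : IsSelfAdjoint f := (IsSelfAdjoint.one _).sub hts
  have hfN : f ∈ N := sub_mem (one_mem _) htN
  set w : ι → H →L[ℂ] H := fun a =>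
    ((if a = b then d a else 0) - u a * star (u b)) * n * f with hw
  have hwN : ∀ a, w a ∈ N := fun a => by
    refine mul_mem (mul_mem (sub_mem ?_ (mul_mem (hu a) (star_mem (hu b)))) hn) hfN
    split_ifs
    exacts [hdN a, zero_mem _]
  have hdw : ∀ a, d a * w a = w a := fun a => by
    have h : d a * ((if a = b then d a else 0) - u a * star (u b)) =
        (if a = b then d a else 0) - u a * star (u b) := by
      rw [mul_sub, ← mul_assoc, hdu, mul_ite, hdd, mul_zero]
    simp only [hw]
    rw [← mul_assoc, ← mul_assoc, h]
  have huw : ∑ a, star (u a) * w a = 0 := by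
    simp only [hw, ← mul_assoc]
    rw [← Finset.sum_mul, ← Finset.sum_mul]
    have : ∑ a, star (u a) * ((if a = b then d a else 0) - u a * star (u b)) = 0 := by
      simp_rw [mul_sub, mul_ite, mul_zero, ← mul_assoc]
      rw [Finset.sum_sub_distrib, ← Finset.sum_mul, ← ht, htu, Finset.sum_ite_eq' Finset.univ b,
        if_pos (Finset.mem_univ b), ← (hd b).star_eq, ← star_mul, hdu, sub_self]
    rw [this, zero_mul, zero_mul]
  have hwf : ∀ a, w a * f = w a := fun a => by simp only [hw, mul_assoc, hff]
  set B : ℝ := ‖col w‖ with hB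
  have hwB : ∀ v, ∑ a, ‖w a v‖ ^ 2 ≤ B ^ 2 * ‖f v‖ ^ 2 := by
    intro v
    have h1 : ∑ a, ‖w a v‖ ^ 2 = ‖col w (f v)‖ ^ 2 := by
      rw [norm_sq_amp_apply]
      refine Finset.sum_congr rfl fun a _ => ?_
      rw [col_apply, ← mul_apply_eq_comp, hwf]
    rw [h1, ← mul_pow]
    exact pow_le_pow_left₀ (norm_nonneg _) ((col w).le_opNorm _) 2
  set c : ℝ := 1 / (B + 1) with hc
  have hB0 : 0 ≤ B := norm_nonneg (col w)
  have hcB : c ^ 2 * B ^ 2 ≤ 1 := by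
    rw [← mul_pow]
    refine pow_le_one₀ (by positivity) ?_
    rw [hc, one_div_mul_eq_div, div_le_one (by linarith)]
    linarith
  have hcpos : c ≠ 0 := by positivity
  have hsplit : ∀ v, ‖v‖ ^ 2 = ∑ a, ‖u a v‖ ^ 2 + ‖f v‖ ^ 2 := by
    intro v
    have h1 : ‖f v‖ ^ 2 = (⟪v, f v⟫_ℂ).re := by
      rw [← re_inner_self_eq, IsSelfAdjoint.inner_right hfs, ← mul_apply_eq_comp, hff]
    rw [sum_norm_sq_apply, ← ht, h1, ← Complex.add_re, ← inner_add_right, ← add_apply, hf,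
      add_sub_cancel, one_apply_eq_self, re_inner_self_eq]
  have horth : ∀ v, ∑ a, (⟪u a v, w a v⟫_ℂ).re = 0 := by
    intro v
    have h1 : ∑ a, (⟪u a v, w a v⟫_ℂ).re = (⟪v, (∑ a, star (u a) * w a) v⟫_ℂ).re := by
      rw [sum_apply, inner_sum, Complex.re_sum]
      refine Finset.sum_congr rfl fun a _ => ?_
      exact congrArg Complex.re (inner_star_right (u a) v (w a v)).symm
    rw [h1, huw, zero_apply, inner_zero_right, Complex.zero_re]
  have hre : ∀ (c : ℝ) (x y : H), (⟪x, c • y⟫_ℂ).re = c * (⟪x, y⟫_ℂ).re := fun c x y => by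
    rw [← Complex.coe_smul, inner_smul_right, Complex.re_ofReal_mul]
  have hnorm : ∀ y : H, ‖c • y‖ ^ 2 = c ^ 2 * ‖y‖ ^ 2 := fun y => by
    rw [norm_smul, mul_pow, Real.norm_eq_abs, sq_abs]
  have hbound : ∀ v, ∑ a, ‖u a v‖ ^ 2 + c ^ 2 * ∑ a, ‖w a v‖ ^ 2 ≤ ‖v‖ ^ 2 := by
    intro v
    rw [hsplit v]
    have h1 := mul_le_mul_of_nonneg_left (hwB v) (sq_nonneg c)
    have h2 := mul_le_mul_of_nonneg_right hcB (sq_nonneg ‖f v‖)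
    nlinarith
  have := hext (fun a => c • w a) (fun a => real_smul_mem N _ (hwN a))
    (fun a => by rw [mul_smul_comm, hdw])
    (fun v => by
      refine le_of_eq_of_le ?_ (hbound v)
      simp_rw [smul_apply, norm_add_sq_re, hre, hnorm]
      rw [Finset.sum_add_distrib, Finset.sum_add_distrib, ← Finset.mul_sum, ← Finset.mul_sum,
        ← Finset.mul_sum, horth]
      ring)
    (fun v => by
      refine le_of_eq_of_le ?_ (hbound v)
      simp_rw [smul_apply, norm_sub_sq_re, hre, hnorm]
      rw [Finset.sum_add_distrib, Finset.sum_sub_distrib, ← Finset.mul_sum, ← Finset.mul_sum,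
        ← Finset.mul_sum, horth]
      ring) a
  exact (smul_eq_zero.1 this).resolve_left hcpos

/-- In a finite von Neumann algebra a column of projections of total trace at most one is the
range of a contractive column, which can be chosen to dominate a linear functional. -/
theorem exists_coisometry {N : VonNeumannAlgebra H} {ξ : H} (hN : IsTracial N ξ)
    {d : ι → H →L[ℂ] H} (hdN : ∀ a, d a ∈ N) (hd : ∀ a, IsSelfAdjoint (d a))
    (hdd : ∀ a, d a * d a = d a)
    (hsize : ∀ z ∈ N, IsSelfAdjoint z → z * z = z → (∀ n ∈ N, Commute z n) →
      ∑ a, (⟪ξ, (d a * z) ξ⟫_ℂ).re ≤ (⟪ξ, z ξ⟫_ℂ).re) (v₀ : ι → H) (w₀ : H) :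
    ∃ u : ι → H →L[ℂ] H, (∀ a, u a ∈ N) ∧ (∀ a, d a * u a = u a) ∧
      (∀ v, ∑ a, ‖u a v‖ ^ 2 ≤ ‖v‖ ^ 2) ∧
      (∀ a b, u a * star (u b) = if a = b then d a else 0) ∧
      (∀ y : ι → H →L[ℂ] H, (∀ a, y a ∈ N) → (∀ a, d a * y a = y a) →
        (∀ v, ∑ a, ‖y a v‖ ^ 2 ≤ ‖v‖ ^ 2) →
        ∑ a, (⟪v₀ a, y a w₀⟫_ℂ).re ≤ ∑ a, (⟪v₀ a, u a w₀⟫_ℂ).re) := by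
  obtain ⟨u, hu, hdu, hu1, hmax, hext⟩ := exists_extreme_column N hd v₀ w₀
  have hut := extreme_column_mul_eq_zero hu hdu hu1 hext
  refine ⟨u, hu, hdu, hu1, ?_, hmax⟩
  have hcorner := fun a b n (hn : n ∈ N) =>
    extreme_column_corner hdN hd hdd hu hdu hut hext a b hn
  set t := ∑ b, star (u b) * u b with ht
  have htN : t ∈ N := sum_mem fun b _ => mul_mem (star_mem (hu b)) (hu b)
  have hts : IsSelfAdjoint t := IsSelfAdjoint.of_nonneg
    (Finset.sum_nonneg fun b _ => star_mul_self_nonneg _)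
  set f := 1 - t with hf
  have hfs : IsSelfAdjoint f := (IsSelfAdjoint.one _).sub hts
  have hfN : f ∈ N := sub_mem (one_mem _) htN
  set E : ι → ι → H →L[ℂ] H := fun a b => (if a = b then d a else 0) - u a * star (u b) with hE
  have hEN : ∀ a b, E a b ∈ N := fun a b => by
    refine sub_mem ?_ (mul_mem (hu a) (star_mem (hu b)))
    split_ifs
    exacts [hdN a, zero_mem _]
  obtain ⟨z, hzN, hzs, hzz, hzc, hzf, hEz⟩ := exists_central_support N hfN
    (E := {e | ∃ a b, e = E a b}) (by
      rintro _ ⟨a, b, rfl⟩ n hn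
      exact hcorner a b n hn)
  have hfz : f * z = f := by rw [← hfs.star_eq, ← hzs.star_eq, ← star_mul, hzf]
  have hEE : ∀ b, ∑ a, star (E a b) * E a b = E b b := by
    intro b
    have h1 : ∀ a, star (E a b) * E a b = (if a = b then d b else 0) -
        (if a = b then u b * star (u b) else 0) - (if a = b then u b * star (u b) else 0) +
        u b * (star (u a) * u a) * star (u b) := by
      intro a
      simp only [hE, star_sub, star_mul, star_star]
      by_cases h : a = b
      · subst h
        simp only [if_true, (hd a).star_eq, sub_mul, mul_sub, hdd]
        have h2 : d a * (u a * star (u a)) = u a * star (u a) := by rw [← mul_assoc, hdu]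
        have h3 : u a * star (u a) * d a = u a * star (u a) := by
          rw [mul_assoc, ← (hd a).star_eq, ← star_mul, hdu]
        rw [h2, h3]
        noncomm_ring
      · simp only [if_neg h, star_zero, zero_sub, sub_zero, neg_mul_neg, zero_add]
        noncomm_ring
    have h4 : u b * t = u b := by
      have := hut b
      rw [hf, mul_sub, mul_one, sub_eq_zero] at this
      exact this.symm
    simp_rw [h1]
    rw [Finset.sum_add_distrib, Finset.sum_sub_distrib, Finset.sum_sub_distrib,
      ← Finset.sum_mul, ← Finset.mul_sum, ← ht, h4]
    simp [hE]
  have hzero : ∑ b, ∑ a, ‖E a b ξ‖ ^ 2 ≤ 0 := by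
    have h1 : ∀ b, ∑ a, ‖E a b ξ‖ ^ 2 = (⟪ξ, (d b * (1 - z)) ξ⟫_ℂ).re -
        (⟪ξ, ((star (u b) * u b) * (1 - z)) ξ⟫_ℂ).re := by
      intro b
      have h2 : E b b = d b * (1 - z) - u b * (star (u b) * (1 - z)) := by
        have : E b b * z = 0 := hEz _ ⟨b, b, rfl⟩
        rw [← mul_assoc, ← sub_mul, mul_sub, mul_one]
        have h3 : d b - u b * star (u b) = E b b := by simp [hE]
        rw [h3, this, sub_zero]
      have h4 : star (u b) * (1 - z) * u b = (star (u b) * u b) * (1 - z) := by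
        rw [mul_assoc, mul_assoc]
        congr 1
        rw [sub_mul, mul_sub, one_mul, mul_one, (hzc _ (hu b)).eq]
      rw [sum_norm_sq_apply, hEE, h2, sub_apply, inner_sub_right, Complex.sub_re,
        hN.trace _ (hu b) _ (mul_mem (star_mem (hu b)) (sub_mem (one_mem _) hzN)), h4]
    simp_rw [h1]
    rw [Finset.sum_sub_distrib, ← Complex.re_sum (f := fun b =>
      ⟪ξ, ((star (u b) * u b) * (1 - z)) ξ⟫_ℂ), ← inner_sum, ← sum_apply, ← Finset.sum_mul, ← ht]
    have h5 : t * (1 - z) = 1 - z := by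
      have : t = 1 - f := by rw [hf, sub_sub_cancel]
      rw [this, sub_mul, one_mul, mul_sub, mul_one, hfz, sub_self, sub_zero]
    rw [h5, sub_nonpos]
    refine hsize _ (sub_mem (one_mem _) hzN) ((IsSelfAdjoint.one _).sub hzs) ?_
      fun n hn => (Commute.one_left n).sub_left (hzc n hn)
    rw [mul_sub, sub_mul, sub_mul, hzz]
    simp
  intro a b
  have h0 : ‖E a b ξ‖ ^ 2 ≤ 0 :=
    ((Finset.single_le_sum (f := fun a => ‖E a b ξ‖ ^ 2) (fun _ _ => sq_nonneg _)
      (Finset.mem_univ a)).trans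
      (Finset.single_le_sum (f := fun b => ∑ a, ‖E a b ξ‖ ^ 2)
        (fun _ _ => Finset.sum_nonneg fun _ _ => sq_nonneg _) (Finset.mem_univ b))).trans hzero
  have h1 : E a b ξ = 0 := by
    have := pow_eq_zero_iff (two_ne_zero) |>.1 (le_antisymm h0 (sq_nonneg _))
    exact norm_eq_zero.1 this
  have h2 : E a b = 0 := by
    refine hN.cyclic'.ext ?_ (zero_mem _) (by rw [h1, zero_apply])
    rw [N.commutant_commutant]
    exact hEN a b
  exact (sub_eq_zero.1 h2).symm

end Coisometry

section VectorState

variable {H : Type*} [NormedAddCommGroup H] [InnerProductSpace ℂ H] [CompleteSpace H]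

/-- The real part of the vector functional of `ξ`. -/
noncomputable def tr (ξ : H) (a : H →L[ℂ] H) : ℝ := (⟪ξ, a ξ⟫_ℂ).re

lemma tr_add (ξ : H) (a b : H →L[ℂ] H) : tr ξ (a + b) = tr ξ a + tr ξ b := by
  rw [tr, add_apply, inner_add_right, Complex.add_re, tr, tr]

lemma tr_sub (ξ : H) (a b : H →L[ℂ] H) : tr ξ (a - b) = tr ξ a - tr ξ b := by
  rw [tr, sub_apply, inner_sub_right, Complex.sub_re, tr, tr]

lemma tr_sum {α : Type*} (s : Finset α) (ξ : H) (a : α → H →L[ℂ] H) :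
    tr ξ (∑ i ∈ s, a i) = ∑ i ∈ s, tr ξ (a i) := by
  rw [tr, sum_apply, inner_sum, Complex.re_sum]
  rfl

lemma tr_zero (ξ : H) : tr ξ 0 = 0 := by simp [tr]

lemma tr_one (ξ : H) : tr ξ 1 = ‖ξ‖ ^ 2 := by
  rw [tr, one_apply_eq_self, re_inner_self_eq]

lemma tr_star_mul (ξ : H) (a b : H →L[ℂ] H) : tr ξ (star a * b) = (⟪a ξ, b ξ⟫_ℂ).re := by
  rw [tr, mul_apply_eq_comp, inner_star_right]

lemma tr_mul (ξ : H) {a : H →L[ℂ] H} (ha : IsSelfAdjoint a) (b : H →L[ℂ] H) :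
    tr ξ (a * b) = (⟪a ξ, b ξ⟫_ℂ).re := by
  rw [← tr_star_mul, ha.star_eq]

lemma tr_mul_self (ξ : H) {a : H →L[ℂ] H} (ha : IsSelfAdjoint a) :
    tr ξ (a * a) = ‖a ξ‖ ^ 2 := by
  rw [tr_mul ξ ha, re_inner_self_eq]

lemma IsTracial.tr_comm {N : VonNeumannAlgebra H} {ξ : H} (hN : IsTracial N ξ)
    {a b : H →L[ℂ] H} (ha : a ∈ N) (hb : b ∈ N) : tr ξ (a * b) = tr ξ (b * a) :=
  congrArg Complex.re (hN.trace a ha b hb)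

/-- The trace of a product of two positive elements is nonnegative. -/
lemma IsTracial.tr_star_mul_mul_nonneg {N : VonNeumannAlgebra H} {ξ : H} (hN : IsTracial N ξ)
    {n x : H →L[ℂ] H} (hn : n ∈ N) (hx : x ∈ N) (h0 : 0 ≤ x) : 0 ≤ tr ξ (star n * n * x) := by
  have h1 : tr ξ (star n * n * x) = (⟪star n ξ, x (star n ξ)⟫_ℂ).re := by
    rw [mul_assoc, hN.tr_comm (star_mem hn) (mul_mem hn hx), mul_assoc, ← star_star n,
      tr_star_mul, star_star]
    rfl
  rw [h1]
  exact re_inner_nonneg h0 _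

lemma IsTracial.tr_proj_mul_nonneg {N : VonNeumannAlgebra H} {ξ : H} (hN : IsTracial N ξ)
    {p x : H →L[ℂ] H} (hp : p ∈ N) (hps : IsSelfAdjoint p) (hpp : p * p = p) (hx : x ∈ N)
    (h0 : 0 ≤ x) : 0 ≤ tr ξ (p * x) := by
  have := hN.tr_star_mul_mul_nonneg hp hx h0
  rwa [hps.star_eq, hpp] at this

lemma norm_proj_le {p : H →L[ℂ] H} (hps : IsSelfAdjoint p) (hpp : p * p = p) (v : H) :
    ‖p v‖ ≤ ‖v‖ := by
  have h1 : ‖p v‖ ^ 2 = (⟪v, p v⟫_ℂ).re := by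
    rw [← re_inner_self_eq, IsSelfAdjoint.inner_right hps, ← mul_apply_eq_comp, hpp]
  have h2 : ‖v - p v‖ ^ 2 = ‖v‖ ^ 2 - ‖p v‖ ^ 2 := by
    rw [norm_sub_sq_re, h1]
    ring
  refine le_of_sq_le_sq ?_ (norm_nonneg _)
  nlinarith [sq_nonneg ‖v - p v‖]

/-- Elements commuting with a system of `m` matrix units have trace uniformly distributed over the
diagonal units. -/
lemma IsTracial.tr_mul_unit {κ : Type*} [Fintype κ] [DecidableEq κ] {N : VonNeumannAlgebra H}
    {ξ : H} (hN : IsTracial N ξ) {F : κ → κ → H →L[ℂ] H} (hF : IsMatrixUnits N F)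
    {c : H →L[ℂ] H} (hc : c ∈ N) (hcF : ∀ i j, Commute c (F i j)) (i : κ) :
    tr ξ (c * (1 - F i i)) = (1 - 1 / Fintype.card κ) * tr ξ c := by
  have : Nonempty κ := ⟨i⟩
  have h1 : ∀ j, tr ξ (c * F j j) = tr ξ (c * F i i) := by
    intro j
    have h2 : F j j = F j i * F i j := by rw [hF.mul_eq, if_pos rfl]
    have h3 : F i i = F i j * F j i := by rw [hF.mul_eq, if_pos rfl]
    rw [h2, ← mul_assoc, hN.tr_comm (mul_mem hc (hF.mem _ _)) (hF.mem _ _), ← mul_assoc,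
      ← (hcF i j).eq, mul_assoc, ← h3]
  have h2 : tr ξ c = Fintype.card κ * tr ξ (c * F i i) := by
    conv_lhs => rw [← mul_one c, ← hF.sum_eq, Finset.mul_sum, tr_sum]
    simp_rw [h1]
    simp
  have h3 : (Fintype.card κ : ℝ) ≠ 0 := Nat.cast_ne_zero.2 Fintype.card_ne_zero
  rw [mul_sub, mul_one, tr_sub, h2]
  field_simp

end VectorState

section Rounding

variable {H : Type*} [NormedAddCommGroup H] [InnerProductSpace ℂ H] [CompleteSpace H]
  {ι κ : Type*} [Fintype ι] [DecidableEq ι] [Fintype κ] [DecidableEq κ]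

/-- A partition of unity into orthogonal projections, given up to completion by a projection. -/
lemma exists_pvm_of_orthogonal [Nonempty ι] {N : VonNeumannAlgebra H} {ξ : H}
    (hN : IsTracial N ξ) {r x : ι → H →L[ℂ] H} (hr : ∀ a, r a ∈ N)
    (hrs : ∀ a, IsSelfAdjoint (r a)) (hrr : ∀ a b, r a * r b = if a = b then r a else 0)
    (hx : ∀ a, x a ∈ N) (hx0 : ∀ a, 0 ≤ x a) :
    ∃ s : ι → H →L[ℂ] H, (∀ a, s a ∈ N) ∧ (∀ a, IsSelfAdjoint (s a)) ∧
      (∀ a, s a * s a = s a) ∧ ∑ a, s a = 1 ∧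
      ∑ a, tr ξ (r a * x a) ≤ ∑ a, tr ξ (s a * x a) := by
  obtain ⟨a₀⟩ := ‹Nonempty ι›
  set t := ∑ a, r a with ht
  have htN : t ∈ N := sum_mem fun a _ => hr a
  have hts : IsSelfAdjoint t := isSelfAdjoint_sum _ fun a _ => hrs a
  have hrt : ∀ a, r a * t = r a := fun a => by
    rw [ht, Finset.mul_sum]
    simp_rw [hrr]
    rw [Finset.sum_ite_eq Finset.univ a, if_pos (Finset.mem_univ a)]
  have htr : ∀ a, t * r a = r a := fun a => by
    rw [← hts.star_eq, ← (hrs a).star_eq, ← star_mul, hrt]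
  have htt : t * t = t := by
    have h : (∑ a, r a) * t = ∑ a, r a := by
      rw [Finset.sum_mul]
      exact Finset.sum_congr rfl fun a _ => hrt a
    exact h
  have hp : (1 - t) * (1 - t) = 1 - t := by
    rw [mul_sub, sub_mul, sub_mul, htt]
    simp
  have hps : IsSelfAdjoint (1 - t) := (IsSelfAdjoint.one _).sub hts
  refine ⟨fun a => r a + if a = a₀ then 1 - t else 0, fun a => add_mem (hr a) ?_, fun a => ?_,
    fun a => ?_, ?_, Finset.sum_le_sum fun a _ => ?_⟩
  · split_ifs
    exacts [sub_mem (one_mem _) htN, zero_mem _]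
  · dsimp only
    split_ifs
    · exact (hrs a).add hps
    · rw [add_zero]
      exact hrs a
  · dsimp only
    split_ifs
    · have h1 : r a * (1 - t) = 0 := by rw [mul_sub, hrt, mul_one, sub_self]
      have h2 : (1 - t) * r a = 0 := by rw [sub_mul, htr, one_mul, sub_self]
      rw [add_mul, mul_add, mul_add, h1, h2, hp, hrr, if_pos rfl, add_zero, zero_add]
    · rw [add_zero, hrr, if_pos rfl]
  · rw [Finset.sum_add_distrib, Finset.sum_ite_eq' Finset.univ a₀, if_pos (Finset.mem_univ a₀),
      ← ht, add_sub_cancel]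
  · rw [add_mul, tr_add, le_add_iff_nonneg_right]
    split_ifs
    · exact hN.tr_proj_mul_nonneg (sub_mem (one_mem _) htN) hps hp (hx a) (hx0 a)
    · rw [zero_mul, tr_zero]

/-- A positive operator-valued measure in the relative commutant of `m × m` matrix units, in a
tracial von Neumann algebra, is close to a projection-valued one. -/
theorem exists_pvm_near [Nonempty ι] [Nonempty κ] {N : VonNeumannAlgebra H} {ξ : H}
    (hN : IsTracial N ξ) {F : κ → κ → H →L[ℂ] H} (hF : IsMatrixUnits N F) {x : ι → H →L[ℂ] H}
    (hx : ∀ a, x a ∈ N) (hx0 : ∀ a, 0 ≤ x a) (hx1 : ∑ a, x a = 1)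
    (hxF : ∀ a i j, Commute (x a) (F i j)) :
    ∃ r : ι → H →L[ℂ] H, (∀ a, r a ∈ N) ∧ (∀ a, IsSelfAdjoint (r a)) ∧
      (∀ a, r a * r a = r a) ∧ ∑ a, r a = 1 ∧
      1 - 1 / Fintype.card κ - 2 * (1 + Fintype.card κ) * (1 - ∑ a, ‖x a ξ‖ ^ 2) ≤
        ∑ a, tr ξ (r a * x a) := by
  obtain ⟨i₀⟩ := ‹Nonempty κ›
  have : Nonempty κ := ⟨i₀⟩
  set m : ℝ := (Fintype.card κ : ℝ) with hm
  have hm1 : 1 ≤ m := by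
    rw [hm]
    exact_mod_cast Fintype.card_pos
  have hxs : ∀ a, IsSelfAdjoint (x a) := fun a => IsSelfAdjoint.of_nonneg (hx0 a)
  have hxle : ∀ a, x a ≤ 1 := fun a => by
    rw [← hx1]
    exact Finset.single_le_sum (fun b _ => hx0 b) (Finset.mem_univ a)
  choose q hqs hqq hqc hqlow hqhigh using fun a => exists_spectral_projection (hx0 a) (hxle a) hm1
  have hqN : ∀ a, q a ∈ N := fun a => mem_of_commute N fun y hy =>
    hqc a y (commute_of_mem (hx a) hy) (commute_of_mem (hx a) (star_mem hy))
  have hqF : ∀ a i j, Commute (q a) (F i j) := fun a i j => by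
    refine hqc a _ (hxF a i j) ?_
    rw [hF.star_eq]
    exact hxF a j i
  have hqx : ∀ a, Commute (q a) (x a) := fun a =>
    hqc a _ (Commute.refl _) (by rw [(hxs a).star_eq])
  set s : ℝ := 1 - 1 / m with hs
  have hs0 : 0 ≤ s := by
    rw [hs, sub_nonneg, div_le_one (by linarith)]
    exact hm1
  have hs1 : s ≤ 1 := by
    rw [hs, sub_le_self_iff]
    positivity
  set f := 1 - F i₀ i₀ with hf
  have hfs : IsSelfAdjoint f := (IsSelfAdjoint.one _).sub (hF.star_eq _ _)
  have hff : f * f = f := by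
    rw [hf, mul_sub, sub_mul, sub_mul, hF.mul_eq, if_pos rfl]
    simp
  have hfN : f ∈ N := sub_mem (one_mem _) (hF.mem _ _)
  have hqf : ∀ a, Commute (q a) f := fun a => (Commute.one_right _).sub_right (hqF a _ _)
  have hxf : ∀ a, Commute (x a) f := fun a => (Commute.one_right _).sub_right (hxF a _ _)
  have htrf : ∀ c ∈ N, (∀ i j, Commute c (F i j)) → tr ξ (c * f) = s * tr ξ c :=
    fun c hc hcF => hN.tr_mul_unit hF hc hcF i₀
  have hdN : ∀ a, q a * f ∈ N := fun a => mul_mem (hqN a) hfN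
  have hds : ∀ a, IsSelfAdjoint (q a * f) := fun a => by
    rw [IsSelfAdjoint, star_mul, hfs.star_eq, (hqs a).star_eq, (hqf a).eq]
  have hdd : ∀ a, q a * f * (q a * f) = q a * f := fun a => by
    rw [mul_assoc, ← mul_assoc f, ← (hqf a).eq, mul_assoc (q a) f f, hff, ← mul_assoc, hqq]
  have hsize : ∀ z ∈ N, IsSelfAdjoint z → z * z = z → (∀ n ∈ N, Commute z n) →
      ∑ a, (⟪ξ, (q a * f * z) ξ⟫_ℂ).re ≤ (⟪ξ, z ξ⟫_ℂ).re := by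
    intro z hz hzs hzz hzc
    have h1 : ∀ a, (⟪ξ, (q a * f * z) ξ⟫_ℂ).re = s * ‖q a (z ξ)‖ ^ 2 := by
      intro a
      have e1 : q a * f * z = q a * z * f := by rw [mul_assoc, mul_assoc, (hzc f hfN).eq]
      have e2 : q a * z = star (q a * z) * (q a * z) := by
        rw [star_mul, (hqs a).star_eq, hzs.star_eq, mul_assoc, ← mul_assoc (q a), hqq,
          ← mul_assoc, (hzc _ (hqN a)).eq, mul_assoc, hzz]
      change tr ξ _ = _
      rw [e1, htrf _ (mul_mem (hqN a) hz)
        fun i j => (hqF a i j).mul_left (hzc _ (hF.mem i j)), e2, tr_star_mul, re_inner_self_eq]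
      rfl
    simp_rw [h1]
    refine (Finset.sum_le_sum fun a _ => hqlow a (z ξ)).trans_eq ?_
    rw [← Complex.re_sum, ← inner_sum, ← sum_apply, hx1, one_apply_eq_self,
      IsSelfAdjoint.inner_right hzs, ← mul_apply_eq_comp, hzz]
  obtain ⟨u, hu, hdu, -, huu, hmax⟩ := exists_coisometry hN hdN hds hdd hsize (fun a => x a ξ) ξ
  have hlower : s * (∑ a, ‖x a ξ‖ ^ 2 - m * (1 - ∑ a, ‖x a ξ‖ ^ 2)) ≤
      ∑ a, (⟪x a ξ, u a ξ⟫_ℂ).re := by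
    refine le_trans ?_ (hmax (fun a => q a * f * x a) (fun a => mul_mem (hdN a) (hx a))
      (fun a => by rw [← mul_assoc, hdd]) fun v => ?_)
    · have h1 : ∀ a, (⟪x a ξ, (q a * f * x a) ξ⟫_ℂ).re =
          s * (‖x a ξ‖ ^ 2 - ‖x a (ξ - q a ξ)‖ ^ 2) := by
        intro a
        have e : x a * q a * (x a * q a) = x a * (x a * q a) := by
          rw [mul_assoc, ← mul_assoc (q a), (hqx a).eq, mul_assoc (x a) (q a), hqq]
        have e' : x a * (x a * q a) = x a * (q a * x a) := by rw [(hqx a).eq]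
        have e0 : x a * (q a * f * x a) = x a * q a * (x a * q a) * f := by
          rw [e, e', mul_assoc (q a), ← (hxf a).eq]
          simp only [mul_assoc]
        have hs' : IsSelfAdjoint (x a * q a) := by
          rw [IsSelfAdjoint, star_mul, (hxs a).star_eq, (hqs a).star_eq, (hqx a).eq]
        have e3 : ‖x a (ξ - q a ξ)‖ ^ 2 = ‖x a ξ‖ ^ 2 - ‖(x a * q a) ξ‖ ^ 2 := by
          have e4 : (⟪x a ξ, x a (q a ξ)⟫_ℂ).re = ‖(x a * q a) ξ‖ ^ 2 := by
            rw [← tr_mul_self ξ hs', e, tr_mul ξ (hxs a), mul_apply_eq_comp]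
          rw [map_sub, norm_sub_sq_re, e4, mul_apply_eq_comp]
          ring
        rw [← tr_mul ξ (hxs a), e0, htrf _ (mul_mem (mul_mem (hx a) (hqN a))
          (mul_mem (hx a) (hqN a))) fun i j => (((hxF a i j).mul_left (hqF a i j)).mul_left
            ((hxF a i j).mul_left (hqF a i j))), tr_mul_self ξ hs', e3, sub_sub_cancel]
      simp_rw [h1]
      rw [← Finset.mul_sum, Finset.sum_sub_distrib]
      refine mul_le_mul_of_nonneg_left (sub_le_sub_left ?_ _) hs0
      refine (Finset.sum_le_sum fun a _ => hqhigh a ξ).trans_eq ?_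
      rw [← Finset.mul_sum]
      congr 1
      change ∑ a, tr ξ (x a - x a * x a) = _
      simp_rw [tr_sub, tr_mul_self ξ (hxs _)]
      rw [Finset.sum_sub_distrib, ← tr_sum, hx1, tr_one, hN.norm_eq, one_pow]
    · have h2 : ‖v‖ ^ 2 = ∑ a, (⟪v, x a v⟫_ℂ).re := by
        rw [← Complex.re_sum, ← inner_sum, ← sum_apply, hx1, one_apply_eq_self, re_inner_self_eq]
      rw [h2]
      refine Finset.sum_le_sum fun a _ =>
        le_trans ?_ (norm_sq_le_re_inner (hx0 a) (hxle a) v)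
      exact pow_le_pow_left₀ (norm_nonneg _) (norm_proj_le (hds a) (hdd a) _) 2
  have hupper : ∑ a, tr ξ (q a * f * x a) ≤ s := by
    have h1 : ∀ a, tr ξ (q a * f * x a) ≤ s * tr ξ (x a) := by
      intro a
      have e1 : q a * f * x a = q a * x a * f := by rw [mul_assoc, mul_assoc, (hxf a).eq]
      rw [e1, htrf _ (mul_mem (hqN a) (hx a)) fun i j => (hqF a i j).mul_left (hxF a i j)]
      refine mul_le_mul_of_nonneg_left ?_ hs0
      have := hN.tr_proj_mul_nonneg (sub_mem (one_mem _) (hqN a))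
        ((IsSelfAdjoint.one _).sub (hqs a)) (by
          rw [mul_sub, sub_mul, sub_mul, hqq]
          simp) (hx a) (hx0 a)
      rw [sub_mul, one_mul, tr_sub] at this
      linarith
    refine (Finset.sum_le_sum fun a _ => h1 a).trans_eq ?_
    rw [← Finset.mul_sum, ← tr_sum, hx1, tr_one, hN.norm_eq, one_pow, mul_one]
  have hkey : ∀ a, 2 * (⟪x a ξ, u a ξ⟫_ℂ).re - tr ξ (q a * f * x a) ≤
      tr ξ (star (u a) * u a * x a) := by
    intro a
    have h1 := hN.tr_star_mul_mul_nonneg (sub_mem (hu a) (hdN a)) (hx a) (hx0 a)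
    have e1 : star (u a) * (q a * f) = star (u a) := by
      rw [← (hds a).star_eq, ← star_mul, hdu]
    have e2 : star (u a - q a * f) * (u a - q a * f) * x a =
        star (u a) * u a * x a - u a * x a - star (u a) * x a + q a * f * x a := by
      rw [star_sub, (hds a).star_eq, mul_sub, sub_mul, sub_mul _ _ (q a * f), sub_mul, hdu, hdd, e1]
      simp only [sub_mul]
      abel
    have e3 : tr ξ (u a * x a) = (⟪x a ξ, u a ξ⟫_ℂ).re := by
      rw [hN.tr_comm (hu a) (hx a), tr_mul ξ (hxs a)]
    have e4 : tr ξ (star (u a) * x a) = (⟪x a ξ, u a ξ⟫_ℂ).re := by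
      rw [tr_star_mul, re_inner_comm]
    rw [e2, tr_add, tr_sub, tr_sub, e3, e4] at h1
    linarith
  obtain ⟨r, hr, hrs, hrr, hr1, hle⟩ := exists_pvm_of_orthogonal hN
    (r := fun a => star (u a) * u a) (fun a => mul_mem (star_mem (hu a)) (hu a))
    (fun a => IsSelfAdjoint.star_mul_self _) (fun a b => by
      have e : star (u a) * u a * (star (u b) * u b) = star (u a) * (u a * star (u b)) * u b := by
        noncomm_ring
      rw [e, huu]
      split_ifs with h
      · subst h
        rw [mul_assoc, hdu]
      · rw [mul_zero, zero_mul]) hx hx0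
  refine ⟨r, hr, hrs, hrr, hr1, le_trans ?_ hle⟩
  have h1 := Finset.sum_le_sum fun a (_ : a ∈ Finset.univ) => hkey a
  rw [Finset.sum_sub_distrib, ← Finset.mul_sum] at h1
  have hδ : 0 ≤ 1 - ∑ a, ‖x a ξ‖ ^ 2 := by
    have h2 : ∑ a, ‖x a ξ‖ ^ 2 ≤ ∑ a, tr ξ (x a) := Finset.sum_le_sum fun a _ =>
      norm_sq_le_re_inner (hx0 a) (hxle a) ξ
    rw [← tr_sum, hx1, tr_one, hN.norm_eq, one_pow] at h2
    linarith
  have h3 : s * (2 * (1 + m) * (1 - ∑ a, ‖x a ξ‖ ^ 2)) ≤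
      1 * (2 * (1 + m) * (1 - ∑ a, ‖x a ξ‖ ^ 2)) :=
    mul_le_mul_of_nonneg_right hs1 (by positivity)
  linarith

end Rounding

section Compression

variable {H : Type*} [NormedAddCommGroup H] [InnerProductSpace ℂ H] [CompleteSpace H]

/-- The projection onto the closure of `M ψ`. -/
lemma exists_orbit_projection (M : VonNeumannAlgebra H) (ψ : H) :
    ∃ e ∈ M.commutant, IsSelfAdjoint e ∧ e * e = e ∧ e ψ = ψ ∧
      ∀ v, e v ∈ closure ((fun x : H →L[ℂ] H => x ψ) '' (M : Set _)) := by
  let W₀ : Submodule ℂ H :=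
    { carrier := (fun x : H →L[ℂ] H => x ψ) '' (M : Set _)
      add_mem' := by
        rintro _ _ ⟨x, hx, rfl⟩ ⟨y, hy, rfl⟩
        exact ⟨x + y, add_mem hx hy, rfl⟩
      zero_mem' := ⟨0, zero_mem M, rfl⟩
      smul_mem' := by
        rintro c _ ⟨x, hx, rfl⟩
        exact ⟨c • x, VonNeumannAlgebra.smul_mem' M c hx, rfl⟩ }
  let W := W₀.topologicalClosure
  have : CompleteSpace W := W₀.isClosed_topologicalClosure.completeSpace_coe
  have hmap : ∀ T ∈ M, ∀ v ∈ W, T v ∈ W := by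
    intro T hT v hv
    have hle : W₀ ≤ W.comap (T : H →ₗ[ℂ] H) := by
      rintro _ ⟨x, hx, rfl⟩
      exact W₀.le_topologicalClosure ⟨T * x, mul_mem hT hx, rfl⟩
    exact Submodule.topologicalClosure_minimal _ hle
      (W₀.isClosed_topologicalClosure.preimage T.continuous) hv
  refine ⟨W.starProjection, ?_, isSelfAdjoint_starProjection W, W.isIdempotentElem_starProjection,
    Submodule.starProjection_eq_self_iff.2 (W₀.le_topologicalClosure ⟨1, one_mem M, rfl⟩),
    fun v => W.starProjection_apply_mem v⟩
  rw [VonNeumannAlgebra.mem_commutant_iff]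
  intro T hT
  exact (commute_starProjection W (hmap T hT) (hmap _ (star_mem hT))).eq.symm

/-- Compressing a commuting pair of algebras to make a vector cyclic for both. -/
theorem exists_cyclic_compression {H : Type} [NormedAddCommGroup H] [InnerProductSpace ℂ H]
    [CompleteSpace H] (M : VonNeumannAlgebra H) (ψ : H) :
    ∃ (K : Type) (_ : NormedAddCommGroup K) (_ : InnerProductSpace ℂ K) (_ : CompleteSpace K)
      (V : K →L[ℂ] H) (η : K) (N : VonNeumannAlgebra K),
      V η = ψ ∧ (∀ v, ‖V v‖ = ‖v‖) ∧ V.adjoint.comp V = 1 ∧ Cyclic N η ∧ Cyclic N.commutant η ∧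
      (∀ x ∈ M, V.adjoint.comp (x.comp V) ∈ N) ∧
      (∀ y ∈ M.commutant, V.adjoint.comp (y.comp V) ∈ N.commutant) ∧
      ∀ x ∈ M, ∀ y ∈ M.commutant,
        V.adjoint.comp (x.comp V) * V.adjoint.comp (y.comp V) = V.adjoint.comp ((x * y).comp V) := by
  obtain ⟨e, he, hes, hee, heψ, hecl⟩ := exists_orbit_projection M ψ
  obtain ⟨s, hs, hss, hsq, hsψ, hscl⟩ := exists_orbit_projection M.commutant ψ
  rw [VonNeumannAlgebra.commutant_commutant] at hs
  have hse : s * e = e * s := (commute_of_mem hs he).eq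
  let W : Submodule ℂ H := LinearMap.ker ((e * s - 1 : H →L[ℂ] H) : H →ₗ[ℂ] H)
  have hW : ∀ v, v ∈ W ↔ e (s v) = v := fun v => by
    change (e * s - 1) v = 0 ↔ _
    rw [sub_apply, sub_eq_zero]
    rfl
  have hcl : IsClosed (W : Set H) := ContinuousLinearMap.isClosed_ker _
  have : CompleteSpace W := hcl.completeSpace_coe
  have he2 : ∀ v, e (e v) = e v := fun v => congrArg (fun T : H →L[ℂ] H => T v) hee
  have hs2 : ∀ v, s (s v) = s v := fun v => congrArg (fun T : H →L[ℂ] H => T v) hsq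
  have hes' : ∀ v, s (e v) = e (s v) := fun v => congrArg (fun T : H →L[ℂ] H => T v) hse
  have heW : ∀ v ∈ W, e v = v := fun v hv => by rw [← (hW v).1 hv, he2]
  have hsW : ∀ v ∈ W, s v = v := fun v hv => by rw [← (hW v).1 hv, hes', hs2]
  let V : W →L[ℂ] H := W.subtypeL
  have hV : ∀ v, V.adjoint v = W.orthogonalProjectionOnto v := fun v => by
    rw [show V.adjoint = W.orthogonalProjectionOnto from W.adjoint_subtypeL]
  have hVV : ∀ v, V (V.adjoint v) = e (s v) := by
    intro v
    rw [hV]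
    refine Submodule.eq_starProjection_of_mem_orthogonal ?_ ?_
    · rw [hW, ← hes' v, hs2, hes', he2]
    · intro w hw
      have : ⟪w, e (s v)⟫_ℂ = ⟪w, v⟫_ℂ := by
        rw [← IsSelfAdjoint.inner_right hes, ← IsSelfAdjoint.inner_right hss, heW w hw, hsW w hw]
      rw [inner_sub_right, this, sub_self]
  have hVi : ∀ v : W, V.adjoint (V v) = v := fun v => by
    rw [hV]
    exact W.orthogonalProjectionOnto_mem_subspace_eq_self v
  have heV : ∀ v, e (V v) = V v := fun v => heW _ v.2
  have hsV : ∀ v, s (V v) = V v := fun v => hsW _ v.2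
  have hVe : ∀ v, V.adjoint (e v) = V.adjoint v := fun v => ext_inner_left ℂ fun w => by
    rw [ContinuousLinearMap.adjoint_inner_right, ContinuousLinearMap.adjoint_inner_right,
      ← IsSelfAdjoint.inner_right hes, heV]
  have hVs : ∀ v, V.adjoint (s v) = V.adjoint v := fun v => ext_inner_left ℂ fun w => by
    rw [ContinuousLinearMap.adjoint_inner_right, ContinuousLinearMap.adjoint_inner_right,
      ← IsSelfAdjoint.inner_right hss, hsV]
  have hψW : ψ ∈ W := (hW ψ).2 (by rw [hsψ, heψ])
  let cmp : (H →L[ℂ] H) → (W →L[ℂ] W) := fun x => V.adjoint.comp (x.comp V)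
  have hcstar : ∀ x, star (cmp x) = cmp (star x) := fun x => by
    rw [ContinuousLinearMap.star_eq_adjoint, ContinuousLinearMap.adjoint_comp,
      ContinuousLinearMap.adjoint_comp, ContinuousLinearMap.adjoint_adjoint]
    rfl
  have hmul : ∀ x ∈ M, ∀ y ∈ M.commutant, cmp x * cmp y = cmp (x * y) := by
    intro x hx y hy
    have h1 : ∀ v, x (e v) = e (x v) := fun v =>
      congrArg (fun T : H →L[ℂ] H => T v) (commute_of_mem hx he).eq
    have h2 : ∀ v, s (y v) = y (s v) := fun v =>
      congrArg (fun T : H →L[ℂ] H => T v) (commute_of_mem hs hy).eq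
    ext v
    change ((V.adjoint (x (V (V.adjoint (y (V v))))) : W) : H) = (V.adjoint (x (y (V v))) : W)
    rw [hVV, h1, hVe, h2, hsV]
  have hmul' : ∀ x ∈ M, ∀ y ∈ M.commutant, cmp y * cmp x = cmp (x * y) := by
    intro x hx y hy
    have h1 : ∀ v, x (e v) = e (x v) := fun v =>
      congrArg (fun T : H →L[ℂ] H => T v) (commute_of_mem hx he).eq
    have h2 : ∀ v, s (y v) = y (s v) := fun v =>
      congrArg (fun T : H →L[ℂ] H => T v) (commute_of_mem hs hy).eq
    have h3 : ∀ v, x (y v) = y (x v) := fun v =>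
      congrArg (fun T : H →L[ℂ] H => T v) (commute_of_mem hx hy).eq
    ext v
    change ((V.adjoint (y (V (V.adjoint (x (V v))))) : W) : H) = (V.adjoint (x (y (V v))) : W)
    rw [hVV, ← hes', ← h2, hVs, ← h1, heV, h3]
  let S : Set (W →L[ℂ] W) := {T | ∃ y ∈ M.commutant, T = cmp y}
  have hS : ∀ x ∈ S, star x ∈ S := by
    rintro _ ⟨y, hy, rfl⟩
    exact ⟨star y, star_mem hy, hcstar y⟩
  have hmem : ∀ x ∈ M, cmp x ∈ vnCentralizer S := by
    intro x hx
    rw [mem_vnCentralizer hS]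
    rintro _ ⟨y, hy, rfl⟩
    rw [hmul x hx y hy, hmul' x hx y hy]
  have hmem' : ∀ y ∈ M.commutant, cmp y ∈ (vnCentralizer S).commutant :=
    fun y hy => subset_commutant_vnCentralizer ⟨y, hy, rfl⟩
  have hcyc : ∀ (R : VonNeumannAlgebra H) (R' : VonNeumannAlgebra W), (∀ x ∈ R, cmp x ∈ R') →
      (∀ v ∈ W, v ∈ closure ((fun x : H →L[ℂ] H => x ψ) '' (R : Set _))) →
      Cyclic R' ⟨ψ, hψW⟩ := by
    intro R R' hR hcl v
    have h1 : V.adjoint (V v) ∈ closure (V.adjoint '' ((fun x : H →L[ℂ] H => x ψ) '' (R : Set _))) :=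
      image_closure_subset_closure_image V.adjoint.continuous ⟨_, hcl _ v.2, rfl⟩
    rw [hVi] at h1
    refine closure_mono ?_ h1
    rintro _ ⟨_, ⟨x, hx, rfl⟩, rfl⟩
    exact ⟨cmp x, hR x hx, rfl⟩
  refine ⟨W, inferInstance, inferInstance, inferInstance, V, ⟨ψ, hψW⟩, vnCentralizer S, rfl,
    fun v => rfl, ContinuousLinearMap.ext hVi, hcyc M _ hmem fun v hv => ?_,
    hcyc M.commutant _ hmem' fun v hv => ?_, hmem, hmem', hmul⟩
  · rw [← heW v hv]
    exact hecl v
  · rw [← hsW v hv]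
    exact hscl v

end Compression

section Povm

variable {H : Type*} [NormedAddCommGroup H] [InnerProductSpace ℂ H] [CompleteSpace H]
  {α β : Type*} [Fintype α] [Fintype β] [DecidableEq β]

lemma le_one_of_sum_eq_one {P : α → H →L[ℂ] H} (h0 : ∀ a, 0 ≤ P a) (h1 : ∑ a, P a = 1) (a : α) :
    P a ≤ 1 :=
  h1 ▸ Finset.single_le_sum (f := P) (fun a _ => h0 a) (Finset.mem_univ a)

lemma sum_norm_sq_le_one {P : α → H →L[ℂ] H} (h0 : ∀ a, 0 ≤ P a) (h1 : ∑ a, P a = 1) {ψ : H}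
    (hψ : ‖ψ‖ = 1) : ∑ a, ‖P a ψ‖ ^ 2 ≤ 1 := by
  calc ∑ a, ‖P a ψ‖ ^ 2 ≤ ∑ a, (⟪ψ, P a ψ⟫_ℂ).re :=
        Finset.sum_le_sum fun a _ => norm_sq_le_re_inner (h0 a) (le_one_of_sum_eq_one h0 h1 a) ψ
    _ = 1 := by
      rw [← Complex.re_sum, ← inner_sum, ← sum_apply, h1, one_apply_eq_self, re_inner_self_eq, hψ,
        one_pow]

lemma sum_norm_sq_sub_le {P Q : α → H →L[ℂ] H} (hP0 : ∀ a, 0 ≤ P a) (hP1 : ∑ a, P a = 1)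
    (hQ0 : ∀ a, 0 ≤ Q a) (hQ1 : ∑ a, Q a = 1) {ψ : H} (hψ : ‖ψ‖ = 1) :
    ∑ a, ‖(P a - Q a) ψ‖ ^ 2 ≤ 2 * (1 - ∑ a, (⟪P a ψ, Q a ψ⟫_ℂ).re) := by
  have h1 := sum_norm_sq_le_one hP0 hP1 hψ
  have h2 := sum_norm_sq_le_one hQ0 hQ1 hψ
  simp only [sub_apply, norm_sub_sq_re, Finset.sum_add_distrib, Finset.sum_sub_distrib,
    ← Finset.mul_sum]
  linarith

/-- The coarse-graining of a family of operators along a map of outcomes. -/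
def coarse (f : α → β) (P : α → H →L[ℂ] H) (b : β) : H →L[ℂ] H := ∑ a with f a = b, P a

lemma sum_fiber {R : Type*} [AddCommMonoid R] (f : α → β) (F : α → β → R) :
    ∑ b, ∑ a with f a = b, F a b = ∑ a, F a (f a) := by
  rw [← Finset.sum_fiberwise Finset.univ f (fun a => F a (f a))]
  exact Finset.sum_congr rfl fun b _ => Finset.sum_congr rfl fun a ha => by
    rw [(Finset.mem_filter.1 ha).2]

lemma coarse_nonneg {f : α → β} {P : α → H →L[ℂ] H} (h0 : ∀ a, 0 ≤ P a) (b : β) :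
    0 ≤ coarse f P b := Finset.sum_nonneg fun a _ => h0 a

lemma sum_coarse (f : α → β) (P : α → H →L[ℂ] H) : ∑ b, coarse f P b = ∑ a, P a :=
  sum_fiber f fun a _ => P a

lemma coarse_mem {M : VonNeumannAlgebra H} {f : α → β} {P : α → H →L[ℂ] H} (h : ∀ a, P a ∈ M)
    (b : β) : coarse f P b ∈ M := sum_mem fun a _ => h a

lemma sum_re_inner_coarse (f : α → β) (P : α → H →L[ℂ] H) (v : H) (w : β → H) :
    ∑ b, (⟪coarse f P b v, w b⟫_ℂ).re = ∑ a, (⟪P a v, w (f a)⟫_ℂ).re := by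
  rw [← sum_fiber f fun a b => (⟪P a v, w b⟫_ℂ).re]
  refine Finset.sum_congr rfl fun b _ => ?_
  rw [coarse, sum_apply, sum_inner, Complex.re_sum]

end Povm

section Defect

variable {H : Type*} [NormedAddCommGroup H] [InnerProductSpace ℂ H] [CompleteSpace H]
  {α β : Type*} [Fintype α] [Fintype β] [DecidableEq β] {M : VonNeumannAlgebra H} {ψ : H}

lemma modOp_commutant_apply {x : H →L[ℂ] H} (hx : x ∈ M) (hxs : IsSelfAdjoint x) :
    modOp (saOrbit M.commutant ψ) (x ψ) = realProj (saOrbit M.commutant ψ) (x ψ) := by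
  have : realProj (saOrbit M.commutant ψ) (Complex.I • x ψ) = 0 := by
    symm
    refine realProj_unique (Submodule.zero_mem _) ?_
    rintro _ ⟨y, hy, hys, rfl⟩
    have h := im_inner_commuting hys hxs (commute_of_mem hx hy).symm ψ
    rw [sub_zero, inner_smul_right, Complex.mul_re, Complex.I_re, Complex.I_im, h]
    ring
  rw [modOp_apply, this, smul_zero, sub_zero]

lemma norm_sq_modOp_sub_one_apply {x : H →L[ℂ] H} (hx : x ∈ M) (hxs : IsSelfAdjoint x) :
    ‖(modOp (saOrbit M.commutant ψ) - 1) (x ψ)‖ ^ 2 =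
      ‖x ψ‖ ^ 2 - (⟪x ψ, modOp (saOrbit M.commutant ψ) (x ψ)⟫_ℂ).re := by
  rw [sub_apply, one_apply_eq_self, modOp_commutant_apply hx hxs, norm_sub_sq_re,
    re_inner_comm, re_inner_realProj_comm, re_inner_self_eq]
  ring

lemma re_inner_modOp_coarse (f : α → β) (P : α → H →L[ℂ] H) (T : H →L[ℂ] H) :
    ∑ b, (⟪coarse f P b ψ, T (coarse f P b ψ)⟫_ℂ).re =
      ∑ a, ∑ a', if f a = f a' then (⟪P a ψ, T (P a' ψ)⟫_ℂ).re else 0 := by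
  rw [sum_re_inner_coarse]
  refine Finset.sum_congr rfl fun a _ => ?_
  rw [coarse, sum_apply, map_sum, inner_sum, Complex.re_sum, Finset.sum_filter]
  exact Finset.sum_congr rfl fun a' _ => by simp only [eq_comm]

lemma re_inner_modOp_ge {x y : H →L[ℂ] H} (hx : x ∈ M) (hxs : IsSelfAdjoint x)
    (hy : y ∈ M.commutant) (hys : IsSelfAdjoint y) :
    2 * (⟪x ψ, y ψ⟫_ℂ).re - ‖y ψ‖ ^ 2 ≤
      (⟪x ψ, modOp (saOrbit M.commutant ψ) (x ψ)⟫_ℂ).re := by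
  have h := norm_sq_sub_realProj (saOrbit M.commutant ψ) (x ψ)
    ((saOrbit M.commutant ψ).le_topologicalClosure (mem_saOrbit hy hys))
  have h2 : ‖x ψ - realProj (saOrbit M.commutant ψ) (x ψ)‖ ^ 2 ≤ ‖y ψ - x ψ‖ ^ 2 := by
    rw [h]
    exact le_add_of_nonneg_left (sq_nonneg _)
  rw [norm_sub_sq_re, norm_sub_sq_re, re_inner_realProj_comm, re_inner_self_eq] at h2
  rw [modOp_commutant_apply hx hxs, re_inner_realProj_comm, re_inner_self_eq, re_inner_comm]
  linarith

lemma re_inner_modOp_nonneg {x y : H →L[ℂ] H} (hx : x ∈ M) (hx0 : 0 ≤ x)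
    (hy : y ∈ M) (hy0 : 0 ≤ y) (hy1 : y ≤ 1) :
    0 ≤ (⟪x ψ, modOp (saOrbit M.commutant ψ) (y ψ)⟫_ℂ).re := by
  obtain ⟨z, hz, hz0, -, h⟩ := exists_radonNikodym M.commutant
    (M.commutant_commutant.symm ▸ hy) hy0 hy1 ψ
  rw [modOp_commutant_apply hy (.of_nonneg hy0), ← h, IsSelfAdjoint.inner_right (.of_nonneg hx0),
    ← mul_apply_eq_comp]
  exact re_inner_nonneg ((commute_of_mem hx hz).mul_nonneg hx0 hz0) ψ

lemma exists_radonNikodym_povm (hcyc' : Cyclic M.commutant ψ) {Q : β → H →L[ℂ] H}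
    (hQ : ∀ b, Q b ∈ M.commutant) (hQ0 : ∀ b, 0 ≤ Q b) (hQ1 : ∑ b, Q b = 1) :
    ∃ y : β → H →L[ℂ] H, (∀ b, y b ∈ M) ∧ (∀ b, 0 ≤ y b) ∧ ∑ b, y b = 1 ∧
      ∀ b, ∀ x ∈ M, IsSelfAdjoint x → ‖(x - y b) ψ‖ ≤ ‖(x - Q b) ψ‖ := by
  choose y hy hy0 hy1 hyψ using fun b =>
    exists_radonNikodym M (hQ b) (hQ0 b) (le_one_of_sum_eq_one hQ0 hQ1 b) ψ
  refine ⟨y, hy, hy0, ?_, fun b x hx hxs => ?_⟩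
  · refine hcyc'.ext (M.commutant_commutant.symm ▸ sum_mem fun b _ => hy b)
      (one_mem _) ?_
    symm
    rw [one_apply_eq_self]
    refine (realProj_of_mem (V := saOrbit M ψ) (Submodule.le_topologicalClosure _
      (by simpa using mem_saOrbit (one_mem M) (IsSelfAdjoint.one _)))).symm.trans ?_
    symm
    refine realProj_unique ?_ ?_
    · rw [sum_apply]
      refine Submodule.sum_mem _ fun b _ => ?_
      rw [hyψ]
      exact realProj_mem _ _
    · intro u hu
      have hu' := (saOrbit M ψ).le_topologicalClosure hu
      have e : ψ - (∑ b, y b) ψ = ∑ b, (Q b ψ - realProj (saOrbit M ψ) (Q b ψ)) := by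
        rw [Finset.sum_sub_distrib, ← sum_apply, hQ1, one_apply_eq_self, sum_apply]
        simp only [hyψ]
      rw [e, inner_sum, Complex.re_sum]
      exact Finset.sum_eq_zero fun b _ => re_inner_sub_realProj _ _ hu'
  · rw [sub_apply, sub_apply, hyψ]
    have h := norm_sq_sub_realProj (saOrbit M ψ) (Q b ψ)
      ((saOrbit M ψ).le_topologicalClosure (mem_saOrbit hx hxs))
    refine (sq_le_sq₀ (norm_nonneg _) (norm_nonneg _)).1 ?_
    rw [h]
    exact le_add_of_nonneg_right (sq_nonneg _)

end Defect

section Gap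

variable {H : Type*} [NormedAddCommGroup H] [InnerProductSpace ℂ H] [CompleteSpace H]
  {M : VonNeumannAlgebra H} {ψ : H}

/-- For a question whose answer is determined by its projections, winning the projection game
bounds the failure of self-consistency. -/
theorem exists_defect {J α : Type*} [Fintype J] [Fintype α]
    {B : J → Type*} [∀ j, Fintype (B j)] (hψ : ‖ψ‖ = 1) {μ : J → ℝ} (hμ : ∀ j, 0 ≤ μ j)
    {p : ∀ j, α → B j} (hnd : ∀ a a', (∀ j, 0 < μ j → p j a = p j a') → a = a')
    {L : ℝ} (hL0 : 0 ≤ L) (hL : ∀ j, 0 < μ j → ∑ j', μ j' ≤ L * μ j)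
    {P : α → H →L[ℂ] H} (hP : ∀ a, P a ∈ M) (hP0 : ∀ a, 0 ≤ P a) (hP1 : ∑ a, P a = 1)
    {Q : ∀ j, B j → H →L[ℂ] H} (hQ : ∀ j b, Q j b ∈ M.commutant) (hQ0 : ∀ j b, 0 ≤ Q j b)
    (hQ1 : ∀ j, ∑ b, Q j b = 1) :
    ∃ d : ℝ, 0 ≤ d ∧
      (∑ j, μ j) * d ≤ 2 * L * ∑ j, μ j * (1 - ∑ a, (⟪P a ψ, Q j (p j a) ψ⟫_ℂ).re) ∧
      1 - d ≤ ∑ a, ‖P a ψ‖ ^ 2 ∧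
      ∑ a, ‖(modOp (saOrbit M.commutant ψ) - 1) (P a ψ)‖ ^ 2 ≤ d := by
  classical
  set S := modOp (saOrbit M.commutant ψ) with hS
  let m : α → α → ℝ := fun a a' => (⟪P a ψ, S (P a' ψ)⟫_ℂ).re
  have hsa : ∀ a, IsSelfAdjoint (P a) := fun a => .of_nonneg (hP0 a)
  have hm0 : ∀ a a', 0 ≤ m a a' := fun a a' =>
    re_inner_modOp_nonneg (hP a) (hP0 a) (hP a') (hP0 a') (le_one_of_sum_eq_one hP0 hP1 a')
  have hPψ : ∑ a, P a ψ = ψ := by rw [← sum_apply, hP1, one_apply_eq_self]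
  have hm1 : ∑ a, ∑ a', m a a' = 1 := by
    simp only [m, ← Complex.re_sum, ← inner_sum, ← sum_inner, ← map_sum, hPψ]
    rw [hS, modOp_fixed, re_inner_self_eq, hψ, one_pow]
  have hgap : ∀ j, 1 - 2 * (1 - ∑ a, (⟪P a ψ, Q j (p j a) ψ⟫_ℂ).re) ≤
      ∑ a, ∑ a', if p j a = p j a' then m a a' else 0 := by
    intro j
    rw [← re_inner_modOp_coarse (p j) P S, ← sum_re_inner_coarse (p j) P ψ fun b => Q j b ψ]
    have h := Finset.sum_le_sum fun b (_ : b ∈ Finset.univ) =>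
      re_inner_modOp_ge (ψ := ψ) (coarse_mem (f := p j) hP b) (.of_nonneg (coarse_nonneg hP0 b)) (hQ j b)
        (.of_nonneg (hQ0 j b))
    rw [Finset.sum_sub_distrib, ← Finset.mul_sum] at h
    have h2 := sum_norm_sq_le_one (hQ0 j) (hQ1 j) hψ
    linarith
  have hnorm : ∀ a, ‖(S - 1) (P a ψ)‖ ^ 2 = ‖P a ψ‖ ^ 2 - m a a := fun a =>
    norm_sq_modOp_sub_one_apply (hP a) (hsa a)
  have hcompl : ∀ c : α → α → Prop, ∑ a, ∑ a', (if c a a' then 0 else m a a') =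
      ∑ a, ∑ a', m a a' - ∑ a, ∑ a', if c a a' then m a a' else 0 := fun c => by
    simp only [← Finset.sum_sub_distrib]
    refine Finset.sum_congr rfl fun a _ => Finset.sum_congr rfl fun a' _ => ?_
    split_ifs <;> simp
  have hle := sum_norm_sq_le_one hP0 hP1 hψ
  refine ⟨1 - ∑ a, m a a, ?_, ?_, ?_, ?_⟩
  · have : ∑ a, m a a ≤ ∑ a, ‖P a ψ‖ ^ 2 := Finset.sum_le_sum fun a _ => by
      have := hnorm a
      nlinarith [sq_nonneg ‖(S - 1) (P a ψ)‖]
    linarith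
  · have hdiag : 1 - ∑ a, m a a = ∑ a, ∑ a', if a = a' then 0 else m a a' := by
      rw [hcompl, hm1]
      simp only [Finset.sum_ite_eq, Finset.mem_univ, if_true]
    have hpair : ∀ a a', a ≠ a' → (∑ j, μ j) ≤ L * ∑ j, if p j a = p j a' then 0 else μ j := by
      intro a a' h
      obtain ⟨j, hj, hne⟩ : ∃ j, 0 < μ j ∧ p j a ≠ p j a' := by
        by_contra! hcon
        exact h (hnd a a' hcon)
      refine (hL j hj).trans (mul_le_mul_of_nonneg_left ?_ hL0)
      have := Finset.single_le_sum (f := fun j => if p j a = p j a' then 0 else μ j)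
        (fun j _ => by split_ifs; exacts [le_rfl, hμ j]) (Finset.mem_univ j)
      simpa [hne] using this
    calc (∑ j, μ j) * (1 - ∑ a, m a a)
        = ∑ a, ∑ a', (∑ j, μ j) * (if a = a' then 0 else m a a') := by
          rw [hdiag, Finset.mul_sum]
          simp only [Finset.mul_sum]
      _ ≤ ∑ a, ∑ a', (L * ∑ j, if p j a = p j a' then 0 else μ j) * m a a' := by
          refine Finset.sum_le_sum fun a _ => Finset.sum_le_sum fun a' _ => ?_
          split_ifs with h
          · subst h
            simp
          · exact mul_le_mul_of_nonneg_right (hpair a a' h) (hm0 a a')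
      _ = L * ∑ j, μ j * ∑ a, ∑ a', (if p j a = p j a' then 0 else m a a') := by
          simp only [Finset.mul_sum, Finset.sum_mul]
          refine Eq.trans ?_ Finset.sum_comm
          refine Finset.sum_congr rfl fun a _ => Eq.trans ?_ Finset.sum_comm
          refine Finset.sum_congr rfl fun a' _ => Finset.sum_congr rfl fun j _ => ?_
          split_ifs <;> ring
      _ ≤ L * ∑ j, μ j * (2 * (1 - ∑ a, (⟪P a ψ, Q j (p j a) ψ⟫_ℂ).re)) := by
          refine mul_le_mul_of_nonneg_left (Finset.sum_le_sum fun j _ =>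
            mul_le_mul_of_nonneg_left ?_ (hμ j)) hL0
          rw [hcompl fun a a' => p j a = p j a', hm1]
          linarith [hgap j]
      _ = _ := by
          simp only [Finset.mul_sum]
          exact Finset.sum_congr rfl fun j _ => by ring
  · have : ∑ a, m a a ≤ ∑ a, ‖P a ψ‖ ^ 2 := Finset.sum_le_sum fun a _ => by
      have := hnorm a
      nlinarith [sq_nonneg ‖(S - 1) (P a ψ)‖]
    linarith
  · simp only [hnorm, Finset.sum_sub_distrib]
    linarith

end Gap

section Estimates

variable {H : Type*} [NormedAddCommGroup H] [InnerProductSpace ℂ H] [CompleteSpace H]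
  {α β : Type*} [Fintype α] [Fintype β] [DecidableEq β] {N : VonNeumannAlgebra H} {ξ : H}

lemma tr_mul_eq_re_inner {a : H →L[ℂ] H} (ha : IsSelfAdjoint a) (b : H →L[ℂ] H) :
    tr ξ (a * b) = (⟪a ξ, b ξ⟫_ℂ).re := by
  rw [← tr_star_mul, ha.star_eq]

lemma IsTracial.tr_mul_nonneg (hN : IsTracial N ξ) {a b : H →L[ℂ] H} (ha : a ∈ N) (ha0 : 0 ≤ a)
    (hb : b ∈ N) (hb0 : 0 ≤ b) : 0 ≤ tr ξ (a * b) := by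
  have hs := IsSelfAdjoint.of_nonneg ha0
  have h : star (cfc Real.sqrt a) * cfc Real.sqrt a = a := by
    rw [(cfc_predicate Real.sqrt a : IsSelfAdjoint _).star_eq, ← cfc_mul _ _ a (by fun_prop) (by fun_prop)]
    conv_rhs => rw [← cfc_id' ℝ a]
    refine cfc_congr fun t ht => Real.mul_self_sqrt ?_
    exact spectrum_nonneg_of_nonneg ha0 ht
  have := hN.tr_star_mul_mul_nonneg (cfc_mem N ha Real.sqrt) hb hb0
  rwa [h] at this

lemma sum_diag_le_sum_coarse {x y : α → H →L[ℂ] H} (f : α → β)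
    (h : ∀ a a', 0 ≤ (⟪x a ξ, y a' ξ⟫_ℂ).re) :
    ∑ a, (⟪x a ξ, y a ξ⟫_ℂ).re ≤ ∑ b, (⟪coarse f x b ξ, coarse f y b ξ⟫_ℂ).re := by
  rw [sum_re_inner_coarse]
  refine Finset.sum_le_sum fun a _ => ?_
  rw [coarse, sum_apply, inner_sum, Complex.re_sum]
  exact Finset.single_le_sum (f := fun a' => (⟪x a ξ, y a' ξ⟫_ℂ).re) (fun a' _ => h a a')
    (Finset.mem_filter.2 ⟨Finset.mem_univ a, rfl⟩)

lemma sum_norm_sq_le_coarse (hN : IsTracial N ξ) {x : α → H →L[ℂ] H} (hx : ∀ a, x a ∈ N)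
    (hx0 : ∀ a, 0 ≤ x a) (f : α → β) : ∑ a, ‖x a ξ‖ ^ 2 ≤ ∑ b, ‖coarse f x b ξ‖ ^ 2 := by
  simp only [← re_inner_self_eq]
  refine sum_diag_le_sum_coarse f fun a a' => ?_
  rw [← tr_mul_eq_re_inner (.of_nonneg (hx0 a))]
  exact hN.tr_mul_nonneg (hx a) (hx0 a) (hx a') (hx0 a')

lemma norm_sq_le_young {v w : H} {γ : ℝ} (hγ : 0 < γ) :
    ‖v‖ ^ 2 ≤ (1 + γ) * ‖w‖ ^ 2 + (1 + 1 / γ) * ‖v - w‖ ^ 2 := by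
  have h1 : ‖v‖ ≤ ‖w‖ + ‖v - w‖ := by
    simpa using norm_add_le w (v - w)
  have h2 : ‖v‖ ^ 2 ≤ (‖w‖ + ‖v - w‖) ^ 2 := pow_le_pow_left₀ (norm_nonneg _) h1 2
  have h3 : (1 + γ) * ‖w‖ ^ 2 + (1 + 1 / γ) * ‖v - w‖ ^ 2 - (‖w‖ + ‖v - w‖) ^ 2 =
      (γ * ‖w‖ - ‖v - w‖) ^ 2 / γ := by
    field_simp
    ring
  have h4 : 0 ≤ (γ * ‖w‖ - ‖v - w‖) ^ 2 / γ := by positivity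
  linarith

lemma one_sub_sum_norm_sq_le {x y : β → H →L[ℂ] H} (hy : ∑ b, ‖y b ξ‖ ^ 2 ≤ 1) {γ : ℝ}
    (hγ : 0 < γ) : 1 - ∑ b, ‖y b ξ‖ ^ 2 ≤
      1 - ∑ b, ‖x b ξ‖ ^ 2 + γ + (1 + 1 / γ) * ∑ b, ‖(x b - y b) ξ‖ ^ 2 := by
  have h := Finset.sum_le_sum fun b (_ : b ∈ Finset.univ) =>
    norm_sq_le_young (v := x b ξ) (w := y b ξ) hγ
  rw [Finset.sum_add_distrib, ← Finset.mul_sum, ← Finset.mul_sum] at h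
  simp only [sub_apply]
  nlinarith

lemma sum_norm_sq_pvm {r : β → H →L[ℂ] H} (hs : ∀ b, IsSelfAdjoint (r b))
    (hr : ∀ b, r b * r b = r b) (h1 : ∑ b, r b = 1) (hξ : ‖ξ‖ = 1) : ∑ b, ‖r b ξ‖ ^ 2 = 1 := by
  have : ∀ b, ‖r b ξ‖ ^ 2 = tr ξ (r b) := fun b => by rw [← tr_mul_self ξ (hs b), hr]
  simp only [this]
  rw [← tr_sum, h1, tr_one, hξ, one_pow]

lemma loss_le {r x y s : β → H →L[ℂ] H} (hr : ∑ b, ‖r b ξ‖ ^ 2 = 1) (hs : ∑ b, ‖s b ξ‖ ^ 2 = 1)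
    (hx : ∑ b, ‖x b ξ‖ ^ 2 ≤ 1) (hy : ∑ b, ‖y b ξ‖ ^ 2 ≤ 1) :
    1 - ∑ b, (⟪r b ξ, s b ξ⟫_ℂ).re ≤ 3 * ((1 - ∑ b, (⟪r b ξ, x b ξ⟫_ℂ).re) +
      (∑ b, ‖(x b - y b) ξ‖ ^ 2) / 2 + (1 - ∑ b, (⟪s b ξ, y b ξ⟫_ℂ).re)) := by
  have h3 : ∀ u v w : H, ‖u + v + w‖ ^ 2 ≤ 3 * (‖u‖ ^ 2 + ‖v‖ ^ 2 + ‖w‖ ^ 2) := fun u v w => by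
    have h1 : ‖u + v + w‖ ≤ ‖u‖ + ‖v‖ + ‖w‖ := norm_add₃_le
    have h2 := pow_le_pow_left₀ (norm_nonneg _) h1 2
    nlinarith [sq_nonneg (‖u‖ - ‖v‖), sq_nonneg (‖v‖ - ‖w‖), sq_nonneg (‖u‖ - ‖w‖)]
  have h := Finset.sum_le_sum fun b (_ : b ∈ Finset.univ) =>
    h3 (r b ξ - x b ξ) (x b ξ - y b ξ) (y b ξ - s b ξ)
  have e : ∀ b, r b ξ - x b ξ + (x b ξ - y b ξ) + (y b ξ - s b ξ) = r b ξ - s b ξ := fun b => by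
    abel
  simp only [e, ← Finset.mul_sum, Finset.sum_add_distrib] at h
  simp only [sub_apply]
  have e1 : ∀ u v : β → H →L[ℂ] H, ∑ b, ‖u b ξ - v b ξ‖ ^ 2 =
      ∑ b, ‖u b ξ‖ ^ 2 - 2 * ∑ b, (⟪u b ξ, v b ξ⟫_ℂ).re + ∑ b, ‖v b ξ‖ ^ 2 := fun u v => by
    simp only [norm_sub_sq_re, Finset.sum_add_distrib, Finset.sum_sub_distrib, ← Finset.mul_sum]
  have e2 : ∑ b, (⟪s b ξ, y b ξ⟫_ℂ).re = ∑ b, (⟪y b ξ, s b ξ⟫_ℂ).re :=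
    Finset.sum_congr rfl fun b _ => re_inner_comm _ _
  rw [e1 r s, e1 r x, e1 y s, hr, hs] at h
  rw [e2]
  linarith

/-- A POVM in a tracial algebra which is maximal in the 2-norm consists of projections. -/
lemma IsTracial.mul_self_of_sum_norm_sq (hN : IsTracial N ξ) {x : α → H →L[ℂ] H}
    (hx : ∀ a, x a ∈ N) (hx0 : ∀ a, 0 ≤ x a) (hx1 : ∑ a, x a = 1)
    (h : 1 ≤ ∑ a, ‖x a ξ‖ ^ 2) (a : α) : x a * x a = x a := by
  have hle : ∀ a, ‖x a ξ‖ ^ 2 ≤ (⟪ξ, x a ξ⟫_ℂ).re :=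
    fun a => norm_sq_le_re_inner (hx0 a) (le_one_of_sum_eq_one hx0 hx1 a) ξ
  have hsum : ∑ a, (⟪ξ, x a ξ⟫_ℂ).re = 1 := by
    rw [← Complex.re_sum, ← inner_sum, ← sum_apply, hx1, one_apply_eq_self, re_inner_self_eq,
      hN.norm_eq, one_pow]
  have heq : ‖x a ξ‖ ^ 2 = (⟪ξ, x a ξ⟫_ℂ).re :=
    (Finset.sum_eq_sum_iff_of_le fun a _ => hle a).1
      (le_antisymm (Finset.sum_le_sum fun a _ => hle a) (hsum.le.trans h)) a (Finset.mem_univ a)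
  obtain ⟨T, hT⟩ : ∃ T : H →L[ℂ] H, T = x a := ⟨_, rfl⟩
  have hTa := hx a
  have hT0 := hx0 a
  have hT1 := le_one_of_sum_eq_one hx0 hx1 a
  rw [← hT] at heq hTa hT0 hT1 ⊢
  have hsa := IsSelfAdjoint.of_nonneg hT0
  -- `T - T²` is positive with vanishing trace
  have hnn : 0 ≤ T - T * T := by
    refine nonneg_of_inner (fun v => ?_) fun v => ?_
    · rw [sub_apply, inner_sub_right, Complex.sub_re, mul_apply_eq_comp,
        ← IsSelfAdjoint.inner_right hsa v (T v), re_inner_self_eq]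
      linarith [norm_sq_le_re_inner hT0 hT1 v]
    · exact im_inner_eq_zero (hsa.sub (by rw [isSelfAdjoint_iff, star_mul, hsa.star_eq])) v
  have hle1 : T - T * T ≤ 1 := by
    have : 0 ≤ T * T := by
      simpa [hsa.star_eq] using star_mul_self_nonneg T
    exact (sub_le_self T this).trans hT1
  have hz : (T - T * T) ξ = 0 := by
    have h1 := norm_sq_le_re_inner hnn hle1 ξ
    have h2 : (⟪ξ, (T - T * T) ξ⟫_ℂ).re = 0 := by
      rw [sub_apply, inner_sub_right, Complex.sub_re, mul_apply_eq_comp,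
        ← IsSelfAdjoint.inner_right hsa ξ (T ξ), re_inner_self_eq, heq, sub_self]
    rw [h2] at h1
    exact norm_eq_zero.1 (pow_eq_zero_iff two_ne_zero |>.1 (le_antisymm h1 (sq_nonneg _)))
  have := hN.cyclic'.ext (y := T - T * T) (z := 0)
    (N.commutant_commutant.symm ▸ sub_mem hTa (mul_mem hTa hTa)) (zero_mem _) (by rw [hz, zero_apply])
  exact (sub_eq_zero.1 this).symm

end Estimates

section Averages

variable {Ω : Type*} [Fintype Ω] {w : Ω → ℝ}

lemma avg_mono {f g : Ω → ℝ} (hw : ∀ q, 0 ≤ w q) (h : ∀ q, f q ≤ g q) :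
    ∑ q, w q * f q ≤ ∑ q, w q * g q :=
  Finset.sum_le_sum fun q _ => mul_le_mul_of_nonneg_left (h q) (hw q)

lemma avg_affine (hw1 : ∑ q, w q = 1) (c k l : ℝ) (f g : Ω → ℝ) :
    ∑ q, w q * (c + k * f q + l * g q) = c + k * ∑ q, w q * f q + l * ∑ q, w q * g q := by
  simp only [mul_add, Finset.sum_add_distrib, ← Finset.sum_mul, hw1, one_mul, Finset.mul_sum]
  congr 1
  · congr 1
    exact Finset.sum_congr rfl fun q _ => by ring
  · exact Finset.sum_congr rfl fun q _ => by ring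

lemma avg_defect_le (hw : ∀ q, 0 ≤ w q) (hw1 : ∑ q, w q = 1) {u : ℝ} {d δ : Ω → ℝ}
    (hd : ∑ q, w q * d q ≤ 2 * u) (hδ : ∀ q α, 0 < α → δ q ≤ d q + 6 * α + 6 * d q / α) {α : ℝ}
    (hα : 0 < α) : ∑ q, w q * δ q ≤ 6 * α + (1 + 6 / α) * (2 * u) := by
  have h1 : ∑ q, w q * δ q ≤ ∑ q, w q * (6 * α + (1 + 6 / α) * d q + 0 * d q) :=
    avg_mono hw fun q => (hδ q α hα).trans_eq (by ring)
  rw [avg_affine hw1] at h1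
  have h2 := mul_le_mul_of_nonneg_left hd (by positivity : 0 ≤ 1 + 6 / α)
  linarith

lemma avg_defect_le' (hw : ∀ q, 0 ≤ w q) (hw1 : ∑ q, w q = 1) {u : ℝ} {e δ δ' : Ω → ℝ}
    (he : ∑ q, w q * e q ≤ u)
    (hδ' : ∀ q β, 0 < β → δ' q ≤ δ q + β + (1 + 1 / β) * (2 * e q)) {β : ℝ} (hβ : 0 < β) :
    ∑ q, w q * δ' q ≤ ∑ q, w q * δ q + β + (1 + 1 / β) * (2 * u) := by
  have h1 : ∑ q, w q * δ' q ≤ ∑ q, w q * (β + 1 * δ q + (1 + 1 / β) * 2 * e q) :=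
    avg_mono hw fun q => (hδ' q β hβ).trans_eq (by ring)
  rw [avg_affine hw1] at h1
  have h2 := mul_le_mul_of_nonneg_left he (by positivity : 0 ≤ (1 + 1 / β) * 2)
  linarith

lemma avg_nonpos_of_defect (hw : ∀ q, 0 ≤ w q) {δ R : Ω → ℝ} (hδ0 : ∀ q, 0 ≤ δ q)
    (h : ∑ q, w q * δ q ≤ 0) (hR : ∀ q, δ q ≤ 0 → R q ≤ 0) : ∑ q, w q * R q ≤ 0 := by
  have h0 : ∀ q ∈ Finset.univ, 0 ≤ w q * δ q := fun q _ => mul_nonneg (hw q) (hδ0 q)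
  have h1 := (Finset.sum_eq_zero_iff_of_nonneg h0).1 (le_antisymm h (Finset.sum_nonneg h0))
  refine Finset.sum_nonpos fun q _ => ?_
  rcases mul_eq_zero.1 (h1 q (Finset.mem_univ q)) with h | h
  · rw [h, zero_mul]
  · exact mul_nonpos_of_nonneg_of_nonpos (hw q) (hR q h.le)

/-- The numerical optimisation of all error terms. -/
theorem avg_loss_le (hw : ∀ q, 0 ≤ w q) (hw1 : ∑ q, w q = 1) {u t m : ℝ} (ht : 0 ≤ t)
    (htu : u = t ^ 4) (ht1 : 148 * t ≤ 1) (hm : 0 < t → 1 / m ≤ 6 * t ∧ m ≤ 1 / (6 * t) + 2)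
    (hm0 : 0 < m) {d e δ δ' R R' loss : Ω → ℝ} (hd : ∑ q, w q * d q ≤ 2 * u)
    (he : ∑ q, w q * e q ≤ u) (hδ : ∀ q α, 0 < α → δ q ≤ d q + 6 * α + 6 * d q / α)
    (hδ' : ∀ q β, 0 < β → δ' q ≤ δ q + β + (1 + 1 / β) * (2 * e q))
    (hδ0 : ∀ q, 0 ≤ δ q) (hδ0' : ∀ q, 0 ≤ δ' q)
    (hR : ∀ q, R q ≤ 1 / m + 2 * (1 + m) * δ q) (hR0 : ∀ q, δ q ≤ 0 → R q ≤ 0)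
    (hR' : ∀ q, R' q ≤ 1 / m + 2 * (1 + m) * δ' q) (hR0' : ∀ q, δ' q ≤ 0 → R' q ≤ 0)
    (hloss : ∀ q, loss q ≤ 3 * (R q + e q + R' q)) :
    ∑ q, w q * loss q ≤ 148 * t := by
  have h1 : ∑ q, w q * loss q ≤
      3 * ∑ q, w q * R q + 3 * ∑ q, w q * e q + 3 * ∑ q, w q * R' q := by
    refine (avg_mono hw hloss).trans_eq ?_
    simp only [Finset.mul_sum, ← Finset.sum_add_distrib]
    exact Finset.sum_congr rfl fun q _ => by ring
  have hD := fun α hα => avg_defect_le hw hw1 (α := α) hd hδ hα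
  have hD' := fun β hβ => avg_defect_le' hw hw1 (β := β) he hδ' hβ
  rcases ht.eq_or_lt with rfl | htpos
  · have hu : u = 0 := by rw [htu]; norm_num
    subst hu
    have h0 : ∑ q, w q * δ q ≤ 0 := by
      refine le_of_forall_pos_le_add fun η hη => (hD (η / 6) (by positivity)).trans_eq ?_
      ring
    have h0' : ∑ q, w q * δ' q ≤ 0 := by
      refine le_of_forall_pos_le_add fun η hη => (hD' η hη).trans ?_
      linarith
    have h2 := avg_nonpos_of_defect hw hδ0 h0 hR0
    have h3 := avg_nonpos_of_defect hw hδ0' h0' hR0'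
    linarith
  · obtain ⟨hm1, hm2⟩ := hm htpos
    have ht2 : 0 < t ^ 2 := by positivity
    have e1 : ∀ c : ℝ, (1 + c / t ^ 2) * (2 * u) = 2 * t ^ 4 + 2 * c * t ^ 2 := fun c => by
      rw [htu]
      field_simp
    have a1 := hD (t ^ 2) ht2
    have a2 := hD' (t ^ 2) ht2
    rw [e1] at a1 a2
    have ht4 : t ^ 4 ≤ t ^ 2 / 20000 := by
      have : t ^ 2 ≤ 1 / 20000 := by nlinarith
      nlinarith
    have hRs : ∀ (D : ℝ) (δ R : Ω → ℝ), (∀ q, R q ≤ 1 / m + 2 * (1 + m) * δ q) →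
        ∑ q, w q * δ q ≤ D → ∑ q, w q * R q ≤ 1 / m + 2 * (1 + m) * D := by
      intro D δ R h hD
      have : ∑ q, w q * R q ≤ ∑ q, w q * (1 / m + 2 * (1 + m) * δ q + 0 * δ q) :=
        avg_mono hw fun q => (h q).trans_eq (by ring)
      rw [avg_affine hw1] at this
      have h2 := mul_le_mul_of_nonneg_left hD (by positivity : 0 ≤ 2 * (1 + m))
      linarith
    have b1 := hRs (19 * t ^ 2) δ R hR (by linarith)
    have b2 := hRs (22 * t ^ 2) δ' R' hR' (by linarith)
    have b3 : (1 + m) * t ^ 2 ≤ t / 6 + 3 * t ^ 2 := by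
      have : (1 + m) * t ^ 2 ≤ (1 / (6 * t) + 3) * t ^ 2 :=
        mul_le_mul_of_nonneg_right (by linarith) ht2.le
      refine this.trans_eq ?_
      field_simp
    have b4 : t ^ 2 ≤ t / 148 := by nlinarith
    linarith

end Averages

section Rounding

variable {H : Type*} [NormedAddCommGroup H] [InnerProductSpace ℂ H] [CompleteSpace H]
  {α κ : Type*} [Fintype α] [DecidableEq α] [Nonempty α] [Fintype κ] [DecidableEq κ] [Nonempty κ]
  {N : VonNeumannAlgebra H} {ξ : H}

lemma exists_pvm_near_or_eq (hN : IsTracial N ξ) {F : κ → κ → H →L[ℂ] H} (hF : IsMatrixUnits N F)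
    {x : α → H →L[ℂ] H} (hx : ∀ a, x a ∈ N) (hx0 : ∀ a, 0 ≤ x a) (hx1 : ∑ a, x a = 1)
    (hxF : ∀ a i j, Commute (x a) (F i j)) :
    ∃ r : α → H →L[ℂ] H, (∀ a, r a ∈ N) ∧ (∀ a, IsSelfAdjoint (r a) ∧ r a * r a = r a) ∧
      ∑ a, r a = 1 ∧ 1 - ∑ a, (⟪r a ξ, x a ξ⟫_ℂ).re ≤
        1 / Fintype.card κ + 2 * (1 + Fintype.card κ) * (1 - ∑ a, ‖x a ξ‖ ^ 2) ∧
      (1 - ∑ a, ‖x a ξ‖ ^ 2 ≤ 0 → 1 - ∑ a, (⟪r a ξ, x a ξ⟫_ℂ).re ≤ 0) := by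
  by_cases h : 1 ≤ ∑ a, ‖x a ξ‖ ^ 2
  · have h2 := sum_norm_sq_le_one hx0 hx1 hN.norm_eq
    refine ⟨x, hx, fun a => ⟨.of_nonneg (hx0 a), hN.mul_self_of_sum_norm_sq hx hx0 hx1 h a⟩, hx1,
      ?_, ?_⟩
    · simp only [re_inner_self_eq]
      rw [le_antisymm h2 h, sub_self, mul_zero, add_zero]
      positivity
    · simp only [re_inner_self_eq]
      exact id
  · obtain ⟨r, hr, hrs, hrr, hr1, hle⟩ := exists_pvm_near hN hF hx hx0 hx1 hxF
    refine ⟨r, hr, fun a => ⟨hrs a, hrr a⟩, hr1, ?_, fun h' => absurd (by linarith) h⟩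
    simp only [← tr_mul_eq_re_inner (hrs _)]
    linarith

end Rounding

section Assembly

/-- A commuting operator strategy can be realised with a vector which is cyclic for both
commuting von Neumann algebras. -/
theorem exists_standard_form {H : Type} [NormedAddCommGroup H] [InnerProductSpace ℂ H]
    [CompleteSpace H] {γ δ : Type} {P : γ → H →L[ℂ] H} {Q : δ → H →L[ℂ] H}
    (hP : ∀ g, 0 ≤ P g) (hQ : ∀ g, 0 ≤ Q g) (hcomm : ∀ g h, P g * Q h = Q h * P g) {ψ : H}
    (hψ : ‖ψ‖ = 1) :
    ∃ (K : Type) (_ : NormedAddCommGroup K) (_ : InnerProductSpace ℂ K) (_ : CompleteSpace K)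
      (η : K) (M : VonNeumannAlgebra K) (P' : γ → K →L[ℂ] K) (Q' : δ → K →L[ℂ] K),
      ‖η‖ = 1 ∧ Cyclic M η ∧ Cyclic M.commutant η ∧ (∀ g, P' g ∈ M) ∧ (∀ g, 0 ≤ P' g) ∧
      (∀ s : Finset γ, ∑ g ∈ s, P g = 1 → ∑ g ∈ s, P' g = 1) ∧
      (∀ g, Q' g ∈ M.commutant) ∧ (∀ g, 0 ≤ Q' g) ∧
      (∀ s : Finset δ, ∑ g ∈ s, Q g = 1 → ∑ g ∈ s, Q' g = 1) ∧
      ∀ g h, ⟪η, (P' g * Q' h) η⟫_ℂ = ⟪ψ, (P g * Q h) ψ⟫_ℂ := by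
  have hstar : ∀ x ∈ Set.range Q, star x ∈ Set.range Q := by
    rintro _ ⟨g, rfl⟩
    exact ⟨g, (IsSelfAdjoint.of_nonneg (hQ g)).star_eq.symm⟩
  obtain ⟨M, hM⟩ : ∃ M, M = vnCentralizer (Set.range Q) := ⟨_, rfl⟩
  have hPM : ∀ g, P g ∈ M := fun g => by
    rw [hM, mem_vnCentralizer hstar]
    rintro _ ⟨h, rfl⟩
    exact (hcomm g h).symm
  have hQM : ∀ g, Q g ∈ M.commutant := fun g => by
    rw [hM]
    exact subset_commutant_vnCentralizer ⟨g, rfl⟩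
  obtain ⟨K, i1, i2, i3, V, η, N, hVη, hV, hVV, hc, hc', hN, hN', hmul⟩ :=
    exists_cyclic_compression M ψ
  have hpos : ∀ x : H →L[ℂ] H, 0 ≤ x → 0 ≤ V.adjoint.comp (x.comp V) := fun x hx => by
    rw [ContinuousLinearMap.nonneg_iff_isPositive] at hx ⊢
    exact hx.adjoint_conj V
  have hsum : ∀ {κ : Type} (s : Finset κ) (x : κ → H →L[ℂ] H), ∑ g ∈ s, x g = 1 →
      ∑ g ∈ s, V.adjoint.comp ((x g).comp V) = 1 := fun s x h => by
    have h2 : V.adjoint.comp ((∑ g ∈ s, x g).comp V) = 1 := by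
      rw [h, ← hVV]; rfl
    rw [← h2]
    ext v
    simp [sum_apply]
  refine ⟨K, i1, i2, i3, η, N, fun g => V.adjoint.comp ((P g).comp V),
    fun g => V.adjoint.comp ((Q g).comp V), ?_, hc, hc', fun g => hN _ (hPM g),
    fun g => hpos _ (hP g), fun s => hsum s P, fun g => hN' _ (hQM g), fun g => hpos _ (hQ g),
    fun s => hsum s Q, fun g h => ?_⟩
  · rw [← hV, hVη, hψ]
  · rw [hmul _ (hPM g) _ (hQM h), ContinuousLinearMap.comp_apply,
      ContinuousLinearMap.adjoint_inner_right, ContinuousLinearMap.comp_apply, hVη]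

variable {I J : Type} [Fintype I] [Fintype J] {A : I → Type} [∀ i, Fintype (A i)]
  {B : J → Type} [∀ j, Fintype (B j)] [∀ j, DecidableEq (B j)]

/-- A nearly perfect strategy in standard form yields measurement operators in a tracial von
Neumann algebra with nearly the same two-norm geometry. -/
theorem exists_tracial_povms {H : Type} [NormedAddCommGroup H] [InnerProductSpace ℂ H]
    [CompleteSpace H] {M : VonNeumannAlgebra H} {ψ : H} (hcyc : Cyclic M ψ)
    (hcyc' : Cyclic M.commutant ψ) (hψ : ‖ψ‖ = 1) {μ : I → J → ℝ} (hμ : ∀ i j, 0 ≤ μ i j)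
    {p : ∀ i j, A i → B j}
    (hnd : ∀ i (a a' : A i), (∀ j, 0 < μ i j → p i j a = p i j a') → a = a')
    {L : ℝ} (hL0 : 0 ≤ L) (hL : ∀ i j, 0 < μ i j → ∑ j', μ i j' ≤ L * μ i j)
    {P : ∀ i, A i → H →L[ℂ] H} (hP : ∀ i a, P i a ∈ M) (hP0 : ∀ i a, 0 ≤ P i a)
    (hP1 : ∀ i, ∑ a, P i a = 1) {Q : ∀ j, B j → H →L[ℂ] H} (hQ : ∀ j b, Q j b ∈ M.commutant)
    (hQ0 : ∀ j b, 0 ≤ Q j b) (hQ1 : ∀ j, ∑ b, Q j b = 1)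
    (ι : Type) [Fintype ι] [DecidableEq ι] [Nonempty ι] :
    ∃ (K : Type) (_ : NormedAddCommGroup K) (_ : InnerProductSpace ℂ K) (_ : CompleteSpace K)
      (ξ : K) (N : VonNeumannAlgebra K) (x : ∀ i, A i → K →L[ℂ] K) (y : ∀ j, B j → K →L[ℂ] K)
      (F : ι → ι → K →L[ℂ] K) (d : I → ℝ),
      IsTracial N ξ ∧ IsMatrixUnits N F ∧
      (∀ i a, x i a ∈ N) ∧ (∀ i a, 0 ≤ x i a) ∧ (∀ i, ∑ a, x i a = 1) ∧
      (∀ i a k l, Commute (x i a) (F k l)) ∧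
      (∀ j b, y j b ∈ N) ∧ (∀ j b, 0 ≤ y j b) ∧ (∀ j, ∑ b, y j b = 1) ∧
      (∀ j b k l, Commute (y j b) (F k l)) ∧
      (∀ i, (∑ j, μ i j) * d i ≤
        2 * L * ∑ j, μ i j * (1 - ∑ a, (⟪P i a ψ, Q j (p i j a) ψ⟫_ℂ).re)) ∧
      (∀ i α, 0 < α → 1 - ∑ a, ‖x i a ξ‖ ^ 2 ≤ d i + 6 * α + 6 * d i / α) ∧
      ∀ i j, ∑ b, ‖(coarse (p i j) (x i) b - y j b) ξ‖ ^ 2 ≤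
        2 * (1 - ∑ a, (⟪P i a ψ, Q j (p i j a) ψ⟫_ℂ).re) := by
  choose d hd0 hd hPd hPm using fun i => exists_defect hψ (hμ i) (hnd i) hL0 (hL i) (hP i)
    (hP0 i) (hP1 i) hQ hQ0 hQ1
  choose z hzM hz0 hz1 hz using fun j => exists_radonNikodym_povm hcyc' (hQ j) (hQ0 j) (hQ1 j)
  let q : (Σ i, A i) ⊕ (Σ j, B j) → H →L[ℂ] H :=
    Sum.elim (fun g => P g.1 g.2) fun g => z g.1 g.2
  have hq : ∀ g, q g ∈ M := by rintro (g | g); exacts [hP _ _, hzM _ _]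
  have hq0 : ∀ g, 0 ≤ q g := by rintro (g | g); exacts [hP0 _ _, hz0 _ _]
  have hq1 : ∀ g, q g ≤ 1 := by
    rintro (g | g)
    exacts [le_one_of_sum_eq_one (hP0 _) (hP1 _) _, le_one_of_sum_eq_one (hz0 _) (hz1 _) _]
  obtain ⟨K, i1, i2, i3, ξ, N, x, F, hN, hF, hxN, hx0, -, hxF, hx1, hle, hge⟩ :=
    exists_tracial hcyc hcyc' hψ hq hq0 hq1 ι
  refine ⟨K, i1, i2, i3, ξ, N, fun i a => x (.inl ⟨i, a⟩), fun j b => x (.inr ⟨j, b⟩), F, d, hN,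
    hF, fun i a => hxN _, fun i a => hx0 _, fun i => ?_, fun i a => hxF _, fun j b => hxN _,
    fun j b => hx0 _, fun j => ?_, fun j b => hxF _, hd, fun i α hα => ?_, fun i j => ?_⟩
  · have := hx1 (Finset.disjSum (Finset.univ.map ⟨fun a => (⟨i, a⟩ : Σ i, A i),
      sigma_mk_injective⟩) ∅) (by simpa [q] using hP1 i)
    simpa using this
  · have := hx1 (Finset.disjSum ∅ (Finset.univ.map ⟨fun b => (⟨j, b⟩ : Σ j, B j),
      sigma_mk_injective⟩)) (by simpa [q] using hz1 j)
    simpa using this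
  · have h := Finset.sum_le_sum fun a (_ : a ∈ Finset.univ) =>
      hge {.inl (⟨i, a⟩ : Σ i, A i)} (fun _ => 1) α hα
    simp only [Finset.sum_singleton, one_smul, Finset.sum_sub_distrib, ← Finset.mul_sum] at h
    have h1 := sum_norm_sq_le_one (hP0 i) (hP1 i) hψ
    have h2 : 6 / α * ∑ a, ‖(modOp (saOrbit M.commutant ψ) - 1) (P i a ψ)‖ ^ 2 ≤ 6 / α * d i :=
      mul_le_mul_of_nonneg_left (hPm i) (by positivity)
    have h3 : 6 * d i / α = 6 / α * d i := by ring
    rw [h3]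
    change (1 - 6 * α) * ∑ a, ‖P i a ψ‖ ^ 2 - 6 / α *
      ∑ a, ‖(modOp (saOrbit M.commutant ψ) - 1) (P i a ψ)‖ ^ 2 ≤ _ at h
    nlinarith [hPd i]
  · have h1 : ∀ b, ‖(coarse (p i j) (fun a => x (.inl ⟨i, a⟩)) b - x (.inr ⟨j, b⟩)) ξ‖ ≤
        ‖(coarse (p i j) (P i) b - Q j b) ψ‖ := fun b => by
      have h2 := hle (Finset.disjSum ((Finset.univ.filter fun a => p i j a = b).map
        ⟨fun a => (⟨i, a⟩ : Σ i, A i), sigma_mk_injective⟩) {(⟨j, b⟩ : Σ j, B j)})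
        (Sum.elim (fun _ => 1) fun _ => -1)
      simp only [Finset.sum_disjSum, Finset.sum_map, Finset.sum_singleton, Sum.elim_inl,
        Sum.elim_inr, one_smul, neg_smul, ← sub_eq_add_neg, Function.Embedding.coeFn_mk] at h2
      exact h2.trans (hz j b _ (coarse_mem (hP i) b) (.of_nonneg (coarse_nonneg (hP0 i) b)))
    refine (Finset.sum_le_sum fun b _ => pow_le_pow_left₀ (norm_nonneg _) (h1 b) 2).trans ?_
    have h2 := sum_norm_sq_sub_le (P := coarse (p i j) (P i)) (coarse_nonneg (hP0 i))
      (by rw [sum_coarse, hP1]) (hQ0 j) (hQ1 j) hψ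
    rwa [sum_re_inner_coarse (p i j) (P i) ψ fun b => Q j b ψ] at h2

end Assembly

section Rounding

variable {I J : Type} [Fintype I] [Fintype J] {A : I → Type} [∀ i, Fintype (A i)]
  [∀ i, Nonempty (A i)] {B : J → Type} [∀ j, Fintype (B j)] [∀ j, Nonempty (B j)]
  {H : Type} [NormedAddCommGroup H] [InnerProductSpace ℂ H] [CompleteSpace H]
  {N : VonNeumannAlgebra H} {ξ : H}

lemma IsTracial.inner_mul_eq_ofReal (hN : IsTracial N ξ) {r s : H →L[ℂ] H} (hr : r ∈ N)
    (hrs : IsSelfAdjoint r) (hs : s ∈ N) (hss : IsSelfAdjoint s) :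
    ((⟪r ξ, s ξ⟫_ℂ).re : ℂ) = ⟪ξ, (r * s) ξ⟫_ℂ := by
  have h1 : ⟪ξ, (r * s) ξ⟫_ℂ = ⟪r ξ, s ξ⟫_ℂ := by
    rw [mul_apply_eq_comp, IsSelfAdjoint.inner_right hrs]
  have h2 : ⟪ξ, (s * r) ξ⟫_ℂ = ⟪s ξ, r ξ⟫_ℂ := by
    rw [mul_apply_eq_comp, IsSelfAdjoint.inner_right hss]
  rw [h1, ← Complex.conj_eq_iff_re, inner_conj_symm, ← h1, ← h2, hN.trace _ hr _ hs]

lemma IsTracial.adjoin_trace (hN : IsTracial N ξ) {S : Set (H →L[ℂ] H)} (hS : ∀ T ∈ S, T ∈ N)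
    {x y : H →L[ℂ] H} (hx : x ∈ StarAlgebra.adjoin ℂ S) (hy : y ∈ StarAlgebra.adjoin ℂ S) :
    ⟪ξ, (x * y) ξ⟫_ℂ = ⟪ξ, (y * x) ξ⟫_ℂ :=
  have h : StarAlgebra.adjoin ℂ S ≤ N.toStarSubalgebra := StarAlgebra.adjoin_le hS
  hN.trace x (h hx) y (h hy)

/-- Rounding the measurement operators in a tracial von Neumann algebra to projections. -/
theorem exists_tracial_pvms [∀ j, DecidableEq (B j)] {n : ℕ}
    {F : Fin (n + 1) → Fin (n + 1) → H →L[ℂ] H} (hN : IsTracial N ξ) (hF : IsMatrixUnits N F)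
    {x : ∀ i, A i → H →L[ℂ] H} {y : ∀ j, B j → H →L[ℂ] H}
    (hx : ∀ i a, x i a ∈ N) (hx0 : ∀ i a, 0 ≤ x i a) (hx1 : ∀ i, ∑ a, x i a = 1)
    (hxF : ∀ i a k l, Commute (x i a) (F k l))
    (hy : ∀ j b, y j b ∈ N) (hy0 : ∀ j b, 0 ≤ y j b) (hy1 : ∀ j, ∑ b, y j b = 1)
    (hyF : ∀ j b k l, Commute (y j b) (F k l))
    {μ : I → J → ℝ} (hμ0 : ∀ i j, 0 ≤ μ i j) (hμ1 : ∑ i, ∑ j, μ i j = 1)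
    {p : ∀ i j, A i → B j} {d : I → ℝ} {e : I → J → ℝ} {u t : ℝ} (ht : 0 ≤ t) (htu : u = t ^ 4)
    (ht1 : 148 * t ≤ 1)
    (hn : 0 < t → 1 / (n + 1 : ℝ) ≤ 6 * t ∧ (n + 1 : ℝ) ≤ 1 / (6 * t) + 2)
    (hd : ∑ i, (∑ j, μ i j) * d i ≤ 2 * u) (he : ∑ i, ∑ j, μ i j * e i j ≤ u)
    (hxd : ∀ i α, 0 < α → 1 - ∑ a, ‖x i a ξ‖ ^ 2 ≤ d i + 6 * α + 6 * d i / α)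
    (hxy : ∀ i j, ∑ b, ‖(coarse (p i j) (x i) b - y j b) ξ‖ ^ 2 ≤ 2 * e i j) :
    ∃ (r : ∀ i, A i → H →L[ℂ] H) (s : ∀ j, B j → H →L[ℂ] H),
      (∀ i a, r i a ∈ N) ∧ (∀ i a, IsSelfAdjoint (r i a) ∧ r i a * r i a = r i a) ∧
      (∀ i, ∑ a, r i a = 1) ∧ (∀ j b, s j b ∈ N) ∧
      (∀ j b, IsSelfAdjoint (s j b) ∧ s j b * s j b = s j b) ∧ (∀ j, ∑ b, s j b = 1) ∧
      1 - 148 * t ≤ ∑ i, ∑ j, μ i j * ∑ a, (⟪r i a ξ, s j (p i j a) ξ⟫_ℂ).re := by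
  classical
  choose r hrN hr hr1 hrx hrx0 using fun i =>
    exists_pvm_near_or_eq hN hF (hx i) (hx0 i) (hx1 i) (hxF i)
  choose s hsN hs hs1 hsy hsy0 using fun j =>
    exists_pvm_near_or_eq hN hF (hy j) (hy0 j) (hy1 j) (hyF j)
  have hr0 : ∀ i a, 0 ≤ r i a := fun i a => by
    rw [← (hr i a).2]
    nth_rw 1 [← (hr i a).1.star_eq]
    exact star_mul_self_nonneg _
  have hR : ∀ i j, 1 - ∑ b, (⟪coarse (p i j) (r i) b ξ, coarse (p i j) (x i) b ξ⟫_ℂ).re ≤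
      1 - ∑ a, (⟪r i a ξ, x i a ξ⟫_ℂ).re := fun i j =>
    sub_le_sub_left (sum_diag_le_sum_coarse (p i j) fun a a' => by
      rw [← tr_mul_eq_re_inner (hr i a).1]
      exact hN.tr_mul_nonneg (hrN i a) (hr0 i a) (hx i a') (hx0 i a')) 1
  have hcr : ∀ i j, ∑ b, ‖coarse (p i j) (r i) b ξ‖ ^ 2 = 1 := fun i j => by
    refine le_antisymm (sum_norm_sq_le_one (coarse_nonneg (hr0 i)) (by rw [sum_coarse, hr1])
      hN.norm_eq) ?_
    rw [← sum_norm_sq_pvm (fun a => (hr i a).1) (fun a => (hr i a).2) (hr1 i) hN.norm_eq]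
    exact sum_norm_sq_le_coarse hN (hrN i) (hr0 i) (p i j)
  simp only [Fintype.card_fin, Nat.cast_add, Nat.cast_one] at hrx hsy
  refine ⟨r, s, hrN, hr, hr1, hsN, hs, hs1, ?_⟩
  have key := avg_loss_le (w := fun q : I × J => μ q.1 q.2) (fun q => hμ0 _ _)
    (by rw [Fintype.sum_prod_type, hμ1]) ht htu ht1 hn (by positivity) (d := fun q => d q.1)
    (e := fun q => e q.1 q.2) (δ := fun q => 1 - ∑ a, ‖x q.1 a ξ‖ ^ 2)
    (δ' := fun q => 1 - ∑ b, ‖y q.2 b ξ‖ ^ 2)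
    (R := fun q => 1 - ∑ b, (⟪coarse (p q.1 q.2) (r q.1) b ξ, coarse (p q.1 q.2) (x q.1) b ξ⟫_ℂ).re)
    (R' := fun q => 1 - ∑ b, (⟪s q.2 b ξ, y q.2 b ξ⟫_ℂ).re)
    (loss := fun q => 1 - ∑ a, (⟪r q.1 a ξ, s q.2 (p q.1 q.2 a) ξ⟫_ℂ).re)
    (by simpa only [Fintype.sum_prod_type, Finset.sum_mul] using hd)
    (by rwa [Fintype.sum_prod_type]) (fun q => hxd q.1) (fun q β hβ => ?_)
    (fun q => sub_nonneg.2 (sum_norm_sq_le_one (hx0 _) (hx1 _) hN.norm_eq))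
    (fun q => sub_nonneg.2 (sum_norm_sq_le_one (hy0 _) (hy1 _) hN.norm_eq))
    (fun q => (hR _ _).trans (hrx _)) (fun q h => (hR _ _).trans (hrx0 _ h))
    (fun q => hsy _) (fun q h => hsy0 _ h) (fun q => ?_)
  · rw [Fintype.sum_prod_type] at key
    simp only [mul_sub, mul_one, Finset.sum_sub_distrib, hμ1] at key
    linarith
  · have h1 := one_sub_sum_norm_sq_le (x := coarse (p q.1 q.2) (x q.1)) (y := y q.2)
      (sum_norm_sq_le_one (hy0 _) (hy1 _) hN.norm_eq) hβ
    have h2 := sum_norm_sq_le_coarse hN (hx q.1) (hx0 q.1) (p q.1 q.2)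
    have h3 := mul_le_mul_of_nonneg_left (hxy q.1 q.2) (by positivity : 0 ≤ 1 + 1 / β)
    linarith
  · have h1 := loss_le (hcr q.1 q.2)
      (sum_norm_sq_pvm (fun b => (hs q.2 b).1) (fun b => (hs q.2 b).2) (hs1 q.2) hN.norm_eq)
      (sum_norm_sq_le_one (coarse_nonneg (hx0 q.1) (f := p q.1 q.2)) (by rw [sum_coarse, hx1])
        hN.norm_eq) (sum_norm_sq_le_one (hy0 q.2) (hy1 q.2) hN.norm_eq)
    rw [sum_re_inner_coarse (p q.1 q.2) (r q.1) ξ fun b => s q.2 b ξ] at h1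
    have h2 := hxy q.1 q.2
    linarith

end Rounding

/-- The deterministic strategy on a one-dimensional space. -/
lemma exists_deterministic {I J : Type} {A : I → Type} [∀ i, Fintype (A i)]
    [∀ i, Nonempty (A i)] {B : J → Type} [∀ j, Fintype (B j)] [∀ j, Nonempty (B j)] :
    ∃ (r : ∀ i, A i → ℂ →L[ℂ] ℂ) (s : ∀ j, B j → ℂ →L[ℂ] ℂ) (c : ∀ i j, A i → B j → ℝ),
      (∀ i a, IsSelfAdjoint (r i a) ∧ r i a * r i a = r i a) ∧ (∀ i, ∑ a, r i a = 1) ∧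
      (∀ j b, IsSelfAdjoint (s j b) ∧ s j b * s j b = s j b) ∧ (∀ j, ∑ b, s j b = 1) ∧
      (∀ i j a b, 0 ≤ c i j a b) ∧
      ∀ i j a b, (c i j a b : ℂ) = ⟪(1 : ℂ), (r i a * s j b) 1⟫_ℂ := by
  classical
  have h : ∀ q : Prop, IsSelfAdjoint (if q then 1 else 0 : ℂ →L[ℂ] ℂ) ∧
      (if q then 1 else 0 : ℂ →L[ℂ] ℂ) * (if q then 1 else 0) = if q then 1 else 0 := fun q => by
    have h0 : IsSelfAdjoint (0 : ℂ →L[ℂ] ℂ) := ContinuousLinearMap.isPositive_zero.isSelfAdjoint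
    by_cases hq : q <;> simp [hq, h0]
  refine ⟨fun i a => if a = Classical.arbitrary _ then 1 else 0,
    fun j b => if b = Classical.arbitrary _ then 1 else 0,
    fun i j a b => if a = Classical.arbitrary _ ∧ b = Classical.arbitrary _ then 1 else 0,
    fun i a => h _, fun i => ?_, fun j b => h _, fun j => ?_, fun i j a b => ?_,
    fun i j a b => ?_⟩
  · simp
  · simp
  · dsimp only
    split_ifs <;> norm_num
  · by_cases h1 : a = Classical.arbitrary _ <;> by_cases h2 : b = Classical.arbitrary _ <;>
      simp [h1, h2]

end TracialRounding

/-- **Main theorem.** Let `G` be a non-degenerate projection game and `c` a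
commuting operator correlation with `w_G(c) ≥ 1 - ε`.  With
`L = max_{(i,j) : μ(i,j) > 0} μ(i)/μ(i,j)`, there is a tracial correlation `c'` (in GNS
form: a Hilbert space `K`, a unit vector `ξ`, PVMs of projections, the vector state of
`ξ` tracial on the generated unital *-subalgebra) with
`w_G(c') ≥ 1 - 148 (L ε)^{1/4}`. -/
theorem almost_perfect_commuting_operator_strategy_near_tracial
    {I J : Type} [Fintype I] [Fintype J] [Nonempty I] [Nonempty J]
    {A : I → Type} [∀ i, Fintype (A i)] [∀ i, Nonempty (A i)]
    {B : J → Type} [∀ j, Fintype (B j)] [∀ j, Nonempty (B j)]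
    (μ : I → J → ℝ) (hμ0 : ∀ i j, 0 ≤ μ i j) (hμ1 : ∑ i, ∑ j, μ i j = 1)
    (p : ∀ i j, A i → B j)
    -- non-degeneracy
    (hnd : ∀ i (a a' : A i), (∀ j, 0 < μ i j → p i j a = p i j a') → a = a')
    -- `L` is the maximum of `μ(i)/μ(i,j)` over pairs with `μ(i,j) > 0`
    (L : ℝ)
    (hL : IsGreatest {x : ℝ | ∃ i j, 0 < μ i j ∧ x = (∑ j', μ i j') / μ i j} L)
    -- `c` is a commuting operator correlation
    {H : Type} [NormedAddCommGroup H] [InnerProductSpace ℂ H] [CompleteSpace H]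
    (P : ∀ i, A i → H →L[ℂ] H) (Q : ∀ j, B j → H →L[ℂ] H)
    (hP : ∀ i a, (P i a).IsPositive) (hPsum : ∀ i, ∑ a, P i a = 1)
    (hQ : ∀ j b, (Q j b).IsPositive) (hQsum : ∀ j, ∑ b, Q j b = 1)
    (hcomm : ∀ i j a b, P i a * Q j b = Q j b * P i a)
    (ψ : H) (hψ : ‖ψ‖ = 1)
    (c : ∀ i j, A i → B j → ℝ)
    (hc : ∀ i j a b, (c i j a b : ℂ) = @inner ℂ H _ ψ ((P i a * Q j b) ψ))
    -- the strategy wins with probability at least `1 - ε`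
    (ε : ℝ) (hε : 0 ≤ ε)
    (hw : 1 - ε ≤ ∑ i, ∑ j, μ i j * ∑ a, c i j a (p i j a)) :
    ∃ (K : Type) (_ : NormedAddCommGroup K) (_ : InnerProductSpace ℂ K)
      (_ : CompleteSpace K) (ξ : K)
      (r : ∀ i, A i → K →L[ℂ] K) (s : ∀ j, B j → K →L[ℂ] K)
      (c' : ∀ i j, A i → B j → ℝ),
      ‖ξ‖ = 1 ∧
      (∀ i a, IsSelfAdjoint (r i a) ∧ r i a * r i a = r i a) ∧ (∀ i, ∑ a, r i a = 1) ∧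
      (∀ j b, IsSelfAdjoint (s j b) ∧ s j b * s j b = s j b) ∧ (∀ j, ∑ b, s j b = 1) ∧
      (∀ x y : K →L[ℂ] K,
        x ∈ StarAlgebra.adjoin ℂ ({T | ∃ i a, T = r i a} ∪ {T | ∃ j b, T = s j b}) →
        y ∈ StarAlgebra.adjoin ℂ ({T | ∃ i a, T = r i a} ∪ {T | ∃ j b, T = s j b}) →
        @inner ℂ K _ ξ ((x * y) ξ) = @inner ℂ K _ ξ ((y * x) ξ)) ∧
      (∀ i j a b, (c' i j a b : ℂ) = @inner ℂ K _ ξ ((r i a * s j b) ξ)) ∧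
      1 - 148 * (L * ε) ^ ((1 : ℝ)/4)
        ≤ ∑ i, ∑ j, μ i j * ∑ a, c' i j a (p i j a) := by
  classical
  have hL0 : 0 ≤ L := by
    obtain ⟨i, j, hij, rfl⟩ := hL.1
    exact div_nonneg (Finset.sum_nonneg fun j _ => hμ0 i j) hij.le
  have hL1 : 1 ≤ L := by
    obtain ⟨i, j, hij, rfl⟩ := hL.1
    rw [le_div_iff₀ hij, one_mul]
    exact Finset.single_le_sum (f := fun j => μ i j) (fun j _ => hμ0 i j) (Finset.mem_univ j)
  have hLμ : ∀ i j, 0 < μ i j → ∑ j', μ i j' ≤ L * μ i j := fun i j hij =>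
    (div_le_iff₀ hij).1 (hL.2 ⟨i, j, hij, rfl⟩)
  obtain ⟨t, htdef⟩ : ∃ t, t = (L * ε) ^ ((1 : ℝ) / 4) := ⟨_, rfl⟩
  have ht : 0 ≤ t := htdef ▸ Real.rpow_nonneg (by positivity) _
  have htu : L * ε = t ^ 4 := by
    rw [htdef, ← Real.rpow_natCast, ← Real.rpow_mul (by positivity)]
    norm_num
  rw [← htdef]
  by_cases ht1 : 148 * t ≤ 1
  swap
  · obtain ⟨r, s, c', hr, hr1, hs, hs1, h0, hc'⟩ :=
      TracialRounding.exists_deterministic (A := A) (B := B)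
    refine ⟨ℂ, inferInstance, inferInstance, inferInstance, 1, r, s, c', by simp, hr, hr1, hs, hs1,
      fun x y _ _ => ?_, hc', ?_⟩
    · congr 2
      ext
      have h : ∀ (x : ℂ →L[ℂ] ℂ) z, x z = z * x 1 := fun x z => by
        rw [← smul_eq_mul, ← map_smul, smul_eq_mul, mul_one]
      simp only [mul_apply_eq_comp]
      rw [h x (y 1), h y (x 1), mul_comm]
    · refine (sub_nonpos.2 (not_le.1 ht1).le).trans ?_
      exact Finset.sum_nonneg fun i _ => Finset.sum_nonneg fun j _ =>
        mul_nonneg (hμ0 i j) (Finset.sum_nonneg fun a _ => h0 _ _ _ _)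
  obtain ⟨K₀, i1, i2, i3, η, M, P', Q', hη, hcyc, hcyc', hPM, hP0, hP1, hQM, hQ0, hQ1, hPQ⟩ :=
    TracialRounding.exists_standard_form (P := fun g : Σ i, A i => P g.1 g.2)
      (Q := fun g : Σ j, B j => Q g.1 g.2)
      (fun g => (ContinuousLinearMap.nonneg_iff_isPositive _).2 (hP _ _))
      (fun g => (ContinuousLinearMap.nonneg_iff_isPositive _).2 (hQ _ _)) (fun g h => hcomm _ _ _ _) hψ
  have hP1' : ∀ i, ∑ a, P' ⟨i, a⟩ = 1 := fun i => by
    simpa using hP1 (Finset.univ.map ⟨fun a => (⟨i, a⟩ : Σ i, A i), sigma_mk_injective⟩)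
      (by simpa using hPsum i)
  have hQ1' : ∀ j, ∑ b, Q' ⟨j, b⟩ = 1 := fun j => by
    simpa using hQ1 (Finset.univ.map ⟨fun b => (⟨j, b⟩ : Σ j, B j), sigma_mk_injective⟩)
      (by simpa using hQsum j)
  have hc' : ∀ i j a b, (@inner ℂ K₀ _ (P' ⟨i, a⟩ η) (Q' ⟨j, b⟩ η)).re = c i j a b :=
    fun i j a b => by
      rw [← Complex.ofReal_re (c i j a b), hc, ← hPQ ⟨i, a⟩ ⟨j, b⟩,
        mul_apply_eq_comp,
        TracialRounding.IsSelfAdjoint.inner_right (.of_nonneg (hP0 _))]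
  obtain ⟨K, j1, j2, j3, ξ, N, x, y, F, d, hN, hF, hx, hx0, hx1, hxF, hy, hy0, hy1, hyF, hd, hxd,
    hxy⟩ := TracialRounding.exists_tracial_povms hcyc hcyc' hη hμ0 hnd hL0 hLμ
      (P := fun i a => P' ⟨i, a⟩) (fun i a => hPM _) (fun i a => hP0 _) hP1'
      (Q := fun j b => Q' ⟨j, b⟩) (fun j b => hQM _) (fun j b => hQ0 _) hQ1'
      (Fin (⌈1 / (6 * t)⌉₊ + 1))
  simp only [hc'] at hd hxy
  have he : ∑ i, ∑ j, μ i j * (1 - ∑ a, c i j a (p i j a)) ≤ ε := by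
    simp only [mul_sub, mul_one, Finset.sum_sub_distrib, hμ1]
    linarith
  have hεL : ε ≤ L * ε := le_mul_of_one_le_left hε hL1
  have hd' : ∑ i, (∑ j, μ i j) * d i ≤ 2 * (L * ε) := by
    refine (Finset.sum_le_sum fun i _ => hd i).trans ?_
    rw [← Finset.mul_sum, ← mul_assoc]
    exact mul_le_mul_of_nonneg_left he (by positivity)
  have hn : 0 < t → 1 / ((⌈1 / (6 * t)⌉₊ : ℝ) + 1) ≤ 6 * t ∧
      (⌈1 / (6 * t)⌉₊ : ℝ) + 1 ≤ 1 / (6 * t) + 2 := fun htpos => by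
    have h1 := Nat.le_ceil (1 / (6 * t))
    have h2 := (Nat.ceil_lt_add_one (a := 1 / (6 * t)) (by positivity)).le
    refine ⟨?_, by linarith⟩
    rw [div_le_iff₀ (by positivity)]
    rw [div_le_iff₀ (by positivity)] at h1
    nlinarith
  obtain ⟨r, s, hrN, hr, hr1, hsN, hs, hs1, hval⟩ := TracialRounding.exists_tracial_pvms hN hF hx
    hx0 hx1 hxF hy hy0 hy1 hyF hμ0 hμ1 ht htu ht1 hn hd' (he.trans hεL) hxd hxy
  refine ⟨K, j1, j2, j3, ξ, r, s, fun i j a b => (@inner ℂ K _ (r i a ξ) (s j b ξ)).re,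
    hN.norm_eq, hr, hr1, hs, hs1, fun x y hx hy => hN.adjoin_trace ?_ hx hy, fun i j a b =>
    hN.inner_mul_eq_ofReal (hrN i a) (hr i a).1 (hsN j b) (hs j b).1, hval⟩
  rintro T (⟨i, a, rfl⟩ | ⟨j, b, rfl⟩)
  exacts [hrN i a, hsN j b]
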